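/- Let d ≥ 3, s ∈ (0,1), μ > 0, 2μ + λ > 0, and let α ∈ (0,1] satisfy α + 2s < 1. Let u : ℝ^d → ℝ^d be bounded and continuous, and let f : ℝ^d → ℝ^d be bounded and α-Hölder continuous. Suppose that for every x ∈ ℝ^d the truncated principal-value integrals 𝕃^s_ε u(x) converge, as ε → 0⁺, to f(x). Then u is (α+2s)-Hölder continuous, and its Hölder seminorm satisfies [u]_{C^{0,α+2s}(ℝ^d)} ≤ C ( sup|u| + sup|f| + [f]_{C^{0,α}(ℝ^d)} ), where C depends only on d, s, α, μ, λ. -/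

import Mathlib

open Real MeasureTheory Filter
open scoped RealInnerProductSpace

noncomputable section

/-- `c_{d,s} = 2^{2s} s Γ(d/2+s)/(π^{d/2} Γ(1−s))`. -/
def cConst (d : ℕ) (s : ℝ) : ℝ :=
  (2 : ℝ) ^ (2 * s) * s * Real.Gamma ((d : ℝ) / 2 + s) /
    (π ^ ((d : ℝ) / 2) * Real.Gamma (1 - s))

/-- `κ_{d,s} = (d+2s) c_{d,s}`. -/
def kappaConst (d : ℕ) (s : ℝ) : ℝ := ((d : ℝ) + 2 * s) * cConst d s

/-- The truncated fractional Lamé–Navier operator `𝕃^s_ε u`. -/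
def lameFracTrunc (d : ℕ) (s μ lam : ℝ)
    (u : EuclideanSpace ℝ (Fin d) → EuclideanSpace ℝ (Fin d)) (ε : ℝ)
    (x : EuclideanSpace ℝ (Fin d)) : EuclideanSpace ℝ (Fin d) :=
  (((2 * s + 1) * μ ^ s - (2 * μ + lam) ^ s) / (2 * s) * cConst d s) •
      (∫ y in {y : EuclideanSpace ℝ (Fin d) | ε ≤ ‖x - y‖},
        (‖x - y‖ ^ ((d : ℝ) + 2 * s))⁻¹ • (u x - u y)) +
    (((2 * μ + lam) ^ s - μ ^ s) / (2 * s) * kappaConst d s) •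
      (∫ y in {y : EuclideanSpace ℝ (Fin d) | ε ≤ ‖x - y‖},
        (⟪x - y, u x - u y⟫ / (‖x - y‖ ^ 2 * ‖x - y‖ ^ ((d : ℝ) + 2 * s))) • (x - y))

namespace LameFrac

set_option linter.unusedSectionVars false

open Module Set Topology

variable {E : Type*} [NormedAddCommGroup E] [InnerProductSpace ℝ E] [FiniteDimensional ℝ E]
  [MeasurableSpace E] [BorelSpace E]
variable {F : Type*} [NormedAddCommGroup F] [NormedSpace ℝ F]

/-- `φ` is integrable with `L¹` norm at most `A` and its translates are `B`-Lipschitz in `L¹`. -/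
structure TF (φ : E → F) (A B : ℝ) : Prop where
  int : Integrable φ
  l1 : ∫ x, ‖φ x‖ ≤ A
  lip : ∀ h, ∫ x, ‖φ (x + h) - φ x‖ ≤ B * ‖h‖

/-- A kernel which is integrable against the weight `min 1 ‖y‖`. -/
structure WK (k : E → F) : Prop where
  meas : AEStronglyMeasurable k volume
  int : Integrable (fun y => ‖k y‖ * min 1 ‖y‖)

/-- The pairing `∫ ⟪v, φ⟫`. -/
def pair (v φ : E → E) : ℝ := ∫ x, ⟪v x, φ x⟫

/-- The difference operator with kernel `k`. -/
def op (k : E → E →L[ℝ] F) (φ : E → E) (x : E) : F := ∫ y, k y (φ x - φ (x - y))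

/-- Convolution with the kernel `k`. -/
def conv (k : E → E →L[ℝ] F) (φ : E → E) (x : E) : F := ∫ y, k y (φ (x - y))

lemma TF.nonneg_left {φ : E → F} {A B : ℝ} (h : TF φ A B) : 0 ≤ A :=
  (integral_nonneg fun _ => norm_nonneg _).trans h.l1

lemma TF.nonneg_right [Nontrivial E] {φ : E → F} {A B : ℝ} (h : TF φ A B) : 0 ≤ B := by
  obtain ⟨e, he⟩ := exists_ne (0 : E)
  have h1 := (integral_nonneg fun x => norm_nonneg (φ (x + e) - φ x)).trans (h.lip e)
  exact nonneg_of_mul_nonneg_left h1 (norm_pos_iff.2 he)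

lemma TF.mono {φ : E → F} {A B A' B' : ℝ} (h : TF φ A B) (hA : A ≤ A') (hB : B ≤ B') :
    TF φ A' B' :=
  ⟨h.int, h.l1.trans hA, fun x => (h.lip x).trans (by gcongr)⟩

lemma TF.int_sub {φ : E → F} {A B : ℝ} (h : TF φ A B) (y : E) :
    Integrable (fun x => φ x - φ (x - y)) :=
  h.int.sub (h.int.comp_sub_right y)

lemma TF.diff_le {φ : E → F} {A B : ℝ} (h : TF φ A B) (y : E) :
    ∫ x, ‖φ x - φ (x - y)‖ ≤ min (2 * A) (B * ‖y‖) := by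
  refine le_min ?_ ?_
  · calc ∫ x, ‖φ x - φ (x - y)‖ ≤ ∫ x, (‖φ x‖ + ‖φ (x - y)‖) :=
        integral_mono (h.int_sub y).norm (h.int.norm.add (h.int.comp_sub_right y).norm)
          fun x => norm_sub_le _ _
      _ = (∫ x, ‖φ x‖) + ∫ x, ‖φ (x - y)‖ := integral_add h.int.norm (h.int.comp_sub_right y).norm
      _ ≤ 2 * A := by
        rw [integral_sub_right_eq_self (fun x => ‖φ x‖) y]
        linarith [h.l1]
  · have := h.lip (-y)
    rw [norm_neg] at this
    refine le_trans (le_of_eq ?_) this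
    congr 1; ext x
    rw [norm_sub_rev, sub_eq_add_neg x y]

lemma TF.add {φ ψ : E → F} {A B A' B' : ℝ} (h : TF φ A B) (h' : TF ψ A' B') :
    TF (fun x => φ x + ψ x) (A + A') (B + B') := by
  refine ⟨h.int.add h'.int, ?_, fun y => ?_⟩
  · calc ∫ x, ‖φ x + ψ x‖ ≤ ∫ x, (‖φ x‖ + ‖ψ x‖) :=
        integral_mono (h.int.add h'.int).norm (h.int.norm.add h'.int.norm) fun x => norm_add_le _ _
      _ = (∫ x, ‖φ x‖) + ∫ x, ‖ψ x‖ := integral_add h.int.norm h'.int.norm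
      _ ≤ _ := add_le_add h.l1 h'.l1
  · have i1 := (h.int.comp_add_right y).sub h.int
    have i2 := (h'.int.comp_add_right y).sub h'.int
    calc ∫ x, ‖φ (x + y) + ψ (x + y) - (φ x + ψ x)‖
        ≤ ∫ x, (‖φ (x + y) - φ x‖ + ‖ψ (x + y) - ψ x‖) := by
          refine integral_mono ?_ (i1.norm.add i2.norm) fun x => ?_
          · exact (((h.int.comp_add_right y).add (h'.int.comp_add_right y)).sub
              (h.int.add h'.int)).norm
          · dsimp only
            rw [add_sub_add_comm]; exact norm_add_le _ _
      _ = (∫ x, ‖φ (x + y) - φ x‖) + ∫ x, ‖ψ (x + y) - ψ x‖ := integral_add i1.norm i2.norm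
      _ ≤ B * ‖y‖ + B' * ‖y‖ := add_le_add (h.lip y) (h'.lip y)
      _ = _ := by ring

lemma TF.clm {G : Type*} [NormedAddCommGroup G] [NormedSpace ℝ G] {φ : E → F} {A B : ℝ}
    (h : TF φ A B) (l : F →L[ℝ] G) : TF (fun x => l (φ x)) (‖l‖ * A) (‖l‖ * B) := by
  refine ⟨l.integrable_comp h.int, ?_, fun y => ?_⟩
  · calc ∫ x, ‖l (φ x)‖ ≤ ∫ x, ‖l‖ * ‖φ x‖ :=
        integral_mono (l.integrable_comp h.int).norm (h.int.norm.const_mul _) fun x => l.le_opNorm _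
      _ = ‖l‖ * ∫ x, ‖φ x‖ := integral_const_mul _ _
      _ ≤ _ := by gcongr; exact h.l1
  · have i1 := (h.int.comp_add_right y).sub h.int
    calc ∫ x, ‖l (φ (x + y)) - l (φ x)‖ ≤ ∫ x, ‖l‖ * ‖φ (x + y) - φ x‖ := by
          refine integral_mono ?_ (i1.norm.const_mul _) fun x => ?_
          · exact ((l.integrable_comp (h.int.comp_add_right y)).sub (l.integrable_comp h.int)).norm
          · dsimp only
            rw [← map_sub]; exact l.le_opNorm _
      _ = ‖l‖ * ∫ x, ‖φ (x + y) - φ x‖ := integral_const_mul _ _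
      _ ≤ ‖l‖ * (B * ‖y‖) := by gcongr; exact h.lip y
      _ = _ := by ring

lemma TF.const_smul {φ : E → F} {A B : ℝ} (h : TF φ A B) (c : ℝ) :
    TF (fun x => c • φ x) (|c| * A) (|c| * B) := by
  refine ⟨h.int.smul c, ?_, fun y => ?_⟩
  · simp_rw [norm_smul, integral_const_mul, Real.norm_eq_abs]
    gcongr; exact h.l1
  · simp_rw [← smul_sub, norm_smul, integral_const_mul, Real.norm_eq_abs, mul_assoc]
    gcongr; exact h.lip y

lemma TF.translate {φ : E → F} {A B : ℝ} (h : TF φ A B) (z : E) :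
    TF (fun x => φ (x + z)) A B := by
  refine ⟨h.int.comp_add_right z, ?_, fun y => ?_⟩
  · rw [integral_add_right_eq_self (fun x => ‖φ x‖) z]; exact h.l1
  · have := integral_add_right_eq_self (μ := (volume : Measure E)) (fun x => ‖φ (x + y) - φ x‖) z
    simp only [add_right_comm _ z y] at this ⊢
    rw [this]; exact h.lip y

lemma WK.int_min {k : E → F} (hk : WK k) (A B : ℝ) (hA : 0 ≤ A) (hB : 0 ≤ B) :
    Integrable (fun y => ‖k y‖ * min A (B * ‖y‖)) := by
  refine (hk.int.const_mul (max A B)).mono' (hk.meas.norm.mul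
    (by fun_prop)) (Eventually.of_forall fun y => ?_)
  rw [Real.norm_of_nonneg (by positivity)]
  have : min A (B * ‖y‖) ≤ max A B * min 1 ‖y‖ := by
    rw [mul_min_of_nonneg _ _ (le_max_of_le_left hA), mul_one]
    exact min_le_min (le_max_left _ _) (by gcongr; exact le_max_right _ _)
  calc ‖k y‖ * min A (B * ‖y‖) ≤ ‖k y‖ * (max A B * min 1 ‖y‖) := by gcongr
    _ = _ := by ring

lemma aesm_comp_sub {φ : E → F} (h : AEStronglyMeasurable φ volume) :
    AEStronglyMeasurable (fun q : E × E => φ (q.1 - q.2)) (volume.prod volume) :=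
  h.comp_quasiMeasurePreserving (quasiMeasurePreserving_sub_of_right_invariant _ _)

lemma aesm_clm_apply {α : Type*} [MeasurableSpace α] {m : Measure α} {k : α → E →L[ℝ] F} {φ : α → E}
    (hk : AEStronglyMeasurable k m) (hφ : AEStronglyMeasurable φ m) :
    AEStronglyMeasurable (fun q => k q (φ q)) m :=
  (ContinuousLinearMap.id ℝ (E →L[ℝ] F)).aestronglyMeasurable_comp₂ hk hφ

lemma op_prod_bound {k : E → E →L[ℝ] F} {φ : E → E} {A B : ℝ} (hφ : TF φ A B) (y : E) :
    ∫ x, ‖k y (φ x - φ (x - y))‖ ≤ ‖k y‖ * min (2 * A) (B * ‖y‖) := by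
  calc ∫ x, ‖k y (φ x - φ (x - y))‖ ≤ ∫ x, ‖k y‖ * ‖φ x - φ (x - y)‖ :=
        integral_mono ((k y).integrable_comp (hφ.int_sub y)).norm ((hφ.int_sub y).norm.const_mul _)
          fun x => (k y).le_opNorm _
    _ = ‖k y‖ * ∫ x, ‖φ x - φ (x - y)‖ := integral_const_mul _ _
    _ ≤ _ := by gcongr; exact hφ.diff_le y

lemma op_prod_integrable [Nontrivial E] {k : E → E →L[ℝ] F} (hk : WK k) {φ : E → E} {A B : ℝ}
    (hφ : TF φ A B) :
    Integrable (fun q : E × E => k q.2 (φ q.1 - φ (q.1 - q.2))) (volume.prod volume) := by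
  have hm : AEStronglyMeasurable (fun q : E × E => k q.2 (φ q.1 - φ (q.1 - q.2)))
      (volume.prod volume) := by
    refine aesm_clm_apply hk.meas.comp_snd ?_
    exact hφ.int.aestronglyMeasurable.comp_fst.sub (aesm_comp_sub hφ.int.aestronglyMeasurable)
  rw [integrable_prod_iff' hm]
  refine ⟨Eventually.of_forall fun y => (k y).integrable_comp (hφ.int_sub y), ?_⟩
  refine (hk.int_min (2 * A) B (by linarith [hφ.nonneg_left]) hφ.nonneg_right).mono'
    hm.norm.prod_swap.integral_prod_right' (Eventually.of_forall fun y => ?_)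
  rw [Real.norm_of_nonneg (integral_nonneg fun _ => norm_nonneg _)]
  exact op_prod_bound hφ y

lemma op_integrable [Nontrivial E] {k : E → E →L[ℝ] F} (hk : WK k) {φ : E → E} {A B : ℝ}
    (hφ : TF φ A B) : Integrable (op k φ) :=
  (op_prod_integrable hk hφ).integral_prod_left

lemma op_l1 [Nontrivial E] {k : E → E →L[ℝ] F} (hk : WK k) {φ : E → E} {A B : ℝ}
    (hφ : TF φ A B) : ∫ x, ‖op k φ x‖ ≤ ∫ y, ‖k y‖ * min (2 * A) (B * ‖y‖) := by
  have hi := op_prod_integrable hk hφ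
  calc ∫ x, ‖op k φ x‖ ≤ ∫ x, ∫ y, ‖k y (φ x - φ (x - y))‖ :=
        integral_mono (op_integrable hk hφ).norm hi.integral_norm_prod_left
          fun x => norm_integral_le_integral_norm _
    _ = ∫ y, ∫ x, ‖k y (φ x - φ (x - y))‖ := integral_integral_swap hi.norm
    _ ≤ _ := by
      refine integral_mono hi.integral_norm_prod_right
        (hk.int_min (2 * A) B (by linarith [hφ.nonneg_left]) hφ.nonneg_right) fun y => ?_
      exact op_prod_bound hφ y

section Pair

variable {v : E → E} {U : ℝ}

lemma pair_integrable (hv : Continuous v) (hU : ∀ x, ‖v x‖ ≤ U) {φ : E → E} (hφ : Integrable φ) :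
    Integrable (fun x => ⟪v x, φ x⟫) := by
  refine (hφ.norm.const_mul U).mono' (hv.aestronglyMeasurable.inner hφ.aestronglyMeasurable)
    (Eventually.of_forall fun x => ?_)
  exact (norm_inner_le_norm _ _).trans (by gcongr; exact hU x)

lemma pair_add (hv : Continuous v) (hU : ∀ x, ‖v x‖ ≤ U) {φ ψ : E → E} (hφ : Integrable φ)
    (hψ : Integrable ψ) : pair v (fun x => φ x + ψ x) = pair v φ + pair v ψ := by
  simp only [pair, inner_add_right]
  exact integral_add (pair_integrable hv hU hφ) (pair_integrable hv hU hψ)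

lemma pair_sub (hv : Continuous v) (hU : ∀ x, ‖v x‖ ≤ U) {φ ψ : E → E} (hφ : Integrable φ)
    (hψ : Integrable ψ) : pair v (fun x => φ x - ψ x) = pair v φ - pair v ψ := by
  simp only [pair, inner_sub_right]
  exact integral_sub (pair_integrable hv hU hφ) (pair_integrable hv hU hψ)

lemma pair_smul (v : E → E) (c : ℝ) (φ : E → E) : pair v (fun x => c • φ x) = c * pair v φ := by
  simp only [pair, inner_smul_right, integral_const_mul]

lemma pair_le (hU : ∀ x, ‖v x‖ ≤ U) {φ : E → E} (hφ : Integrable φ) :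
    |pair v φ| ≤ U * ∫ x, ‖φ x‖ := by
  rw [← integral_const_mul, ← Real.norm_eq_abs]
  refine norm_integral_le_of_norm_le (hφ.norm.const_mul U) (Eventually.of_forall fun x => ?_)
  exact (norm_inner_le_norm _ _).trans (by gcongr; exact hU x)

/-- Integrating a family of test functions under the pairing. -/
lemma pair_integral {α : Type*} [MeasurableSpace α] {m : Measure α} [SFinite m]
    (hv : Continuous v) (hU : ∀ x, ‖v x‖ ≤ U)
    {f : E × α → E} (hf : Integrable f (volume.prod m)) :
    pair v (fun x => ∫ y, f (x, y) ∂m) = ∫ y, pair v (fun x => f (x, y)) ∂m := by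
  have hi : Integrable (fun q : E × α => ⟪v q.1, f q⟫) (volume.prod m) := by
    refine (hf.norm.const_mul U).mono'
      (hv.aestronglyMeasurable.comp_fst.inner hf.aestronglyMeasurable)
      (Eventually.of_forall fun x => ?_)
    exact (norm_inner_le_norm _ _).trans (by gcongr; exact hU _)
  have h1 : pair v (fun x => ∫ y, f (x, y) ∂m) = ∫ x, ∫ y, ⟪v x, f (x, y)⟫ ∂m := by
    refine integral_congr_ae ?_
    filter_upwards [hf.prod_right_ae] with x hx
    exact ((innerSL ℝ (v x)).integral_comp_comm hx).symm
  rw [h1, integral_integral_swap hi]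
  rfl

lemma pair_integral_integrable {α : Type*} [MeasurableSpace α] {m : Measure α} [SFinite m]
    (hv : Continuous v) (hU : ∀ x, ‖v x‖ ≤ U)
    {f : E × α → E} (hf : Integrable f (volume.prod m)) :
    Integrable (fun y => pair v (fun x => f (x, y))) m := by
  have hi : Integrable (fun q : E × α => ⟪v q.1, f q⟫) (volume.prod m) := by
    refine (hf.norm.const_mul U).mono'
      (hv.aestronglyMeasurable.comp_fst.inner hf.aestronglyMeasurable)
      (Eventually.of_forall fun x => ?_)
    exact (norm_inner_le_norm _ _).trans (by gcongr; exact hU _)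
  exact hi.integral_prod_right

end Pair

section Conv

variable {v : E → E} {U : ℝ}

/-- The functional `φ ↦ ∫ ⟪v, op k φ⟫`. -/
def T (k : E → E →L[ℝ] E) (v φ : E → E) : ℝ := pair v (op k φ)

lemma T_bound [Nontrivial E] {k : E → E →L[ℝ] E} (hk : WK k) (hU : ∀ x, ‖v x‖ ≤ U)
    {φ : E → E} {A B : ℝ} (hφ : TF φ A B) :
    |T k v φ| ≤ U * ∫ y, ‖k y‖ * min (2 * A) (B * ‖y‖) := by
  have hU0 : 0 ≤ U := (norm_nonneg _).trans (hU 0)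
  exact (pair_le hU (op_integrable hk hφ)).trans
    (mul_le_mul_of_nonneg_left (op_l1 hk hφ) hU0)

lemma T_eq_integral [Nontrivial E] {k : E → E →L[ℝ] E} (hk : WK k) (hv : Continuous v)
    (hU : ∀ x, ‖v x‖ ≤ U) {φ : E → E} {A B : ℝ} (hφ : TF φ A B) :
    T k v φ = ∫ y, pair v (fun x => k y (φ x - φ (x - y))) :=
  pair_integral hv hU (op_prod_integrable hk hφ)

lemma op_ae_integrable [Nontrivial E] {k : E → E →L[ℝ] F} (hk : WK k)
    {φ : E → E} {A B : ℝ} (hφ : TF φ A B) :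
    ∀ᵐ x, Integrable (fun y => k y (φ x - φ (x - y))) :=
  (op_prod_integrable hk hφ).prod_right_ae

lemma op_add_ae [Nontrivial E] {k : E → E →L[ℝ] F} (hk : WK k) {φ ψ : E → E} {A B A' B' : ℝ}
    (hφ : TF φ A B) (hψ : TF ψ A' B') :
    op k (fun x => φ x + ψ x) =ᵐ[volume] fun x => op k φ x + op k ψ x := by
  filter_upwards [op_ae_integrable hk hφ, op_ae_integrable hk hψ] with x h1 h2
  simp only [op]
  rw [← integral_add h1 h2]
  congr 1; ext y
  rw [← map_add]; congr 1; abel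

lemma T_add [Nontrivial E] {k : E → E →L[ℝ] E} (hk : WK k) (hv : Continuous v)
    (hU : ∀ x, ‖v x‖ ≤ U) {φ ψ : E → E} {A B A' B' : ℝ} (hφ : TF φ A B) (hψ : TF ψ A' B') :
    T k v (fun x => φ x + ψ x) = T k v φ + T k v ψ := by
  rw [T, T, T, ← pair_add hv hU (op_integrable hk hφ) (op_integrable hk hψ)]
  refine integral_congr_ae ?_
  filter_upwards [op_add_ae hk hφ hψ] with x hx
  rw [hx]

lemma op_smul (k : E → E →L[ℝ] F) (c : ℝ) (φ : E → E) (x : E) :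
    op k (fun x => c • φ x) x = c • op k φ x := by
  simp only [op, ← smul_sub, map_smul, integral_smul]

lemma T_smul (k : E → E →L[ℝ] E) (v : E → E) (c : ℝ) (φ : E → E) :
    T k v (fun x => c • φ x) = c * T k v φ := by
  simp only [T]
  rw [← pair_smul]
  congr 1; ext x; exact op_smul _ _ _ _

lemma T_sub [Nontrivial E] {k : E → E →L[ℝ] E} (hk : WK k) (hv : Continuous v)
    (hU : ∀ x, ‖v x‖ ≤ U) {φ ψ : E → E} {A B A' B' : ℝ} (hφ : TF φ A B) (hψ : TF ψ A' B') :
    T k v (fun x => φ x - ψ x) = T k v φ - T k v ψ := by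
  have h := T_add hk hv hU hφ (hψ.const_smul (-1))
  rw [T_smul] at h
  simp only [neg_smul, one_smul, ← sub_eq_add_neg] at h
  linarith

lemma T_translate (k : E → E →L[ℝ] E) (v φ : E → E) (z : E) :
    T k (fun x => v (x + z)) (fun x => φ (x + z)) = T k v φ := by
  have := integral_add_right_eq_self (μ := (volume : Measure E)) (fun x => ⟪v x, op k φ x⟫) z
  rw [T, T, pair, pair, ← this]
  congr 1; ext x
  simp only [op]
  congr 2; ext y; congr 3; abel

/-! Convolutions. -/

lemma conv_prod_integrable {k : E → E →L[ℝ] F} (hk : Integrable k) {φ : E → E}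
    (hφ : Integrable φ) :
    Integrable (fun q : E × E => k q.2 (φ (q.1 - q.2))) (volume.prod volume) := by
  have hm : AEStronglyMeasurable (fun q : E × E => k q.2 (φ (q.1 - q.2)))
      (volume.prod volume) :=
    aesm_clm_apply hk.aestronglyMeasurable.comp_snd (aesm_comp_sub hφ.aestronglyMeasurable)
  rw [integrable_prod_iff' hm]
  refine ⟨Eventually.of_forall fun y => (k y).integrable_comp (hφ.comp_sub_right y), ?_⟩
  refine (hk.norm.mul_const (∫ x, ‖φ x‖)).mono'
    hm.norm.prod_swap.integral_prod_right' (Eventually.of_forall fun y => ?_)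
  rw [Real.norm_of_nonneg (integral_nonneg fun _ => norm_nonneg _)]
  calc ∫ x, ‖k y (φ (x - y))‖ ≤ ∫ x, ‖k y‖ * ‖φ (x - y)‖ :=
        integral_mono ((k y).integrable_comp (hφ.comp_sub_right y)).norm
          ((hφ.comp_sub_right y).norm.const_mul _) fun x => (k y).le_opNorm _
    _ = _ := by
      rw [integral_const_mul, integral_sub_right_eq_self (fun x => ‖φ x‖) y]

lemma conv_integrable {k : E → E →L[ℝ] F} (hk : Integrable k) {φ : E → E}
    (hφ : Integrable φ) : Integrable (conv k φ) :=
  (conv_prod_integrable hk hφ).integral_prod_left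

lemma conv_l1 {k : E → E →L[ℝ] F} (hk : Integrable k) {φ : E → E}
    (hφ : Integrable φ) : ∫ x, ‖conv k φ x‖ ≤ (∫ y, ‖k y‖) * ∫ x, ‖φ x‖ := by
  have hi := conv_prod_integrable hk hφ
  calc ∫ x, ‖conv k φ x‖ ≤ ∫ x, ∫ y, ‖k y (φ (x - y))‖ :=
        integral_mono (conv_integrable hk hφ).norm hi.integral_norm_prod_left
          fun x => norm_integral_le_integral_norm _
    _ = ∫ y, ∫ x, ‖k y (φ (x - y))‖ := integral_integral_swap hi.norm
    _ ≤ ∫ y, ‖k y‖ * ∫ x, ‖φ x‖ := by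
      refine integral_mono hi.integral_norm_prod_right (hk.norm.mul_const _) fun y => ?_
      calc ∫ x, ‖k y (φ (x - y))‖ ≤ ∫ x, ‖k y‖ * ‖φ (x - y)‖ :=
            integral_mono ((k y).integrable_comp (hφ.comp_sub_right y)).norm
              ((hφ.comp_sub_right y).norm.const_mul _) fun x => (k y).le_opNorm _
        _ = _ := by
          rw [integral_const_mul, integral_sub_right_eq_self (fun x => ‖φ x‖) y]
    _ = _ := integral_mul_const _ _

lemma conv_ae_integrable {k : E → E →L[ℝ] F} (hk : Integrable k) {φ : E → E}
    (hφ : Integrable φ) : ∀ᵐ x, Integrable (fun y => k y (φ (x - y))) :=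
  (conv_prod_integrable hk hφ).prod_right_ae

lemma conv_sub_ae {k : E → E →L[ℝ] F} (hk : Integrable k) {φ ψ : E → E}
    (hφ : Integrable φ) (hψ : Integrable ψ) :
    conv k (fun x => φ x - ψ x) =ᵐ[volume] fun x => conv k φ x - conv k ψ x := by
  filter_upwards [conv_ae_integrable hk hφ, conv_ae_integrable hk hψ] with x h1 h2
  simp only [conv]
  rw [← integral_sub h1 h2]
  simp only [map_sub]

lemma conv_kernel_sub_ae {k l : E → E →L[ℝ] F} (hk : Integrable k) (hl : Integrable l) {φ : E → E}
    (hφ : Integrable φ) :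
    conv (fun y => k y - l y) φ =ᵐ[volume] fun x => conv k φ x - conv l φ x := by
  filter_upwards [conv_ae_integrable hk hφ, conv_ae_integrable hl hφ] with x h1 h2
  simp only [conv]
  rw [← integral_sub h1 h2]
  simp only [_root_.sub_apply]

lemma conv_comp_add (k : E → E →L[ℝ] F) (φ : E → E) (h x : E) :
    conv k φ (x + h) = conv k (fun x => φ (x + h)) x := by
  simp only [conv, sub_add_eq_add_sub]

lemma conv_kernel_comp_add (k : E → E →L[ℝ] F) (φ : E → E) (h x : E) :
    conv (fun y => k (y + h)) φ x = conv k φ (x + h) := by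
  simp only [conv]
  rw [← integral_add_right_eq_self (fun y => k y (φ (x + h - y))) h]
  simp only [add_sub_add_right_eq_sub]

/-- The convolution in the other form. -/
lemma conv_eq (k : E → E →L[ℝ] F) (φ : E → E) (x : E) :
    conv k φ x = ∫ z, k (x - z) (φ z) := by
  rw [conv, ← integral_sub_left_eq_self (fun z => k (x - z) (φ z)) volume x]
  simp only [sub_sub_cancel]

lemma conv_tf {k : E → E →L[ℝ] F} (hk : Integrable k) {φ : E → E} {A B : ℝ} (hφ : TF φ A B) :
    TF (conv k φ) ((∫ y, ‖k y‖) * A) ((∫ y, ‖k y‖) * B) := by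
  have h0 : 0 ≤ ∫ y, ‖k y‖ := integral_nonneg fun _ => norm_nonneg _
  refine ⟨conv_integrable hk hφ.int, (conv_l1 hk hφ.int).trans (by gcongr; exact hφ.l1),
    fun h => ?_⟩
  have := conv_sub_ae hk (hφ.int.comp_add_right h) hφ.int
  calc ∫ x, ‖conv k φ (x + h) - conv k φ x‖
      = ∫ x, ‖conv k (fun x => φ (x + h) - φ x) x‖ := by
        refine integral_congr_ae ?_
        filter_upwards [this] with x hx
        rw [hx, conv_comp_add]
    _ ≤ (∫ y, ‖k y‖) * ∫ x, ‖φ (x + h) - φ x‖ :=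
        conv_l1 hk ((hφ.int.comp_add_right h).sub hφ.int)
    _ ≤ _ := by rw [mul_assoc]; gcongr; exact hφ.lip h

lemma conv_tf_kernel {k : E → E →L[ℝ] F} {A B : ℝ} (hk : TF k A B) {φ : E → E}
    (hφ : Integrable φ) : TF (conv k φ) (A * ∫ x, ‖φ x‖) (B * ∫ x, ‖φ x‖) := by
  have h0 : 0 ≤ ∫ y, ‖φ y‖ := integral_nonneg fun _ => norm_nonneg _
  refine ⟨conv_integrable hk.int hφ, (conv_l1 hk.int hφ).trans (by gcongr; exact hk.l1),
    fun h => ?_⟩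
  have := conv_kernel_sub_ae (hk.int.comp_add_right h) hk.int hφ
  calc ∫ x, ‖conv k φ (x + h) - conv k φ x‖
      = ∫ x, ‖conv (fun x => k (x + h) - k x) φ x‖ := by
        refine integral_congr_ae ?_
        filter_upwards [this] with x hx
        rw [hx, conv_kernel_comp_add]
    _ ≤ (∫ y, ‖k (y + h) - k y‖) * ∫ x, ‖φ x‖ :=
        conv_l1 ((hk.int.comp_add_right h).sub hk.int) hφ
    _ ≤ (B * ‖h‖) * ∫ x, ‖φ x‖ := by gcongr; exact hk.lip h
    _ = _ := by ring

lemma aesm_comp_sub_fun {α : Type*} [MeasurableSpace α] {m : Measure α} [SFinite m] {φ : E → F}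
    (h : AEStronglyMeasurable φ volume) {g : α → E} (hg : Measurable g) :
    AEStronglyMeasurable (fun q : E × α => φ (q.1 - g q.2)) (volume.prod m) := by
  refine h.comp_quasiMeasurePreserving
    (QuasiMeasurePreserving.prod_of_left (by fun_prop) (Eventually.of_forall fun y => ?_))
  exact (measurePreserving_sub_right volume (g y)).quasiMeasurePreserving

lemma TF.kernel_apply {m : E → E →L[ℝ] F} {A B : ℝ} (hm : TF m A B) (z w : E) :
    TF (fun x => m (x - z) w) (A * ‖w‖) (B * ‖w‖) := by
  have h1 := (hm.translate (-z)).clm (ContinuousLinearMap.apply ℝ F w)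
  have h2 : ‖ContinuousLinearMap.apply ℝ F w‖ ≤ ‖w‖ :=
    ContinuousLinearMap.opNorm_le_bound _ (norm_nonneg _) fun f => by
      rw [ContinuousLinearMap.apply_apply, mul_comm]; exact f.le_opNorm w
  simp only [← sub_eq_add_neg, ContinuousLinearMap.apply_apply] at h1
  rcases subsingleton_or_nontrivial E with hE | hE
  · have : w = 0 := Subsingleton.elim _ _
    subst this
    refine ⟨h1.int, ?_, fun h => ?_⟩ <;> simp
  · have hA := hm.nonneg_left
    have hB := hm.nonneg_right
    exact h1.mono (by rw [mul_comm]; gcongr) (by rw [mul_comm]; gcongr)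

lemma T_conv_integrable [Nontrivial E] {k : E → E →L[ℝ] E} (hk : WK k)
    {m : E → E →L[ℝ] E} {A B : ℝ} (hm : TF m A B) {φ : E → E}
    (hφ : Integrable φ) :
    Integrable (fun q : E × E × E =>
      k q.2.1 (m (q.1 - q.2.2) (φ q.2.2) - m (q.1 - q.2.1 - q.2.2) (φ q.2.2)))
      (volume.prod (volume.prod volume)) := by
  have hme : AEStronglyMeasurable (fun q : E × E × E =>
      k q.2.1 (m (q.1 - q.2.2) (φ q.2.2) - m (q.1 - q.2.1 - q.2.2) (φ q.2.2)))
      (volume.prod (volume.prod volume)) := by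
    have hφ' : AEStronglyMeasurable (fun q : E × E × E => φ q.2.2)
        (volume.prod (volume.prod volume)) := hφ.aestronglyMeasurable.comp_snd.comp_snd
    refine aesm_clm_apply hk.meas.comp_fst.comp_snd (.sub ?_ ?_)
    · exact aesm_clm_apply (aesm_comp_sub_fun hm.int.aestronglyMeasurable measurable_snd) hφ'
    · refine aesm_clm_apply ?_ hφ'
      have := aesm_comp_sub_fun (m := (volume : Measure E).prod (volume : Measure E))
        hm.int.aestronglyMeasurable (g := fun q : E × E => q.1 + q.2) (by fun_prop)
      simpa only [sub_sub] using this
  have key (w : E × E) := op_prod_bound (k := k) (hm.kernel_apply w.2 (φ w.2)) w.1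
  rw [integrable_prod_iff' hme]
  refine ⟨Eventually.of_forall fun w => ?_, ?_⟩
  · exact (k w.1).integrable_comp ((hm.kernel_apply w.2 (φ w.2)).int_sub w.1)
  · refine ((hk.int_min (2 * A) B (by linarith [hm.nonneg_left]) hm.nonneg_right).mul_prod
      hφ.norm).mono' hme.norm.prod_swap.integral_prod_right' (Eventually.of_forall fun w => ?_)
    rw [Real.norm_of_nonneg (integral_nonneg fun _ => norm_nonneg _)]
    refine (key w).trans (le_of_eq ?_)
    have : min (2 * (A * ‖φ w.2‖)) (B * ‖φ w.2‖ * ‖w.1‖)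
        = min (2 * A) (B * ‖w.1‖) * ‖φ w.2‖ := by
      rw [min_mul_of_nonneg _ _ (norm_nonneg _)]; congr 1 <;> ring
    rw [this, mul_assoc]

/-- Superposition: `T` of a convolution is an integral of `T` of translated kernels. -/
lemma T_conv [Nontrivial E] {k : E → E →L[ℝ] E} (hk : WK k) (hv : Continuous v)
    (hU : ∀ x, ‖v x‖ ≤ U) {m : E → E →L[ℝ] E} {A B : ℝ} (hm : TF m A B) {φ : E → E}
    (hφ : Integrable φ) :
    Integrable (fun z => T k v (fun x => m (x - z) (φ z))) ∧
    T k v (conv m φ) = ∫ z, T k v (fun x => m (x - z) (φ z)) := by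
  have hi := T_conv_integrable hk hm hφ
  have hg := pair_integral_integrable hv hU hi
  have hT (z : E) : T k v (fun x => m (x - z) (φ z)) =
      ∫ y, pair v (fun x => k y (m (x - z) (φ z) - m (x - y - z) (φ z))) :=
    T_eq_integral hk hv hU (hm.kernel_apply z (φ z))
  constructor
  · simp_rw [hT]
    exact hg.integral_prod_right
  · simp_rw [hT]
    rw [T_eq_integral hk hv hU (conv_tf_kernel hm hφ),
      ← integral_integral_swap hg]
    congr 1; ext y
    have hmy : Integrable (fun x => m x - m (x - y)) := hm.int_sub y
    have e1 : pair v (fun x => k y (conv m φ x - conv m φ (x - y))) =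
        pair v (fun x => ∫ z, k y ((m (x - z) - m (x - y - z)) (φ z))) := by
      refine integral_congr_ae ?_
      have h1 := conv_kernel_sub_ae hm.int (hm.int.comp_sub_right y) hφ
      filter_upwards [h1, conv_ae_integrable hmy hφ] with x hx hx2
      have hx3 : Integrable (fun z => (m (x - z) - m (x - y - z)) (φ z)) := by
        have := hx2.comp_sub_left x
        simpa only [sub_sub_cancel, sub_right_comm x _ y] using this
      rw [(k y).integral_comp_comm hx3]
      have h2 : conv m φ (x - y) = conv (fun z => m (z - y)) φ x := by
        have := (conv_kernel_comp_add m φ (-y) x).symm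
        simpa only [← sub_eq_add_neg] using this
      rw [h2, ← hx, conv_eq]
      simp only [sub_right_comm x _ y]
    rw [e1]
    have hcp : Integrable (fun q : E × E => k y ((m (q.1 - q.2) - m (q.1 - y - q.2)) (φ q.2)))
        (volume.prod volume) := by
      refine (k y).integrable_comp ?_
      have hm' : AEStronglyMeasurable
          (fun q : E × E => (m (q.1 - q.2) - m (q.1 - y - q.2)) (φ q.2)) (volume.prod volume) := by
        refine aesm_clm_apply ?_ hφ.aestronglyMeasurable.comp_snd
        have := aesm_comp_sub hmy.aestronglyMeasurable
        simpa only [sub_right_comm _ _ y] using this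
      rw [integrable_prod_iff' hm']
      have hs (z : E) : Integrable (fun x => (m (x - z) - m (x - y - z)) (φ z)) := by
        have := (hm.kernel_apply z (φ z)).int_sub y
        simpa only [_root_.sub_apply] using this
      refine ⟨Eventually.of_forall hs, ?_⟩
      refine (hφ.norm.const_mul (2 * A)).mono' hm'.norm.prod_swap.integral_prod_right'
        (Eventually.of_forall fun z => ?_)
      rw [Real.norm_of_nonneg (integral_nonneg fun _ => norm_nonneg _)]
      have := ((hm.kernel_apply z (φ z)).diff_le y).trans (min_le_left _ _)
      simpa only [_root_.sub_apply, mul_assoc] using this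
    rw [pair_integral hv hU hcp]
    simp only [_root_.sub_apply]

end Conv

section Sym

variable {v : E → E} {U : ℝ}

lemma WK.of_integrable {k : E → F} (hk : Integrable k) : WK k := by
  refine ⟨hk.aestronglyMeasurable, hk.norm.mono' (hk.aestronglyMeasurable.norm.mul (by fun_prop))
    (Eventually.of_forall fun y => ?_)⟩
  rw [Real.norm_of_nonneg (by positivity)]
  exact mul_le_of_le_one_right (norm_nonneg _) (min_le_left _ _)

lemma bdd_integrable {k : E → E →L[ℝ] F} (hk : Integrable k) (hv : Continuous v)
    (hU : ∀ x, ‖v x‖ ≤ U) (x : E) : Integrable (fun y => k y (v (x - y))) := by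
  refine (hk.norm.mul_const U).mono' (aesm_clm_apply hk.aestronglyMeasurable
    (hv.comp (continuous_const.sub continuous_id)).aestronglyMeasurable)
    (Eventually.of_forall fun y => ?_)
  exact ((k y).le_opNorm _).trans (by gcongr; exact hU _)

lemma op_eq_sub_conv_of_bdd {k : E → E →L[ℝ] F} (hk : Integrable k) (hv : Continuous v)
    (hU : ∀ x, ‖v x‖ ≤ U) (x : E) : op k v x = (∫ y, k y) (v x) - conv k v x := by
  simp only [op, conv, map_sub]
  rw [integral_sub (hk.apply_continuousLinearMap (v x)) (bdd_integrable hk hv hU x),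
    ContinuousLinearMap.integral_apply hk]

lemma op_eq_sub_conv_ae {k : E → E →L[ℝ] F} (hk : Integrable k) {φ : E → E} (hφ : Integrable φ) :
    op k φ =ᵐ[volume] fun x => (∫ y, k y) (φ x) - conv k φ x := by
  filter_upwards [conv_ae_integrable hk hφ] with x hx
  simp only [op, conv, map_sub]
  rw [integral_sub (hk.apply_continuousLinearMap (φ x)) hx,
    ContinuousLinearMap.integral_apply hk]

/-- Symmetry of convolution with an even symmetric integrable kernel. -/
lemma conv_symm {k : E → E →L[ℝ] E} (hk : Integrable k) (he : ∀ y, k (-y) = k y)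
    (hs : ∀ y w z, ⟪k y w, z⟫ = ⟪w, k y z⟫) (hv : Continuous v) (hU : ∀ x, ‖v x‖ ≤ U)
    {φ : E → E} (hφ : Integrable φ) : ∫ x, ⟪conv k v x, φ x⟫ = pair v (conv k φ) := by
  have hcp := conv_prod_integrable hk hφ
  have e2 : pair v (conv k φ) = ∫ y, pair v (fun x => k y (φ (x - y))) :=
    pair_integral hv hU hcp
  have e3 (y : E) : pair v (fun x => k y (φ (x - y))) = ∫ x, ⟪k (-y) (v (x - (-y))), φ x⟫ := by
    rw [pair, ← integral_sub_right_eq_self (fun x => ⟪k (-y) (v (x - (-y))), φ x⟫) y]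
    congr 1; ext x
    rw [sub_neg_eq_add, sub_add_cancel, he, hs]
  have hi : Integrable (fun q : E × E => ⟪k q.2 (v (q.1 - q.2)), φ q.1⟫)
      (volume.prod volume) := by
    have h1 : Integrable (fun q : E × E => ‖φ q.1‖ * ‖k q.2‖) (volume.prod volume) :=
      hφ.norm.mul_prod hk.norm
    refine (h1.const_mul U).mono' ?_ (Eventually.of_forall fun q => ?_)
    · exact (aesm_clm_apply hk.aestronglyMeasurable.comp_snd
        (hv.comp (continuous_fst.sub continuous_snd)).aestronglyMeasurable).inner
        hφ.aestronglyMeasurable.comp_fst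
    · calc ‖⟪k q.2 (v (q.1 - q.2)), φ q.1⟫‖ ≤ ‖k q.2 (v (q.1 - q.2))‖ * ‖φ q.1‖ :=
            norm_inner_le_norm _ _
        _ ≤ (‖k q.2‖ * U) * ‖φ q.1‖ := by
            gcongr; exact ((k q.2).le_opNorm _).trans (by gcongr; exact hU _)
        _ = _ := by ring
  rw [e2]
  simp_rw [e3]
  rw [integral_neg_eq_self (fun y => ∫ x, ⟪k y (v (x - y)), φ x⟫) volume,
    ← integral_integral_swap hi]
  congr 1; ext x
  simp only [conv]
  rw [real_inner_comm, ← innerSL_apply_apply ℝ,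
    ← (innerSL ℝ (φ x)).integral_comp_comm (bdd_integrable hk hv hU x)]
  congr 1; ext y
  rw [innerSL_apply_apply, real_inner_comm]

/-- Symmetry of `op` with an even symmetric integrable kernel. -/
lemma op_symm {k : E → E →L[ℝ] E} (hk : Integrable k) (he : ∀ y, k (-y) = k y)
    (hs : ∀ y w z, ⟪k y w, z⟫ = ⟪w, k y z⟫) (hv : Continuous v) (hU : ∀ x, ‖v x‖ ≤ U)
    {φ : E → E} (hφ : Integrable φ) : ∫ x, ⟪op k v x, φ x⟫ = T k v φ := by
  have hsI (w z : E) : ⟪(∫ y, k y) w, z⟫ = ⟪w, (∫ y, k y) z⟫ := by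
    rw [ContinuousLinearMap.integral_apply hk, ContinuousLinearMap.integral_apply hk,
      real_inner_comm, ← innerSL_apply_apply ℝ, ← innerSL_apply_apply ℝ,
      ← (innerSL ℝ z).integral_comp_comm (hk.apply_continuousLinearMap w),
      ← (innerSL ℝ w).integral_comp_comm (hk.apply_continuousLinearMap z)]
    congr 1; ext y
    rw [innerSL_apply_apply, innerSL_apply_apply, real_inner_comm, hs]
  have e1 : T k v φ = pair v (fun x => (∫ y, k y) (φ x) - conv k φ x) := by
    refine integral_congr_ae ?_
    filter_upwards [op_eq_sub_conv_ae hk hφ] with x hx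
    rw [hx]
  rw [e1, pair_sub hv hU ((∫ y, k y).integrable_comp hφ) (conv_integrable hk hφ),
    ← conv_symm hk he hs hv hU hφ, pair, ← integral_sub]
  · congr 1; ext x
    rw [op_eq_sub_conv_of_bdd hk hv hU, inner_sub_left, hsI]
  · exact pair_integrable hv hU ((∫ y, k y).integrable_comp hφ)
  · have hc : Continuous (conv k v) := by
      refine continuous_of_dominated (bound := fun y => ‖k y‖ * U)
        (fun x => (bdd_integrable hk hv hU x).aestronglyMeasurable)
        (fun x => Eventually.of_forall fun y => ?_) (hk.norm.mul_const U)
        (Eventually.of_forall fun y => by fun_prop)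
      exact ((k y).le_opNorm _).trans (by gcongr; exact hU _)
    refine pair_integrable hc (U := (∫ y, ‖k y‖) * U) (fun x => ?_) hφ
    rw [← integral_mul_const]
    refine norm_integral_le_of_norm_le (hk.norm.mul_const U) (Eventually.of_forall fun y => ?_)
    exact ((k y).le_opNorm _).trans (by gcongr; exact hU _)

end Sym

section Weights

/-- `D < p < D + 1` makes `‖y‖^{-p} min(1,‖y‖)` integrable. -/
lemma integrable_weight [Nontrivial E] {p : ℝ} (hp : (finrank ℝ E : ℝ) < p)
    (hp' : p < finrank ℝ E + 1) : Integrable (fun y : E => ‖y‖ ^ (-p) * min 1 ‖y‖) := by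
  have hD : 1 ≤ finrank ℝ E := finrank_pos
  rw [integrable_fun_norm_addHaar volume (f := fun r => r ^ (-p) * min 1 r)]
  have e : ∀ y ∈ Ioi (0:ℝ), y ^ (finrank ℝ E - 1) • (y ^ (-p) * min 1 y)
      = y ^ ((finrank ℝ E : ℝ) - 1 - p) * min 1 y := by
    intro y hy
    have hy : 0 < y := hy
    rw [smul_eq_mul, ← mul_assoc, ← Real.rpow_natCast, ← Real.rpow_add hy, Nat.cast_sub hD]
    norm_num [sub_eq_add_neg]
  rw [integrableOn_congr_fun e measurableSet_Ioi, ← Ioc_union_Ioi_eq_Ioi zero_le_one,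
    integrableOn_union]
  constructor
  · have : IntegrableOn (fun y : ℝ => y ^ ((finrank ℝ E : ℝ) - p)) (Ioc 0 1) := by
      rw [← intervalIntegrable_iff_integrableOn_Ioc_of_le zero_le_one]
      exact intervalIntegral.intervalIntegrable_rpow' (by linarith)
    refine this.congr_fun (fun y hy => ?_) measurableSet_Ioc
    dsimp only
    rw [min_eq_right hy.2, ← Real.rpow_add_one hy.1.ne']
    congr 1; ring
  · have := integrableOn_Ioi_rpow_of_lt (a := (finrank ℝ E : ℝ) - 1 - p) (by linarith) zero_lt_one
    refine this.congr_fun (fun y hy => ?_) measurableSet_Ioi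
    dsimp only
    rw [min_eq_left (le_of_lt hy), mul_one]

lemma integral_weight_scale [Nontrivial E] {p A B : ℝ} (hA : 0 < A) (hB : 0 < B) :
    ∫ y : E, ‖y‖ ^ (-p) * min A (B * ‖y‖) =
      A ^ (1 - (p - finrank ℝ E)) * B ^ (p - finrank ℝ E) *
        ∫ y : E, ‖y‖ ^ (-p) * min 1 ‖y‖ := by
  have hr : 0 < B / A := div_pos hB hA
  have h := Measure.integral_comp_smul (volume : Measure E)
    (fun y : E => ‖y‖ ^ (-p) * min 1 ‖y‖) (B / A)
  have e (y : E) : ‖y‖ ^ (-p) * min A (B * ‖y‖) =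
      (A * (B / A) ^ p) * (‖(B / A) • y‖ ^ (-p) * min 1 ‖(B / A) • y‖) := by
    rw [norm_smul, Real.norm_of_nonneg hr.le, Real.mul_rpow hr.le (norm_nonneg _),
      Real.rpow_neg hr.le]
    have h1 : (B / A) ^ p ≠ 0 := (Real.rpow_pos_of_pos hr p).ne'
    have h2 : min A (B * ‖y‖) = A * min 1 (B / A * ‖y‖) := by
      rw [mul_min_of_nonneg _ _ hA.le, mul_one]; congr 1; field_simp
    rw [h2]; field_simp
  simp_rw [e]
  rw [integral_const_mul, h, smul_eq_mul, ← mul_assoc]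
  congr 1
  rw [abs_of_pos (by positivity), ← Real.rpow_natCast, Real.div_rpow hB.le hA.le,
    Real.div_rpow hB.le hA.le, Real.rpow_sub hA, Real.rpow_sub hA, Real.rpow_sub hB, Real.rpow_one]
  have := (Real.rpow_pos_of_pos hA p).ne'
  have := (Real.rpow_pos_of_pos hA (finrank ℝ E : ℝ)).ne'
  have := (Real.rpow_pos_of_pos hB (finrank ℝ E : ℝ)).ne'
  field_simp

lemma integral_weight_le [Nontrivial E] {p A B : ℝ} (hA : 0 ≤ A) (hB : 0 ≤ B) :
    ∫ y : E, ‖y‖ ^ (-p) * min A (B * ‖y‖) ≤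
      A ^ (1 - (p - finrank ℝ E)) * B ^ (p - finrank ℝ E) *
        ∫ y : E, ‖y‖ ^ (-p) * min 1 ‖y‖ := by
  have hI : 0 ≤ ∫ y : E, ‖y‖ ^ (-p) * min 1 ‖y‖ := integral_nonneg fun y => by positivity
  rcases hA.eq_or_lt with rfl | hA
  · have (y : E) : min 0 (B * ‖y‖) = 0 := min_eq_left (by positivity)
    simp only [this, mul_zero, integral_zero]; positivity
  rcases hB.eq_or_lt with rfl | hB
  · have (y : E) : min A (0 * ‖y‖) = 0 := by rw [zero_mul]; exact min_eq_right hA.le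
    simp only [this, mul_zero, integral_zero]; positivity
  · exact (integral_weight_scale hA hB).le

end Weights

section Ker

variable {v : E → E} {U a b p : ℝ}

/-- The Lamé kernel `‖y‖^{-p} (a + b ŷ ⊗ ŷ)`. -/
def ker (a b p : ℝ) (y : E) : E →L[ℝ] E :=
  ‖y‖ ^ (-p) • (a • ContinuousLinearMap.id ℝ E) +
    (b * ‖y‖ ^ (-(p + 2))) • InnerProductSpace.rankOne ℝ y y

lemma ker_apply (y w : E) :
    ker a b p y w = (‖y‖ ^ (-p) * a) • w + (b * ‖y‖ ^ (-(p + 2)) * ⟪y, w⟫) • y := by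
  simp [ker, smul_smul]

lemma ker_norm_le (y : E) : ‖ker a b p y‖ ≤ (|a| + |b|) * ‖y‖ ^ (-p) := by
  refine ContinuousLinearMap.opNorm_le_bound _ (by positivity) fun w => ?_
  rw [ker_apply]
  refine (norm_add_le _ _).trans ?_
  have h1 : ‖(‖y‖ ^ (-p) * a) • w‖ = |a| * ‖y‖ ^ (-p) * ‖w‖ := by
    rw [norm_smul, norm_mul, Real.norm_eq_abs, Real.norm_eq_abs, abs_of_nonneg (by positivity)]
    ring
  have h2 : ‖(b * ‖y‖ ^ (-(p + 2)) * ⟪y, w⟫) • y‖ ≤ |b| * ‖y‖ ^ (-p) * ‖w‖ := by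
    rcases eq_or_ne y 0 with rfl | hy
    · simp only [smul_zero, norm_zero]; positivity
    have hy' : 0 < ‖y‖ := norm_pos_iff.2 hy
    have h3 : ‖y‖ ^ (-p) = ‖y‖ ^ (-(p + 2)) * ‖y‖ ^ 2 := by
      rw [← Real.rpow_natCast, ← Real.rpow_add hy']; congr 1; push_cast; ring
    rw [norm_smul, norm_mul, norm_mul, Real.norm_eq_abs, Real.norm_eq_abs, h3,
      abs_of_nonneg (by positivity : 0 ≤ ‖y‖ ^ (-(p + 2)))]
    calc |b| * ‖y‖ ^ (-(p + 2)) * ‖⟪y, w⟫‖ * ‖y‖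
        ≤ |b| * ‖y‖ ^ (-(p + 2)) * (‖y‖ * ‖w‖) * ‖y‖ := by
          gcongr; exact norm_inner_le_norm _ _
      _ = _ := by ring
  rw [h1]; linarith

lemma ker_measurable : StronglyMeasurable (ker a b p : E → E →L[ℝ] E) := by
  have h1 : Continuous fun y : E => InnerProductSpace.rankOne ℝ y y :=
    (InnerProductSpace.rankOne ℝ).continuous.clm_apply continuous_id
  have h2 := (by fun_prop : Measurable fun y : E => ‖y‖ ^ (-p)).stronglyMeasurable
  have h3 := (by fun_prop : Measurable fun y : E => b * ‖y‖ ^ (-(p + 2))).stronglyMeasurable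
  exact (h2.smul (stronglyMeasurable_const (b := a • ContinuousLinearMap.id ℝ E))).add
    (h3.smul h1.stronglyMeasurable)

lemma ker_neg (y : E) : ker a b p (-y) = ker a b p y := by
  ext w; simp [ker_apply]

lemma ker_symm (y w z : E) : ⟪ker a b p y w, z⟫ = ⟪w, ker a b p y z⟫ := by
  simp only [ker_apply, inner_add_left, inner_add_right, inner_smul_left, inner_smul_right,
    RCLike.conj_to_real]
  rw [real_inner_comm w y]; ring

lemma ker_smul {t : ℝ} (ht : 0 < t) (y : E) : ker a b p (t • y) = t ^ (-p) • ker a b p y := by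
  ext w
  rw [_root_.smul_apply, ker_apply, ker_apply, norm_smul, Real.norm_of_nonneg ht.le,
    Real.mul_rpow ht.le (norm_nonneg _), Real.mul_rpow ht.le (norm_nonneg _), inner_smul_left,
    smul_add, smul_smul, smul_smul, smul_smul, RCLike.conj_to_real]
  have h3 : t ^ (-p) = t ^ (-(p + 2)) * t ^ 2 := by
    rw [← Real.rpow_natCast, ← Real.rpow_add ht]; congr 1; push_cast; ring
  congr 2
  · ring
  · rw [h3]; ring

lemma ker_wk [Nontrivial E] (hp : (finrank ℝ E : ℝ) < p) (hp' : p < finrank ℝ E + 1) :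
    WK (ker a b p : E → E →L[ℝ] E) := by
  refine ⟨ker_measurable.aestronglyMeasurable,
    ((integrable_weight hp hp').const_mul (|a| + |b|)).mono'
    (ker_measurable.aestronglyMeasurable.norm.mul (by fun_prop))
    (Eventually.of_forall fun y => ?_)⟩
  rw [Real.norm_of_nonneg (by positivity), ← mul_assoc]
  gcongr; exact ker_norm_le y

variable (E) in
/-- The constant in the basic bound for `T`. -/
def kC (a b p : ℝ) : ℝ := 2 * (|a| + |b|) * ∫ y : E, ‖y‖ ^ (-p) * min 1 ‖y‖

lemma kC_nonneg : 0 ≤ kC E a b p :=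
  mul_nonneg (by positivity) (integral_nonneg fun y => by positivity)

lemma T_ker_bound [Nontrivial E] (hp : (finrank ℝ E : ℝ) < p) (hp' : p < finrank ℝ E + 1)
    (hU : ∀ x, ‖v x‖ ≤ U) {φ : E → E} {A B : ℝ} (hφ : TF φ A B) :
    |T (ker a b p) v φ| ≤ kC E a b p * U *
      (A ^ (1 - (p - finrank ℝ E)) * B ^ (p - finrank ℝ E)) := by
  have hU0 : 0 ≤ U := (norm_nonneg _).trans (hU 0)
  have hA := hφ.nonneg_left
  have hB := hφ.nonneg_right
  have hw : Integrable (fun y : E => ‖y‖ ^ (-p) * min A (B * ‖y‖)) := by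
    have h1 : WK (fun y : E => ‖y‖ ^ (-p)) := by
      refine ⟨(by fun_prop : Measurable fun y : E => ‖y‖ ^ (-p)).aestronglyMeasurable, ?_⟩
      simpa only [Real.norm_of_nonneg (Real.rpow_nonneg (norm_nonneg _) _)] using
        integrable_weight hp hp'
    simpa only [Real.norm_of_nonneg (Real.rpow_nonneg (norm_nonneg _) _)] using
      h1.int_min A B hA hB
  refine (T_bound (ker_wk hp hp') hU hφ).trans ?_
  calc U * ∫ y, ‖ker a b p y‖ * min (2 * A) (B * ‖y‖)
      ≤ U * ∫ y : E, 2 * (|a| + |b|) * (‖y‖ ^ (-p) * min A (B * ‖y‖)) := by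
        gcongr ?_ * ?_
        refine integral_mono ((ker_wk hp hp').int_min _ _ (by positivity) hB)
          (hw.const_mul _) fun y => ?_
        have : min (2 * A) (B * ‖y‖) ≤ 2 * min A (B * ‖y‖) := by
          rw [mul_min_of_nonneg _ _ zero_le_two]
          exact min_le_min le_rfl (by nlinarith [mul_nonneg hB (norm_nonneg y)])
        calc ‖ker a b p y‖ * min (2 * A) (B * ‖y‖)
            ≤ ((|a| + |b|) * ‖y‖ ^ (-p)) * (2 * min A (B * ‖y‖)) := by
              gcongr; exact ker_norm_le y
          _ = _ := by ring
    _ ≤ U * (2 * (|a| + |b|) * (A ^ (1 - (p - finrank ℝ E)) * B ^ (p - finrank ℝ E) *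
        ∫ y : E, ‖y‖ ^ (-p) * min 1 ‖y‖)) := by
        rw [integral_const_mul]; gcongr; exact integral_weight_le hA hB
    _ = _ := by rw [kC]; ring

/-! Scaling. -/

lemma integral_comp_smul_pos (f : E → F) {t : ℝ} (ht : 0 < t) :
    ∫ x, f (t • x) = t ^ (-(finrank ℝ E : ℝ)) • ∫ x, f x := by
  rw [Measure.integral_comp_smul, abs_of_pos (by positivity), Real.rpow_neg ht.le,
    Real.rpow_natCast]

lemma op_ker_scale {t : ℝ} (ht : 0 < t) (φ : E → E) (x : E) :
    op (ker a b p) (fun x => φ (t • x)) x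
      = t ^ (p - finrank ℝ E) • op (ker a b p) φ (t • x) := by
  have h := integral_comp_smul_pos (fun y => ker a b p y (φ (t • x) - φ (t • x - y))) ht
  simp only [ker_smul ht, _root_.smul_apply, integral_smul, ← smul_sub] at h
  rw [op, op, sub_eq_add_neg p, Real.rpow_add ht, mul_smul, ← h, smul_smul, ← Real.rpow_add ht]
  simp

lemma T_ker_scale {t : ℝ} (ht : 0 < t) (v φ : E → E) :
    T (ker a b p) (fun x => v (t • x)) (fun x => φ (t • x))
      = t ^ (p - 2 * finrank ℝ E) * T (ker a b p) v φ := by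
  simp only [T, pair, op_ker_scale ht, inner_smul_right]
  rw [integral_const_mul, integral_comp_smul_pos (fun x => ⟪v x, op (ker a b p) φ x⟫) ht,
    smul_eq_mul, ← mul_assoc, ← Real.rpow_add ht]
  congr 2; ring

lemma TF.scale {φ : E → F} {A B : ℝ} (h : TF φ A B) {t : ℝ} (ht : 0 < t) :
    TF (fun x => φ (t • x)) (t ^ (-(finrank ℝ E : ℝ)) * A)
      (t ^ (-(finrank ℝ E : ℝ)) * (t * B)) := by
  have h0 : 0 ≤ t ^ (-(finrank ℝ E : ℝ)) := Real.rpow_nonneg ht.le _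
  refine ⟨(integrable_comp_smul_iff volume φ ht.ne').2 h.int, ?_, fun y => ?_⟩
  · rw [integral_comp_smul_pos (fun x => ‖φ x‖) ht, smul_eq_mul]
    gcongr; exact h.l1
  · have e (x : E) : t • (x + y) = t • x + t • y := smul_add _ _ _
    simp_rw [e]
    rw [integral_comp_smul_pos (fun x => ‖φ (x + t • y) - φ x‖) ht, smul_eq_mul, mul_assoc]
    gcongr
    refine (h.lip _).trans (le_of_eq ?_)
    rw [norm_smul, Real.norm_of_nonneg ht.le]; ring

/-- The truncated operator. -/
def trunc (k : E → E →L[ℝ] E) (v : E → E) (ε : ℝ) (x : E) : E :=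
  ∫ y in {y : E | ε ≤ ‖y‖}, k y (v x - v (x - y))

lemma trunc_scale {t : ℝ} (ht : 0 < t) (v : E → E) (ε : ℝ) (x : E) :
    trunc (ker a b p) (fun x => v (t • x)) ε x
      = t ^ (p - finrank ℝ E) • trunc (ker a b p) v (t * ε) (t • x) := by
  have hm (δ : ℝ) : MeasurableSet {y : E | δ ≤ ‖y‖} := measurableSet_le (by fun_prop) (by fun_prop)
  simp only [trunc]
  rw [← integral_indicator (hm _), ← integral_indicator (hm _)]
  have h := integral_comp_smul_pos ({y : E | t * ε ≤ ‖y‖}.indicator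
    fun y => ker a b p y (v (t • x) - v (t • x - y))) ht
  have e (y : E) : ({y : E | t * ε ≤ ‖y‖}.indicator
      (fun y => ker a b p y (v (t • x) - v (t • x - y))) (t • y)) =
      t ^ (-p) • ({y : E | ε ≤ ‖y‖}.indicator
      (fun y => ker a b p y (v (t • x) - v (t • (x - y)))) y) := by
    simp only [indicator_apply, Set.mem_ofPred_eq, norm_smul, Real.norm_of_nonneg ht.le,
      mul_le_mul_iff_right₀ ht, ker_smul ht, smul_sub]
    split_ifs <;> simp
  simp_rw [e, integral_smul] at h
  rw [sub_eq_add_neg p, Real.rpow_add ht, mul_smul, ← h, smul_smul, ← Real.rpow_add ht]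
  simp

lemma integrable_tail {p : ℝ} (hp : (finrank ℝ E : ℝ) < p) {ε : ℝ} (hε : 0 < ε) :
    IntegrableOn (fun y : E => ‖y‖ ^ (-p)) {y | ε ≤ ‖y‖} := by
  have hm : MeasurableSet {y : E | ε ≤ ‖y‖} := measurableSet_le (by fun_prop) (by fun_prop)
  have hp0 : 0 < p := lt_of_le_of_lt (Nat.cast_nonneg _) hp
  refine (((integrable_one_add_norm (μ := (volume : Measure E)) hp).const_mul
    ((1 + ε⁻¹) ^ p)).integrableOn (s := {y : E | ε ≤ ‖y‖})).mono'
    (by fun_prop : Measurable fun y : E => ‖y‖ ^ (-p)).aestronglyMeasurable ?_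
  filter_upwards [ae_restrict_mem hm] with y hy
  have hy : ε ≤ ‖y‖ := hy
  have hy0 : 0 < ‖y‖ := hε.trans_le hy
  rw [Real.norm_of_nonneg (by positivity), Real.rpow_neg hy0.le, Real.rpow_neg (by positivity),
    ← div_eq_mul_inv, ← Real.div_rpow (by positivity) (by positivity), ← Real.inv_rpow hy0.le]
  gcongr
  rw [le_div_iff₀ (by positivity)]
  have : 1 ≤ ε⁻¹ * ‖y‖ := by rw [inv_mul_eq_div, le_div_iff₀ hε]; linarith
  rw [mul_add, mul_one, inv_mul_cancel₀ hy0.ne']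
  have := inv_mul_le_one_of_le₀ (le_refl ‖y‖) hy0.le
  have h2 : ‖y‖⁻¹ ≤ ε⁻¹ := inv_anti₀ hε hy
  linarith

lemma trunc_integrable (hp : (finrank ℝ E : ℝ) < p) (hv : Continuous v) (hU : ∀ x, ‖v x‖ ≤ U)
    {ε : ℝ} (hε : 0 < ε) (x : E) :
    IntegrableOn (fun y => ker a b p y (v x - v (x - y))) {y | ε ≤ ‖y‖} := by
  refine ((integrable_tail (E := E) hp hε).const_mul ((|a| + |b|) * (2 * U))).mono'
    (aesm_clm_apply ker_measurable.aestronglyMeasurable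
    (by fun_prop : Continuous fun y => v x - v (x - y)).aestronglyMeasurable)
    (Eventually.of_forall fun y => ?_)
  calc ‖ker a b p y (v x - v (x - y))‖ ≤ ((|a| + |b|) * ‖y‖ ^ (-p)) * (2 * U) := by
        refine ((ker a b p y).le_opNorm _).trans ?_
        gcongr
        · exact ker_norm_le y
        · exact (norm_sub_le _ _).trans (by linarith [hU x, hU (x - y)])
    _ = _ := by ring

lemma trunc_continuous (hp : (finrank ℝ E : ℝ) < p) (hv : Continuous v) (hU : ∀ x, ‖v x‖ ≤ U)
    {ε : ℝ} (hε : 0 < ε) : Continuous (trunc (ker a b p) v ε) := by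
  refine continuous_of_dominated (bound := fun y => ((|a| + |b|) * (2 * U)) * ‖y‖ ^ (-p))
    (fun x => (trunc_integrable hp hv hU hε x).aestronglyMeasurable)
    (fun x => Eventually.of_forall fun y => ?_) ((integrable_tail (E := E) hp hε).const_mul _)
    (Eventually.of_forall fun y => by fun_prop)
  calc ‖ker a b p y (v x - v (x - y))‖ ≤ ((|a| + |b|) * ‖y‖ ^ (-p)) * (2 * U) := by
        refine ((ker a b p y).le_opNorm _).trans ?_
        gcongr
        · exact ker_norm_le y
        · exact (norm_sub_le _ _).trans (by linarith [hU x, hU (x - y)])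
    _ = _ := by ring

lemma trunc_bound (hp : (finrank ℝ E : ℝ) < p) (hU : ∀ x, ‖v x‖ ≤ U)
    {ε : ℝ} (hε : 0 < ε) (x : E) : ‖trunc (ker a b p) v ε x‖ ≤
      ((|a| + |b|) * (2 * U)) * ∫ y in {y : E | ε ≤ ‖y‖}, ‖y‖ ^ (-p) := by
  rw [← integral_const_mul]
  refine norm_integral_le_of_norm_le ((integrable_tail (E := E) hp hε).const_mul _)
    (Eventually.of_forall fun y => ?_)
  calc ‖ker a b p y (v x - v (x - y))‖ ≤ ((|a| + |b|) * ‖y‖ ^ (-p)) * (2 * U) := by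
        refine ((ker a b p y).le_opNorm _).trans ?_
        gcongr
        · exact ker_norm_le y
        · exact (norm_sub_le _ _).trans (by linarith [hU x, hU (x - y)])
    _ = _ := by ring

end Ker

section Multiplier

variable {a b p : ℝ}

lemma one_sub_cos_le (y ξ : E) :
    1 - cos (2 * π * ⟪y, ξ⟫) ≤ (2 + 2 * π * ‖ξ‖) * min 1 ‖y‖ := by
  have h1 : 1 - cos (2 * π * ⟪y, ξ⟫) ≤ 2 := by linarith [neg_one_le_cos (2 * π * ⟪y, ξ⟫)]
  have h2 : 1 - cos (2 * π * ⟪y, ξ⟫) ≤ 2 * π * ‖ξ‖ * ‖y‖ := by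
    have h3 := abs_cos_sub_cos_le 0 (2 * π * ⟪y, ξ⟫)
    rw [cos_zero, zero_sub, abs_neg, abs_mul, abs_of_pos two_pi_pos] at h3
    have h4 := abs_real_inner_le_norm y ξ
    calc _ ≤ 2 * π * |⟪y, ξ⟫| := (le_abs_self _).trans h3
      _ ≤ 2 * π * (‖y‖ * ‖ξ‖) := by gcongr
      _ = _ := by ring
  have h5 : 0 ≤ 2 * π * ‖ξ‖ := by positivity
  rcases le_total 1 ‖y‖ with h | h
  · rw [min_eq_left h]; linarith
  · rw [min_eq_right h]; nlinarith [norm_nonneg y]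

lemma one_sub_cos_nonneg (t : ℝ) : 0 ≤ 1 - cos t := by linarith [cos_le_one t]

lemma integrable_weight_cos [Nontrivial E] (hp : (finrank ℝ E : ℝ) < p)
    (hp' : p < finrank ℝ E + 1) (ξ : E) :
    Integrable fun y : E => ‖y‖ ^ (-p) * (1 - cos (2 * π * ⟪y, ξ⟫)) := by
  have hm : Measurable fun y : E => ‖y‖ ^ (-p) := by fun_prop
  refine ((integrable_weight hp hp').const_mul (2 + 2 * π * ‖ξ‖)).mono'
    (hm.aestronglyMeasurable.mul (by fun_prop)) (Eventually.of_forall fun y => ?_)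
  rw [Real.norm_of_nonneg (mul_nonneg (by positivity) (one_sub_cos_nonneg _))]
  calc ‖y‖ ^ (-p) * (1 - cos (2 * π * ⟪y, ξ⟫))
      ≤ ‖y‖ ^ (-p) * ((2 + 2 * π * ‖ξ‖) * min 1 ‖y‖) := by
        gcongr; exact one_sub_cos_le y ξ
    _ = _ := by ring

/-- The symbol of the fractional Laplacian, up to normalization. -/
def symJ (p : ℝ) (ξ : E) : ℝ := ∫ y : E, ‖y‖ ^ (-p) * (1 - cos (2 * π * ⟪y, ξ⟫))

lemma symJ_smul {t : ℝ} (ht : 0 < t) (ξ : E) :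
    symJ p (t • ξ) = t ^ (p - finrank ℝ E) * symJ p ξ := by
  have h := integral_comp_smul_pos
    (fun y : E => ‖y‖ ^ (-p) * (1 - cos (2 * π * ⟪y, ξ⟫))) ht
  simp only [norm_smul, Real.norm_of_nonneg ht.le, inner_smul_left, RCLike.conj_to_real,
    Real.mul_rpow ht.le (norm_nonneg _), mul_assoc (t ^ (-p))] at h
  rw [integral_const_mul] at h
  simp only [symJ, inner_smul_right]
  rw [sub_eq_add_neg p, Real.rpow_add ht, mul_assoc, ← smul_eq_mul (t ^ (-(finrank ℝ E : ℝ))), ← h,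
    ← mul_assoc, ← Real.rpow_add ht]
  simp

lemma symJ_eq_of_norm_eq {ξ η : E} (h : ‖ξ‖ = ‖η‖) : symJ p ξ = symJ p η := by
  set R := (Submodule.span ℝ {ξ - η})ᗮ.reflection with hR
  have e : R ξ = η := Submodule.reflection_sub h
  have h1 := (R.measurePreserving).integral_comp R.toHomeomorph.measurableEmbedding
    fun y : E => ‖y‖ ^ (-p) * (1 - cos (2 * π * ⟪y, η⟫))
  rw [symJ, symJ, ← h1]
  congr 1; ext y
  rw [← e, R.norm_map, R.inner_map_map]

lemma symJ_pos [Nontrivial E] (hp : (finrank ℝ E : ℝ) < p)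
    (hp' : p < finrank ℝ E + 1) {ξ : E} (hξ : ξ ≠ 0) : 0 < symJ p ξ := by
  rw [symJ, integral_pos_iff_support_of_nonneg
    (fun y => mul_nonneg (by positivity) (one_sub_cos_nonneg _)) (integrable_weight_cos hp hp' ξ)]
  have ho : IsOpen {y : E | 0 < ⟪y, ξ⟫ ∧ ⟪y, ξ⟫ < 1} :=
    (isOpen_lt (f := fun _ : E => (0 : ℝ)) (g := fun y : E => ⟪y, ξ⟫) (by fun_prop)
      (by fun_prop)).inter (isOpen_lt (f := fun y : E => ⟪y, ξ⟫) (g := fun _ : E => (1 : ℝ)) (by fun_prop)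
      (by fun_prop))
  have hx : 0 < ‖ξ‖ := norm_pos_iff.2 hξ
  refine (ho.measure_pos volume ⟨(2 * ‖ξ‖ ^ 2)⁻¹ • ξ, ?_⟩).trans_le (measure_mono fun y hy => ?_)
  · have : ⟪(2 * ‖ξ‖ ^ 2)⁻¹ • ξ, ξ⟫ = (1 / 2 : ℝ) := by
      rw [inner_smul_left, real_inner_self_eq_norm_sq, RCLike.conj_to_real]; field_simp
    simp only [Set.mem_ofPred_eq, this]; norm_num
  · obtain ⟨h1, h2⟩ := hy
    have hy0 : y ≠ 0 := by rintro rfl; simp at h1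
    refine mul_ne_zero (Real.rpow_pos_of_pos (norm_pos_iff.2 hy0) _).ne' fun h3 => ?_
    have h4 : cos (2 * π * ⟪y, ξ⟫) = 1 := by linarith
    rw [cos_eq_one_iff] at h4
    obtain ⟨n, hn⟩ := h4
    have h5 : (n : ℝ) = ⟪y, ξ⟫ := by
      have := pi_pos
      rw [← mul_right_inj' (by positivity : 2 * π ≠ 0)]; linarith
    rw [← h5] at h1 h2
    have h6 : 0 < n := by exact_mod_cast h1
    have h7 : n < 1 := by exact_mod_cast h2
    omega

variable (E) in
/-- The constant of the symbol. -/
def symJ0 [Nontrivial E] (p : ℝ) : ℝ :=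
  symJ p ((‖(exists_ne (0 : E)).choose‖⁻¹ : ℝ) • (exists_ne (0 : E)).choose)

lemma symJ_eq [Nontrivial E] (hp : (finrank ℝ E : ℝ) < p) (ξ : E) :
    symJ p ξ = symJ0 E p * ‖ξ‖ ^ (p - finrank ℝ E) := by
  have h0 := (exists_ne (0 : E)).choose_spec
  rcases eq_or_ne ξ 0 with rfl | hξ
  · simp [symJ, Real.zero_rpow (sub_pos.2 hp).ne']
  · rw [mul_comm, symJ0, ← symJ_smul (norm_pos_iff.2 hξ)]
    refine symJ_eq_of_norm_eq ?_
    rw [norm_smul, norm_smul, norm_inv, norm_norm, norm_norm,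
      inv_mul_cancel₀ (norm_ne_zero_iff.2 h0), mul_one]

lemma symJ0_pos [Nontrivial E] (hp : (finrank ℝ E : ℝ) < p)
    (hp' : p < finrank ℝ E + 1) : 0 < symJ0 E p := by
  have h0 := (exists_ne (0 : E)).choose_spec
  exact symJ_pos hp hp' (smul_ne_zero (inv_ne_zero (norm_ne_zero_iff.2 h0)) h0)

/-- Stretching by the factor `r` in the direction `w`. -/
def stretch (w : E) (r : ℝ) : E →ₗ[ℝ] E :=
  LinearMap.transvection (innerₛₗ ℝ w) ((r - 1) • w)

lemma stretch_apply (w : E) (r : ℝ) (y : E) : stretch w r y = y + (⟪w, y⟫ * (r - 1)) • w := by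
  simp [stretch, LinearMap.transvection.apply, smul_smul]

lemma stretch_det {w : E} (hw : ‖w‖ = 1) (r : ℝ) : LinearMap.det (stretch w r) = r := by
  rw [stretch, LinearMap.transvection.det]
  simp [hw]

lemma stretch_norm_sq {w : E} (hw : ‖w‖ = 1) (r : ℝ) (y : E) :
    ‖stretch w r y‖ ^ 2 = ‖y‖ ^ 2 + (r ^ 2 - 1) * ⟪w, y⟫ ^ 2 := by
  rw [stretch_apply, norm_add_sq_real, norm_smul, inner_smul_right, hw, mul_one, real_inner_comm,
    Real.norm_eq_abs, sq_abs]
  ring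

lemma stretch_inner {w : E} (hw : ‖w‖ = 1) {r : ℝ} (hr : r ≠ 0) (y ξ : E) :
    ⟪stretch w r y, stretch w r⁻¹ ξ⟫ = ⟪y, ξ⟫ := by
  simp only [stretch_apply, inner_add_left, inner_add_right, inner_smul_left, inner_smul_right,
    RCLike.conj_to_real, real_inner_self_eq_norm_sq, hw, real_inner_comm w y]
  field_simp; ring

lemma integral_stretch {w : E} (hw : ‖w‖ = 1) {r : ℝ} (hr : 0 < r) (f : E → ℝ) :
    ∫ y, f (stretch w r y) = r⁻¹ * ∫ y, f y := by
  have hd : LinearMap.det (stretch w r) ≠ 0 := by rw [stretch_det hw]; exact hr.ne'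
  have h := Measure.map_linearMap_addHaar_eq_smul_addHaar (volume : Measure E) hd
  have hme : MeasurableEmbedding (stretch w r) :=
    (LinearEquiv.ofIsUnitDet (f := stretch w r) (v := Module.finBasis ℝ E) (v' := Module.finBasis ℝ E)
      (by rw [LinearMap.det_toMatrix]; exact hd.isUnit)).toContinuousLinearEquiv.toHomeomorph.measurableEmbedding
  rw [← hme.integral_map, h, integral_smul_measure, stretch_det hw, abs_of_pos (inv_pos.2 hr),
    ENNReal.toReal_ofReal (inv_pos.2 hr).le, smul_eq_mul]

lemma symJ_stretch {w : E} (hw : ‖w‖ = 1) {r : ℝ} (hr : 0 < r) (ξ : E) :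
    ∫ y : E, (‖y‖ ^ 2 + (r ^ 2 - 1) * ⟪w, y⟫ ^ 2) ^ (-p / 2) * (1 - cos (2 * π * ⟪y, ξ⟫)) =
      r⁻¹ * symJ p (stretch w r⁻¹ ξ) := by
  rw [symJ, ← integral_stretch hw hr]
  congr 1; ext y
  rw [stretch_inner hw hr.ne', ← stretch_norm_sq hw, ← Real.rpow_natCast, ← Real.rpow_mul
    (norm_nonneg _)]
  congr 3; push_cast; ring

lemma symQ_aux [Nontrivial E] (hp : (finrank ℝ E : ℝ) < p)
    (hp' : p < finrank ℝ E + 1) {w ξ : E} (hw : ‖w‖ = 1) (hξ : ξ ≠ 0) :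
    p * ∫ y : E, ‖y‖ ^ (-(p + 2)) * ⟪w, y⟫ ^ 2 * (1 - cos (2 * π * ⟪y, ξ⟫)) =
      symJ0 E p * (‖ξ‖ ^ (p - finrank ℝ E) +
        (p - finrank ℝ E) * ‖ξ‖ ^ (p - finrank ℝ E - 2) * ⟪w, ξ⟫ ^ 2) := by
  have hp0 : 0 < p := lt_of_le_of_lt (Nat.cast_nonneg _) hp
  have hx : 0 < ‖ξ‖ := norm_pos_iff.2 hξ
  have hin (y : E) : ⟪w, y⟫ ^ 2 ≤ ‖y‖ ^ 2 := by
    have := abs_real_inner_le_norm w y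
    rw [hw, one_mul] at this
    exact sq_le_sq' (neg_le_of_abs_le this) (le_of_abs_le this)
  have hlow {r : ℝ} (hr : r ∈ Ioo (1 / 2 : ℝ) 2) (y : E) :
      ‖y‖ ^ 2 / 4 ≤ ‖y‖ ^ 2 + (r ^ 2 - 1) * ⟪w, y⟫ ^ 2 := by
    have h1 := hin y
    have h2 : 1 / 4 ≤ r ^ 2 := by nlinarith [hr.1]
    nlinarith [sq_nonneg ⟪w, y⟫]
  have hmeas (q r : ℝ) : Measurable fun y : E => (‖y‖ ^ 2 + (r ^ 2 - 1) * ⟪w, y⟫ ^ 2) ^ q := by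
    fun_prop
  have key := hasDerivAt_integral_of_dominated_loc_of_deriv_le (μ := (volume : Measure E))
    (F := fun (r : ℝ) (y : E) =>
      (‖y‖ ^ 2 + (r ^ 2 - 1) * ⟪w, y⟫ ^ 2) ^ (-p / 2) * (1 - cos (2 * π * ⟪y, ξ⟫)))
    (F' := fun (r : ℝ) (y : E) => ((2 * r * ⟪w, y⟫ ^ 2) * (-p / 2) *
      (‖y‖ ^ 2 + (r ^ 2 - 1) * ⟪w, y⟫ ^ 2) ^ (-p / 2 - 1)) * (1 - cos (2 * π * ⟪y, ξ⟫)))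
    (x₀ := 1) (s := Ioo (1 / 2) 2)
    (bound := fun y => (2 * p * 4 ^ (p / 2 + 1)) * (‖y‖ ^ (-p) * (1 - cos (2 * π * ⟪y, ξ⟫))))
    (Ioo_mem_nhds (by norm_num) (by norm_num))
    (Eventually.of_forall fun r => ((hmeas _ _).mul (by fun_prop)).aestronglyMeasurable)
    (by
      convert integrable_weight_cos hp hp' ξ using 3 with y
      rw [one_pow, sub_self, zero_mul, add_zero, ← Real.rpow_natCast, ← Real.rpow_mul
        (norm_nonneg _)]
      congr 1; push_cast; ring)
    (((Measurable.mul (by fun_prop) (hmeas _ _)).mul (by fun_prop)).aestronglyMeasurable)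
    (Eventually.of_forall fun y r hr => by
      rcases eq_or_ne y 0 with rfl | hy
      · simp
      have hy0 : 0 < ‖y‖ := norm_pos_iff.2 hy
      have h1 : 0 < ‖y‖ ^ 2 / 4 := by positivity
      have h2 := hlow hr y
      have hr0 : 0 < r := by linarith [hr.1]
      rw [norm_mul, norm_mul, norm_mul, Real.norm_of_nonneg (one_sub_cos_nonneg _),
        Real.norm_of_nonneg (by positivity : 0 ≤ 2 * r * ⟪w, y⟫ ^ 2),
        Real.norm_of_nonneg (Real.rpow_nonneg (h1.le.trans h2) _), neg_div, norm_neg,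
        Real.norm_of_nonneg (by positivity), ← mul_assoc (2 * p * _)]
      refine mul_le_mul_of_nonneg_right ?_ (one_sub_cos_nonneg _)
      have h3 : (‖y‖ ^ 2 + (r ^ 2 - 1) * ⟪w, y⟫ ^ 2) ^ (-(p / 2) - 1) ≤
          (‖y‖ ^ 2 / 4) ^ (-(p / 2) - 1) :=
        Real.rpow_le_rpow_of_nonpos h1 h2 (by linarith)
      have h4 : (‖y‖ ^ 2 / 4) ^ (-(p / 2) - 1) = 4 ^ (p / 2 + 1) * (‖y‖ ^ (-p) * (‖y‖ ^ 2)⁻¹) := by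
        rw [Real.div_rpow (by positivity) (by norm_num), ← Real.rpow_natCast, ← Real.rpow_mul
          (norm_nonneg _), div_eq_mul_inv, ← Real.rpow_neg (by norm_num), mul_comm,
          ← Real.rpow_neg (norm_nonneg _), ← Real.rpow_add hy0]
        congr 2 <;> push_cast <;> ring
      calc 2 * r * ⟪w, y⟫ ^ 2 * (p / 2) * (‖y‖ ^ 2 + (r ^ 2 - 1) * ⟪w, y⟫ ^ 2) ^ (-(p / 2) - 1)
          ≤ 2 * 2 * ‖y‖ ^ 2 * (p / 2) * (4 ^ (p / 2 + 1) * (‖y‖ ^ (-p) * (‖y‖ ^ 2)⁻¹)) := by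
            rw [← h4]
            have := hin y
            have := hr.2.le
            have := Real.rpow_nonneg (h1.le.trans h2) (-(p / 2) - 1)
            gcongr
        _ = _ := by field_simp)
    ((integrable_weight_cos hp hp' ξ).const_mul _)
    (Eventually.of_forall fun y r hr => by
      rcases eq_or_ne y 0 with rfl | hy
      · simpa using hasDerivAt_const r (0 : ℝ)
      have hy0 : 0 < ‖y‖ := norm_pos_iff.2 hy
      have h1 : 0 < ‖y‖ ^ 2 / 4 := by positivity
      have h2 := hlow hr y
      refine HasDerivAt.mul_const ?_ _
      refine HasDerivAt.rpow_const ?_ (Or.inl (h1.trans_le h2).ne')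
      refine ((((hasDerivAt_id r).pow 2).sub_const 1).mul_const (⟪w, y⟫ ^ 2)).const_add
        (‖y‖ ^ 2) |>.congr_deriv ?_
      simp)
  have hR : HasDerivAt (fun r : ℝ => r⁻¹ * (symJ0 E p *
      (‖ξ‖ ^ 2 + (r⁻¹ ^ 2 - 1) * ⟪w, ξ⟫ ^ 2) ^ ((p - finrank ℝ E) / 2)))
      (-(symJ0 E p * (‖ξ‖ ^ (p - finrank ℝ E) +
        (p - finrank ℝ E) * ‖ξ‖ ^ (p - finrank ℝ E - 2) * ⟪w, ξ⟫ ^ 2))) 1 := by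
    have h1 : HasDerivAt (fun r : ℝ => r⁻¹) (-1) 1 := by
      simpa using hasDerivAt_inv (one_ne_zero (α := ℝ))
    have h2 := (((h1.pow 2).sub_const 1).mul_const (⟪w, ξ⟫ ^ 2)).const_add (‖ξ‖ ^ 2)
    have h3 := h2.rpow_const (p := (p - finrank ℝ E) / 2) (Or.inl (by simpa using hξ))
    have h4 := h1.mul (h3.const_mul (symJ0 E p))
    refine h4.congr_deriv ?_
    have e1 : (‖ξ‖ ^ 2) ^ ((p - finrank ℝ E) / 2) = ‖ξ‖ ^ (p - finrank ℝ E) := by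
      rw [← Real.rpow_natCast, ← Real.rpow_mul (norm_nonneg _)]; congr 1; push_cast; ring
    have e2 : (‖ξ‖ ^ 2) ^ ((p - finrank ℝ E) / 2 - 1) = ‖ξ‖ ^ (p - finrank ℝ E - 2) := by
      rw [← Real.rpow_natCast, ← Real.rpow_mul (norm_nonneg _)]; congr 1; push_cast; ring
    simp [e1, e2]
    ring
  have hL := key.2
  have hcongr : (fun r : ℝ => ∫ y : E,
      (‖y‖ ^ 2 + (r ^ 2 - 1) * ⟪w, y⟫ ^ 2) ^ (-p / 2) * (1 - cos (2 * π * ⟪y, ξ⟫))) =ᶠ[𝓝 1]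
      (fun r : ℝ => r⁻¹ * (symJ0 E p *
      (‖ξ‖ ^ 2 + (r⁻¹ ^ 2 - 1) * ⟪w, ξ⟫ ^ 2) ^ ((p - finrank ℝ E) / 2))) := by
    filter_upwards [lt_mem_nhds (zero_lt_one (α := ℝ))] with r hr
    rw [symJ_stretch hw hr, symJ_eq hp, ← stretch_norm_sq hw, ← Real.rpow_natCast, ← Real.rpow_mul
      (norm_nonneg _)]
    congr 3; push_cast; ring
  have := hL.unique (hR.congr_of_eventuallyEq hcongr)
  rw [eq_neg_iff_add_eq_zero] at this
  rw [← sub_eq_zero, ← neg_eq_zero, ← this, neg_sub, sub_eq_add_neg, add_comm, ← integral_const_mul,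
    ← integral_neg]
  congr 1
  congr 1; ext y
  rw [one_pow, sub_self, zero_mul, add_zero, ← Real.rpow_natCast ‖y‖, ← Real.rpow_mul
        (norm_nonneg _), show ((2:ℕ):ℝ) * (-p / 2 - 1) = -(p + 2) by push_cast; ring]
  ring

end Multiplier

section Rapid

/-- `φ` and its difference quotients decay like `(1 + ‖x‖)^{-q}`. -/
structure RD (q C : ℝ) (φ : E → F) : Prop where
  cont : Continuous φ
  decay : ∀ x, ‖φ x‖ ≤ C * (1 + ‖x‖) ^ (-q)
  lip : ∀ x h, ‖h‖ ≤ 1 → ‖φ (x + h) - φ x‖ ≤ C * ‖h‖ * (1 + ‖x‖) ^ (-q)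

variable {q q' C C' : ℝ}

lemma RD.nonneg {φ : E → F} (h : RD q C φ) : 0 ≤ C := by
  have := (norm_nonneg _).trans (h.decay 0)
  simpa using this

lemma RD.add {φ ψ : E → F} (h : RD q C φ) (h' : RD q C' ψ) :
    RD q (C + C') fun x => φ x + ψ x := by
  refine ⟨h.cont.add h'.cont, fun x => ?_, fun x y hy => ?_⟩
  · rw [add_mul]; exact (norm_add_le _ _).trans (add_le_add (h.decay x) (h'.decay x))
  · rw [add_mul, add_mul, add_sub_add_comm]
    exact (norm_add_le _ _).trans (add_le_add (h.lip x y hy) (h'.lip x y hy))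

lemma RD.sum {ι : Type*} (s : Finset ι) {φ : ι → E → F} (h : ∀ i, ∃ C, RD q C (φ i)) :
    ∃ C, RD q C fun x => ∑ i ∈ s, φ i x := by
  classical
  induction s using Finset.induction_on with
  | empty => exact ⟨0, by simpa using continuous_const, by simp, by simp⟩
  | insert i s hi ih =>
    obtain ⟨C, hC⟩ := ih
    obtain ⟨C', hC'⟩ := h i
    simp only [Finset.sum_insert hi]
    exact ⟨_, hC'.add hC⟩

lemma RD.smul_const {φ : E → ℝ} (h : RD q C φ) (c : F) : RD q (C * ‖c‖) fun x => φ x • c := by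
  refine ⟨h.cont.smul continuous_const, fun x => ?_, fun x y hy => ?_⟩
  · rw [norm_smul, mul_right_comm]; gcongr; exact h.decay x
  · rw [← sub_smul, norm_smul, mul_right_comm C, mul_right_comm]; gcongr; exact h.lip x y hy

variable (E) in
/-- The mass of the weight `(1 + ‖x‖)^{-q}`. -/
def massI (q : ℝ) : ℝ := ∫ x : E, (1 + ‖x‖) ^ (-q)

lemma massI_nonneg : 0 ≤ massI E q := integral_nonneg fun x => by positivity

lemma RD.integrable {φ : E → F} (h : RD q C φ) (hq : (finrank ℝ E : ℝ) < q) : Integrable φ :=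
  ((integrable_one_add_norm hq).const_mul C).mono' h.cont.aestronglyMeasurable
    (Eventually.of_forall h.decay)

lemma RD.tf {φ : E → F} (h : RD q C φ) (hq : (finrank ℝ E : ℝ) < q) :
    TF φ (C * massI E q) (2 * (C * massI E q)) := by
  have hi := h.integrable hq
  have h0 := h.nonneg
  have hI : 0 ≤ massI E q := massI_nonneg
  have hl : ∫ x, ‖φ x‖ ≤ C * massI E q := by
    rw [massI, ← integral_const_mul]
    exact integral_mono hi.norm ((integrable_one_add_norm hq).const_mul C) h.decay
  refine ⟨hi, hl, fun y => ?_⟩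
  rcases le_total ‖y‖ 1 with hy | hy
  · calc ∫ x, ‖φ (x + y) - φ x‖ ≤ ∫ x, C * ‖y‖ * (1 + ‖x‖) ^ (-q) :=
          integral_mono ((hi.comp_add_right y).sub hi).norm
            ((integrable_one_add_norm hq).const_mul _) fun x => h.lip x y hy
      _ = 1 * (C * massI E q) * ‖y‖ := by rw [integral_const_mul, massI]; ring
      _ ≤ 2 * (C * massI E q) * ‖y‖ := by gcongr; norm_num
  · calc ∫ x, ‖φ (x + y) - φ x‖ ≤ ∫ x, (‖φ (x + y)‖ + ‖φ x‖) :=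
          integral_mono ((hi.comp_add_right y).sub hi).norm
            ((hi.comp_add_right y).norm.add hi.norm) fun x => norm_sub_le _ _
      _ = 2 * ∫ x, ‖φ x‖ := by
          rw [integral_add (hi.comp_add_right y).norm hi.norm,
            integral_add_right_eq_self (fun x => ‖φ x‖) y]; ring
      _ ≤ 2 * (C * massI E q) * 1 := by linarith
      _ ≤ 2 * (C * massI E q) * ‖y‖ := by gcongr

lemma norm_mul_weight_le (x : E) (q : ℝ) : ‖x‖ * (1 + ‖x‖) ^ (-(q + 1)) ≤ (1 + ‖x‖) ^ (-q) := by
  have h : 0 < 1 + ‖x‖ := by positivity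
  calc ‖x‖ * (1 + ‖x‖) ^ (-(q + 1)) ≤ (1 + ‖x‖) * (1 + ‖x‖) ^ (-(q + 1)) := by gcongr; linarith
    _ = (1 + ‖x‖) ^ (-q) := by
      rw [mul_comm, ← Real.rpow_add_one h.ne']; congr 1; ring

lemma RD.moment {φ : E → F} (h : RD (q + 1) C φ) (hq : (finrank ℝ E : ℝ) < q) :
    Integrable fun x => ‖x‖ * ‖φ x‖ := by
  refine ((integrable_one_add_norm hq).const_mul C).mono'
    (continuous_norm.mul h.cont.norm).aestronglyMeasurable (Eventually.of_forall fun x => ?_)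
  rw [norm_mul, norm_norm, norm_norm]
  calc ‖x‖ * ‖φ x‖ ≤ ‖x‖ * (C * (1 + ‖x‖) ^ (-(q + 1))) := by gcongr; exact h.decay x
    _ = C * (‖x‖ * (1 + ‖x‖) ^ (-(q + 1))) := by ring
    _ ≤ _ := by have := h.nonneg; gcongr; exact norm_mul_weight_le x q

lemma RD.moment_lip {φ : E → F} (h : RD (q + 1) C φ) (hq : (finrank ℝ E : ℝ) < q) {y : E}
    (hy : ‖y‖ ≤ 1) : Integrable (fun x => ‖x‖ * ‖φ (x + y) - φ x‖) ∧
      ∫ x, ‖x‖ * ‖φ (x + y) - φ x‖ ≤ C * massI E q * ‖y‖ := by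
  have hb (x : E) : ‖x‖ * ‖φ (x + y) - φ x‖ ≤ C * ‖y‖ * (1 + ‖x‖) ^ (-q) := by
    have := h.nonneg
    calc ‖x‖ * ‖φ (x + y) - φ x‖ ≤ ‖x‖ * (C * ‖y‖ * (1 + ‖x‖) ^ (-(q + 1))) := by
          gcongr; exact h.lip x y hy
      _ = C * ‖y‖ * (‖x‖ * (1 + ‖x‖) ^ (-(q + 1))) := by ring
      _ ≤ _ := by gcongr; exact norm_mul_weight_le x q
  have hi : Integrable (fun x => ‖x‖ * ‖φ (x + y) - φ x‖) := by
    refine ((integrable_one_add_norm hq).const_mul (C * ‖y‖)).mono'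
      (continuous_norm.mul (((h.cont.comp (continuous_id.add continuous_const)).sub
        h.cont).norm)).aestronglyMeasurable (Eventually.of_forall fun x => ?_)
    rw [Real.norm_of_nonneg (by positivity)]; exact hb x
  refine ⟨hi, (integral_mono hi ((integrable_one_add_norm hq).const_mul _) hb).trans (le_of_eq ?_)⟩
  rw [integral_const_mul, massI]; ring

open scoped SchwartzMap FourierTransform ContDiff in
lemma RD.of_schwartz (g : 𝓢(E, ℂ)) (n : ℕ) : ∃ C, RD (n : ℝ) C fun x => (g x).re := by
  set C0 : ℝ := 2 ^ n * (Finset.Iic (n, 1)).sup (fun m => SchwartzMap.seminorm ℝ m.1 m.2) g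
  have h0 (x : E) : (1 + ‖x‖) ^ n * ‖g x‖ ≤ C0 := by
    simpa using SchwartzMap.one_add_le_sup_seminorm_apply (𝕜 := ℝ) (m := (n, 1)) (k := n) (n := 0)
      le_rfl (by simp) g x
  have h1 (x : E) : (1 + ‖x‖) ^ n * ‖fderiv ℝ g x‖ ≤ C0 := by
    have := SchwartzMap.one_add_le_sup_seminorm_apply (𝕜 := ℝ) (m := (n, 1)) (k := n) (n := 1)
      le_rfl le_rfl g x
    rwa [norm_iteratedFDeriv_one] at this
  have hC0 : 0 ≤ C0 := le_trans (by positivity) (h0 0)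
  have h2 : (1:ℝ) ≤ 2 ^ n := one_le_pow₀ (by norm_num)
  refine ⟨2 ^ n * C0, Complex.continuous_re.comp g.continuous, fun x => ?_, fun x h hh => ?_⟩
  · have hx : 0 < (1 + ‖x‖) ^ n := by positivity
    rw [Real.rpow_neg (by positivity), Real.rpow_natCast, ← div_eq_mul_inv, le_div_iff₀ hx]
    calc _ ≤ ‖g x‖ * (1 + ‖x‖) ^ n := by gcongr; exact Complex.abs_re_le_norm _
      _ ≤ 1 * C0 := by rw [one_mul, mul_comm]; exact h0 x
      _ ≤ _ := by gcongr
  · have hx : 0 < (1 + ‖x‖) ^ n := by positivity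
    have hb : ∀ z ∈ Metric.closedBall x ‖h‖, ‖fderiv ℝ g z‖ ≤ 2 ^ n * C0 * ((1 + ‖x‖) ^ n)⁻¹ := by
      intro z hz
      rw [Metric.mem_closedBall, dist_eq_norm] at hz
      have h3 : 1 + ‖x‖ ≤ 2 * (1 + ‖z‖) := by
        have := norm_sub_norm_le x z
        rw [norm_sub_rev] at this
        linarith [norm_nonneg z]
      rw [← div_eq_mul_inv, le_div_iff₀ hx]
      calc ‖fderiv ℝ g z‖ * (1 + ‖x‖) ^ n ≤ ‖fderiv ℝ g z‖ * (2 * (1 + ‖z‖)) ^ n := by gcongr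
        _ = 2 ^ n * ((1 + ‖z‖) ^ n * ‖fderiv ℝ g z‖) := by rw [mul_pow]; ring
        _ ≤ _ := by gcongr; exact h1 z
    have h4 := (convex_closedBall x ‖h‖).norm_image_sub_le_of_norm_fderiv_le
      (fun z _ => g.differentiableAt) hb (Metric.mem_closedBall_self (norm_nonneg _))
      (y := x + h) (by simp)
    rw [add_sub_cancel_left] at h4
    rw [← Complex.sub_re, Real.rpow_neg (by positivity), Real.rpow_natCast]
    calc _ ≤ ‖g (x + h) - g x‖ := Complex.abs_re_le_norm _
      _ ≤ _ := h4
      _ = _ := by ring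

/-- The cosine transform. -/
def cosint (f : E → ℝ) (x : E) : ℝ := ∫ ξ, cos (2 * π * ⟪x, ξ⟫) * f ξ

open scoped SchwartzMap FourierTransform ContDiff in
lemma cosint_schwartz {f : E → ℝ} (hf : ContDiff ℝ ∞ f) (hc : HasCompactSupport f) :
    ∃ g : 𝓢(E, ℂ), (∀ x, cosint f x = (g x).re) ∧ ∫ x, cosint f x = f 0 := by
  have hf' : ContDiff ℝ ∞ fun x => (f x : ℂ) := Complex.ofRealCLM.contDiff.comp hf
  have hc' : HasCompactSupport fun x => (f x : ℂ) := hc.comp_left Complex.ofReal_zero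
  set S : 𝓢(E, ℂ) := hc'.toSchwartzMap hf'
  have hS (x : E) : S x = f x := rfl
  have e (x : E) : cosint f x = ((𝓕 S) x).re := by
    rw [SchwartzMap.fourier_coe, Real.fourier_eq']
    have hi : Integrable fun ξ => Complex.exp (↑(-2 * π * ⟪ξ, x⟫) * Complex.I) • S ξ := by
      refine S.integrable.norm.mono' (by fun_prop) (Eventually.of_forall fun ξ => ?_)
      rw [norm_smul, Complex.norm_exp_ofReal_mul_I, one_mul]
    rw [← RCLike.re_eq_complex_re, ← integral_re hi]
    refine integral_congr_ae (Eventually.of_forall fun ξ => ?_)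
    simp only [hS, RCLike.re_eq_complex_re, smul_eq_mul, Complex.re_mul_ofReal,
      Complex.exp_ofReal_mul_I_re]
    rw [real_inner_comm, neg_mul, neg_mul, cos_neg]
  refine ⟨𝓕 S, e, ?_⟩
  simp_rw [e]
  have h1 : ∫ x, ((𝓕 S) x).re = (∫ x, (𝓕 S) x).re := by
    exact integral_re (𝕜 := ℂ) (μ := volume) (f := fun x => (𝓕 S) x) (𝓕 S).integrable
  have h2 : 𝓕⁻ (𝓕 S) 0 = S 0 := by simp
  rw [h1, ← Complex.ofReal_re (f 0), ← hS, ← h2, SchwartzMap.fourierInv_coe, Real.fourierInv_eq']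
  simp

lemma cosint_rd {f : E → ℝ} (hf : ContDiff ℝ (⊤ : ℕ∞) f) (hc : HasCompactSupport f) (n : ℕ) :
    ∃ C, RD (n : ℝ) C (cosint f) := by
  obtain ⟨g, hg, -⟩ := cosint_schwartz hf hc
  rw [funext hg]
  exact RD.of_schwartz g n

end Rapid

section Parametrix

variable {a b p : ℝ}

lemma integrable_smul_ker [Nontrivial E] (hp : (finrank ℝ E : ℝ) < p)
    (hp' : p < finrank ℝ E + 1) {g : E → ℝ} (hg : Continuous g) {c : ℝ}
    (hc : ∀ y, |g y| ≤ c * min 1 ‖y‖) : Integrable fun y => g y • (ker a b p y : E →L[ℝ] E) := by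
  refine ((ker_wk (a := a) (b := b) hp hp').int.const_mul c).mono'
    (hg.aestronglyMeasurable.smul ker_measurable.aestronglyMeasurable)
    (Eventually.of_forall fun y => ?_)
  rw [norm_smul, Real.norm_eq_abs]
  calc |g y| * ‖(ker a b p y : E →L[ℝ] E)‖ ≤ c * min 1 ‖y‖ * ‖(ker a b p y : E →L[ℝ] E)‖ := by
        gcongr; exact hc y
    _ = _ := by ring

lemma one_sub_cos_abs_le (ξ y : E) :
    |1 - cos (2 * π * ⟪y, ξ⟫)| ≤ (2 + 2 * π * ‖ξ‖) * min 1 ‖y‖ := by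
  rw [abs_of_nonneg (one_sub_cos_nonneg _)]; exact one_sub_cos_le y ξ

lemma min_weight_le {c t : ℝ} (ξ y : E) (h1 : |t| ≤ 2) (h2 : |t| ≤ |2 * π * ⟪y, ξ⟫|)
    (hc : c = 2 + 2 * π * ‖ξ‖) : |t| ≤ c * min 1 ‖y‖ := by
  subst hc
  rw [abs_mul, abs_of_pos two_pi_pos] at h2
  have h4 := abs_real_inner_le_norm y ξ
  have h3 : |t| ≤ 2 * π * ‖ξ‖ * ‖y‖ := by
    calc _ ≤ 2 * π * |⟪y, ξ⟫| := h2
      _ ≤ 2 * π * (‖y‖ * ‖ξ‖) := by gcongr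
      _ = _ := by ring
  have h5 : 0 ≤ 2 * π * ‖ξ‖ := by positivity
  rcases le_total 1 ‖y‖ with h | h
  · rw [min_eq_left h]; linarith
  · rw [min_eq_right h]; nlinarith [norm_nonneg y]

lemma symM_inner [Nontrivial E] (hp : (finrank ℝ E : ℝ) < p) (hp' : p < finrank ℝ E + 1)
    {ξ : E} (hξ : ξ ≠ 0) (w : E) :
    ∫ y : E, (1 - cos (2 * π * ⟪y, ξ⟫)) * ⟪ker a b p y w, w⟫ =
      symJ0 E p * (‖ξ‖ ^ (p - finrank ℝ E) * (a + b / p) * ‖w‖ ^ 2 +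
        b / p * (p - finrank ℝ E) * ‖ξ‖ ^ (p - finrank ℝ E - 2) * ⟪w, ξ⟫ ^ 2) := by
  have hp0 : 0 < p := lt_of_le_of_lt (Nat.cast_nonneg _) hp
  rcases eq_or_ne w 0 with rfl | hw
  · simp
  have hw0 : 0 < ‖w‖ := norm_pos_iff.2 hw
  set n : E := ‖w‖⁻¹ • w with hn
  have hn1 : ‖n‖ = 1 := by rw [hn, norm_smul, norm_inv, norm_norm, inv_mul_cancel₀ hw0.ne']
  have hwn : w = ‖w‖ • n := by rw [hn, smul_smul, mul_inv_cancel₀ hw0.ne', one_smul]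
  have hQ := symQ_aux hp hp' hn1 hξ
  have hJ := symJ_eq hp ξ
  have hQ' : ∫ y : E, ‖y‖ ^ (-(p + 2)) * ⟪n, y⟫ ^ 2 * (1 - cos (2 * π * ⟪y, ξ⟫)) =
      symJ0 E p * (‖ξ‖ ^ (p - finrank ℝ E) +
        (p - finrank ℝ E) * ‖ξ‖ ^ (p - finrank ℝ E - 2) * ⟪n, ξ⟫ ^ 2) / p := by
    rw [← hQ]; field_simp
  have hQi : Integrable fun y : E =>
      ‖y‖ ^ (-(p + 2)) * ⟪n, y⟫ ^ 2 * (1 - cos (2 * π * ⟪y, ξ⟫)) := by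
    refine (integrable_weight_cos hp hp' ξ).mono' (by
      have hm : Measurable fun y : E => ‖y‖ ^ (-(p + 2)) := by fun_prop
      exact ((hm.mul (by fun_prop)).mul (by fun_prop)).aestronglyMeasurable)
      (Eventually.of_forall fun y => ?_)
    rw [norm_mul, Real.norm_of_nonneg (one_sub_cos_nonneg _), Real.norm_of_nonneg (by positivity)]
    refine mul_le_mul_of_nonneg_right ?_ (one_sub_cos_nonneg _)
    rcases eq_or_ne y 0 with rfl | hy
    · simp [Real.rpow_nonneg]
    have hy0 : 0 < ‖y‖ := norm_pos_iff.2 hy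
    have h1 := abs_real_inner_le_norm n y
    rw [hn1, one_mul] at h1
    calc ‖y‖ ^ (-(p + 2)) * ⟪n, y⟫ ^ 2 ≤ ‖y‖ ^ (-(p + 2)) * ‖y‖ ^ 2 := by
          rw [← sq_abs ⟪n, y⟫]; gcongr
      _ = ‖y‖ ^ (-p) := by
          rw [← Real.rpow_natCast, ← Real.rpow_add hy0]; congr 1; push_cast; ring
  have e : ∀ y : E, (1 - cos (2 * π * ⟪y, ξ⟫)) * ⟪ker a b p y w, w⟫ =
      (a * ‖w‖ ^ 2) * (‖y‖ ^ (-p) * (1 - cos (2 * π * ⟪y, ξ⟫))) + (b * ‖w‖ ^ 2) *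
        (‖y‖ ^ (-(p + 2)) * ⟪n, y⟫ ^ 2 * (1 - cos (2 * π * ⟪y, ξ⟫))) := by
    intro y
    rw [ker_apply, inner_add_left, inner_smul_left, inner_smul_left, real_inner_self_eq_norm_sq,
      RCLike.conj_to_real, RCLike.conj_to_real]
    have : ⟪y, w⟫ = ‖w‖ * ⟪n, y⟫ := by
      conv_lhs => rw [hwn]
      rw [inner_smul_right, real_inner_comm]
    rw [this]; ring
  have hwx : ⟪w, ξ⟫ = ‖w‖ * ⟪n, ξ⟫ := by
    conv_lhs => rw [hwn]
    rw [inner_smul_left, RCLike.conj_to_real]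
  simp_rw [e]
  rw [integral_add ((integrable_weight_cos hp hp' ξ).const_mul _) (hQi.const_mul _),
    integral_const_mul, integral_const_mul, hQ', ← symJ, hJ, hwx]
  field_simp; ring

lemma symM_apply [Nontrivial E] (hp : (finrank ℝ E : ℝ) < p) (hp' : p < finrank ℝ E + 1)
    {ξ : E} (hξ : ξ ≠ 0) (w : E) :
    ∫ y : E, (1 - cos (2 * π * ⟪y, ξ⟫)) • ker a b p y w =
      (symJ0 E p * ‖ξ‖ ^ (p - finrank ℝ E) * (a + b / p)) • w +
        (symJ0 E p * (b / p * (p - finrank ℝ E) * ‖ξ‖ ^ (p - finrank ℝ E - 2)) * ⟪ξ, w⟫) • ξ := by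
  have hi := integrable_smul_ker (a := a) (b := b) hp hp' (g := fun y => 1 - cos (2 * π * ⟪y, ξ⟫))
    (by fun_prop) (fun y => one_sub_cos_abs_le ξ y)
  have hiw (z : E) : Integrable fun y => (1 - cos (2 * π * ⟪y, ξ⟫)) • ker a b p y z := by
    have := hi.apply_continuousLinearMap z
    exact this
  set S : E →L[ℝ] E := ∫ y : E, (1 - cos (2 * π * ⟪y, ξ⟫)) • ker a b p y with hS
  have hSa (z : E) : S z = ∫ y : E, (1 - cos (2 * π * ⟪y, ξ⟫)) • ker a b p y z := by
    rw [hS, ContinuousLinearMap.integral_apply hi]; rfl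
  have hSi (z x : E) : ⟪S z, x⟫ = ∫ y : E, (1 - cos (2 * π * ⟪y, ξ⟫)) * ⟪ker a b p y z, x⟫ := by
    rw [hSa, real_inner_comm, ← integral_inner (hiw z)]
    congr 1; ext y
    rw [inner_smul_right, real_inner_comm x]
  set S' : E →L[ℝ] E := (symJ0 E p * ‖ξ‖ ^ (p - finrank ℝ E) * (a + b / p)) •
    ContinuousLinearMap.id ℝ E + (symJ0 E p * (b / p * (p - finrank ℝ E) *
      ‖ξ‖ ^ (p - finrank ℝ E - 2))) • InnerProductSpace.rankOne ℝ ξ ξ with hS'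
  have hSa' (z : E) : S' z = (symJ0 E p * ‖ξ‖ ^ (p - finrank ℝ E) * (a + b / p)) • z +
        (symJ0 E p * (b / p * (p - finrank ℝ E) * ‖ξ‖ ^ (p - finrank ℝ E - 2)) * ⟪ξ, z⟫) • ξ := by
    simp [hS', smul_smul]
  have hsym : ((S - S' : E →L[ℝ] E) : E →ₗ[ℝ] E).IsSymmetric := by
    intro z x
    simp only [ContinuousLinearMap.coe_coe, _root_.sub_apply, inner_sub_left, inner_sub_right]
    congr 1
    · rw [hSi, real_inner_comm (S x), hSi]
      congr 1; ext y
      rw [ker_symm, real_inner_comm z]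
    · simp only [hSa', inner_add_left, inner_add_right, inner_smul_left, inner_smul_right,
        RCLike.conj_to_real, real_inner_comm z ξ]
      ring
  have h0 := hsym.inner_map_self_eq_zero.1 fun x => by
    rw [ContinuousLinearMap.coe_coe, _root_.sub_apply, inner_sub_left, hSi, symM_inner hp hp' hξ,
      hSa', inner_add_left, inner_smul_left, inner_smul_left, real_inner_self_eq_norm_sq,
      RCLike.conj_to_real, RCLike.conj_to_real, real_inner_comm x ξ]
    ring
  have h1 : (S - S') w = 0 := by
    rw [← ContinuousLinearMap.coe_coe, h0]; rfl
  rw [_root_.sub_apply, sub_eq_zero, hSa, hSa'] at h1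
  exact h1

lemma sin_ker_integral_zero (ξ w : E) :
    ∫ y : E, sin (2 * π * ⟪y, ξ⟫) • ker a b p y w = 0 := by
  have h := integral_neg_eq_self (fun y : E => sin (2 * π * ⟪y, ξ⟫) • ker a b p y w) volume
  simp only [inner_neg_left, mul_neg, sin_neg, ker_neg, neg_smul, integral_neg] at h
  set I := ∫ y : E, sin (2 * π * ⟪y, ξ⟫) • ker a b p y w with hI
  have h2 : (2 : ℝ) • I = 0 := by
    rw [two_smul]; nth_rewrite 1 [← h]; exact neg_add_cancel I
  exact (smul_eq_zero.1 h2).resolve_left two_ne_zero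

lemma cos_diff_ker_integral [Nontrivial E] (hp : (finrank ℝ E : ℝ) < p)
    (hp' : p < finrank ℝ E + 1) (x ξ w : E) :
    ∫ y : E, (cos (2 * π * ⟪x, ξ⟫) - cos (2 * π * ⟪x - y, ξ⟫)) • ker a b p y w =
      cos (2 * π * ⟪x, ξ⟫) • ∫ y : E, (1 - cos (2 * π * ⟪y, ξ⟫)) • ker a b p y w := by
  have hi : Integrable fun y : E => (1 - cos (2 * π * ⟪y, ξ⟫)) • ker a b p y w :=
    (integrable_smul_ker (a := a) (b := b) hp hp' (g := fun y => 1 - cos (2 * π * ⟪y, ξ⟫))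
    (by fun_prop) (fun y => one_sub_cos_abs_le ξ y)).apply_continuousLinearMap w
  have hi' : Integrable fun y : E => sin (2 * π * ⟪y, ξ⟫) • ker a b p y w := (integrable_smul_ker (a := a) (b := b) hp hp' (g := fun y => sin (2 * π * ⟪y, ξ⟫))
    (by fun_prop) (fun y => min_weight_le ξ y
      ((abs_sin_le_one _).trans one_le_two) abs_sin_le_abs rfl)).apply_continuousLinearMap w
  have e (y : E) : (cos (2 * π * ⟪x, ξ⟫) - cos (2 * π * ⟪x - y, ξ⟫)) • ker a b p y w =
      cos (2 * π * ⟪x, ξ⟫) • ((1 - cos (2 * π * ⟪y, ξ⟫)) • ker a b p y w) -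
        sin (2 * π * ⟪x, ξ⟫) • (sin (2 * π * ⟪y, ξ⟫) • ker a b p y w) := by
    rw [inner_sub_left, mul_sub, cos_sub, smul_smul, smul_smul, ← sub_smul]; congr 1; ring
  simp_rw [e]
  rw [integral_sub (hi.fun_smul _) (hi'.fun_smul _), integral_smul, integral_smul, sin_ker_integral_zero,
    smul_zero, sub_zero]

lemma cos_diff_abs_le (x ξ y : E) :
    |cos (2 * π * ⟪x, ξ⟫) - cos (2 * π * ⟪x - y, ξ⟫)| ≤ (2 + 2 * π * ‖ξ‖) * min 1 ‖y‖ := by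
  refine min_weight_le ξ y ?_ ?_ rfl
  · have h1 := abs_cos_le_one (2 * π * ⟪x, ξ⟫)
    have h2 := abs_cos_le_one (2 * π * ⟪x - y, ξ⟫)
    exact (abs_sub _ _).trans (by linarith)
  · refine (abs_cos_sub_cos_le _ _).trans (le_of_eq ?_)
    rw [inner_sub_left]; congr 1; ring

/-- The operator applied to a superposition of cosine waves. -/
lemma op_ker_cos [Nontrivial E] (hp : (finrank ℝ E : ℝ) < p) (hp' : p < finrank ℝ E + 1)
    {B : E → E} (hB : Continuous B) (hc : HasCompactSupport B) (x : E) :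
    op (ker a b p) (fun x => ∫ ξ, cos (2 * π * ⟪x, ξ⟫) • B ξ) x =
      ∫ ξ, cos (2 * π * ⟪x, ξ⟫) • ∫ y : E, (1 - cos (2 * π * ⟪y, ξ⟫)) • ker a b p y (B ξ) := by
  have hBi (z : E) : Integrable fun ξ => cos (2 * π * ⟪z, ξ⟫) • B ξ :=
    Continuous.integrable_of_hasCompactSupport (by fun_prop) hc.smul_left
  have hW : Integrable fun ξ => (2 + 2 * π * ‖ξ‖) * ‖B ξ‖ :=
    Continuous.integrable_of_hasCompactSupport (by fun_prop) hc.norm.mul_left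
  have hprod : Integrable (fun q : E × E =>
      (cos (2 * π * ⟪x, q.2⟫) - cos (2 * π * ⟪x - q.1, q.2⟫)) • ker a b p q.1 (B q.2))
      (volume.prod volume) := by
    refine ((ker_wk (a := a) (b := b) hp hp').int.mul_prod hW).mono'
      (AEStronglyMeasurable.smul (by fun_prop) (aesm_clm_apply
        ker_measurable.aestronglyMeasurable.comp_fst (by fun_prop)))
      (Eventually.of_forall fun q => ?_)
    rw [norm_smul, Real.norm_eq_abs]
    calc _ ≤ ((2 + 2 * π * ‖q.2‖) * min 1 ‖q.1‖) * (‖(ker a b p q.1 : E →L[ℝ] E)‖ * ‖B q.2‖) := by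
          gcongr
          · exact cos_diff_abs_le _ _ _
          · exact ContinuousLinearMap.le_opNorm _ _
      _ = _ := by ring
  have e (y : E) : ker a b p y ((∫ ξ, cos (2 * π * ⟪x, ξ⟫) • B ξ) -
      ∫ ξ, cos (2 * π * ⟪x - y, ξ⟫) • B ξ) =
      ∫ ξ, (cos (2 * π * ⟪x, ξ⟫) - cos (2 * π * ⟪x - y, ξ⟫)) • ker a b p y (B ξ) := by
    have hd : Integrable fun ξ => cos (2 * π * ⟪x, ξ⟫) • B ξ - cos (2 * π * ⟪x - y, ξ⟫) • B ξ :=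
      (hBi x).sub (hBi (x - y))
    rw [← integral_sub (hBi _) (hBi _), ← ContinuousLinearMap.integral_comp_comm _ hd]
    congr 1; ext ξ
    rw [← sub_smul, map_smul]
  rw [op]
  simp_rw [e]
  rw [integral_integral_swap hprod]
  congr 1; ext ξ
  exact cos_diff_ker_integral hp hp' x ξ _

end Parametrix

section Parametrix2

open scoped ContDiff

variable {a b p : ℝ}

/-- A rapidly decaying parametrix on one dyadic frequency shell. -/
structure Para (a b p : ℝ) (ψ : E → ℝ) (H : E → E →L[ℝ] E) (C : ℝ) : Prop where
  psi : RD ((finrank ℝ E : ℝ) + 1 + 1) C ψ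
  ker : RD ((finrank ℝ E : ℝ) + 1 + 1) C H
  psi_int : ∫ x, ψ x = 1
  ker_int : ∫ x, H x = 0
  psi_even : ∀ x, ψ (-x) = ψ x
  ker_even : ∀ x, H (-x) = H x
  eq : ∀ w x, op (LameFrac.ker a b p) (fun y => H y w) x =
    ((2 : ℝ) ^ finrank ℝ E * ψ ((2 : ℝ) • x) - ψ x) • w

lemma contDiff_mul_rpow_norm {θ : E → ℝ} (hθ : ContDiff ℝ ∞ θ) {r : ℝ} (hr : 0 < r)
    (h0 : ∀ x, ‖x‖ ≤ r → θ x = 0) (q : ℝ) : ContDiff ℝ ∞ fun x => θ x * ‖x‖ ^ q := by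
  rw [contDiff_iff_contDiffAt]
  intro x
  rcases eq_or_ne x 0 with rfl | hx
  · have : (fun x : E => θ x * ‖x‖ ^ q) =ᶠ[𝓝 0] fun _ => 0 := by
      filter_upwards [Metric.closedBall_mem_nhds (0 : E) hr] with y hy
      rw [h0 y (by simpa using hy), zero_mul]
    exact contDiffAt_const.congr_of_eventuallyEq this
  · exact hθ.contDiffAt.mul ((contDiffAt_norm ℝ hx).rpow_const_of_ne (norm_ne_zero_iff.2 hx))

lemma cosint_neg (f : E → ℝ) (x : E) : cosint f (-x) = cosint f x := by
  simp [cosint]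

lemma cosint_family {ι : Type*} [Fintype ι] {f : ι → E → ℝ} (hf : ∀ i, ContDiff ℝ ∞ (f i))
    (hc : ∀ i, HasCompactSupport (f i)) (l : ι → E →L[ℝ] E) :
    ((∃ C, RD ((finrank ℝ E : ℝ) + 1 + 1) C fun x => ∑ i, cosint (f i) x • l i) ∧
    ∫ x, ∑ i, cosint (f i) x • l i = ∑ i, f i 0 • l i) ∧
    ∀ x w, (∑ i, cosint (f i) x • l i) w = ∫ ξ, cos (2 * π * ⟪x, ξ⟫) • ∑ i, f i ξ • l i w := by
  have hrd (i : ι) : ∃ C, RD ((finrank ℝ E : ℝ) + 1 + 1) C (cosint (f i)) := by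
    obtain ⟨C, hC⟩ := cosint_rd (hf i) (hc i) (finrank ℝ E + 2)
    refine ⟨C, ?_⟩
    convert hC using 1; push_cast; ring
  have hi (i : ι) : Integrable (cosint (f i)) := (hrd i).choose_spec.integrable (by linarith)
  refine ⟨⟨RD.sum _ fun i => ?_, ?_⟩, fun x w => ?_⟩
  · obtain ⟨C, hC⟩ := hrd i
    exact ⟨_, hC.smul_const (l i)⟩
  · rw [integral_finsetSum _ fun i _ => (hi i).smul_const _]
    refine Finset.sum_congr rfl fun i _ => ?_
    obtain ⟨g, -, hg⟩ := cosint_schwartz (hf i) (hc i)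
    rw [integral_smul_const, hg]
  · simp_rw [Finset.smul_sum]
    have hintg (i : ι) : Integrable fun ξ => cos (2 * π * ⟪x, ξ⟫) * f i ξ :=
      Continuous.integrable_of_hasCompactSupport
        (Continuous.mul (by fun_prop) (hf i).continuous) (hc i).mul_left
    rw [integral_finsetSum _ fun i _ => by simpa [smul_smul] using (hintg i).smul_const (l i w)]
    rw [_root_.sum_apply]
    refine Finset.sum_congr rfl fun i _ => ?_
    simp_rw [smul_smul]
    rw [integral_smul_const]; rfl

variable (E) in
lemma exists_bump : ∃ Ψ : E → ℝ, ContDiff ℝ ∞ Ψ ∧ HasCompactSupport Ψ ∧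
    (∀ x, ‖x‖ ≤ 1 → Ψ x = 1) := by
  let f : ContDiffBump (0 : E) := ⟨1, 2, one_pos, one_lt_two⟩
  exact ⟨f, f.contDiff, f.hasCompactSupport, fun x hx => f.one_of_mem_closedBall (by simpa using hx)⟩

lemma symbol_inverse {J N κ m1 m2 th n1 n2 : ℝ} (hJ : J ≠ 0) (hN : 0 < N) (hm1 : m1 ≠ 0)
    (hm2 : m2 ≠ 0) (h1 : n1 = th * N ^ (-κ)) (h2 : n2 = th * N ^ (-κ - 2)) (t : ℝ) :
    J * N ^ κ * m1 * (1 / m1 / J * n1) = th ∧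
    J * N ^ κ * m1 * ((1 / m2 - 1 / m1) / J * n2 * t) + J * ((m2 - m1) * N ^ (κ - 2)) *
      (1 / m1 / J * n1 * t + (1 / m2 - 1 / m1) / J * n2 * t * N ^ 2) = 0 := by
  have e1 : N ^ κ * N ^ (-κ) = 1 := by rw [← Real.rpow_add hN]; simp
  have e2 : N ^ (-κ - 2) = N ^ (-κ) * (N ^ 2)⁻¹ := by
    rw [sub_eq_add_neg, Real.rpow_add hN, Real.rpow_neg hN.le 2]; norm_cast
  have e3 : N ^ (κ - 2) = N ^ κ * (N ^ 2)⁻¹ := by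
    rw [sub_eq_add_neg, Real.rpow_add hN, Real.rpow_neg hN.le 2]; norm_cast
  rw [h1, h2, e2, e3]
  constructor
  · field_simp; linear_combination th * e1
  · field_simp; ring

lemma exists_para [Nontrivial E] (hp : (finrank ℝ E : ℝ) < p) (hp' : p < finrank ℝ E + 1)
    (h1 : a + b / p ≠ 0) (h2 : a + b * (1 + (p - finrank ℝ E)) / p ≠ 0) :
    ∃ (ψ : E → ℝ) (H : E → E →L[ℝ] E) (C : ℝ), Para a b p ψ H C := by
  obtain ⟨Ψ, hΨ, hΨc, hΨ1⟩ := exists_bump E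
  set κ := p - finrank ℝ E with hκ
  have hJ : symJ0 E p ≠ 0 := (symJ0_pos hp hp').ne'
  set th : E → ℝ := fun ξ => Ψ ((2 : ℝ)⁻¹ • ξ) - Ψ ξ with hth
  have hΨ2c : HasCompactSupport fun ξ => Ψ ((2 : ℝ)⁻¹ • ξ) :=
    hΨc.comp_homeomorph (Homeomorph.smulOfNeZero (2 : ℝ)⁻¹ (by norm_num))
  have hΨ2 : ContDiff ℝ ∞ fun ξ => Ψ ((2 : ℝ)⁻¹ • ξ) := hΨ.comp (contDiff_const_smul _)
  have hths : ContDiff ℝ ∞ th := hΨ2.sub hΨ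
  have hthc : HasCompactSupport th := hΨ2c.sub hΨc
  have hth0 (x : E) (hx : ‖x‖ ≤ 1) : th x = 0 := by
    simp only [hth]
    rw [hΨ1 x hx, hΨ1 _ (by rw [norm_smul]; norm_num; linarith), sub_self]
  set n1 : E → ℝ := fun ξ => th ξ * ‖ξ‖ ^ (-κ) with hn1
  set n2 : E → ℝ := fun ξ => th ξ * ‖ξ‖ ^ (-κ - 2) with hn2
  have hn1s : ContDiff ℝ ∞ n1 := contDiff_mul_rpow_norm hths one_pos hth0 _
  have hn2s : ContDiff ℝ ∞ n2 := contDiff_mul_rpow_norm hths one_pos hth0 _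
  have hn1c : HasCompactSupport n1 := hthc.mul_right
  have hn2c : HasCompactSupport n2 := hthc.mul_right
  set m1 := a + b / p with hm1
  set m2 := a + b * (1 + κ) / p with hm2
  set A1 := 1 / m1 / symJ0 E p with hA1
  set A2 := (1 / m2 - 1 / m1) / symJ0 E p with hA2
  let e := stdOrthonormalBasis ℝ E
  let ι := Option (Fin (finrank ℝ E) × Fin (finrank ℝ E))
  let f : ι → E → ℝ := fun i => i.elim (fun ξ => A1 * n1 ξ)
    fun q ξ => A2 * n2 ξ * (⟪ξ, e q.1⟫ * ⟪ξ, e q.2⟫)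
  let l : ι → E →L[ℝ] E := fun i => i.elim (ContinuousLinearMap.id ℝ E)
    fun q => InnerProductSpace.rankOne ℝ (e q.1) (e q.2)
  have hf (i) : ContDiff ℝ ∞ (f i) := by
    rcases i with _ | q
    · exact contDiff_const.mul hn1s
    · exact (contDiff_const.mul hn2s).mul
        ((contDiff_id.inner ℝ contDiff_const).mul (contDiff_id.inner ℝ contDiff_const))
  have hfc (i) : HasCompactSupport (f i) := by
    rcases i with _ | q
    · exact hn1c.mul_left
    · exact (hn2c.mul_left).mul_right
  obtain ⟨⟨⟨C, hC⟩, hintg⟩, happ⟩ := cosint_family hf hfc l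
  obtain ⟨C', hC'⟩ := cosint_rd hΨ hΨc (finrank ℝ E + 2)
  have hth00 : th 0 = 0 := hth0 0 (by simp)
  have hB (ξ w : E) : ∑ i, f i ξ • l i w = (A1 * n1 ξ) • w + (A2 * n2 ξ * ⟪ξ, w⟫) • ξ := by
    rw [Fintype.sum_option, Fintype.sum_prod_type]
    simp only [f, l, Option.elim, ContinuousLinearMap.id_apply, InnerProductSpace.rankOne_apply,
      smul_smul]
    congr 1
    have hw : ⟪ξ, w⟫ = ∑ j, ⟪ξ, e j⟫ * ⟪e j, w⟫ := (e.sum_inner_mul_inner ξ w).symm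
    have hx : ξ = ∑ i, ⟪e i, ξ⟫ • e i := (e.sum_repr' ξ).symm
    rw [hw]
    conv_rhs => rw [hx]
    rw [Finset.smul_sum]
    refine Finset.sum_congr rfl fun i _ => ?_
    rw [← Finset.sum_smul, smul_smul, ← hx, real_inner_comm ξ (e i), Finset.mul_sum,
      Finset.sum_mul]
    congr 1
    refine Finset.sum_congr rfl fun j _ => ?_
    ring
  have hBcont (w : E) : Continuous fun ξ => ∑ i, f i ξ • l i w :=
    continuous_finsetSum _ fun i _ => (hf i).continuous.smul continuous_const
  have hBc (w : E) : HasCompactSupport fun ξ => ∑ i, f i ξ • l i w := by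
    simp_rw [hB]
    exact HasCompactSupport.add (hn1c.mul_left.smul_right) ((hn2c.mul_left).mul_right.smul_right)
  have hMB (ξ w : E) : ∫ y : E, (1 - cos (2 * π * ⟪y, ξ⟫)) • ker a b p y (∑ i, f i ξ • l i w) =
      th ξ • w := by
    rcases eq_or_ne ξ 0 with rfl | hξ
    · simp [hth00]
    rw [symM_apply hp hp' hξ, ← hκ, hB]
    obtain ⟨q1, q2⟩ := symbol_inverse (t := ⟪ξ, w⟫) hJ (norm_pos_iff.2 hξ) h1 h2
      (show n1 ξ = _ from rfl) (show n2 ξ = _ from rfl)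
    have hb : b / p * κ = m2 - m1 := by rw [hm1, hm2]; ring
    rw [hb, inner_add_right, inner_smul_right, inner_smul_right, real_inner_self_eq_norm_sq,
      smul_add, smul_smul, smul_smul, q1, add_assoc, ← add_smul]
    have : symJ0 E p * ‖ξ‖ ^ κ * m1 * (A2 * n2 ξ * ⟪ξ, w⟫) +
      symJ0 E p * ((m2 - m1) * ‖ξ‖ ^ (κ - 2)) *
        (A1 * n1 ξ * ⟪ξ, w⟫ + A2 * n2 ξ * ⟪ξ, w⟫ * ‖ξ‖ ^ 2) = 0 := q2
    rw [this, zero_smul, add_zero]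
  have hscale (x : E) : ∫ ξ, cos (2 * π * ⟪x, ξ⟫) * Ψ ((2 : ℝ)⁻¹ • ξ) =
      (2 : ℝ) ^ finrank ℝ E * cosint Ψ ((2 : ℝ) • x) := by
    have := Measure.integral_comp_inv_smul (volume : Measure E)
      (fun ξ => cos (2 * π * ⟪(2 : ℝ) • x, ξ⟫) * Ψ ξ) 2
    rw [cosint, ← smul_eq_mul (a := (2 : ℝ) ^ finrank ℝ E),
      ← abs_of_pos (show (0 : ℝ) < 2 ^ finrank ℝ E by positivity), ← this]
    congr 1; ext ξ
    congr 3
    rw [inner_smul_left, inner_smul_right]; simp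
  refine ⟨cosint Ψ, fun x => ∑ i, cosint (f i) x • l i, max C C', ?_, ?_, ?_, ?_,
    cosint_neg Ψ, fun x => by simp_rw [cosint_neg], fun w x => ?_⟩
  · have hC'' : RD ((finrank ℝ E : ℝ) + 1 + 1) C' (cosint Ψ) := by
      convert hC' using 1; push_cast; ring
    exact ⟨hC''.cont, fun x => (hC''.decay x).trans (by gcongr; exact le_max_right _ _),
      fun x h hh => (hC''.lip x h hh).trans (by gcongr; exact le_max_right _ _)⟩
  · exact ⟨hC.cont, fun x => (hC.decay x).trans (by gcongr; exact le_max_left _ _),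
      fun x h hh => (hC.lip x h hh).trans (by gcongr; exact le_max_left _ _)⟩
  · obtain ⟨g, -, hg⟩ := cosint_schwartz hΨ hΨc
    rw [hg, hΨ1 0 (by simp)]
  · rw [hintg]
    refine Finset.sum_eq_zero fun i _ => ?_
    rcases i with _ | q
    · simp [f, hn1, hth00]
    · simp [f]
  · have : (fun y => (∑ i, cosint (f i) y • l i) w) =
        fun y => ∫ ξ, cos (2 * π * ⟪y, ξ⟫) • ∑ i, f i ξ • l i w := by
      ext y; exact happ y w
    rw [this, op_ker_cos hp hp' (hBcont w) (hBc w)]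
    simp_rw [hMB, smul_smul]
    rw [integral_smul_const]
    congr 1
    simp only [hth, mul_sub]
    rw [integral_sub, hscale]
    · rfl
    · exact Continuous.integrable_of_hasCompactSupport
        (Continuous.mul (by fun_prop) hΨ2.continuous) hΨ2c.mul_left
    · exact Continuous.integrable_of_hasCompactSupport
        (Continuous.mul (by fun_prop) hΨ.continuous) hΨc.mul_left

end Parametrix2

section Dyadic

variable {a b p : ℝ} {ψ : E → ℝ} {H : E → E →L[ℝ] E} {C : ℝ} {v : E → E} {U S : ℝ}

lemma TF.congr_ae {φ φ' : E → F} {A B : ℝ} (h : TF φ A B) (he : φ' =ᵐ[volume] φ) : TF φ' A B := by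
  refine ⟨h.int.congr he.symm, ?_, fun y => ?_⟩
  · rw [integral_congr_ae (he.mono fun x hx => by rw [hx])]; exact h.l1
  · have h2 : ∀ᵐ x : E, φ' (x + y) = φ (x + y) :=
      (measurePreserving_add_right volume y).quasiMeasurePreserving.ae he
    rw [integral_congr_ae (g := fun x => ‖φ (x + y) - φ x‖)
      ((h2.and he).mono fun x hx => by simp only [hx.1, hx.2])]
    exact h.lip y

/-- Scalar kernels acting as multiples of the identity. -/
def sid (θ : E → ℝ) : E → E →L[ℝ] E := fun y => θ y • ContinuousLinearMap.id ℝ E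

lemma sid_tf [Nontrivial E] {θ : E → ℝ} {A B : ℝ} (h : TF θ A B) : TF (sid θ) A B := by
  have := h.clm (ContinuousLinearMap.toSpanSingleton ℝ (ContinuousLinearMap.id ℝ E))
  rw [ContinuousLinearMap.norm_toSpanSingleton, ContinuousLinearMap.norm_id, one_mul, one_mul]
    at this
  exact this

lemma sid_norm [Nontrivial E] (θ : E → ℝ) (y : E) : ‖sid θ y‖ = |θ y| := by
  rw [sid, norm_smul, ContinuousLinearMap.norm_id, mul_one, Real.norm_eq_abs]

lemma conv_sid_eq (θ : E → ℝ) (φ : E → E) (x : E) :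
    conv (sid θ) φ x = ∫ z, θ (x - z) • φ z := by
  rw [conv_eq]; rfl

lemma conv_sid_sub [Nontrivial E] {θ : E → ℝ} (hθ : Integrable θ)
    (hm : Integrable fun y => ‖y‖ * ‖θ y‖)
    (h1 : ∫ y, θ y = 1) {φ : E → E} {A B : ℝ} (hφ : TF φ A B) :
    ∫ x, ‖φ x - conv (sid θ) φ x‖ ≤ B * ∫ y, ‖y‖ * ‖θ y‖ := by
  have hi : Integrable (sid θ) := hθ.smul_const _
  have he := op_eq_sub_conv_ae hi hφ.int
  have hI : ∫ y, sid θ y = ContinuousLinearMap.id ℝ E := by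
    simp only [sid]; rw [integral_smul_const, h1, one_smul]
  rw [hI] at he
  have hB := hφ.nonneg_right
  have hA := hφ.nonneg_left
  calc ∫ x, ‖φ x - conv (sid θ) φ x‖ = ∫ x, ‖op (sid θ) φ x‖ :=
        integral_congr_ae (he.mono fun x hx => by simp [hx])
    _ ≤ ∫ y, ‖sid θ y‖ * min (2 * A) (B * ‖y‖) := op_l1 (WK.of_integrable hi) hφ
    _ ≤ ∫ y, B * (‖y‖ * ‖θ y‖) := by
        refine integral_mono ((WK.of_integrable hi).int_min _ _ (by positivity) hB)
          (hm.const_mul B) fun y => ?_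
        simp only [sid_norm]
        rw [Real.norm_eq_abs]
        calc |θ y| * min (2 * A) (B * ‖y‖) ≤ |θ y| * (B * ‖y‖) := by gcongr; exact min_le_right _ _
          _ = _ := by ring
    _ = _ := integral_const_mul _ _

lemma conv_diff_ae {k : E → E →L[ℝ] F} (hk : Integrable k) {φ : E → E} (hφ : Integrable φ) (h : E) :
    conv k (fun x => φ (x + h) - φ x) =ᵐ[volume] conv (fun y => k (y + h) - k y) φ := by
  have h1 := conv_sub_ae hk (hφ.comp_add_right h) hφ
  have h2 := conv_kernel_sub_ae (hk.comp_add_right h) hk hφ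
  filter_upwards [h1, h2] with x hx1 hx2
  rw [hx1, hx2, conv_kernel_comp_add, conv_comp_add]

lemma conv_diff_tf [Nontrivial E] {k : E → E →L[ℝ] F} {A B : ℝ} (hk : TF k A B) {φ : E → E}
    {a a' : ℝ} (hφ : TF φ a a') (h : E) :
    TF (conv k fun x => φ (x + h) - φ x) (B * ‖h‖ * a) (B * ‖h‖ * a') := by
  refine TF.congr_ae ?_ (conv_diff_ae hk.int hφ.int h)
  have := hφ.nonneg_left
  have := hφ.nonneg_right
  exact (conv_tf ((hk.int.comp_add_right h).sub hk.int) hφ).mono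
    (mul_le_mul_of_nonneg_right (hk.lip h) ‹_›) (mul_le_mul_of_nonneg_right (hk.lip h) ‹_›)

/-- The parametrix at frequency `l`. -/
def hs (p : ℝ) (H : E → E →L[ℝ] E) (l : ℝ) (y : E) : E →L[ℝ] E :=
  l ^ (2 * (finrank ℝ E : ℝ) - p) • H (l • y)

/-- The `L¹`-normalized dilation. -/
def ps (ψ : E → ℝ) (l : ℝ) (y : E) : ℝ := l ^ (finrank ℝ E : ℝ) * ψ (l • y)

lemma Para.op_hs (hP : Para a b p ψ H C) {l : ℝ} (hl : 0 < l) (w x : E) :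
    op (LameFrac.ker a b p) (fun y => hs p H l y w) x = (ps ψ (2 * l) x - ps ψ l x) • w := by
  have h1 := op_smul (LameFrac.ker a b p) (l ^ (2 * (finrank ℝ E : ℝ) - p))
    (fun y => H (l • y) w) x
  have h2 := op_ker_scale (a := a) (b := b) (p := p) hl (fun y => H y w) x
  have e : (fun y => hs p H l y w) = fun y => l ^ (2 * (finrank ℝ E : ℝ) - p) • H (l • y) w := by
    ext y; simp [hs]
  rw [e, h1, h2, hP.eq, smul_smul, smul_smul, ← Real.rpow_add hl, ps, ps,
    Real.mul_rpow (by norm_num) hl.le, smul_smul]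
  congr 1
  rw [show (2 * (finrank ℝ E : ℝ) - p + (p - finrank ℝ E)) = finrank ℝ E by ring,
    Real.rpow_natCast, Real.rpow_natCast]
  ring

/-- A constant controlling the total mass and variation of a parametrix. -/
def Para.c (_ : Para (E := E) a b p ψ H C) : ℝ := 2 * (C * massI E ((finrank ℝ E : ℝ) + 1 + 1))

lemma Para.c_nonneg (hP : Para a b p ψ H C) : 0 ≤ hP.c :=
  mul_nonneg two_pos.le (mul_nonneg hP.psi.nonneg massI_nonneg)

lemma Para.psi_tf (hP : Para a b p ψ H C) : TF ψ hP.c hP.c := by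
  have := hP.c_nonneg
  refine (hP.psi.tf (by linarith)).mono ?_ le_rfl
  rw [Para.c] at *; linarith

lemma Para.ker_tf (hP : Para a b p ψ H C) : TF H hP.c hP.c := by
  have := hP.c_nonneg
  refine (hP.ker.tf (by linarith)).mono ?_ le_rfl
  rw [Para.c] at *; linarith

lemma Para.hs_tf (hP : Para a b p ψ H C) {l : ℝ} (hl : 0 < l) :
    TF (hs p H l) (l ^ (-(p - finrank ℝ E)) * hP.c) (l ^ (1 - (p - finrank ℝ E)) * hP.c) := by
  refine ((hP.ker_tf.scale hl).const_smul (l ^ (2 * (finrank ℝ E : ℝ) - p))).mono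
    (le_of_eq ?_) (le_of_eq ?_)
  · rw [abs_of_pos (by positivity), ← mul_assoc, ← Real.rpow_add hl]; ring_nf
  · rw [abs_of_pos (by positivity), ← mul_assoc, ← mul_assoc, ← Real.rpow_add hl,
      ← Real.rpow_add_one hl.ne']; ring_nf

lemma Para.ps_tf (hP : Para a b p ψ H C) {l : ℝ} (hl : 0 < l) : TF (ps ψ l) hP.c (l * hP.c) := by
  refine ((hP.psi_tf.scale hl).const_smul (l ^ (finrank ℝ E : ℝ))).mono
    (le_of_eq ?_) (le_of_eq ?_)
  · rw [abs_of_pos (by positivity), ← mul_assoc, ← Real.rpow_add hl]; simp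
  · rw [abs_of_pos (by positivity), ← mul_assoc, ← Real.rpow_add hl]; simp

lemma Para.ps_int (hP : Para a b p ψ H C) {l : ℝ} (hl : 0 < l) : ∫ y, ps ψ l y = 1 := by
  simp only [ps]
  rw [integral_const_mul, integral_comp_smul_pos _ hl, hP.psi_int, smul_eq_mul, ← mul_assoc,
    ← Real.rpow_add hl]
  simp

lemma ps_moment {l : ℝ} (hl : 0 < l) : ∫ y, ‖y‖ * ‖ps ψ l y‖ = l⁻¹ * ∫ y, ‖y‖ * ‖ψ y‖ := by
  have e (y : E) : ‖y‖ * ‖ps ψ l y‖ =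
      l ^ (finrank ℝ E : ℝ) * l⁻¹ * (‖l • y‖ * ‖ψ (l • y)‖) := by
    rw [ps, norm_mul, Real.norm_of_nonneg (by positivity), norm_smul, Real.norm_of_nonneg hl.le]
    field_simp
  simp_rw [e]
  rw [integral_const_mul, integral_comp_smul_pos (fun y : E => ‖y‖ * ‖ψ y‖) hl, smul_eq_mul,
    ← mul_assoc, mul_right_comm _ l⁻¹, ← Real.rpow_add hl]
  simp

lemma Para.ps_moment_int (hP : Para a b p ψ H C) {l : ℝ} (hl : 0 < l) :
    Integrable fun y => ‖y‖ * ‖ps ψ l y‖ := by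
  have h := (hP.psi.moment (by linarith)).comp_smul hl.ne'
  refine (h.const_mul (l ^ (finrank ℝ E : ℝ) * l⁻¹)).congr (Eventually.of_forall fun y => ?_)
  simp only [ps]
  rw [norm_mul, Real.norm_of_nonneg (show 0 ≤ l ^ (finrank ℝ E : ℝ) by positivity), norm_smul,
    Real.norm_of_nonneg hl.le]
  field_simp

/-- Pairing with the low frequency part of `g`. -/
def lowPair (ψ : E → ℝ) (v g : E → E) (l : ℝ) : ℝ := pair v (conv (sid (ps ψ l)) g)

lemma op_comp_sub (k : E → E →L[ℝ] F) (φ : E → E) (z x : E) :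
    op k (fun x => φ (x - z)) x = op k φ (x - z) := by
  simp only [op, sub_right_comm]

lemma Para.T_conv_hs [Nontrivial E] (hP : Para a b p ψ H C) (hp : (finrank ℝ E : ℝ) < p)
    (hp' : p < finrank ℝ E + 1) (hv : Continuous v) (hU : ∀ x, ‖v x‖ ≤ U) {l : ℝ} (hl : 0 < l)
    {g : E → E} (hg : Integrable g) :
    T (LameFrac.ker a b p) v (conv (hs p H l) g) = lowPair ψ v g (2 * l) - lowPair ψ v g l := by
  rw [(T_conv (ker_wk hp hp') hv hU (hP.hs_tf hl) hg).2]
  have key {θ : E → ℝ} (hθ : Integrable θ) :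
      Integrable (fun q : E × E => θ (q.1 - q.2) • g q.2) (volume.prod volume) :=
    hg.convolution_integrand (ContinuousLinearMap.lsmul ℝ ℝ).flip hθ
  have h2l := (hP.ps_tf (l := 2 * l) (by positivity)).int
  have h1l := (hP.ps_tf hl).int
  have e1 (z : E) : T (LameFrac.ker a b p) v (fun x => hs p H l (x - z) (g z)) =
      pair v (fun x => ps ψ (2 * l) (x - z) • g z) - pair v (fun x => ps ψ l (x - z) • g z) := by
    rw [T, ← pair_sub hv hU ((h2l.comp_sub_right z).smul_const _)
      ((h1l.comp_sub_right z).smul_const _)]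
    congr 1; ext x
    rw [op_comp_sub _ (fun y => hs p H l y (g z)), hP.op_hs hl, sub_smul]
  simp_rw [e1]
  rw [integral_sub (pair_integral_integrable hv hU (key h2l))
    (pair_integral_integrable hv hU (key h1l)), ← pair_integral hv hU (key h2l),
    ← pair_integral hv hU (key h1l), lowPair, lowPair]
  simp_rw [← conv_sid_eq]

lemma Para.lowPair_sub [Nontrivial E] (hP : Para a b p ψ H C) (hv : Continuous v)
    (hU : ∀ x, ‖v x‖ ≤ U) {l : ℝ} (hl : 0 < l) {g : E → E} {A B : ℝ} (hg : TF g A B) :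
    |pair v g - lowPair ψ v g l| ≤ U * B * (∫ y, ‖y‖ * ‖ψ y‖) * l⁻¹ := by
  have h1 := (hP.ps_tf hl).int
  have hc : Integrable (conv (sid (ps ψ l)) g) := conv_integrable (h1.smul_const _) hg.int
  have hU0 : 0 ≤ U := (norm_nonneg _).trans (hU 0)
  rw [lowPair, ← pair_sub hv hU hg.int hc]
  refine (pair_le hU (hg.int.sub hc)).trans ?_
  calc U * ∫ x, ‖g x - conv (sid (ps ψ l)) g x‖ ≤ U * (B * ∫ y, ‖y‖ * ‖ps ψ l y‖) := by
        gcongr; exact conv_sid_sub h1 (hP.ps_moment_int hl) (hP.ps_int hl) hg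
    _ = _ := by rw [ps_moment hl]; ring

lemma Para.lowPair_diff [Nontrivial E] (hP : Para a b p ψ H C)
    (hU : ∀ x, ‖v x‖ ≤ U) {l : ℝ} (hl : 0 < l) {φ : E → E} {A B : ℝ} (hφ : TF φ A B) (h : E) :
    |lowPair ψ v (fun x => φ (x + h) - φ x) l| ≤ U * hP.c * ‖h‖ * A * l := by
  have hU0 : 0 ≤ U := (norm_nonneg _).trans (hU 0)
  have := conv_diff_tf (sid_tf (hP.ps_tf hl)) hφ h
  refine (pair_le hU this.int).trans ?_
  calc _ ≤ U * (l * hP.c * ‖h‖ * A) := by gcongr; exact this.l1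
    _ = _ := by ring

/-- The constant in the difference estimate. -/
def Para.cD (hP : Para a b p ψ H C) : ℝ :=
  2 * hP.c * (1 / (1 - 2 ^ (-(p - finrank ℝ E))) + 1 / (1 - 2 ^ (-(1 - (p - finrank ℝ E)))))

lemma two_rpow_lt_one {t : ℝ} (ht : 0 < t) : (2 : ℝ) ^ (-t) < 1 :=
  Real.rpow_lt_one_of_one_lt_of_neg one_lt_two (by linarith)

lemma Para.cD_nonneg (hP : Para a b p ψ H C) (hp : (finrank ℝ E : ℝ) < p)
    (hp' : p < finrank ℝ E + 1) : 0 ≤ hP.cD := by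
  have h1 := two_rpow_lt_one (sub_pos.2 hp)
  have h2 := two_rpow_lt_one (t := 1 - (p - finrank ℝ E)) (by linarith)
  have := hP.c_nonneg
  rw [cD]
  have : 0 ≤ 1 / (1 - (2 : ℝ) ^ (-(p - finrank ℝ E))) := by apply one_div_nonneg.2; linarith
  have : 0 ≤ 1 / (1 - (2 : ℝ) ^ (-(1 - (p - finrank ℝ E)))) := by
    apply one_div_nonneg.2; linarith
  positivity

lemma Para.pair_diff [Nontrivial E] (hP : Para a b p ψ H C) (hp : (finrank ℝ E : ℝ) < p)
    (hp' : p < finrank ℝ E + 1) (hv : Continuous v) (hU : ∀ x, ‖v x‖ ≤ U)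
    (hS : ∀ φ A B, TF φ A B → |T (LameFrac.ker a b p) v φ| ≤ S * (A + B))
    {φ : E → E} {A : ℝ} (hφ : TF φ A A) {h : E}
    (hg : TF (fun x => φ (x + h) - φ x) (A * ‖h‖) (A * ‖h‖)) :
    |pair v fun x => φ (x + h) - φ x| ≤ hP.cD * S * A * ‖h‖ := by
  set g : E → E := fun x => φ (x + h) - φ x with hgdef
  set κ := p - finrank ℝ E with hκ
  have hκ0 : 0 < κ := sub_pos.2 hp
  have hκ1 : 0 < 1 - κ := by linarith
  set P := lowPair ψ v g with hPdef
  have hstep {l : ℝ} (hl : 0 < l) : |P (2 * l) - P l| ≤ 2 * hP.c * S * A * ‖h‖ * l ^ (-κ) := by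
    rw [hPdef, ← hP.T_conv_hs hp hp' hv hU hl hg.int]
    refine (hS _ _ _ ((conv_tf (hP.hs_tf hl).int hg).mono (mul_le_mul_of_nonneg_right
      (hP.hs_tf hl).l1 hg.nonneg_left) (mul_le_mul_of_nonneg_right
      (hP.hs_tf hl).l1 hg.nonneg_left))).trans (le_of_eq (by rw [← hκ]; ring))
  have hstep' {l : ℝ} (hl : 0 < l) :
      |P (2 * l) - P l| ≤ 2 * hP.c * S * A * ‖h‖ * l ^ (1 - κ) := by
    rw [hPdef, ← hP.T_conv_hs hp hp' hv hU hl hg.int]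
    exact (hS _ _ _ (conv_diff_tf (hP.hs_tf hl) hφ h)).trans (le_of_eq (by rw [← hκ]; ring))
  have hpow (t : ℝ) (n : ℕ) : ((2 : ℝ) ^ n) ^ (-t) = ((2 : ℝ) ^ (-t)) ^ n := by
    rw [← Real.rpow_natCast, ← Real.rpow_mul (by norm_num), mul_comm, Real.rpow_mul (by norm_num),
      Real.rpow_natCast]
  have hinv (t : ℝ) (n : ℕ) : (((2 : ℝ) ^ n)⁻¹) ^ t = ((2 : ℝ) ^ (-t)) ^ n := by
    rw [← hpow, Real.rpow_neg (by positivity), Real.inv_rpow (by positivity)]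
  have hS0 : 0 ≤ 2 * hP.c * S * A * ‖h‖ := by
    have := (abs_nonneg _).trans (hstep (l := 1) one_pos)
    simpa using this
  have lim1 : Tendsto (fun n : ℕ => P (2 ^ n)) atTop (𝓝 (pair v g)) := by
    rw [tendsto_iff_norm_sub_tendsto_zero]
    refine squeeze_zero (fun _ => norm_nonneg _) (fun n => ?_)
      (g := fun n : ℕ => U * (A * ‖h‖) * (∫ y, ‖y‖ * ‖ψ y‖) * ((2 : ℝ) ^ n)⁻¹) ?_
    · rw [← norm_neg, neg_sub]
      exact hP.lowPair_sub hv hU (by positivity) hg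
    · have := (tendsto_inv_atTop_zero.comp (tendsto_pow_atTop_atTop_of_one_lt
        (one_lt_two (α := ℝ)))).const_mul (U * (A * ‖h‖) * (∫ y, ‖y‖ * ‖ψ y‖))
      simpa using this
  have lim2 : Tendsto (fun n : ℕ => P ((2 ^ n)⁻¹)) atTop (𝓝 0) := by
    refine squeeze_zero_norm (fun n => hP.lowPair_diff hU (by positivity) hφ h) ?_
    have := (tendsto_inv_atTop_zero.comp (tendsto_pow_atTop_atTop_of_one_lt
        (one_lt_two (α := ℝ)))).const_mul (U * hP.c * ‖h‖ * A)
    simpa using this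
  have b1 : dist (P (2 ^ 0)) (pair v g) ≤
      2 * hP.c * S * A * ‖h‖ / (1 - (2 : ℝ) ^ (-κ)) := by
    refine dist_le_of_le_geometric_of_tendsto₀ _ _ (two_rpow_lt_one hκ0) (fun n => ?_) lim1
    rw [dist_comm, Real.dist_eq, pow_succ', ← hpow]
    exact hstep (by positivity)
  have b2 : dist (P ((2 ^ 0)⁻¹)) 0 ≤
      2 * hP.c * S * A * ‖h‖ / (1 - (2 : ℝ) ^ (-(1 - κ))) := by
    refine dist_le_of_le_geometric_of_tendsto₀ _ _ (two_rpow_lt_one hκ1) (fun n => ?_) lim2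
    have e : ((2 : ℝ) ^ n)⁻¹ = 2 * ((2 : ℝ) ^ (n + 1))⁻¹ := by rw [pow_succ]; field_simp
    rw [Real.dist_eq, e]
    refine (hstep' (by positivity)).trans ?_
    rw [hinv]
    gcongr ?_ * ?_
    exact pow_le_pow_of_le_one (by positivity) (two_rpow_lt_one hκ1).le (Nat.le_succ n)
  rw [Real.dist_eq] at b1 b2
  rw [pow_zero] at b1
  rw [pow_zero, inv_one, sub_zero] at b2
  calc |pair v g| = |P 1 - (P 1 - pair v g)| := by rw [sub_sub_cancel]
    _ ≤ |P 1| + |P 1 - pair v g| := abs_sub _ _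
    _ ≤ _ := add_le_add b2 b1
    _ = _ := by rw [cD, ← hκ]; ring

end Dyadic

section Analytic

/-- Functions on a complex tube around `E` that decay and are holomorphic along complex lines. -/
structure Tube (q C r : ℝ) (f : E → E → ℂ) : Prop where
  bound : ∀ x y, ‖y‖ ≤ r → ‖f x y‖ ≤ C * (1 + ‖x‖) ^ (-q)
  holo : ∀ x y h, DifferentiableOn ℂ (fun ζ : ℂ => f (x + ζ.re • h) (y + ζ.im • h))
    {ζ | ‖y + ζ.im • h‖ < r}

variable {q C r : ℝ} {f : E → E → ℂ}

lemma Tube.nonneg (hf : Tube q C r f) (hr : 0 < r) : 0 ≤ C := by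
  have := (norm_nonneg _).trans (hf.bound 0 0 (by simpa using hr.le))
  simpa using this

lemma weight_shift (hq : 0 ≤ q) {x z : E} (hz : ‖z‖ ≤ 2) :
    (1 + ‖x + z‖) ^ (-q) ≤ 3 ^ q * (1 + ‖x‖) ^ (-q) := by
  have h1 : 1 + ‖x‖ ≤ 3 * (1 + ‖x + z‖) := by
    have : ‖x‖ ≤ ‖x + z‖ + ‖z‖ := by simpa using norm_sub_le (x + z) z
    have := norm_nonneg (x + z)
    linarith
  have h2 : (3 * (1 + ‖x + z‖)) ^ (-q) ≤ (1 + ‖x‖) ^ (-q) :=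
    Real.rpow_le_rpow_of_nonpos (by positivity) h1 (by linarith)
  rw [Real.mul_rpow (by norm_num) (by positivity), Real.rpow_neg (by norm_num)] at h2
  rwa [inv_mul_le_iff₀ (by positivity)] at h2

lemma Tube.line_deriv (hf : Tube q C r f) (hq : 0 ≤ q) (hr : 0 < r) (hr1 : r ≤ 1) {h : E}
    (hh : ‖h‖ ≤ 1) (x : E) {y : E} (hy : ‖y‖ ≤ r / 2) {s : ℝ} (hs : |s| ≤ 1) :
    HasDerivAt (fun ζ : ℂ => f (x + ζ.re • h) (y + ζ.im • h))
      (deriv (fun ζ : ℂ => f (x + ζ.re • h) (y + ζ.im • h)) s) s ∧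
    ‖deriv (fun ζ : ℂ => f (x + ζ.re • h) (y + ζ.im • h)) s‖ ≤
      4 / r * 3 ^ q * C * ‖h‖ * (1 + ‖x‖) ^ (-q) := by
  set φ := fun ζ : ℂ => f (x + ζ.re • h) (y + ζ.im • h) with hφ
  have hC := hf.nonneg hr
  have hopen : IsOpen {ζ : ℂ | ‖y + ζ.im • h‖ < r} :=
    isOpen_lt (continuous_const.add (Complex.continuous_im.smul continuous_const)).norm
      continuous_const
  refine ⟨((hf.holo x y h).differentiableAt (hopen.mem_nhds (by
    simp only [mem_ofPred_eq, Complex.ofReal_im, zero_smul, add_zero]; linarith))).hasDerivAt, ?_⟩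
  rcases eq_or_ne h 0 with rfl | h0
  · simp [hφ]
  have hn : 0 < ‖h‖ := norm_pos_iff.2 h0
  have hρ : 0 < r / (4 * ‖h‖) := by positivity
  have him {ζ : ℂ} (hζ : ζ ∈ Metric.closedBall (s : ℂ) (r / (4 * ‖h‖))) :
      ‖ζ.im • h‖ ≤ r / 4 ∧ ‖(ζ.re - s) • h‖ ≤ r / 4 := by
    rw [mem_closedBall_iff_norm] at hζ
    have h1 := (Complex.abs_im_le_norm (ζ - s)).trans hζ
    have h2 := (Complex.abs_re_le_norm (ζ - s)).trans hζ
    simp only [Complex.sub_im, Complex.sub_re, Complex.ofReal_im, Complex.ofReal_re, sub_zero]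
      at h1 h2
    rw [norm_smul, norm_smul, Real.norm_eq_abs, Real.norm_eq_abs]
    have e : r / 4 = r / (4 * ‖h‖) * ‖h‖ := by field_simp
    rw [e]
    constructor <;> gcongr
  have hsub : Metric.closedBall (s : ℂ) (r / (4 * ‖h‖)) ⊆ {ζ : ℂ | ‖y + ζ.im • h‖ < r} := by
    intro ζ hζ
    have := norm_add_le y (ζ.im • h)
    have := (him hζ).1
    simp only [mem_ofPred_eq]; linarith
  have hd : DiffContOnCl ℂ φ (Metric.ball (s : ℂ) (r / (4 * ‖h‖))) := by
    refine DifferentiableOn.diffContOnCl ((hf.holo x y h).mono ?_)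
    exact Metric.closure_ball_subset_closedBall.trans hsub
  refine (Complex.norm_deriv_le_of_forall_mem_sphere_norm_le hρ hd
    (C := C * (3 ^ q * (1 + ‖x‖) ^ (-q))) fun ζ hζ => ?_).trans (le_of_eq ?_)
  · have hζ' := Metric.sphere_subset_closedBall hζ
    refine (hf.bound _ _ (hsub hζ').le).trans ?_
    gcongr
    refine weight_shift hq ?_
    have e : ζ.re • h = s • h + (ζ.re - s) • h := by rw [← add_smul]; congr 1; ring
    rw [e]
    have h1 := norm_add_le (s • h) ((ζ.re - s) • h)
    have h2 := (him hζ').2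
    have h3 : ‖s • h‖ ≤ 1 := by
      rw [norm_smul, Real.norm_eq_abs]; exact mul_le_one₀ hs (norm_nonneg _) hh
    linarith
  · field_simp

lemma Tube.diff (hf : Tube q C r f) (hq : 0 ≤ q) (hr : 0 < r) (hr1 : r ≤ 1) {h : E}
    (hh : ‖h‖ ≤ 1) : Tube q (4 / r * 3 ^ q * C * ‖h‖) (r / 2) fun x y => f (x + h) y - f x y := by
  refine ⟨fun x y hy => ?_, fun x y k => ?_⟩
  · have := Convex.norm_image_sub_le_of_norm_hasDerivWithin_le (s := Icc (0 : ℝ) 1)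
      (f := fun t : ℝ => f (x + t • h) y)
      (f' := fun t => deriv (fun ζ : ℂ => f (x + ζ.re • h) (y + ζ.im • h)) t)
      (C := 4 / r * 3 ^ q * C * ‖h‖ * (1 + ‖x‖) ^ (-q)) (fun t ht => ?_) (fun t ht => ?_)
      (convex_Icc 0 1) (left_mem_Icc.2 zero_le_one) (right_mem_Icc.2 zero_le_one)
    · simpa using this
    · have := (hf.line_deriv hq hr hr1 hh x hy (abs_le.2 ⟨by linarith [ht.1], ht.2⟩)).1
      have h2 := this.comp_ofReal
      simp only [Complex.ofReal_re, Complex.ofReal_im, zero_smul, add_zero] at h2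
      exact h2.hasDerivWithinAt
    · exact (hf.line_deriv hq hr hr1 hh x hy (abs_le.2 ⟨by linarith [ht.1], ht.2⟩)).2
  · have hsub : {ζ : ℂ | ‖y + ζ.im • k‖ < r / 2} ⊆ {ζ : ℂ | ‖y + ζ.im • k‖ < r} := by
      intro ζ hζ
      simp only [mem_ofPred_eq] at hζ ⊢; linarith
    have h1 := (hf.holo (x + h) y k).mono hsub
    simp only [add_right_comm x h] at h1
    exact h1.sub ((hf.holo x y k).mono hsub)

lemma Tube.rd (hf : Tube q C r f) (hq : 0 ≤ q) (hr : 0 < r) (hr1 : r ≤ 1) {y : E}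
    (hy : ‖y‖ ≤ r / 2) : RD q (4 / r * 3 ^ q * C) fun x => f x y := by
  have hC := hf.nonneg hr
  have hl (x h : E) (hh : ‖h‖ ≤ 1) :
      ‖f (x + h) y - f x y‖ ≤ 4 / r * 3 ^ q * C * ‖h‖ * (1 + ‖x‖) ^ (-q) :=
    (hf.diff hq hr hr1 hh).bound x y hy
  refine ⟨?_, fun x => ?_, hl⟩
  · rw [continuous_iff_continuousAt]
    intro x
    rw [ContinuousAt, tendsto_iff_norm_sub_tendsto_zero]
    refine squeeze_zero' (Eventually.of_forall fun _ => norm_nonneg _) (t₀ := 𝓝 x)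
      (g := fun z => 4 / r * 3 ^ q * C * ‖z - x‖ * (1 + ‖x‖) ^ (-q)) ?_ ?_
    · filter_upwards [Metric.closedBall_mem_nhds x one_pos] with z hz
      rw [mem_closedBall_iff_norm] at hz
      simpa using hl x (z - x) hz
    · have : Continuous fun z : E => 4 / r * 3 ^ q * C * ‖z - x‖ * (1 + ‖x‖) ^ (-q) := by fun_prop
      simpa using this.tendsto x
  · refine (hf.bound x y (by linarith)).trans ?_
    have : 1 ≤ 4 / r * 3 ^ q :=
      one_le_mul_of_one_le_of_one_le ((one_le_div hr).2 (by linarith))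
        (Real.one_le_rpow (by norm_num) hq)
    gcongr
    exact le_mul_of_one_le_left hC this

/-- A constant controlling the second order regularity of a tube function. -/
def tubeC (E : Type*) [NormedAddCommGroup E] [InnerProductSpace ℝ E] [FiniteDimensional ℝ E]
    [MeasurableSpace E] [BorelSpace E] (q C r : ℝ) : ℝ :=
  4 * (8 / r * 3 ^ q * (4 / r * 3 ^ q * C) * massI E q)

lemma Tube.tf (hf : Tube q C r f) (hq : (finrank ℝ E : ℝ) < q) (hr : 0 < r) (hr1 : r ≤ 1) {y : E}
    (hy : ‖y‖ ≤ r / 4) :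
    TF (fun x => f x y) (tubeC E q C r) (tubeC E q C r) ∧
    ∀ h : E, TF (fun x => f (x + h) y - f x y) (tubeC E q C r * ‖h‖) (tubeC E q C r * ‖h‖) := by
  have hq0 : 0 ≤ q := (Nat.cast_nonneg _).trans hq.le
  have hC := hf.nonneg hr
  have hI : 0 ≤ massI E q := massI_nonneg
  set c := 4 / r * 3 ^ q * C with hc
  have hc0 : 0 ≤ c := by positivity
  have h8 : 1 ≤ 8 / r * 3 ^ q :=
    one_le_mul_of_one_le_of_one_le ((one_le_div hr).2 (by linarith))
      (Real.one_le_rpow (by norm_num) hq0)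
  have h1 := (hf.rd hq0 hr hr1 (y := y) (by linarith)).tf hq
  have hcc : c * massI E q ≤ 8 / r * 3 ^ q * c * massI E q := by
    gcongr; exact le_mul_of_one_le_left hc0 h8
  have hcm : 0 ≤ c * massI E q := by positivity
  refine ⟨h1.mono (by rw [tubeC]; linarith) (by rw [tubeC]; linarith), fun h => ?_⟩
  rcases le_total ‖h‖ 1 with hh | hh
  · have h2 := ((hf.diff hq0 hr hr1 hh).rd hq0 (by linarith) (by linarith) (y := y)
      (by linarith)).tf hq
    have e : 4 / (r / 2) * 3 ^ q * (4 / r * 3 ^ q * C * ‖h‖) * massI E q =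
        8 / r * 3 ^ q * c * massI E q * ‖h‖ := by rw [hc]; field_simp; ring
    have : 0 ≤ 8 / r * 3 ^ q * c * massI E q * ‖h‖ := by positivity
    rw [e] at h2
    exact h2.mono (by rw [tubeC]; linarith) (by rw [tubeC]; linarith)
  · have h2 := (h1.translate h).add (h1.const_smul (-1))
    have h3 : TF (fun x => f (x + h) y - f x y) (2 * (c * massI E q)) (4 * (c * massI E q)) := by
      convert h2 using 2
      · simp [sub_eq_add_neg]
      · simp; ring
      · simp; ring
    have h4 : tubeC E q C r ≤ tubeC E q C r * ‖h‖ :=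
      le_mul_of_one_le_right (by rw [tubeC]; positivity) hh
    have h5 : tubeC E q C r = 4 * (8 / r * 3 ^ q * c * massI E q) := rfl
    exact h3.mono (by linarith) (by linarith)

end Analytic

section AF

open Nat in
/-- Successive derivatives of a function that is real analytic along lines with direction `e`,
with uniform Cauchy estimates. -/
structure AF (e : E) (r C : ℝ) (g : ℕ → E → ℝ) : Prop where
  bound : ∀ k x, |g k x| ≤ C * (k ! / r ^ k)
  lip : ∀ k x y, |g k x - g k y| ≤ C * (k ! / r ^ k) * ‖x - y‖
  deriv : ∀ k x, HasDerivAt (fun t : ℝ => g k (x + t • e)) (g (k + 1) x) 0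

variable {e : E} {r C : ℝ} {g : ℕ → E → ℝ}

lemma AF.hasDerivAt (hg : AF e r C g) (k : ℕ) (x : E) (t : ℝ) :
    HasDerivAt (fun t : ℝ => g k (x + t • e)) (g (k + 1) (x + t • e)) t := by
  have h := hg.deriv k (x + t • e)
  rw [← sub_self t] at h
  have := h.comp_sub_const t t
  simpa [add_assoc, ← add_smul] using this

lemma AF.nonneg (hg : AF e r C g) : 0 ≤ C := by
  simpa using (abs_nonneg _).trans (hg.bound 0 0)

lemma AF.taylor (hg : AF e r C g) (hr : 0 < r) (k : ℕ) (x : E) (t : ℝ) :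
    |g k (x + t • e) - g k x - t * g (k + 1) x| ≤
      C * ((k + 1).factorial / r ^ (k + 1)) * ‖e‖ * t ^ 2 := by
  have hC := hg.nonneg
  have hs (s : ℝ) (h : s ∈ uIcc 0 t) : |s| ≤ |t| := by
    simpa using abs_sub_left_of_mem_uIcc h
  have := Convex.norm_image_sub_le_of_norm_hasDerivWithin_le (s := uIcc 0 t)
    (f := fun s : ℝ => g k (x + s • e) - s * g (k + 1) x)
    (f' := fun s => g (k + 1) (x + s • e) - g (k + 1) x)
    (C := C * ((k + 1).factorial / r ^ (k + 1)) * (|t| * ‖e‖)) (fun s h => ?_) (fun s h => ?_)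
    (convex_uIcc 0 t) left_mem_uIcc right_mem_uIcc
  · simp only [zero_smul, add_zero, zero_mul, sub_zero, Real.norm_eq_abs] at this
    refine (le_of_eq ?_).trans (this.trans (le_of_eq ?_))
    · congr 1; ring
    · rw [← sq_abs t]; ring
  · have := ((hg.hasDerivAt k x s).fun_sub
      ((hasDerivAt_id' s).mul_const (g (k + 1) x))).hasDerivWithinAt (s := uIcc 0 t)
    simpa using this
  · refine (hg.lip (k + 1) _ _).trans ?_
    rw [add_sub_cancel_left, norm_smul, Real.norm_eq_abs]
    have := hs s h
    gcongr

lemma AF.of_taylor {D : ℕ → ℝ} (h1 : ∀ k x, |g k x| ≤ C * (k.factorial / r ^ k))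
    (h2 : ∀ k x y, |g k x - g k y| ≤ C * (k.factorial / r ^ k) * ‖x - y‖)
    (h3 : ∀ k x (t : ℝ), |g k (x + t • e) - g k x - t * g (k + 1) x| ≤ D k * t ^ 2) :
    AF e r C g := by
  refine ⟨h1, h2, fun k x => ?_⟩
  rw [hasDerivAt_iff_isLittleO_nhds_zero]
  have hO : (fun t : ℝ => g k (x + (0 + t) • e) - g k (x + (0 : ℝ) • e) - t • g (k + 1) x)
      =O[𝓝 0] fun t : ℝ => t ^ 2 := by
    refine Asymptotics.IsBigO.of_bound (D k) (Eventually.of_forall fun t => ?_)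
    simpa using h3 k x t
  refine hO.trans_isLittleO ?_
  simpa using (Asymptotics.isLittleO_pow_pow (𝕜 := ℝ) (show 1 < 2 by norm_num))

lemma AF.bound_of_vanish (hg : AF e r C g) (hr : 0 < r) {x : E} (hx : ∀ k, g k x = 0) (m j : ℕ)
    {t : ℝ} (ht : 0 ≤ t) :
    |g j (x + t • e)| ≤ C * ((j + m).factorial / r ^ (j + m)) * (t ^ m / m.factorial) := by
  induction m generalizing j t with
  | zero => simpa using hg.bound j (x + t • e)
  | succ m ih =>
    refine image_norm_le_of_norm_deriv_right_le_deriv_boundary (a := 0) (b := t)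
      (f := fun t : ℝ => g j (x + t • e)) (f' := fun t => g (j + 1) (x + t • e))
      (B := fun t => C * ((j + (m + 1)).factorial / r ^ (j + (m + 1))) *
        (t ^ (m + 1) / (m + 1).factorial))
      (B' := fun t => C * ((j + 1 + m).factorial / r ^ (j + 1 + m)) * (t ^ m / m.factorial))
      (fun s _ => (hg.hasDerivAt j x s).continuousAt.continuousWithinAt)
      (fun s _ => (hg.hasDerivAt j x s).hasDerivWithinAt) ?_ (fun s => ?_)
      (fun s hs => ih (j + 1) hs.1) ⟨ht, le_rfl⟩
    · simp [hx j]
    · have h := (((hasDerivAt_pow (m + 1) s).div_const ((m + 1).factorial : ℝ)).const_mul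
        (C * ((j + (m + 1)).factorial / r ^ (j + (m + 1)))))
      refine h.congr_deriv ?_
      have e1 : j + 1 + m = j + (m + 1) := by omega
      rw [e1, Nat.factorial_succ m]
      push_cast
      have : (m.factorial : ℝ) ≠ 0 := by positivity
      field_simp

lemma AF.eq_zero_near (hg : AF e r C g) (hr : 0 < r) {x : E} (hx : ∀ k, g k x = 0) (j : ℕ)
    {t : ℝ} (ht : 0 ≤ t) (htr : t ≤ r / 4) : g j (x + t • e) = 0 := by
  have hC := hg.nonneg
  have hb (m : ℕ) : |g j (x + t • e)| ≤ C * (j.factorial * (2 / r) ^ j) * (1 / 2) ^ m := by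
    refine (hg.bound_of_vanish hr hx m j ht).trans ?_
    have h1 : ((j + m).factorial : ℝ) ≤ 2 ^ (j + m) * (j.factorial * m.factorial) := by
      have h2 := Nat.add_choose_mul_factorial_mul_factorial j m
      have h3 := Nat.choose_le_two_pow (j + m) m
      have : (j + m).factorial ≤ 2 ^ (j + m) * (j.factorial * m.factorial) := by
        rw [← h2, mul_assoc]
        gcongr
      exact_mod_cast this
    have h4 : t ^ m ≤ (r / 4) ^ m := by gcongr
    calc C * ((j + m).factorial / r ^ (j + m)) * (t ^ m / m.factorial)
        ≤ C * (2 ^ (j + m) * (j.factorial * m.factorial) / r ^ (j + m)) *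
          ((r / 4) ^ m / m.factorial) := by gcongr
      _ = C * (j.factorial * (2 / r) ^ j) * (1 / 2) ^ m := by
          have : (m.factorial : ℝ) ≠ 0 := by positivity
          have e4 : (4 : ℝ) ^ m = 2 ^ m * 2 ^ m := by rw [← mul_pow]; norm_num
          rw [pow_add, pow_add, div_pow, div_pow, div_pow, one_pow, e4]
          field_simp
  have h0 : Tendsto (fun m : ℕ => C * (j.factorial * (2 / r) ^ j) * (1 / 2 : ℝ) ^ m) atTop
      (𝓝 0) := by
    simpa using (tendsto_pow_atTop_nhds_zero_of_lt_one (r := (1 / 2 : ℝ)) (by norm_num)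
      (by norm_num)).const_mul (C * (j.factorial * (2 / r) ^ j))
  exact abs_nonpos_iff.1 (ge_of_tendsto' h0 hb)

lemma AF.eq_zero_on_ray (hg : AF e r C g) (hr : 0 < r) {x : E} (hx : ∀ k, g k x = 0)
    {t : ℝ} (ht : 0 ≤ t) (j : ℕ) : g j (x + t • e) = 0 := by
  have key (n : ℕ) : ∀ t : ℝ, 0 ≤ t → t ≤ n * (r / 4) → ∀ j, g j (x + t • e) = 0 := by
    induction n with
    | zero =>
      intro t h0 h1 j
      have : t = 0 := le_antisymm (by simpa using h1) h0
      simpa [this] using hx j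
    | succ n ih =>
      intro t h0 h1 j
      rcases le_total t (n * (r / 4)) with h | h
      · exact ih t h0 h j
      · have := hg.eq_zero_near hr (x := x + ((n : ℝ) * (r / 4)) • e)
          (fun k => ih _ (by positivity) le_rfl k) j (t := t - n * (r / 4)) (by linarith)
          (by push_cast at h1; linarith)
        rw [add_assoc, ← add_smul] at this
        simpa using this
  obtain ⟨n, hn⟩ := exists_nat_ge (t / (r / 4))
  exact key n t ht ((div_le_iff₀ (by positivity)).1 hn) j

lemma exists_ultralim (U : Ultrafilter ℕ) {a : ℕ → ℝ} {C : ℝ} (h : ∀ n, |a n| ≤ C) :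
    ∃ l, Tendsto a U (𝓝 l) := by
  obtain ⟨l, -, hl⟩ := (isCompact_Icc (a := -C) (b := C)).ultrafilter_le_nhds (U.map a)
    (le_principal_iff.2 (Ultrafilter.mem_coe.2 (U.mem_map.2
      (Filter.univ_mem' fun n => abs_le.1 (h n)))))
  exact ⟨l, hl⟩

lemma AF.ultralim (U : Ultrafilter ℕ) (hr : 0 < r) {g : ℕ → ℕ → E → ℝ}
    (hg : ∀ n, AF e r C (g n)) :
    ∃ G : ℕ → E → ℝ, AF e r C G ∧ ∀ k x, Tendsto (fun n => g n k x) U (𝓝 (G k x)) := by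
  choose G hG using fun k x => exists_ultralim U fun n => (hg n).bound k x
  refine ⟨G, AF.of_taylor (D := fun k => C * ((k + 1).factorial / r ^ (k + 1)) * ‖e‖) (fun k x => ?_) (fun k x y => ?_) (fun k x t => ?_), hG⟩
  · exact le_of_tendsto' (hG k x).abs fun n => (hg n).bound k x
  · exact le_of_tendsto' ((hG k x).sub (hG k y)).abs fun n => (hg n).lip k x y
  · exact le_of_tendsto' (((hG k _).sub (hG k x)).sub ((hG (k + 1) x).const_mul t)).abs
      fun n => (hg n).taylor hr k x t

lemma AF.of_holo {Φ : E → ℂ → ℂ} (hr : 0 < r)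
    (hd : ∀ x, DifferentiableOn ℂ (Φ x) (Metric.ball 0 (2 * r)))
    (hb : ∀ x, ∀ ζ ∈ Metric.ball (0 : ℂ) (2 * r), ‖Φ x ζ‖ ≤ C)
    (hl : ∀ x y, ∀ ζ ∈ Metric.ball (0 : ℂ) (2 * r), ‖Φ x ζ - Φ y ζ‖ ≤ C * ‖x - y‖)
    (hs : ∀ x (ζ : ℂ) (t : ℝ), Φ x (ζ + t) = Φ (x + t • e) ζ) :
    AF e r C fun k x => (iteratedDeriv k (Φ x) 0).re := by
  have hsub : Metric.closedBall (0 : ℂ) r ⊆ Metric.ball 0 (2 * r) :=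
    Metric.closedBall_subset_ball (by linarith)
  have hcl {f : ℂ → ℂ} (hf : DifferentiableOn ℂ f (Metric.ball 0 (2 * r))) :
      DiffContOnCl ℂ f (Metric.ball 0 r) :=
    (hf.mono (Metric.closure_ball_subset_closedBall.trans hsub)).diffContOnCl
  have hcd (x : E) (k : ℕ) : ContDiffAt ℂ k (Φ x) 0 :=
    ((hd x).contDiffOn Metric.isOpen_ball).contDiffAt
      (Metric.isOpen_ball.mem_nhds (Metric.mem_ball_self (by linarith)))
  refine ⟨fun k x => ?_, fun k x y => ?_, fun k x => ?_⟩
  · refine (Complex.abs_re_le_norm _).trans ?_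
    refine (Complex.norm_iteratedDeriv_le_of_forall_mem_sphere_norm_le k hr (hcl (hd x))
      fun ζ hζ => hb x ζ (hsub (Metric.sphere_subset_closedBall hζ))).trans (le_of_eq ?_)
    ring
  · rw [← Complex.sub_re, ← iteratedDeriv_fun_sub (hcd x k) (hcd y k)]
    refine (Complex.abs_re_le_norm _).trans ?_
    refine (Complex.norm_iteratedDeriv_le_of_forall_mem_sphere_norm_le k hr
      (hcl ((hd x).sub (hd y)))
      fun ζ hζ => hl x y ζ (hsub (Metric.sphere_subset_closedBall hζ))).trans (le_of_eq ?_)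
    ring
  · have hsh (t : ℝ) : Φ (x + t • e) = fun ζ => Φ x (ζ + t) := funext fun ζ => (hs x ζ t).symm
    have e1 (t : ℝ) : iteratedDeriv k (Φ (x + t • e)) 0 = iteratedDeriv k (Φ x) t := by
      rw [hsh, iteratedDeriv_comp_add_const]; simp
    simp only [e1]
    have h2 : HasDerivAt (iteratedDeriv k (Φ x)) (iteratedDeriv (k + 1) (Φ x) 0) 0 := by
      rw [iteratedDeriv_succ]
      have hU := Metric.isOpen_ball (x := (0 : ℂ)) (ε := 2 * r)
      have hc := ((hd x).contDiffOn (n := ((k + 1 : ℕ) : ℕ∞)) hU).differentiableOn_iteratedDerivWithin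
        (m := k) (by exact_mod_cast Nat.lt_succ_self k) hU.uniqueDiffOn
      refine DifferentiableAt.hasDerivAt (DifferentiableOn.differentiableAt (s := Metric.ball 0 (2 * r)) ?_
        (hU.mem_nhds (Metric.mem_ball_self (by linarith))))
      exact hc.congr fun ζ hζ => (iteratedDerivWithin_of_isOpen hU hζ).symm
    exact HasDerivAt.real_of_complex (z := 0) (by simpa using h2)

end AF

section TubeIntegral

variable {q C r U : ℝ} {f : E → E → ℂ} {b : E → ℝ} {h : E}

lemma Tube.hasDerivAt (hf : Tube q C r f) (hq : 0 ≤ q) (hr : 0 < r) (hr1 : r ≤ 1)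
    (hh : ‖h‖ ≤ 1) (x : E) {ζ : ℂ} (hre : |ζ.re| ≤ 1) (him : |ζ.im| ≤ r / 2) :
    ∃ d, HasDerivAt (fun ζ : ℂ => f (x + ζ.re • h) (ζ.im • h)) d ζ ∧
      ‖d‖ ≤ 4 / r * 3 ^ q * C * (1 + ‖x‖) ^ (-q) := by
  have hC := hf.nonneg hr
  have hy : ‖ζ.im • h‖ ≤ r / 2 := by
    rw [norm_smul, Real.norm_eq_abs]
    exact (mul_le_of_le_one_right (abs_nonneg _) hh).trans him
  obtain ⟨h1, h2⟩ := hf.line_deriv hq hr hr1 hh x hy hre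
  refine ⟨_, ?_, h2.trans ?_⟩
  · have e : ζ - ζ.im * Complex.I = (ζ.re : ℂ) := by
      apply Complex.ext <;> simp
    rw [← e] at h1
    have h3 := h1.comp_sub_const ζ (ζ.im * Complex.I)
    rw [e] at h3
    refine h3.congr_of_eventuallyEq (Eventually.of_forall fun ω => ?_)
    simp [← add_smul]
  · have : 0 ≤ 4 / r * 3 ^ q * C := by positivity
    exact mul_le_mul_of_nonneg_right (mul_le_of_le_one_right this hh) (by positivity)

/-- Integral of a tube function against a real function. -/
def tubeInt (b : E → ℝ) (f : E → E → ℂ) (h x : E) (ζ : ℂ) : ℂ :=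
  ∫ z, (b z : ℂ) * f (z - x + ζ.re • h) (ζ.im • h)

lemma tubeInt_shift (b : E → ℝ) (f : E → E → ℂ) (h x : E) (ζ : ℂ) (t : ℝ) :
    tubeInt b f h x (ζ + t) = tubeInt b f h (x - t • h) ζ := by
  simp only [tubeInt, Complex.add_re, Complex.add_im, Complex.ofReal_re, Complex.ofReal_im,
    add_zero]
  congr! 4
  module

lemma Tube.mul_integrable (hf : Tube q C r f) (hq : (finrank ℝ E : ℝ) < q) (hr : 0 < r)
    (hr1 : r ≤ 1) (hb : Continuous b) (hU : ∀ x, |b x| ≤ U) (x : E) {y : E} (hy : ‖y‖ ≤ r / 4) :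
    Integrable fun z => (b z : ℂ) * f (z - x) y := by
  have h1 : Integrable fun z => f (z - x) y := (hf.tf hq hr hr1 hy).1.int.comp_sub_right x
  refine h1.bdd_mul (c := U) (by fun_prop) (Eventually.of_forall fun z => ?_)
  simpa using hU z

lemma Tube.mul_integrable' (hf : Tube q C r f) (hq : (finrank ℝ E : ℝ) < q) (hr : 0 < r)
    (hr1 : r ≤ 1) (hb : Continuous b) (hU : ∀ x, |b x| ≤ U) (hh : ‖h‖ ≤ 1) (x : E) {ζ : ℂ}
    (hζ : |ζ.im| ≤ r / 4) :
    Integrable fun z => (b z : ℂ) * f (z - x + ζ.re • h) (ζ.im • h) := by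
  have := hf.mul_integrable hq hr hr1 hb hU (x - ζ.re • h) (y := ζ.im • h) (by
    rw [norm_smul, Real.norm_eq_abs]
    exact (mul_le_of_le_one_right (abs_nonneg _) hh).trans hζ)
  simpa [sub_sub_eq_add_sub, sub_add_eq_add_sub] using this

lemma Tube.differentiableOn_tubeInt (hf : Tube q C r f) (hq : (finrank ℝ E : ℝ) < q) (hr : 0 < r)
    (hr1 : r ≤ 1) (hb : Continuous b) (hU : ∀ x, |b x| ≤ U) (hh : ‖h‖ ≤ 1) (x : E) :
    DifferentiableOn ℂ (tubeInt b f h x) (Metric.ball 0 (r / 4)) := by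
  have hq0 : 0 ≤ q := (Nat.cast_nonneg _).trans hq.le
  have hC := hf.nonneg hr
  have hU0 : 0 ≤ U := (abs_nonneg _).trans (hU 0)
  have hre {ζ : ℂ} (h : ζ ∈ Metric.ball (0 : ℂ) (r / 4)) : |ζ.re| ≤ 1 ∧ |ζ.im| ≤ r / 4 := by
    rw [mem_ball_zero_iff] at h
    exact ⟨(Complex.abs_re_le_norm ζ).trans (by linarith),
      (Complex.abs_im_le_norm ζ).trans h.le⟩
  have key (z : E) {ζ : ℂ} (hζ : ζ ∈ Metric.ball (0 : ℂ) (r / 4)) :=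
    hf.hasDerivAt hq0 hr hr1 hh (z - x) (hre hζ).1 ((hre hζ).2.trans (by linarith))
  intro ζ₀ hζ₀
  have hd (z : E) {ζ : ℂ} (hζ : ζ ∈ Metric.ball (0 : ℂ) (r / 4)) :
      HasDerivAt (fun ζ : ℂ => (b z : ℂ) * f (z - x + ζ.re • h) (ζ.im • h))
        (deriv (fun ζ : ℂ => (b z : ℂ) * f (z - x + ζ.re • h) (ζ.im • h)) ζ) ζ := by
    obtain ⟨d, h1, -⟩ := key z hζ
    exact (h1.const_mul (b z : ℂ)).differentiableAt.hasDerivAt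
  have hintg {ζ : ℂ} (hζ : ζ ∈ Metric.ball (0 : ℂ) (r / 4)) :=
    hf.mul_integrable' hq hr hr1 hb hU hh x (hre hζ).2
  have hnh := Metric.isOpen_ball.mem_nhds hζ₀
  refine (hasDerivAt_integral_of_dominated_loc_of_deriv_le (𝕜 := ℂ) (μ := volume)
    (F := fun ζ z => (b z : ℂ) * f (z - x + ζ.re • h) (ζ.im • h))
    (F' := fun ζ z => deriv (fun ζ : ℂ => (b z : ℂ) * f (z - x + ζ.re • h) (ζ.im • h)) ζ)
    (bound := fun z => U * (4 / r * 3 ^ q * C * (1 + ‖z - x‖) ^ (-q))) hnh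
    ?_ (hintg hζ₀) ?_ ?_ ?_ ?_).2.differentiableAt.differentiableWithinAt
  · filter_upwards [hnh] with ζ hζ using (hintg hζ).aestronglyMeasurable
  · have hn : Tendsto (fun n : ℕ => ζ₀ + ((1 / ((n : ℝ) + 1) : ℝ) : ℂ)) atTop (𝓝 ζ₀) := by
      have := (Complex.continuous_ofReal.tendsto 0).comp
        (tendsto_one_div_add_atTop_nhds_zero_nat (𝕜 := ℝ))
      simpa using this.const_add ζ₀
    obtain ⟨N, hN⟩ := eventually_atTop.1 (hn.eventually hnh)
    refine aestronglyMeasurable_of_tendsto_ae (u := (atTop : Filter ℕ))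
      (f := fun n z => slope (fun ζ : ℂ => (b z : ℂ) * f (z - x + ζ.re • h) (ζ.im • h)) ζ₀
        (ζ₀ + ((1 / (((n + N : ℕ) : ℝ) + 1) : ℝ) : ℂ))) (fun n => ?_)
      (Eventually.of_forall fun z => ?_)
    · simp only [slope, vsub_eq_sub, add_sub_cancel_left]
      exact ((hintg (hN (n + N) (by omega))).aestronglyMeasurable.sub
        (hintg hζ₀).aestronglyMeasurable).const_smul
        (((1 / (((n + N : ℕ) : ℝ) + 1) : ℝ) : ℂ)⁻¹)
    · refine (hasDerivAt_iff_tendsto_slope.1 (hd z hζ₀)).comp ?_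
      refine tendsto_nhdsWithin_iff.2 ⟨(tendsto_add_atTop_iff_nat N).2 hn,
        Eventually.of_forall fun n => ?_⟩
      simp only [mem_compl_iff, mem_singleton_iff, add_eq_left, Complex.ofReal_eq_zero]
      positivity
  · refine Eventually.of_forall fun z ζ hζ => ?_
    obtain ⟨d, h1, h2⟩ := key z hζ
    rw [(h1.const_mul (b z : ℂ)).deriv, norm_mul]
    gcongr
    simpa using hU z
  · exact (((integrable_one_add_norm hq).comp_sub_right x).const_mul _).const_mul _
  · exact Eventually.of_forall fun z ζ hζ => hd z hζ

variable {v : E → E} {L : ℝ}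

lemma integral_re_eq_pair {e : E} {g : E → ℂ}
    (hg : Integrable fun z => ((⟪v z, e⟫ : ℝ) : ℂ) * g z) (c : ℂ) :
    (c * ∫ z, ((⟪v z, e⟫ : ℝ) : ℂ) * g z).re = pair v fun z => (c * g z).re • e := by
  rw [← integral_const_mul, pair]
  have := integral_re (𝕜 := ℂ) (hg.const_mul c)
  simp only [RCLike.re_to_complex] at this
  rw [← this]
  refine integral_congr_ae (Eventually.of_forall fun z => ?_)
  simp only [inner_smul_right, Complex.mul_re, Complex.ofReal_re, Complex.ofReal_im, zero_mul,
    sub_zero, Complex.mul_im, add_zero]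
  ring

lemma Tube.tubeInt_lip (hf : Tube q C r f) (hq : (finrank ℝ E : ℝ) < q) (hr : 0 < r)
    (hr1 : r ≤ 1) (hv : Continuous v) (hU : ∀ x, ‖v x‖ ≤ U) (hh : ‖h‖ ≤ 1) {e : E} (he : ‖e‖ ≤ 1)
    (hD : ∀ (φ : E → E) (A : ℝ), TF φ A A →
      (∀ h : E, TF (fun x => φ (x + h) - φ x) (A * ‖h‖) (A * ‖h‖)) →
      ∀ h : E, |pair v fun x => φ (x + h) - φ x| ≤ L * A * ‖h‖) (x y : E) {ζ : ℂ}
    (hζ : ζ ∈ Metric.ball (0 : ℂ) (r / 4)) :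
    ‖tubeInt (fun z => ⟪v z, e⟫) f h x ζ - tubeInt (fun z => ⟪v z, e⟫) f h y ζ‖ ≤
      2 * (L * tubeC E q C r) * ‖x - y‖ := by
  have hζi : |ζ.im| ≤ r / 4 := (Complex.abs_im_le_norm ζ).trans (mem_ball_zero_iff.1 hζ).le
  have hyy : ‖ζ.im • h‖ ≤ r / 4 := by
    rw [norm_smul, Real.norm_eq_abs]
    exact (mul_le_of_le_one_right (abs_nonneg _) hh).trans hζi
  obtain ⟨t1, t2⟩ := hf.tf hq hr hr1 hyy
  have hbc : Continuous fun z => ⟪v z, e⟫ := hv.inner continuous_const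
  have hbU (z : E) : |⟪v z, e⟫| ≤ U :=
    (abs_real_inner_le_norm _ _).trans
      ((mul_le_of_le_one_right (norm_nonneg _) he).trans (hU z))
  have hi (x : E) := hf.mul_integrable' hq hr hr1 hbc hbU hh x hζi
  have key (c : ℂ) (hc : ‖c‖ = 1) :
      |(c * (tubeInt (fun z => ⟪v z, e⟫) f h x ζ - tubeInt (fun z => ⟪v z, e⟫) f h y ζ)).re| ≤
        L * tubeC E q C r * ‖x - y‖ := by
    set l : ℂ →L[ℝ] E := (Complex.reCLM.comp
      ((ContinuousLinearMap.mul ℝ ℂ) c)).smulRight e with hl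
    have hl1 : ‖l‖ ≤ 1 := by
      refine ContinuousLinearMap.opNorm_le_bound _ zero_le_one fun w => ?_
      simp only [hl, ContinuousLinearMap.smulRight_apply, ContinuousLinearMap.comp_apply,
        ContinuousLinearMap.mul_apply', Complex.reCLM_apply, norm_smul, Real.norm_eq_abs]
      have := (Complex.abs_re_le_norm (c * w))
      rw [norm_mul, hc] at this
      exact mul_le_mul this he (norm_nonneg _) (by positivity) |>.trans (by linarith)
    have hlv (w : ℂ) : l w = (c * w).re • e := by simp [hl]
    have m1 {φ : E → ℂ} {A : ℝ} (hφ : TF φ A A) : TF (fun z => l (φ z)) A A := by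
      have hA := hφ.nonneg_left
      exact (hφ.clm l).mono (mul_le_of_le_one_left hA hl1) (mul_le_of_le_one_left hA hl1)
    set φ : E → E := fun z => l (f (z + (ζ.re • h - x)) (ζ.im • h)) with hφ
    have hφ1 : TF φ (tubeC E q C r) (tubeC E q C r) := m1 (t1.translate _)
    have hφ2 (k : E) : TF (fun z => φ (z + k) - φ z) (tubeC E q C r * ‖k‖)
        (tubeC E q C r * ‖k‖) := by
      have := m1 ((t2 k).translate (ζ.re • h - x))
      simp only [map_sub] at this
      simp only [hφ, add_right_comm _ k]
      exact this
    have h3 := hD φ _ hφ1 hφ2 (x - y)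
    rw [pair_sub hv hU (hφ1.translate _).int hφ1.int] at h3
    rw [mul_sub, Complex.sub_re, tubeInt, tubeInt, integral_re_eq_pair (hi x),
      integral_re_eq_pair (hi y), abs_sub_comm]
    convert h3 using 5
    · simp only [hφ, hlv]
      congr! 4
      abel
    · simp only [hφ, hlv]
      congr! 4
      abel
  refine (Complex.norm_le_abs_re_add_abs_im _).trans ?_
  have h1 := key 1 (by simp)
  have h2 := key (-Complex.I) (by simp)
  rw [one_mul] at h1
  simp only [neg_mul, Complex.neg_re, Complex.mul_re, Complex.I_re, zero_mul, Complex.I_im,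
    one_mul, zero_sub, neg_neg] at h2
  linarith

variable {ι : Type*} [Fintype ι] {fi : ι → E → E → ℂ} {ei : ι → E}

/-- Constant in the analyticity estimates for convolutions with tube functions. -/
def tubeAC (E : Type*) [NormedAddCommGroup E] [InnerProductSpace ℝ E] [FiniteDimensional ℝ E]
    [MeasurableSpace E] [BorelSpace E] (n : ℕ) (q C r L B : ℝ) : ℝ :=
  B + n * (2 * (L * tubeC E q C r))

lemma Tube.exists_af (hf : ∀ i, Tube q C r (fi i)) (hq : (finrank ℝ E : ℝ) < q) (hr : 0 < r)
    (hr1 : r ≤ 1) (hv : Continuous v) (hU : ∀ x, ‖v x‖ ≤ U) (hh : ‖h‖ ≤ 1)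
    (he : ∀ i, ‖ei i‖ ≤ 1) (hL : 0 ≤ L) (hC : 0 ≤ C)
    (hD : ∀ (φ : E → E) (A : ℝ), TF φ A A →
      (∀ h : E, TF (fun x => φ (x + h) - φ x) (A * ‖h‖) (A * ‖h‖)) →
      ∀ h : E, |pair v fun x => φ (x + h) - φ x| ≤ L * A * ‖h‖)
    (hreal : ∀ i x, (fi i x 0).im = 0) {B : ℝ}
    (hB : ∀ x, |pair v fun z => ∑ i, (fi i (z - x) 0).re • ei i| ≤ B) :
    ∃ g, AF (-h) (r / 8) (tubeAC E (Fintype.card ι) q C r L B) g ∧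
      ∀ x, g 0 x = pair v fun z => ∑ i, (fi i (z - x) 0).re • ei i := by
  set Φ : E → ℂ → ℂ := fun x ζ => ∑ i, tubeInt (fun z => ⟪v z, ei i⟫) (fi i) h x ζ with hΦ
  set K := (Fintype.card ι : ℝ) * (2 * (L * tubeC E q C r)) with hK
  have hT : 0 ≤ tubeC E q C r := by
    rw [tubeC]; have : 0 ≤ massI E q := massI_nonneg
    positivity
  have hK0 : 0 ≤ K := by positivity
  have hB0 : 0 ≤ B := (abs_nonneg _).trans (hB 0)
  have hbc (i : ι) : Continuous fun z => ⟪v z, ei i⟫ := hv.inner continuous_const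
  have hbU (i : ι) (z : E) : |⟪v z, ei i⟫| ≤ U :=
    (abs_real_inner_le_norm _ _).trans
      ((mul_le_of_le_one_right (norm_nonneg _) (he i)).trans (hU z))
  have hi (i : ι) (x : E) := (hf i).mul_integrable hq hr hr1 (hbc i) (hbU i) x (y := 0)
    (by simp; positivity)
  have hdiff (x : E) : DifferentiableOn ℂ (Φ x) (Metric.ball 0 (r / 4)) :=
    DifferentiableOn.fun_sum fun i _ =>
      (hf i).differentiableOn_tubeInt hq hr hr1 (hbc i) (hbU i) hh x
  have hlip (x y : E) (ζ : ℂ) (hζ : ζ ∈ Metric.ball (0 : ℂ) (r / 4)) :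
      ‖Φ x ζ - Φ y ζ‖ ≤ K * ‖x - y‖ := by
    rw [hΦ, ← Finset.sum_sub_distrib]
    refine (norm_sum_le _ _).trans ((Finset.sum_le_sum fun i _ =>
      (hf i).tubeInt_lip hq hr hr1 hv hU hh (he i) hD x y hζ).trans (le_of_eq ?_))
    rw [Finset.sum_const, Finset.card_univ, nsmul_eq_mul, hK]; ring
  have hsh (x : E) (ζ : ℂ) (t : ℝ) : Φ x (ζ + t) = Φ (x + t • -h) ζ := by
    simp only [hΦ, tubeInt_shift, smul_neg, sub_eq_add_neg]
  have hderiv (x : E) (ζ : ℂ) (hζ : ζ ∈ Metric.ball (0 : ℂ) (r / 4)) : ‖deriv (Φ x) ζ‖ ≤ K := by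
    have hd := ((hdiff x).differentiableAt (Metric.isOpen_ball.mem_nhds hζ)).hasDerivAt
    have h1 : HasDerivAt (fun t : ℝ => Φ x (ζ + t)) (deriv (Φ x) ζ) 0 := by
      have h2 : HasDerivAt (fun t : ℂ => Φ x (ζ + t)) (deriv (Φ x) ζ) ((0 : ℝ) : ℂ) := by
        have := HasDerivAt.comp_const_add (f := Φ x) (f' := deriv (Φ x) ζ) ζ 0 (by simpa using hd)
        simpa using this
      exact h2.comp_ofReal
    refine h1.le_of_lip' hK0 (Eventually.of_forall fun t => ?_)
    rw [hsh, Complex.ofReal_zero, add_zero]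
    refine (hlip _ _ ζ hζ).trans ?_
    rw [add_sub_cancel_left, norm_smul, norm_neg, sub_zero]
    gcongr
    exact mul_le_of_le_one_right (norm_nonneg _) hh
  have hre (x : E) : (Φ x 0).re = pair v fun z => ∑ i, (fi i (z - x) 0).re • ei i := by
    simp only [hΦ, Complex.re_sum, tubeInt, Complex.zero_re, Complex.zero_im, zero_smul, add_zero,
      pair, inner_sum]
    rw [integral_finsetSum]
    · refine Finset.sum_congr rfl fun i _ => ?_
      have := integral_re_eq_pair (hi i x) 1
      simpa [pair] using this
    · intro i _
      refine ((hi i x).re).congr (Eventually.of_forall fun z => ?_)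
      simp [inner_smul_right, mul_comm]
  have him (x : E) : (Φ x 0).im = 0 := by
    simp only [hΦ, Complex.im_sum, tubeInt, Complex.zero_re, Complex.zero_im, zero_smul, add_zero]
    refine Finset.sum_eq_zero fun i _ => ?_
    have := integral_im (𝕜 := ℂ) (hi i x)
    simp only [RCLike.im_to_complex] at this
    rw [← this]
    simp [hreal]
  have h0 (x : E) : ‖Φ x 0‖ ≤ B := by
    have e : Φ x 0 = ((Φ x 0).re : ℂ) := Complex.ext (by simp) (by simp [him])
    rw [e, Complex.norm_real, hre]
    exact hB x
  refine ⟨fun k x => (iteratedDeriv k (Φ x) 0).re, ?_, fun x => by simpa using hre x⟩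
  have e8 : 2 * (r / 8) = r / 4 := by ring
  refine AF.of_holo (by positivity) (by rwa [e8]) (fun x ζ hζ => ?_) (fun x y ζ hζ => ?_) hsh
  · rw [e8] at hζ
    have h0m : (0 : ℂ) ∈ Metric.ball (0 : ℂ) (r / 4) := Metric.mem_ball_self (by positivity)
    have h1 := (convex_ball (0 : ℂ) (r / 4)).norm_image_sub_le_of_norm_deriv_le (f := Φ x)
      (fun ω hω => (hdiff x).differentiableAt (Metric.isOpen_ball.mem_nhds hω)) (hderiv x) h0m hζ
    have h2 : ‖Φ x ζ‖ ≤ ‖Φ x ζ - Φ x 0‖ + ‖Φ x 0‖ := by simpa using norm_add_le (Φ x ζ - Φ x 0) (Φ x 0)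
    have h3 : ‖ζ - 0‖ ≤ 1 := by
      rw [sub_zero]; have := mem_ball_zero_iff.1 hζ; linarith
    have := h0 x
    have : K * ‖ζ - 0‖ ≤ K := mul_le_of_le_one_right hK0 h3
    rw [tubeAC, ← hK]
    linarith
  · rw [e8] at hζ
    refine (hlip x y ζ hζ).trans ?_
    rw [tubeAC, ← hK]
    gcongr
    linarith

end TubeIntegral

section Eta

variable {a b p : ℝ}

/-- The monotone radial cutoff `(‖y‖² / (1 + ‖y‖²))^q`. -/
def cut (q : ℝ) (y : E) : ℝ := (‖y‖ ^ 2 / (1 + ‖y‖ ^ 2)) ^ q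

lemma cut_nonneg (q : ℝ) (y : E) : 0 ≤ cut q y := by unfold cut; positivity

lemma cut_base_lt (y : E) : ‖y‖ ^ 2 / (1 + ‖y‖ ^ 2) < 1 := by
  rw [div_lt_one (by positivity)]; linarith

lemma cut_lt_one {q : ℝ} (hq : 0 < q) (y : E) : cut q y < 1 :=
  Real.rpow_lt_one (by positivity) (cut_base_lt y) hq

lemma cut_measurable (q : ℝ) : Measurable (cut q : E → ℝ) := by unfold cut; fun_prop

lemma one_sub_cut_le {q : ℝ} (hq : 1 ≤ q) (y : E) : 1 - cut q y ≤ q / (1 + ‖y‖ ^ 2) := by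
  have h0 : (0 : ℝ) < 1 + ‖y‖ ^ 2 := by positivity
  have e : ‖y‖ ^ 2 / (1 + ‖y‖ ^ 2) = 1 + -(1 / (1 + ‖y‖ ^ 2)) := by field_simp; ring
  have h1 : 1 / (1 + ‖y‖ ^ 2) ≤ 1 := by
    rw [div_le_one h0]; nlinarith [sq_nonneg ‖y‖]
  have h := one_add_mul_self_le_rpow_one_add (s := -(1 / (1 + ‖y‖ ^ 2))) (by linarith) hq
  rw [cut, e]
  have : q / (1 + ‖y‖ ^ 2) = q * (1 / (1 + ‖y‖ ^ 2)) := by ring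
  linarith

/-- Radius of the superlevel set `{u ≤ cut q}`. -/
def cutR (q u : ℝ) : ℝ := √(u ^ q⁻¹ / (1 - u ^ q⁻¹))

lemma cutR_pos {q u : ℝ} (hq : 0 < q) (hu : u ∈ Ioo (0 : ℝ) 1) : 0 < cutR q u := by
  have h1 : u ^ q⁻¹ < 1 := Real.rpow_lt_one hu.1.le hu.2 (inv_pos.2 hq)
  have h0 : 0 < u ^ q⁻¹ := Real.rpow_pos_of_pos hu.1 _
  exact Real.sqrt_pos.2 (div_pos h0 (by linarith))

lemma le_cut_iff {q u : ℝ} (hq : 0 < q) (hu : u ∈ Ioo (0 : ℝ) 1) (y : E) :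
    u ≤ cut q y ↔ cutR q u ≤ ‖y‖ := by
  have h1 : u ^ q⁻¹ < 1 := Real.rpow_lt_one hu.1.le hu.2 (inv_pos.2 hq)
  have h0 : 0 < u ^ q⁻¹ := Real.rpow_pos_of_pos hu.1 _
  rw [cut, ← Real.rpow_inv_le_iff_of_pos hu.1.le (by positivity) hq, cutR,
    Real.sqrt_le_left (norm_nonneg _), le_div_iff₀ (by positivity), div_le_iff₀ (by linarith)]
  constructor <;> intro h <;> nlinarith

variable (E) in
/-- First radial moment entering the choice of the cutoff. -/
def etaI (p : ℝ) : ℝ := ∫ y : E, ‖y‖ ^ 2 * (1 + ‖y‖ ^ 2) ^ (-((p + 2) / 2))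

variable (E) in
/-- Second radial moment entering the choice of the cutoff. -/
def etaI' (p : ℝ) : ℝ := ∫ y : E, (‖y‖ ^ 2) ^ 2 * (1 + ‖y‖ ^ 2) ^ (-((p + 2) / 2 + 1))

variable (E) in
/-- First coefficient of the cutoff. -/
def etaA (p : ℝ) : ℝ := -etaI' E p / (etaI E p - etaI' E p)

variable (E) in
/-- Second coefficient of the cutoff. -/
def etaB (p : ℝ) : ℝ := etaI E p / (etaI E p - etaI' E p)

/-- A radial cutoff, equal to `1` at infinity, making the Lamé kernel real analytic and
of zero mass. -/
def eta (p : ℝ) (y : E) : ℝ :=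
  etaA E p * cut ((p + 2) / 2) y + etaB E p * cut ((p + 2) / 2 + 1) y

/-- Radial profile of the regularised kernel. -/
def etaE (c c' p ρ : ℝ) : ℝ :=
  c * (1 + ρ) ^ (-((p + 2) / 2)) + c' * ρ * (1 + ρ) ^ (-((p + 2) / 2 + 1))

lemma weight_sq_le {N : ℝ} (hN : 0 ≤ N) (y : E) :
    (1 + ‖y‖ ^ 2) ^ (-N) ≤ 2 ^ N * (1 + ‖y‖) ^ (-(2 * N)) := by
  have h1 : (1 + ‖y‖) ^ 2 ≤ 2 * (1 + ‖y‖ ^ 2) := by nlinarith [sq_nonneg (‖y‖ - 1)]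
  have h2 : (2 * (1 + ‖y‖ ^ 2)) ^ (-N) ≤ ((1 + ‖y‖) ^ 2) ^ (-N) :=
    Real.rpow_le_rpow_of_nonpos (by positivity) h1 (by linarith)
  rw [Real.mul_rpow (by norm_num) (by positivity), Real.rpow_neg (by norm_num),
    inv_mul_le_iff₀ (by positivity), ← Real.rpow_natCast (1 + ‖y‖) 2, ← Real.rpow_mul (by positivity)] at h2
  rwa [Nat.cast_ofNat, mul_neg] at h2

lemma etaI_integrand_le (hp : 0 ≤ p) (y : E) :
    ‖y‖ ^ 2 * (1 + ‖y‖ ^ 2) ^ (-((p + 2) / 2)) ≤ 2 ^ ((p + 2) / 2) * (1 + ‖y‖) ^ (-p) := by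
  calc ‖y‖ ^ 2 * (1 + ‖y‖ ^ 2) ^ (-((p + 2) / 2))
      ≤ (1 + ‖y‖) ^ (2 : ℝ) * (2 ^ ((p + 2) / 2) * (1 + ‖y‖) ^ (-(2 * ((p + 2) / 2)))) := by
        gcongr
        · norm_cast
          have := norm_nonneg y
          gcongr; linarith
        · exact weight_sq_le (by positivity) y
    _ = 2 ^ ((p + 2) / 2) * ((1 + ‖y‖) ^ (2 : ℝ) * (1 + ‖y‖) ^ (-(2 * ((p + 2) / 2)))) := by ring
    _ = _ := by rw [← Real.rpow_add (by positivity)]; congr 2; ring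

lemma etaI_integrable (hp : (finrank ℝ E : ℝ) < p) :
    Integrable fun y : E => ‖y‖ ^ 2 * (1 + ‖y‖ ^ 2) ^ (-((p + 2) / 2)) := by
  have hp0 : 0 ≤ p := (Nat.cast_nonneg _).trans hp.le
  refine ((integrable_one_add_norm (μ := (volume : Measure E)) hp).const_mul
    (2 ^ ((p + 2) / 2))).mono' (by fun_prop) (Eventually.of_forall fun y => ?_)
  rw [Real.norm_of_nonneg (by positivity)]
  exact etaI_integrand_le hp0 y

lemma etaI'_integrand_eq (y : E) : (‖y‖ ^ 2) ^ 2 * (1 + ‖y‖ ^ 2) ^ (-((p + 2) / 2 + 1)) =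
    ‖y‖ ^ 2 / (1 + ‖y‖ ^ 2) * (‖y‖ ^ 2 * (1 + ‖y‖ ^ 2) ^ (-((p + 2) / 2))) := by
  rw [neg_add, Real.rpow_add (by positivity), Real.rpow_neg_one]
  field_simp

lemma etaI'_integrable (hp : (finrank ℝ E : ℝ) < p) :
    Integrable fun y : E => (‖y‖ ^ 2) ^ 2 * (1 + ‖y‖ ^ 2) ^ (-((p + 2) / 2 + 1)) := by
  refine (etaI_integrable hp).mono' (by fun_prop) (Eventually.of_forall fun y => ?_)
  rw [Real.norm_of_nonneg (by positivity), etaI'_integrand_eq]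
  exact mul_le_of_le_one_left (by positivity) (cut_base_lt y).le

lemma etaI'_lt [Nontrivial E] (hp : (finrank ℝ E : ℝ) < p) : etaI' E p < etaI E p := by
  rw [← sub_pos, etaI, etaI', ← integral_sub (etaI_integrable hp) (etaI'_integrable hp)]
  have e (y : E) : ‖y‖ ^ 2 * (1 + ‖y‖ ^ 2) ^ (-((p + 2) / 2)) -
      (‖y‖ ^ 2) ^ 2 * (1 + ‖y‖ ^ 2) ^ (-((p + 2) / 2 + 1)) =
      (1 - ‖y‖ ^ 2 / (1 + ‖y‖ ^ 2)) * (‖y‖ ^ 2 * (1 + ‖y‖ ^ 2) ^ (-((p + 2) / 2))) := by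
    rw [etaI'_integrand_eq]; ring
  have hi : Integrable fun y : E => ‖y‖ ^ 2 * (1 + ‖y‖ ^ 2) ^ (-((p + 2) / 2)) -
      (‖y‖ ^ 2) ^ 2 * (1 + ‖y‖ ^ 2) ^ (-((p + 2) / 2 + 1)) :=
    (etaI_integrable hp).sub (etaI'_integrable hp)
  rw [integral_pos_iff_support_of_nonneg (fun y => ?_) hi]
  · have hs : {y : E | y ≠ 0} ⊆ Function.support fun y : E =>
        ‖y‖ ^ 2 * (1 + ‖y‖ ^ 2) ^ (-((p + 2) / 2)) -
        (‖y‖ ^ 2) ^ 2 * (1 + ‖y‖ ^ 2) ^ (-((p + 2) / 2 + 1)) := by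
      intro y hy
      rw [Function.mem_support, e]
      have h1 : 0 < ‖y‖ := norm_pos_iff.2 hy
      have h2 := cut_base_lt y
      exact (mul_pos (by linarith) (by positivity)).ne'
    refine lt_of_lt_of_le ?_ (measure_mono hs)
    exact (isOpen_ne.measure_pos volume (exists_ne 0))
  · simp only [Pi.zero_apply]
    rw [e]
    have h2 := cut_base_lt y
    exact mul_nonneg (by linarith) (by positivity)

lemma etaA_add_etaB [Nontrivial E] (hp : (finrank ℝ E : ℝ) < p) : etaA E p + etaB E p = 1 := by
  have := sub_pos.2 (etaI'_lt hp)
  rw [etaA, etaB]; field_simp; ring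

lemma etaE_mass [Nontrivial E] (hp : (finrank ℝ E : ℝ) < p) :
    ∫ y : E, etaE (etaA E p) (etaB E p) p (‖y‖ ^ 2) * ‖y‖ ^ 2 = 0 := by
  have e (y : E) : etaE (etaA E p) (etaB E p) p (‖y‖ ^ 2) * ‖y‖ ^ 2 =
      etaA E p * (‖y‖ ^ 2 * (1 + ‖y‖ ^ 2) ^ (-((p + 2) / 2))) +
      etaB E p * ((‖y‖ ^ 2) ^ 2 * (1 + ‖y‖ ^ 2) ^ (-((p + 2) / 2 + 1))) := by
    rw [etaE]; ring
  simp_rw [e]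
  rw [integral_add ((etaI_integrable hp).const_mul _) ((etaI'_integrable hp).const_mul _),
    integral_const_mul, integral_const_mul, ← etaI, ← etaI', etaA, etaB]
  ring

/-- The regularised kernel. -/
def gk (a b p : ℝ) (y : E) : E →L[ℝ] E := eta p y • ker a b p y

lemma gk_apply (hp : 0 < p) (y w : E) : gk a b p y w =
    etaE (etaA E p) (etaB E p) p (‖y‖ ^ 2) • ((a * ‖y‖ ^ 2) • w + (b * ⟪y, w⟫) • y) := by
  rcases eq_or_ne y 0 with rfl | hy
  · simp [gk, ker_apply, Real.zero_rpow (neg_ne_zero.2 hp.ne')]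
  have hy' : 0 < ‖y‖ := norm_pos_iff.2 hy
  have h1 : ‖y‖ ^ (-p) = ‖y‖ ^ (-(p + 2)) * ‖y‖ ^ 2 := by
    rw [← Real.rpow_natCast, ← Real.rpow_add hy']; congr 1; push_cast; ring
  have hc (q : ℝ) : cut q y = ‖y‖ ^ (2 * q) * (1 + ‖y‖ ^ 2) ^ (-q) := by
    rw [cut, Real.div_rpow (by positivity) (by positivity), Real.rpow_neg (by positivity),
      Real.rpow_mul hy'.le, div_eq_mul_inv]
    norm_num
  have h2 : eta p y * ‖y‖ ^ (-(p + 2)) = etaE (etaA E p) (etaB E p) p (‖y‖ ^ 2) := by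
    rw [eta, etaE, hc, hc, add_mul]
    have e1 : ‖y‖ ^ (2 * ((p + 2) / 2)) * ‖y‖ ^ (-(p + 2)) = 1 := by
      rw [← Real.rpow_add hy']; ring_nf; simp
    have e2 : ‖y‖ ^ (2 * ((p + 2) / 2 + 1)) * ‖y‖ ^ (-(p + 2)) = ‖y‖ ^ 2 := by
      rw [← Real.rpow_add hy', ← Real.rpow_natCast]; congr 1; push_cast; ring
    congr 1
    · linear_combination (etaA E p * (1 + ‖y‖ ^ 2) ^ (-((p + 2) / 2))) * e1
    · linear_combination (etaB E p * (1 + ‖y‖ ^ 2) ^ (-((p + 2) / 2 + 1))) * e2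
  rw [gk, _root_.smul_apply, ker_apply, ← h2, smul_add, smul_add, smul_smul, smul_smul, smul_smul,
    smul_smul, h1]
  congr 2 <;> ring

lemma gk_measurable : StronglyMeasurable (gk a b p : E → E →L[ℝ] E) := by
  have : Measurable (eta p : E → ℝ) := by
    unfold eta
    exact ((cut_measurable _).const_mul _).add ((cut_measurable _).const_mul _)
  exact this.stronglyMeasurable.smul ker_measurable

lemma gk_neg (y : E) : gk a b p (-y) = gk a b p y := by
  simp [gk, ker_neg, eta, cut]

lemma gk_symm (y w z : E) : ⟪gk a b p y w, z⟫ = ⟪w, gk a b p y z⟫ := by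
  simp [gk, inner_smul_left, inner_smul_right, ker_symm]

lemma cut_smul_ker_integrable (hp : (finrank ℝ E : ℝ) < p) {q : ℝ} (hq : (p + 2) / 2 ≤ q) :
    Integrable fun y : E => cut q y • ker a b p y := by
  have hp0 : 0 ≤ p := (Nat.cast_nonneg _).trans hp.le
  have hm : StronglyMeasurable fun y : E => cut q y • ker a b p y :=
    (cut_measurable _).stronglyMeasurable.smul ker_measurable
  refine ((etaI_integrable (E := E) hp).const_mul (|a| + |b|)).mono' hm.aestronglyMeasurable ?_
  filter_upwards with y
  rw [norm_smul, Real.norm_of_nonneg (cut_nonneg _ _)]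
  have h1 : cut q y ≤ cut ((p + 2) / 2) y := by
    rcases eq_or_ne y 0 with rfl | hy
    · simp [cut, Real.zero_rpow (by linarith : q ≠ 0), Real.zero_rpow (by linarith : (p + 2) / 2 ≠ 0)]
    · have : 0 < ‖y‖ := norm_pos_iff.2 hy
      exact Real.rpow_le_rpow_of_exponent_ge (by positivity) (cut_base_lt y).le hq
  have h3 : ‖y‖ ^ (p + 2) * ‖y‖ ^ (-p) ≤ ‖y‖ ^ 2 := by
    rcases eq_or_ne y 0 with rfl | hy
    · simp [Real.zero_rpow (by linarith : p + 2 ≠ 0)]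
    · rw [← Real.rpow_add (norm_pos_iff.2 hy), ← Real.rpow_natCast]
      exact le_of_eq (by congr 1; push_cast; ring)
  have h4 : cut ((p + 2) / 2) y = ‖y‖ ^ (p + 2) * (1 + ‖y‖ ^ 2) ^ (-((p + 2) / 2)) := by
    rw [cut, Real.div_rpow (by positivity) (by positivity), Real.rpow_neg (by positivity),
      div_eq_mul_inv, ← Real.rpow_natCast, ← Real.rpow_mul (norm_nonneg _)]
    congr 2; push_cast; ring
  calc cut q y * ‖ker a b p y‖ ≤ cut ((p + 2) / 2) y * ((|a| + |b|) * ‖y‖ ^ (-p)) := by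
        gcongr
        · exact cut_nonneg _ _
        · exact ker_norm_le y
    _ = (|a| + |b|) * ((‖y‖ ^ (p + 2) * ‖y‖ ^ (-p)) * (1 + ‖y‖ ^ 2) ^ (-((p + 2) / 2))) := by
        rw [h4]; ring
    _ ≤ _ := by gcongr

lemma gk_integrable (hp : (finrank ℝ E : ℝ) < p) : Integrable (gk a b p : E → E →L[ℝ] E) := by
  have h := ((cut_smul_ker_integrable (E := E) (a := a) (b := b) hp le_rfl).smul (etaA E p)).add
    ((cut_smul_ker_integrable (E := E) (a := a) (b := b) hp
      (show (p + 2) / 2 ≤ (p + 2) / 2 + 1 by linarith)).smul (etaB E p))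
  refine h.congr (Eventually.of_forall fun y => ?_)
  simp [gk, eta, add_smul, smul_smul]

lemma integral_radial_inner_sq {g : ℝ → ℝ}
    (hg : ∀ w : E, Integrable fun y : E => g ‖y‖ * ⟪y, w⟫ ^ 2)
    (h0 : ∫ y : E, g ‖y‖ * ‖y‖ ^ 2 = 0) (w : E) : ∫ y : E, g ‖y‖ * ⟪y, w⟫ ^ 2 = 0 := by
  have hrot {ξ η : E} (h : ‖ξ‖ = ‖η‖) :
      ∫ y : E, g ‖y‖ * ⟪y, ξ⟫ ^ 2 = ∫ y : E, g ‖y‖ * ⟪y, η⟫ ^ 2 := by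
    set R := (Submodule.span ℝ {ξ - η})ᗮ.reflection with hR
    have e : R ξ = η := Submodule.reflection_sub h
    have h1 := (R.measurePreserving).integral_comp R.toHomeomorph.measurableEmbedding
      fun y : E => g ‖y‖ * ⟪y, η⟫ ^ 2
    rw [← h1]
    congr 1; ext y
    rw [← e, R.norm_map, R.inner_map_map]
  rcases eq_or_ne w 0 with rfl | hw
  · simp
  have hn : ‖w‖ ≠ 0 := norm_ne_zero_iff.2 hw
  set bb := stdOrthonormalBasis ℝ E
  have hsum : ∑ i, ∫ y : E, g ‖y‖ * ⟪y, ‖w‖ • bb i⟫ ^ 2 = 0 := by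
    rw [← integral_finsetSum _ fun i _ => hg _]
    have e (y : E) : ∑ i, g ‖y‖ * ⟪y, ‖w‖ • bb i⟫ ^ 2 = ‖w‖ ^ 2 * (g ‖y‖ * ‖y‖ ^ 2) := by
      simp only [inner_smul_right, mul_pow]
      rw [← bb.sum_sq_inner_left y, ← Finset.mul_sum, ← Finset.mul_sum]
      ring
    simp_rw [e]
    rw [integral_const_mul, h0, mul_zero]
  have hall (i) : ∫ y : E, g ‖y‖ * ⟪y, ‖w‖ • bb i⟫ ^ 2 = ∫ y : E, g ‖y‖ * ⟪y, w⟫ ^ 2 :=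
    hrot (by simp [norm_smul])
  simp only [hall, Finset.sum_const, Finset.card_univ, Fintype.card_fin, nsmul_eq_mul,
    mul_eq_zero] at hsum
  refine hsum.resolve_left ?_
  have : Nontrivial E := ⟨w, 0, hw⟩
  exact_mod_cast (finrank_pos (R := ℝ) (M := E)).ne'

lemma gk_integral [Nontrivial E] (hp : (finrank ℝ E : ℝ) < p) :
    ∫ y : E, gk a b p y = 0 := by
  have hp0 : 0 < p := lt_of_le_of_lt (Nat.cast_nonneg _) hp
  have hi := gk_integrable (E := E) (a := a) (b := b) hp
  have happ (w z : E) : ⟪(∫ y : E, gk a b p y) w, z⟫ = ∫ y : E, ⟪gk a b p y w, z⟫ := by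
    rw [ContinuousLinearMap.integral_apply hi, real_inner_comm,
      ← integral_inner (hi.apply_continuousLinearMap w)]
    simp_rw [real_inner_comm]
  have hE (a b : ℝ) (w : E) : Integrable fun y : E => ⟪gk a b p y w, w⟫ :=
    ((gk_integrable (E := E) (a := a) (b := b) hp).apply_continuousLinearMap w).inner_const w
  have hsymm : ((∫ y : E, gk a b p y : E →L[ℝ] E) : E →ₗ[ℝ] E).IsSymmetric := by
    intro w z
    simp only [ContinuousLinearMap.coe_coe]
    rw [happ, ← real_inner_comm, happ]
    congr 1; ext y
    rw [gk_symm, real_inner_comm]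
  have hq (w : E) : ⟪(∫ y : E, gk a b p y) w, w⟫ = 0 := by
    have h2 : ∀ w : E, Integrable fun y : E =>
        etaE (etaA E p) (etaB E p) p (‖y‖ ^ 2) * ⟪y, w⟫ ^ 2 := fun w => by
      refine (hE 0 1 w).congr (Eventually.of_forall fun y => ?_)
      simp [gk_apply hp0, inner_smul_left, sq]
    have h1 := integral_radial_inner_sq (E := E)
      (g := fun r => etaE (etaA E p) (etaB E p) p (r ^ 2)) h2 (etaE_mass hp) w
    have e (y : E) : ⟪gk a b p y w, w⟫ =
        a * ‖w‖ ^ 2 * (etaE (etaA E p) (etaB E p) p (‖y‖ ^ 2) * ‖y‖ ^ 2) +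
        b * (etaE (etaA E p) (etaB E p) p (‖y‖ ^ 2) * ⟪y, w⟫ ^ 2) := by
      simp only [gk_apply hp0, inner_smul_left, inner_add_left, RCLike.conj_to_real,
        real_inner_self_eq_norm_sq]
      ring
    have h3 : Integrable fun y : E => etaE (etaA E p) (etaB E p) p (‖y‖ ^ 2) * ‖y‖ ^ 2 := by
      obtain ⟨z, hz⟩ := exists_ne (0 : E)
      have hz' : ‖z‖ ^ 2 ≠ 0 := by simpa using hz
      refine ((hE 1 0 z).const_mul (‖z‖ ^ 2)⁻¹).congr (Eventually.of_forall fun y => ?_)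
      simp only [gk_apply hp0, inner_smul_left, RCLike.conj_to_real,
        real_inner_self_eq_norm_sq, zero_mul, zero_smul, add_zero]
      field_simp
    rw [happ]
    simp_rw [e]
    rw [integral_add (h3.const_mul _) ((h2 w).const_mul _), integral_const_mul, integral_const_mul,
      h1, etaE_mass hp]
    ring
  have h := (hsymm.inner_map_self_eq_zero).1 fun w => hq w
  ext1 w
  exact LinearMap.congr_fun h w

end Eta

section LayerCake

variable {a b p : ℝ} {v : E → E} {U : ℝ}

lemma setIntegral_ite_le [CompleteSpace F] {c : ℝ} (h0 : 0 ≤ c) (h1 : c < 1) (g : F) :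
    IntegrableOn (fun u : ℝ => if u ≤ c then g else 0) (Ioo 0 1) ∧
      ∫ u in Ioo (0 : ℝ) 1, (if u ≤ c then g else 0) = c • g := by
  have e : (fun u : ℝ => if u ≤ c then g else 0) = (Iic c).indicator fun _ => g := by
    ext u; simp [indicator_apply]
  have hs : Ioo (0 : ℝ) 1 ∩ Iic c = Ioc 0 c := by
    ext u; simp only [mem_inter_iff, mem_Ioo, mem_Iic, mem_Ioc]
    constructor
    · rintro ⟨h, h'⟩; exact ⟨h.1, h'⟩
    · rintro ⟨h, h'⟩; exact ⟨⟨h, h'.trans_lt h1⟩, h'⟩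
  constructor
  · rw [e]
    exact IntegrableOn.indicator (by simp) measurableSet_Iic
  · rw [e, setIntegral_indicator measurableSet_Iic, hs, setIntegral_const]
    simp [h0]

lemma op_cut_smul (hp : (finrank ℝ E : ℝ) < p) {q : ℝ} (hq : (p + 2) / 2 ≤ q) (hv : Continuous v)
    (hU : ∀ x, ‖v x‖ ≤ U) (x : E) :
    IntegrableOn (fun u => trunc (ker a b p) v (cutR q u) x) (Ioo 0 1) ∧
    op (fun y => cut q y • ker a b p y) v x =
      ∫ u in Ioo (0 : ℝ) 1, trunc (ker a b p) v (cutR q u) x := by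
  have hp0 : 0 ≤ p := (Nat.cast_nonneg _).trans hp.le
  have hq0 : 0 < q := by linarith
  set g : E → E := fun y => ker a b p y (v x - v (x - y)) with hg
  have hgm : AEStronglyMeasurable g := aesm_clm_apply ker_measurable.aestronglyMeasurable
    (by fun_prop : Continuous fun y => v x - v (x - y)).aestronglyMeasurable
  have hci : Integrable fun y => cut q y • g y := by
    have h := cut_smul_ker_integrable (E := E) (a := a) (b := b) hp hq
    refine (h.norm.mul_const (2 * U)).mono' ((cut_measurable q).aestronglyMeasurable.smul hgm)
      (Eventually.of_forall fun y => ?_)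
    rw [hg, norm_smul, norm_smul, mul_assoc]
    gcongr
    refine ((ker a b p y).le_opNorm _).trans ?_
    gcongr
    exact (norm_sub_le _ _).trans (by linarith [hU x, hU (x - y)])
  set f : ℝ × E → E := fun z => if z.1 ≤ cut q z.2 then g z.2 else 0 with hf
  have hfm : AEStronglyMeasurable f ((volume.restrict (Ioo (0 : ℝ) 1)).prod volume) := by
    have hs : MeasurableSet {z : ℝ × E | z.1 ≤ cut q z.2} :=
      measurableSet_le measurable_fst ((cut_measurable q).comp measurable_snd)
    have e : f = {z : ℝ × E | z.1 ≤ cut q z.2}.indicator fun z => g z.2 := by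
      ext z; simp [f, indicator_apply]
    rw [e]
    exact hgm.comp_snd.indicator hs
  have hfi : Integrable f ((volume.restrict (Ioo (0 : ℝ) 1)).prod volume) := by
    rw [integrable_prod_iff' hfm]
    refine ⟨Eventually.of_forall fun y =>
      (setIntegral_ite_le (cut_nonneg q y) (cut_lt_one hq0 y) (g y)).1, ?_⟩
    refine hci.norm.congr (Eventually.of_forall fun y => ?_)
    have e (u : ℝ) : ‖f (u, y)‖ = if u ≤ cut q y then ‖g y‖ else 0 := by
      simp only [f]; split_ifs <;> simp
    simp only [e]
    rw [(setIntegral_ite_le (cut_nonneg q y) (cut_lt_one hq0 y) ‖g y‖).2, norm_smul,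
      Real.norm_of_nonneg (cut_nonneg q y), smul_eq_mul]
  have ht (u : ℝ) (hu : u ∈ Ioo (0 : ℝ) 1) :
      ∫ y, f (u, y) = trunc (ker a b p) v (cutR q u) x := by
    rw [trunc, ← integral_indicator (measurableSet_le (by fun_prop) (by fun_prop))]
    congr 1; ext y
    simp only [f, indicator_apply, le_cut_iff hq0 hu, Set.mem_ofPred_eq, g]
  have h1 := hfi.integral_prod_left
  refine ⟨IntegrableOn.congr_fun h1 ht measurableSet_Ioo, ?_⟩
  rw [← setIntegral_congr_fun measurableSet_Ioo ht, integral_integral_swap hfi]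
  simp only [op]
  congr 1; ext y
  exact (setIntegral_ite_le (cut_nonneg q y) (cut_lt_one hq0 y) (g y)).2.symm

lemma op_gk_eq (hp : (finrank ℝ E : ℝ) < p) (hv : Continuous v) (hU : ∀ x, ‖v x‖ ≤ U) (x : E) :
    op (gk a b p) v x =
      etaA E p • (∫ u in Ioo (0 : ℝ) 1, trunc (ker a b p) v (cutR ((p + 2) / 2) u) x) +
      etaB E p • (∫ u in Ioo (0 : ℝ) 1, trunc (ker a b p) v (cutR ((p + 2) / 2 + 1) u) x) := by
  rw [← (op_cut_smul hp le_rfl hv hU x).2, ← (op_cut_smul hp (by linarith) hv hU x).2]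
  have hi (q : ℝ) (hq : (p + 2) / 2 ≤ q) :
      Integrable fun y => (cut q y • ker a b p y) (v x - v (x - y)) := by
    have h := cut_smul_ker_integrable (E := E) (a := a) (b := b) hp hq
    simp only [map_sub]
    exact (h.apply_continuousLinearMap (v x)).sub (bdd_integrable h hv hU x)
  rw [op, op, op, ← integral_smul, ← integral_smul,
    ← integral_add ((hi _ le_rfl).fun_smul _) ((hi _ (by linarith)).fun_smul _)]
  congr 1; ext y
  simp [gk, eta, add_smul, smul_smul]

lemma op_gk_bound (hp : (finrank ℝ E : ℝ) < p) (hv : Continuous v) (hU : ∀ x, ‖v x‖ ≤ U) (x : E)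
    {M : ℝ} (hM : ∀ ε > 0, ‖trunc (ker a b p) v ε x‖ ≤ M) :
    ‖op (gk a b p) v x‖ ≤ (|etaA E p| + |etaB E p|) * M := by
  have hp0 : 0 ≤ p := (Nat.cast_nonneg _).trans hp.le
  have h (q : ℝ) (hq : 0 < q) :
      ‖∫ u in Ioo (0 : ℝ) 1, trunc (ker a b p) v (cutR q u) x‖ ≤ M := by
    have := norm_setIntegral_le_of_norm_le_const (μ := volume) (s := Ioo (0 : ℝ) 1) (C := M)
      (f := fun u => trunc (ker a b p) v (cutR q u) x) (by simp)
      fun u hu => hM _ (cutR_pos hq hu)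
    simpa using this
  rw [op_gk_eq hp hv hU, add_mul]
  refine (norm_add_le _ _).trans (add_le_add ?_ ?_) <;>
  · rw [norm_smul, Real.norm_eq_abs]
    gcongr
    exact h _ (by linarith)

lemma op_gk_tendsto [Nontrivial E] (hp : (finrank ℝ E : ℝ) < p) (hv : Continuous v)
    (hU : ∀ x, ‖v x‖ ≤ U) (x : E)
    {M : ℝ} (hM : ∀ ε > 0, ‖trunc (ker a b p) v ε x‖ ≤ M) {l : E}
    (hl : Tendsto (fun ε => trunc (ker a b p) v ε x) (𝓝[>] 0) (𝓝 l)) :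
    Tendsto (fun t : ℝ => t ^ (-(p - finrank ℝ E)) •
      op (gk a b p) (fun z => v (t • z)) (t⁻¹ • x)) (𝓝[>] 0) (𝓝 l) := by
  have hp0 : 0 ≤ p := (Nat.cast_nonneg _).trans hp.le
  have hc (q : ℝ) (hq : (p + 2) / 2 ≤ q) : Tendsto (fun t : ℝ =>
      ∫ u in Ioo (0 : ℝ) 1, trunc (ker a b p) v (t * cutR q u) x) (𝓝[>] 0) (𝓝 l) := by
    have hq0 : 0 < q := by linarith
    have e : l = ∫ u in Ioo (0 : ℝ) 1, l := by simp
    rw [e]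
    refine tendsto_integral_filter_of_dominated_convergence (fun _ => M) ?_ ?_ (by simp) ?_
    · filter_upwards [self_mem_nhdsWithin] with t (ht : 0 < t)
      have h1 := (op_cut_smul (a := a) (b := b) hp hq (v := fun z => v (t • z)) (U := U)
        (by fun_prop) (fun x => hU _) (t⁻¹ • x)).1
      simp only [trunc_scale ht, smul_inv_smul₀ ht.ne'] at h1
      have h2 := (h1.smul (t ^ (-(p - finrank ℝ E)))).aestronglyMeasurable
      refine h2.congr (Eventually.of_forall fun u => ?_)
      simp only [Pi.smul_apply, smul_smul]
      rw [← Real.rpow_add ht]; simp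
    · filter_upwards [self_mem_nhdsWithin] with t (ht : 0 < t)
      filter_upwards [ae_restrict_mem measurableSet_Ioo] with u hu
      exact hM _ (mul_pos ht (cutR_pos hq0 hu))
    · filter_upwards [ae_restrict_mem measurableSet_Ioo] with u hu
      refine hl.comp (tendsto_nhdsWithin_iff.2 ⟨?_, ?_⟩)
      · have : Tendsto (fun t : ℝ => t * cutR q u) (𝓝 0) (𝓝 (0 * cutR q u)) :=
          tendsto_id.mul_const _
        rw [zero_mul] at this
        exact this.mono_left nhdsWithin_le_nhds
      · filter_upwards [self_mem_nhdsWithin] with t (ht : 0 < t)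
        exact mul_pos ht (cutR_pos hq0 hu)
  have h := ((hc _ le_rfl).const_smul (etaA E p)).add
    ((hc ((p + 2) / 2 + 1) (by linarith)).const_smul (etaB E p))
  rw [← add_smul, etaA_add_etaB hp, one_smul] at h
  refine h.congr' ?_
  filter_upwards [self_mem_nhdsWithin] with t (ht : 0 < t)
  rw [op_gk_eq hp (v := fun z => v (t • z)) (U := U) (by fun_prop) (fun x => hU _)]
  simp only [trunc_scale ht, smul_inv_smul₀ ht.ne', integral_smul]
  rw [smul_add, smul_comm, smul_smul (t ^ _), ← Real.rpow_add ht, smul_comm (t ^ _),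
    smul_smul (t ^ _), ← Real.rpow_add ht]
  simp

end LayerCake

section GkTube

variable {a b p : ℝ} {v : E → E} {U : ℝ}

/-- The complexified square `∑ⱼ (xⱼ + i yⱼ)²`. -/
def zsq (x y : E) : ℂ := ⟨‖x‖ ^ 2 - ‖y‖ ^ 2, 2 * ⟪x, y⟫⟩

/-- The complexified inner product `∑ⱼ (xⱼ + i yⱼ) wⱼ`. -/
def zin (w x y : E) : ℂ := ⟨⟪x, w⟫, ⟪y, w⟫⟩

variable (a b p) in
/-- Holomorphic extension of the components of the regularised kernel. -/
def gkC (w e x y : E) : ℂ :=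
  (etaA E p * (1 + zsq x y) ^ (((-((p + 2) / 2) : ℝ)) : ℂ) +
    etaB E p * zsq x y * (1 + zsq x y) ^ (((-((p + 2) / 2 + 1) : ℝ)) : ℂ)) *
  (a * zsq x y * (⟪w, e⟫ : ℝ) + b * zin w x y * zin e x y)

lemma zsq_line (x y h : E) (ζ : ℂ) : zsq (x + ζ.re • h) (y + ζ.im • h) =
    zsq x y + 2 * ζ * zin h x y + ζ ^ 2 * (‖h‖ ^ 2 : ℝ) := by
  apply Complex.ext
  · simp only [zsq, norm_add_sq_real, norm_smul, mul_pow, Real.norm_eq_abs, sq_abs,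
      inner_smul_right]
    simp only [zin, Complex.add_re, Complex.mul_re, Complex.mul_im, sq, Complex.ofReal_re,
      Complex.ofReal_im, Complex.re_ofNat, Complex.im_ofNat]
    ring
  · simp only [zsq, zin, inner_add_left, inner_add_right, inner_smul_left, inner_smul_right,
      RCLike.conj_to_real, Complex.add_im, Complex.mul_re, Complex.mul_im, sq, Complex.ofReal_re,
      Complex.ofReal_im, Complex.re_ofNat, Complex.im_ofNat, real_inner_comm y h,
      real_inner_self_eq_norm_mul_norm]
    ring

lemma zin_line (w x y h : E) (ζ : ℂ) : zin w (x + ζ.re • h) (y + ζ.im • h) =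
    zin w x y + ζ * (⟪h, w⟫ : ℝ) := by
  apply Complex.ext <;> simp [zin, inner_add_left, inner_smul_left]

lemma norm_zsq_le (x y : E) : ‖zsq x y‖ ≤ (‖x‖ + ‖y‖) ^ 2 := by
  have h := abs_real_inner_le_norm x y
  refine (Complex.norm_le_abs_re_add_abs_im _).trans ?_
  have h1 : |‖x‖ ^ 2 - ‖y‖ ^ 2| ≤ ‖x‖ ^ 2 + ‖y‖ ^ 2 := by
    rw [abs_le]; constructor <;> nlinarith [sq_nonneg ‖x‖, sq_nonneg ‖y‖]
  have h2 : |2 * ⟪x, y⟫| ≤ 2 * (‖x‖ * ‖y‖) := by rw [abs_mul]; norm_num; exact h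
  simp only [zsq]
  nlinarith

lemma norm_zin_le (w x y : E) (hw : ‖w‖ ≤ 1) : ‖zin w x y‖ ≤ ‖x‖ + ‖y‖ := by
  refine (Complex.norm_le_abs_re_add_abs_im _).trans ?_
  simp only [zin]
  gcongr <;>
  · refine (abs_real_inner_le_norm _ _).trans ?_
    exact mul_le_of_le_one_right (norm_nonneg _) hw

lemma one_add_zsq_re (x : E) {y : E} (hy : ‖y‖ ≤ 1 / 2) :
    (1 + ‖x‖) ^ 2 / 3 ≤ (1 + zsq x y).re ∧ 0 < (1 + zsq x y).re := by
  have h : (1 + ‖x‖) ^ 2 / 3 ≤ (1 + zsq x y).re := by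
    simp only [zsq, Complex.add_re, Complex.one_re]
    nlinarith [sq_nonneg (‖x‖ - 1), norm_nonneg y, sq_nonneg ‖x‖]
  exact ⟨h, lt_of_lt_of_le (by positivity) h⟩

lemma norm_one_add_zsq_cpow_le (x : E) {y : E} (hy : ‖y‖ ≤ 1 / 2) {N : ℝ} (hN : 0 ≤ N) :
    ‖(1 + zsq x y) ^ ((-N : ℝ) : ℂ)‖ ≤ 3 ^ N * (1 + ‖x‖) ^ (-(2 * N)) := by
  rw [Complex.norm_cpow_real]
  have h1 : (1 + ‖x‖) ^ 2 / 3 ≤ ‖1 + zsq x y‖ :=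
    (one_add_zsq_re x hy).1.trans (Complex.re_le_norm _)
  refine (Real.rpow_le_rpow_of_nonpos (by positivity) h1 (by linarith)).trans (le_of_eq ?_)
  rw [Real.div_rpow (by positivity) (by norm_num), ← Real.rpow_natCast (1 + ‖x‖) 2,
    ← Real.rpow_mul (by positivity), Real.rpow_neg (by norm_num : (0 : ℝ) ≤ 3), div_inv_eq_mul,
    mul_comm]
  congr 2; push_cast; ring

variable (E a b p) in
/-- Bound for the holomorphic extension of the regularised kernel. -/
def gkM : ℝ := (|etaA E p| * 3 ^ ((p + 2) / 2) + |etaB E p| * 3 ^ ((p + 2) / 2 + 1)) * (|a| + |b|)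

lemma gkM_nonneg : 0 ≤ gkM E a b p := by unfold gkM; positivity

lemma gkC_tube (hp : 0 < p) {w e : E} (hw : ‖w‖ ≤ 1) (he : ‖e‖ ≤ 1) :
    Tube p (gkM E a b p) (1 / 2) (gkC a b p w e) := by
  refine ⟨fun x y hy => ?_, fun x y h ζ hζ => ?_⟩
  · have hX : 0 < 1 + ‖x‖ := by positivity
    have hs : ‖x‖ + ‖y‖ ≤ 1 + ‖x‖ := by linarith
    have hz := (norm_zsq_le x y).trans (pow_le_pow_left₀ (by positivity) hs 2)
    have h1 := norm_one_add_zsq_cpow_le x hy (show 0 ≤ (p + 2) / 2 by linarith)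
    have h2 := norm_one_add_zsq_cpow_le x hy (show 0 ≤ (p + 2) / 2 + 1 by linarith)
    have e1 : (1 + ‖x‖) ^ (-(2 * ((p + 2) / 2))) = (1 + ‖x‖) ^ (-p) / (1 + ‖x‖) ^ 2 := by
      rw [← Real.rpow_natCast, ← Real.rpow_sub hX]; congr 1; push_cast; ring
    have e2 : (1 + ‖x‖) ^ (-(2 * ((p + 2) / 2 + 1))) =
        (1 + ‖x‖) ^ (-p) / ((1 + ‖x‖) ^ 2) ^ 2 := by
      rw [← pow_mul, ← Real.rpow_natCast, ← Real.rpow_sub hX]; congr 1; push_cast; ring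
    rw [e1] at h1
    rw [e2] at h2
    have hwe : |⟪w, e⟫| ≤ 1 := (abs_real_inner_le_norm w e).trans (mul_le_one₀ hw (norm_nonneg _) he)
    have hE : ‖etaA E p * (1 + zsq x y) ^ (((-((p + 2) / 2) : ℝ)) : ℂ) +
        etaB E p * zsq x y * (1 + zsq x y) ^ (((-((p + 2) / 2 + 1) : ℝ)) : ℂ)‖ ≤
        |etaA E p| * (3 ^ ((p + 2) / 2) * ((1 + ‖x‖) ^ (-p) / (1 + ‖x‖) ^ 2)) +
        |etaB E p| * (1 + ‖x‖) ^ 2 *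
          (3 ^ ((p + 2) / 2 + 1) * ((1 + ‖x‖) ^ (-p) / ((1 + ‖x‖) ^ 2) ^ 2)) := by
      refine (norm_add_le _ _).trans ?_
      rw [norm_mul, norm_mul, norm_mul, Complex.norm_real, Complex.norm_real, Real.norm_eq_abs,
        Real.norm_eq_abs]
      gcongr
    have hF : ‖a * zsq x y * (⟪w, e⟫ : ℝ) + b * zin w x y * zin e x y‖ ≤
        |a| * (1 + ‖x‖) ^ 2 * 1 + |b| * (1 + ‖x‖) * (1 + ‖x‖) := by
      refine (norm_add_le _ _).trans ?_
      rw [norm_mul, norm_mul, norm_mul, norm_mul, Complex.norm_real, Complex.norm_real,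
        Complex.norm_real, Real.norm_eq_abs, Real.norm_eq_abs, Real.norm_eq_abs]
      have h3 := (norm_zin_le w x y hw).trans hs
      have h4 := (norm_zin_le e x y he).trans hs
      gcongr
    rw [gkC, norm_mul]
    refine (mul_le_mul hE hF (norm_nonneg _) (by positivity)).trans (le_of_eq ?_)
    rw [gkM]
    field_simp
  · have hpos := (one_add_zsq_re (x + ζ.re • h) (y := y + ζ.im • h) (le_of_lt hζ)).2
    have hsl : 1 + zsq (x + ζ.re • h) (y + ζ.im • h) ∈ Complex.slitPlane := Or.inl hpos
    simp only [gkC]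
    simp only [zsq_line, zin_line] at hsl ⊢
    have hd (N : ℝ) : DifferentiableAt ℂ (fun ζ : ℂ =>
        (1 + (zsq x y + 2 * ζ * zin h x y + ζ ^ 2 * (‖h‖ ^ 2 : ℝ))) ^ (N : ℂ)) ζ :=
      DifferentiableAt.cpow_const (by fun_prop) hsl
    have := hd (-((p + 2) / 2))
    have := hd (-((p + 2) / 2 + 1))
    apply DifferentiableAt.differentiableWithinAt
    fun_prop

lemma gkC_real (w e x : E) : gkC a b p w e x 0 =
    ((etaE (etaA E p) (etaB E p) p (‖x‖ ^ 2) *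
      (a * ‖x‖ ^ 2 * ⟪w, e⟫ + b * ⟪x, w⟫ * ⟪x, e⟫) : ℝ) : ℂ) := by
  have e1 : zsq x 0 = ((‖x‖ ^ 2 : ℝ) : ℂ) := by
    refine Complex.ext ?_ ?_
    · rw [Complex.ofReal_re]; simp [zsq]
    · rw [Complex.ofReal_im]; simp [zsq]
  have e2 (w : E) : zin w x 0 = ((⟪x, w⟫ : ℝ) : ℂ) := by apply Complex.ext <;> simp [zin]
  have e3 (N : ℝ) : (1 + ((‖x‖ ^ 2 : ℝ) : ℂ)) ^ (N : ℂ) = (((1 + ‖x‖ ^ 2) ^ N : ℝ) : ℂ) := by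
    rw [Complex.ofReal_cpow (by positivity)]; push_cast; rfl
  rw [gkC, e1, e2, e2, e3, e3, etaE]
  push_cast
  ring

lemma sum_gkC (hp : 0 < p) (w x : E) :
    ∑ i, (gkC a b p w (stdOrthonormalBasis ℝ E i) x 0).re • stdOrthonormalBasis ℝ E i =
      gk a b p x w := by
  conv_rhs => rw [← (stdOrthonormalBasis ℝ E).sum_repr' (gk a b p x w)]
  refine Finset.sum_congr rfl fun i _ => ?_
  rw [gkC_real, Complex.ofReal_re, gk_apply hp]
  simp only [real_inner_comm _ (stdOrthonormalBasis ℝ E i)]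
  simp only [inner_smul_left, inner_add_left, RCLike.conj_to_real]

end GkTube

section Mollify

variable {a b p : ℝ} {v : E → E} {U L : ℝ} {A : ℝ}

/-- Two derivatives in `L¹`, measured by differences. -/
def W2 (φ : E → F) (A : ℝ) : Prop :=
  TF φ A A ∧ ∀ h, TF (fun x => φ (x + h) - φ x) (A * ‖h‖) (A * ‖h‖)

variable (v L) in
/-- Differences of twice differentiable fields have controlled pairing with `v`. -/
def DB : Prop := ∀ (φ : E → E) (A : ℝ), W2 φ A →
  ∀ h : E, |pair v fun x => φ (x + h) - φ x| ≤ L * A * ‖h‖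

lemma W2.clm {G : Type*} [NormedAddCommGroup G] [NormedSpace ℝ G] {φ : E → F} (h : W2 φ A)
    (l : F →L[ℝ] G) : W2 (fun x => l (φ x)) (‖l‖ * A) := by
  refine ⟨h.1.clm l, fun y => ?_⟩
  have := (h.2 y).clm l
  simp only [map_sub, ← mul_assoc] at this
  exact this

lemma W2.mono {φ : E → F} (h : W2 φ A) {A' : ℝ} (hA : A ≤ A') : W2 φ A' :=
  ⟨h.1.mono hA hA, fun y => (h.2 y).mono (by gcongr) (by gcongr)⟩

lemma W2.translate {φ : E → F} (h : W2 φ A) (z : E) : W2 (fun x => φ (x + z)) A := by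
  refine ⟨h.1.translate z, fun y => ?_⟩
  have := (h.2 y).translate z
  simpa only [add_right_comm] using this

lemma W2.add {φ ψ : E → F} {A' : ℝ} (h : W2 φ A) (h' : W2 ψ A') :
    W2 (fun x => φ x + ψ x) (A + A') := by
  refine ⟨h.1.add h'.1, fun y => ?_⟩
  have := (h.2 y).add (h'.2 y)
  simpa only [add_mul, add_sub_add_comm] using this

lemma W2.sum {ι : Type*} (s : Finset ι) {φ : ι → E → F} (h : ∀ i, W2 (φ i) A) :
    W2 (fun x => ∑ i ∈ s, φ i x) (s.card * A) := by
  classical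
  induction s using Finset.induction_on with
  | empty =>
    have h0 : TF (fun _ : E => (0 : F)) 0 0 := ⟨by simp, by simp, by simp⟩
    simpa [W2] using h0
  | insert i s hi ih =>
    simp only [Finset.sum_insert hi, Finset.card_insert_of_notMem hi]
    refine ((h i).add ih).mono (le_of_eq ?_)
    push_cast; ring

lemma DB.pair_sub_le (hL : DB v L) {φ : E → E} (h : W2 φ A) (y : E) :
    |pair v fun x => φ x - φ (x - y)| ≤ L * A * ‖y‖ := by
  have h1 := hL φ A h (-y)
  rw [norm_neg] at h1
  have e : (fun x => φ x - φ (x - y)) = fun x => (-1 : ℝ) • (φ (x + -y) - φ x) := by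
    ext x; simp [sub_eq_add_neg, add_comm]
  rw [e, pair_smul, neg_one_mul, abs_neg]
  exact h1

lemma DB.T_le [Nontrivial E] (hL : DB v L) {k : E → E →L[ℝ] E} (hk : WK k)
    (hm : Integrable fun y => ‖k y‖ * ‖y‖) (hv : Continuous v) (hU : ∀ x, ‖v x‖ ≤ U)
    {φ : E → E} (h : W2 φ A) : |T k v φ| ≤ L * A * ∫ y, ‖k y‖ * ‖y‖ := by
  rw [T_eq_integral hk hv hU h.1, ← integral_const_mul, ← Real.norm_eq_abs]
  refine norm_integral_le_of_norm_le (hm.const_mul _) (Eventually.of_forall fun y => ?_)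
  simp only [map_sub]
  refine (hL.pair_sub_le (h.clm (k y)) y).trans (le_of_eq ?_)
  ring

lemma T_kernel_sub [Nontrivial E] {k k' : E → E →L[ℝ] E} (hk : WK k) (hk' : WK k')
    (hv : Continuous v) (hU : ∀ x, ‖v x‖ ≤ U) {φ : E → E} {A B : ℝ} (h : TF φ A B) :
    T (fun y => k y - k' y) v φ = T k v φ - T k' v φ := by
  rw [T, T, T, ← pair_sub hv hU (op_integrable hk h) (op_integrable hk' h), pair, pair]
  refine integral_congr_ae ?_
  filter_upwards [op_ae_integrable hk h, op_ae_integrable hk' h] with x h1 h2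
  simp only [op]
  rw [← integral_sub h1 h2]
  rfl

/-- The singular part removed from the kernel. -/
def lk (a b p : ℝ) (y : E) : E →L[ℝ] E := ker a b p y - gk a b p y

lemma lk_moment [Nontrivial E] (hp : (finrank ℝ E : ℝ) < p) (hp' : p < finrank ℝ E + 1) :
    Integrable fun y : E => ‖lk a b p y‖ * ‖y‖ := by
  have hp0 : 0 ≤ p := (Nat.cast_nonneg _).trans hp.le
  set c := |etaA E p| * ((p + 2) / 2) + |etaB E p| * ((p + 2) / 2 + 1) with hc
  have hm : AEStronglyMeasurable (lk a b p : E → E →L[ℝ] E) volume :=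
    (ker_measurable.sub gk_measurable).aestronglyMeasurable
  refine ((integrable_weight hp hp').const_mul ((|a| + |b|) * c)).mono'
    (hm.norm.mul (by fun_prop)) (Eventually.of_forall fun y => ?_)
  rw [Real.norm_of_nonneg (by positivity)]
  have e : lk a b p y = (1 - eta p y) • ker a b p y := by rw [lk, gk, sub_smul, one_smul]
  have h0 : (0 : ℝ) < 1 + ‖y‖ ^ 2 := by positivity
  have h1 (q : ℝ) (hq : 1 ≤ q) : |1 - cut q y| ≤ q / (1 + ‖y‖ ^ 2) := by
    rw [abs_of_nonneg (by linarith [cut_lt_one (by linarith : 0 < q) y])]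
    exact one_sub_cut_le hq y
  have hD : (1 : ℝ) ≤ finrank ℝ E := by exact_mod_cast (finrank_pos (R := ℝ) (M := E))
  have h2 : |1 - eta p y| ≤ c / (1 + ‖y‖ ^ 2) := by
    have e2 : 1 - eta p y = etaA E p * (1 - cut ((p + 2) / 2) y) +
        etaB E p * (1 - cut ((p + 2) / 2 + 1) y) := by
      rw [eta]; linear_combination -etaA_add_etaB (E := E) hp
    have e3 : c / (1 + ‖y‖ ^ 2) = |etaA E p| * ((p + 2) / 2 / (1 + ‖y‖ ^ 2)) +
        |etaB E p| * (((p + 2) / 2 + 1) / (1 + ‖y‖ ^ 2)) := by rw [hc]; ring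
    rw [e2, e3]
    refine (abs_add_le _ _).trans (add_le_add ?_ ?_) <;> rw [abs_mul] <;> gcongr
    · exact h1 _ (by linarith)
    · exact h1 _ (by linarith)
  have h3 : ‖y‖ / (1 + ‖y‖ ^ 2) ≤ min 1 ‖y‖ := by
    refine le_min ?_ ?_ <;> rw [div_le_iff₀ h0]
    · nlinarith [sq_nonneg (‖y‖ - 1)]
    · nlinarith [norm_nonneg y, sq_nonneg ‖y‖, mul_nonneg (norm_nonneg y) (sq_nonneg ‖y‖)]
  have hc0 : 0 ≤ c := by positivity
  rw [e, norm_smul, Real.norm_eq_abs]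
  calc |1 - eta p y| * ‖ker a b p y‖ * ‖y‖
      ≤ c / (1 + ‖y‖ ^ 2) * ((|a| + |b|) * ‖y‖ ^ (-p)) * ‖y‖ := by
        gcongr; exact ker_norm_le y
    _ = (|a| + |b|) * c * (‖y‖ ^ (-p) * (‖y‖ / (1 + ‖y‖ ^ 2))) := by ring
    _ ≤ _ := by gcongr

lemma lk_wk [Nontrivial E] (hp : (finrank ℝ E : ℝ) < p) (hp' : p < finrank ℝ E + 1) :
    WK (lk a b p : E → E →L[ℝ] E) := by
  have hm : AEStronglyMeasurable (lk a b p : E → E →L[ℝ] E) volume :=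
    (ker_measurable.sub gk_measurable).aestronglyMeasurable
  refine ⟨hm, (lk_moment (a := a) (b := b) hp hp').mono' (hm.norm.mul (by fun_prop))
    (Eventually.of_forall fun y => ?_)⟩
  rw [Real.norm_of_nonneg (by positivity)]
  gcongr
  exact min_le_right _ _

/-- Splitting of the weak operator into the regularised operator and a small remainder. -/
lemma T_ker_split [Nontrivial E] (hp : (finrank ℝ E : ℝ) < p) (hp' : p < finrank ℝ E + 1)
    (hv : Continuous v) (hU : ∀ x, ‖v x‖ ≤ U) {φ : E → E} {A B : ℝ} (h : TF φ A B) :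
    T (ker a b p) v φ = (∫ x, ⟪op (gk a b p) v x, φ x⟫) + T (lk a b p) v φ := by
  have h1 := T_kernel_sub (ker_wk (a := a) (b := b) hp hp')
    (WK.of_integrable (gk_integrable (a := a) (b := b) hp)) hv hU h
  have h2 : T (lk a b p) v φ = T (ker a b p) v φ - T (gk a b p) v φ := h1
  rw [op_symm (gk_integrable hp) gk_neg gk_symm hv hU h.int, h2]
  ring

variable (E a b p) in
/-- Bound for the `L¹` norms of two derivatives of the regularised kernel. -/
def gkA : ℝ := finrank ℝ E * tubeC E p (gkM E a b p) (1 / 2)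

lemma tubeC_nonneg {q C r : ℝ} (hC : 0 ≤ C) (hr : 0 ≤ r) : 0 ≤ tubeC E q C r := by
  have : 0 ≤ massI E q := massI_nonneg
  rw [tubeC]; positivity

lemma gkA_nonneg : 0 ≤ gkA E a b p :=
  mul_nonneg (Nat.cast_nonneg _) (tubeC_nonneg gkM_nonneg (by norm_num))

lemma gk_W2 (hp : (finrank ℝ E : ℝ) < p) {w : E} (hw : ‖w‖ ≤ 1) :
    W2 (fun x => gk a b p x w) (gkA E a b p) := by
  have hp0 : 0 < p := lt_of_le_of_lt (Nat.cast_nonneg _) hp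
  simp only [← sum_gkC hp0 w]
  have h := W2.sum (F := E) Finset.univ (A := tubeC E p (gkM E a b p) (1 / 2))
    (φ := fun i x => (gkC a b p w (stdOrthonormalBasis ℝ E i) x 0).re • stdOrthonormalBasis ℝ E i)
    fun i => ?_
  · simpa [gkA] using h
  · have h1 : ‖stdOrthonormalBasis ℝ E i‖ = 1 := (stdOrthonormalBasis ℝ E).orthonormal.1 i
    have h2 : W2 (fun x => gkC a b p w (stdOrthonormalBasis ℝ E i) x 0)
        (tubeC E p (gkM E a b p) (1 / 2)) :=
      (gkC_tube hp0 hw h1.le).tf hp (by norm_num) (by norm_num) (by norm_num)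
    have h3 := h2.clm (Complex.reCLM.smulRight (stdOrthonormalBasis ℝ E i))
    rw [ContinuousLinearMap.norm_smulRight_apply, h1, Complex.reCLM_norm, one_mul, one_mul] at h3
    exact h3

/-- A compactly supported mollifier with two derivatives in `L¹`. -/
structure Moll (ϱ : E → ℝ) (A : ℝ) : Prop where
  cont : Continuous ϱ
  supp : HasCompactSupport ϱ
  mass : ∫ x, ϱ x = 1
  w2 : W2 ϱ A

lemma Moll.moment {ϱ : E → ℝ} (h : Moll ϱ A) : Integrable fun y => ‖y‖ * ‖ϱ y‖ := by
  refine Continuous.integrable_of_hasCompactSupport ?_ ?_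
  · have := h.cont; fun_prop
  · exact h.supp.norm.mul_left

lemma Moll.smul_w2 {ϱ : E → ℝ} (h : Moll ϱ A) {w : E} (hw : ‖w‖ ≤ 1) (x : E) :
    W2 (fun z => ϱ (z - x) • w) A := by
  have h1 := (h.w2.translate (-x)).clm (ContinuousLinearMap.toSpanSingleton ℝ w)
  simp only [← sub_eq_add_neg] at h1
  refine h1.mono ?_
  rw [ContinuousLinearMap.norm_toSpanSingleton]
  exact mul_le_of_le_one_left h.w2.1.nonneg_left hw

lemma pair_gk_eq [Nontrivial E] (hp : (finrank ℝ E : ℝ) < p) (hp' : p < finrank ℝ E + 1)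
    (hv : Continuous v) (hU : ∀ x, ‖v x‖ ≤ U) {ϱ : E → ℝ} (hϱ : Moll ϱ A) {w : E}
    (hw : ‖w‖ ≤ 1) (x : E) :
    pair v (fun z => gk a b p (z - x) w) = T (sid ϱ) v (fun z => gk a b p (z - x) w) -
      T (ker a b p) v (fun z => ϱ (z - x) • w) + T (lk a b p) v (fun z => ϱ (z - x) • w) := by
  set φ : E → E := fun z => gk a b p (z - x) w with hφ
  have hφ2 : W2 φ (gkA E a b p) := by
    have := (gk_W2 (a := a) (b := b) hp hw).translate (-x)
    simpa only [← sub_eq_add_neg] using this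
  have hϱw := hϱ.smul_w2 hw x
  have hϱi : Integrable ϱ := hϱ.w2.1.int
  have hsi : Integrable (sid ϱ) := hϱi.smul_const _
  have h1 : T (sid ϱ) v φ = pair v φ - pair v (conv (sid ϱ) φ) := by
    rw [← pair_sub hv hU hφ2.1.int (conv_integrable hsi hφ2.1.int), T, pair, pair]
    refine integral_congr_ae ?_
    filter_upwards [op_eq_sub_conv_ae hsi hφ2.1.int] with z hz
    rw [hz]
    simp only [sid]
    rw [integral_smul_const, hϱ.mass, one_smul]; rfl
  have h2 : conv (sid ϱ) φ = conv (gk a b p) fun z => ϱ (z - x) • w := by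
    ext z
    simp only [conv, hφ, map_smul]
    rw [← integral_sub_left_eq_self _ volume (z - x)]
    refine integral_congr_ae (Eventually.of_forall fun y => ?_)
    simp only [sid, _root_.smul_apply, ContinuousLinearMap.id_apply]
    congr 2
    · abel
    · congr 1; abel
  have h3 : T (gk a b p) v (fun z => ϱ (z - x) • w) =
      -pair v (conv (gk a b p) fun z => ϱ (z - x) • w) := by
    rw [← neg_one_mul, ← pair_smul, T, pair, pair]
    refine integral_congr_ae ?_
    filter_upwards [op_eq_sub_conv_ae (gk_integrable hp) hϱw.1.int] with z hz
    rw [hz, gk_integral hp]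
    simp
  have h4 := T_ker_split (a := a) (b := b) hp hp' hv hU hϱw.1
  rw [op_symm (gk_integrable hp) gk_neg gk_symm hv hU hϱw.1.int] at h4
  rw [h2] at h1
  linarith

lemma inner_op_gk [Nontrivial E] (hp : (finrank ℝ E : ℝ) < p) (hv : Continuous v)
    (hU : ∀ x, ‖v x‖ ≤ U) (w x : E) :
    ⟪op (gk a b p) v x, w⟫ = pair v fun z => gk a b p (z - x) (-w) := by
  rw [op_eq_sub_conv_of_bdd (gk_integrable hp) hv hU, gk_integral hp, conv,
    ← integral_sub_left_eq_self _ volume x, real_inner_comm]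
  simp only [sub_sub_cancel, _root_.zero_apply, zero_sub, inner_neg_right]
  have hi : Integrable fun z => gk a b p (x - z) (v z) := by
    have := (bdd_integrable (gk_integrable (a := a) (b := b) hp) hv hU x).comp_sub_left x
    simpa using this
  rw [← integral_inner hi, ← integral_neg, pair]
  congr 1; ext z
  rw [map_neg, inner_neg_right, ← gk_neg, neg_sub, ← gk_symm, real_inner_comm, real_inner_comm]

end Mollify

section Regular

variable {a b p : ℝ}

lemma exists_moll [Nontrivial E] : ∃ (ϱ : E → ℝ) (A : ℝ), Moll ϱ A := by
  obtain ⟨e, he⟩ := exists_norm_eq E zero_le_one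
  obtain ⟨η, hc, hs, hsm, hintg⟩ : ∃ η : E → ℝ, Continuous η ∧ HasCompactSupport η ∧
      ContDiff ℝ (⊤ : ℕ∞) η ∧ ∫ x, η x = 1 := by
    let β : ContDiffBump (0 : E) := ⟨1, 2, one_pos, one_lt_two⟩
    exact ⟨β.normed volume, β.continuous_normed, β.hasCompactSupport_normed, β.contDiff_normed,
      β.integral_normed⟩
  have hi : Integrable η := hc.integrable_of_hasCompactSupport hs
  have htf : ∃ B, TF η B B := by
    have h1 : HasCompactSupport (fun x => (η x : ℂ)) := hs.comp_left (g := ((↑) : ℝ → ℂ)) Complex.ofReal_zero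
    have h2 : ContDiff ℝ (⊤ : ℕ∞) (fun x => (η x : ℂ)) :=
      Complex.ofRealCLM.contDiff.comp hsm
    obtain ⟨C, hC⟩ := RD.of_schwartz (h1.toSchwartzMap h2) (finrank ℝ E + 1)
    have h3 := hC.tf (by push_cast; linarith)
    exact ⟨_, h3.mono (le_max_left _ _) (le_max_right _ _)⟩
  obtain ⟨B, hB⟩ := htf
  set k : E → E →L[ℝ] ℝ := fun y => η y • innerSL ℝ e with hk
  set φ : E → E := fun y => η y • e with hφ
  have hn : ‖innerSL ℝ e‖ = 1 := by rw [innerSL_apply_norm, he]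
  have hkB : TF k B B := by
    have := hB.clm (ContinuousLinearMap.toSpanSingleton ℝ (innerSL ℝ e))
    rwa [ContinuousLinearMap.norm_toSpanSingleton, hn, one_mul] at this
  have hφB : TF φ B B := by
    have := hB.clm (ContinuousLinearMap.toSpanSingleton ℝ e)
    rwa [ContinuousLinearMap.norm_toSpanSingleton, he, one_mul] at this
  have hB0 := hB.nonneg_left
  have hconv : conv k φ = convolution η η (ContinuousLinearMap.mul ℝ ℝ) volume := by
    ext x
    simp only [conv, convolution, hk, hφ, _root_.smul_apply, map_smul, smul_eq_mul,
      innerSL_apply_apply, real_inner_self_eq_norm_sq, he, ContinuousLinearMap.mul_apply']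
    congr 1; ext y; ring
  refine ⟨conv k φ, B * B, ?_, ?_, ?_, ?_, fun h => ?_⟩
  · rw [hconv]
    exact hs.continuous_convolution_right _ hi.locallyIntegrable hc
  · rw [hconv]; exact hs.convolution _ hs
  · rw [hconv, integral_convolution _ hi hi, hintg]; simp
  · refine (conv_tf_kernel hkB hφB.int).mono ?_ ?_ <;> gcongr <;> exact hφB.l1
  · have h1 := conv_diff_tf hkB hφB h
    refine (h1.congr_ae ?_).mono (by nlinarith [norm_nonneg h]) (by nlinarith [norm_nonneg h])
    filter_upwards [conv_sub_ae hkB.int (hφB.int.comp_add_right h) hφB.int] with x hx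
    rw [hx, conv_comp_add]

lemma AF.mono {e : E} {r C C' : ℝ} {g : ℕ → E → ℝ} (hg : AF e r C g) (hr : 0 ≤ r) (h : C ≤ C') :
    AF e r C' g :=
  ⟨fun k x => (hg.bound k x).trans (by gcongr), fun k x y => (hg.lip k x y).trans (by gcongr),
    hg.deriv⟩

/-- Weak bounds of order zero give uniform bounds for the regularised operator, together with
analyticity on lines. -/
lemma exists_regular [Nontrivial E] (hp : (finrank ℝ E : ℝ) < p) (hp' : p < finrank ℝ E + 1)
    (h1 : a + b / p ≠ 0) (h2 : a + b * (1 + (p - finrank ℝ E)) / p ≠ 0) :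
    ∃ C, 0 ≤ C ∧ ∀ (v : E → E) (U S : ℝ), Continuous v → (∀ x, ‖v x‖ ≤ U) → 0 ≤ S →
      (∀ φ A B, TF φ A B → |T (ker a b p) v φ| ≤ S * (A + B)) →
      DB v (C * S) ∧ (∀ x w : E, ‖w‖ ≤ 1 → |⟪op (gk a b p) v x, w⟫| ≤ C * S) ∧
      ∀ w e : E, ‖w‖ ≤ 1 → ‖e‖ ≤ 1 →
        ∃ g, AF e (1 / 16) (C * S) g ∧ ∀ x, g 0 x = ⟪op (gk a b p) v x, w⟫ := by
  obtain ⟨ϱ, A, hϱ⟩ := exists_moll (E := E)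
  obtain ⟨ψ, H, C, hP⟩ := exists_para (E := E) hp hp' h1 h2
  set I1 := ∫ y, ‖sid ϱ y‖ * ‖y‖ with hI1
  set I2 := ∫ y, ‖(lk a b p y : E →L[ℝ] E)‖ * ‖y‖ with hI2
  have hI1' : 0 ≤ I1 := integral_nonneg fun _ => by positivity
  have hI2' : 0 ≤ I2 := integral_nonneg fun _ => by positivity
  have hc0 : 0 ≤ hP.cD := hP.cD_nonneg hp hp'
  have hA0 := hϱ.w2.1.nonneg_left
  have hgA : 0 ≤ gkA E a b p := gkA_nonneg
  have htu : 0 ≤ tubeC E p (gkM E a b p) (1 / 2) := tubeC_nonneg gkM_nonneg (by norm_num)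
  set C1 := hP.cD * gkA E a b p * I1 + 2 * A + hP.cD * A * I2 with hC1
  have hC1' : 0 ≤ C1 := by positivity
  set C2 := C1 + finrank ℝ E * (2 * (hP.cD * tubeC E p (gkM E a b p) (1 / 2))) with hC2
  have hC2' : C1 ≤ C2 := le_add_of_nonneg_right (by positivity)
  refine ⟨C2 + hP.cD, by positivity, fun v U S hv hU hS hT => ?_⟩
  have hD : DB v (hP.cD * S) := fun φ A hφ h => hP.pair_diff hp hp' hv hU hT hφ.1 (hφ.2 h)
  have hB (x w : E) (hw : ‖w‖ ≤ 1) : |pair v fun z => gk a b p (z - x) w| ≤ C1 * S := by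
    rw [pair_gk_eq hp hp' hv hU hϱ hw x]
    have hsm : Integrable fun y => ‖sid ϱ y‖ * ‖y‖ := by
      refine hϱ.moment.congr (Eventually.of_forall fun y => ?_)
      simp only [sid_norm, Real.norm_eq_abs, mul_comm]
    have hsi : Integrable (sid ϱ) := hϱ.w2.1.int.smul_const _
    have hg : W2 (fun z => gk a b p (z - x) w) (gkA E a b p) := by
      have := (gk_W2 (a := a) (b := b) hp hw).translate (-x)
      simpa only [← sub_eq_add_neg] using this
    have hw2 := hϱ.smul_w2 hw x
    have t1 := hD.T_le (WK.of_integrable hsi) hsm hv hU hg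
    have t2 := hT _ _ _ hw2.1
    have t3 := hD.T_le (lk_wk (a := a) (b := b) hp hp') (lk_moment hp hp') hv hU hw2
    refine (abs_add_le _ _).trans ((add_le_add ((abs_sub _ _).trans (add_le_add t1 t2)) t3).trans
      (le_of_eq ?_))
    rw [hC1]; ring
  have hF (x w : E) (hw : ‖w‖ ≤ 1) : |⟪op (gk a b p) v x, w⟫| ≤ C1 * S := by
    rw [inner_op_gk hp hv hU]
    exact hB x _ (by rwa [norm_neg])
  refine ⟨fun φ A hφ h => (hD φ A hφ h).trans ?_, fun x w hw => (hF x w hw).trans ?_,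
    fun w e hw he => ?_⟩
  · have := hφ.1.nonneg_left
    gcongr; linarith
  · gcongr; linarith
  · have hp0 : 0 < p := lt_of_le_of_lt (Nat.cast_nonneg _) hp
    have hbb (i) : ‖stdOrthonormalBasis ℝ E i‖ ≤ 1 :=
      ((stdOrthonormalBasis ℝ E).orthonormal.1 i).le
    obtain ⟨g, hg, hg0⟩ := Tube.exists_af (h := -e) (L := hP.cD * S) (B := C1 * S)
      (fun i => gkC_tube (a := a) (b := b) hp0 (w := -w) (by rwa [norm_neg]) (hbb i))
      hp (by norm_num) (by norm_num) hv hU (by rwa [norm_neg]) hbb (by positivity) gkM_nonneg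
      (fun φ A h h' => hD φ A ⟨h, h'⟩)
      (fun i x => by rw [gkC_real, Complex.ofReal_im])
      (fun x => by
        simp only [sum_gkC hp0]
        exact hB x _ (by rwa [norm_neg]))
    refine ⟨g, ?_, fun x => ?_⟩
    · rw [neg_neg] at hg
      have e1 : (1 / 2 : ℝ) / 8 = 1 / 16 := by norm_num
      rw [e1] at hg
      refine hg.mono (by norm_num) ?_
      rw [tubeAC, Fintype.card_fin]
      nlinarith [mul_nonneg hc0 hS]
    · rw [hg0, inner_op_gk hp hv hU]
      simp only [sum_gkC hp0]

end Regular

section Multiplier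

/-- Bounded Lipschitz functions. -/
def BLip (g : E → ℝ) : Prop :=
  ∃ σ K, (∀ x, |g x| ≤ σ) ∧ ∀ x y, |g x - g y| ≤ K * ‖x - y‖

lemma continuous_of_lip {g : E → ℝ} {K : ℝ} (h : ∀ x y, |g x - g y| ≤ K * ‖x - y‖) :
    Continuous g := by
  refine (LipschitzWith.of_dist_le_mul (K := K.toNNReal) fun x y => ?_).continuous
  rw [Real.dist_eq, dist_eq_norm]
  exact (h x y).trans (by gcongr; exact le_max_left _ _)

lemma BLip.continuous {g : E → ℝ} (h : BLip g) : Continuous g := by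
  obtain ⟨σ, K, -, h⟩ := h
  exact continuous_of_lip h

lemma BLip.const (c : ℝ) : BLip fun _ : E => c := ⟨|c|, 0, by simp, by simp⟩

lemma BLip.add {f g : E → ℝ} (hf : BLip f) (hg : BLip g) : BLip fun x => f x + g x := by
  obtain ⟨σ, K, h1, h2⟩ := hf
  obtain ⟨σ', K', h1', h2'⟩ := hg
  refine ⟨σ + σ', K + K', fun x => (abs_add_le _ _).trans (add_le_add (h1 x) (h1' x)),
    fun x y => ?_⟩
  rw [add_sub_add_comm, add_mul]
  exact (abs_add_le _ _).trans (add_le_add (h2 x y) (h2' x y))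

lemma BLip.mul {f g : E → ℝ} (hf : BLip f) (hg : BLip g) : BLip fun x => f x * g x := by
  obtain ⟨σ, K, h1, h2⟩ := hf
  obtain ⟨σ', K', h1', h2'⟩ := hg
  have hσ : 0 ≤ σ := (abs_nonneg _).trans (h1 0)
  refine ⟨σ * σ', σ * K' + K * σ', fun x => ?_, fun x y => ?_⟩
  · rw [abs_mul]; exact mul_le_mul (h1 x) (h1' x) (abs_nonneg _) hσ
  · have e : f x * g x - f y * g y = f x * (g x - g y) + (f x - f y) * g y := by ring
    have hK := (abs_nonneg _).trans (h2 x y)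
    rw [e, add_mul]
    refine (abs_add_le _ _).trans (add_le_add ?_ ?_) <;> rw [abs_mul]
    · rw [mul_assoc]; exact mul_le_mul (h1 x) (h2' x y) (abs_nonneg _) hσ
    · rw [mul_right_comm]; exact mul_le_mul (h2 x y) (h1' y) (abs_nonneg _) hK

lemma BLip.neg {f : E → ℝ} (hf : BLip f) : BLip fun x => -f x := by
  simpa using (BLip.const (-1)).mul hf

lemma BLip.sub {f g : E → ℝ} (hf : BLip f) (hg : BLip g) : BLip fun x => f x - g x := by
  simpa only [sub_eq_add_neg] using hf.add hg.neg

lemma BLip.abs {f : E → ℝ} (hf : BLip f) : BLip fun x => |f x| := by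
  obtain ⟨σ, K, h1, h2⟩ := hf
  exact ⟨σ, K, fun x => by simpa using h1 x,
    fun x y => (abs_abs_sub_abs_le_abs_sub _ _).trans (h2 x y)⟩

lemma BLip.max {f g : E → ℝ} (hf : BLip f) (hg : BLip g) : BLip fun x => max (f x) (g x) := by
  have h : (fun x => Max.max (f x) (g x)) = fun x => 1 / 2 * (f x + g x + |f x - g x|) := by
    ext x
    rcases le_total (f x) (g x) with h | h
    · rw [max_eq_right h, abs_of_nonpos (by linarith)]; ring
    · rw [max_eq_left h, abs_of_nonneg (by linarith)]; ring
  rw [h]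
  exact (BLip.const _).mul ((hf.add hg).add (hf.sub hg).abs)

lemma BLip.min {f g : E → ℝ} (hf : BLip f) (hg : BLip g) : BLip fun x => min (f x) (g x) := by
  have h := (hf.neg.max hg.neg).neg
  simpa only [max_neg_neg, neg_neg] using h

lemma BLip.inv {f : E → ℝ} (hf : BLip f) {c : ℝ} (hc : 0 < c) (h : ∀ x, c ≤ f x) :
    BLip fun x => (f x)⁻¹ := by
  obtain ⟨σ, K, h1, h2⟩ := hf
  refine ⟨c⁻¹, c⁻¹ * c⁻¹ * K, fun x => ?_, fun x y => ?_⟩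
  · rw [abs_of_nonneg (inv_nonneg.2 (hc.le.trans (h x)))]
    exact inv_anti₀ hc (h x)
  · have hx := hc.trans_le (h x)
    have hy := hc.trans_le (h y)
    have e : (f x)⁻¹ - (f y)⁻¹ = (f x)⁻¹ * (f y)⁻¹ * (f y - f x) := by field_simp
    rw [e, abs_mul, abs_of_nonneg (by positivity), mul_assoc (c⁻¹ * c⁻¹), abs_sub_comm]
    refine mul_le_mul ?_ (h2 x y) (abs_nonneg _) (by positivity)
    exact mul_le_mul (inv_anti₀ hc (h x)) (inv_anti₀ hc (h y)) (by positivity) (by positivity)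

lemma TF.mul {g : E → ℝ} {σ K : ℝ} (h1 : ∀ x, |g x| ≤ σ)
    (h2 : ∀ x y, |g x - g y| ≤ K * ‖x - y‖) {φ : E → F} {A B : ℝ} (hφ : TF φ A B) :
    TF (fun x => g x • φ x) (σ * A) (K * A + σ * B) := by
  have hσ : 0 ≤ σ := (abs_nonneg _).trans (h1 0)
  have hc := continuous_of_lip h2
  have hi : Integrable fun x => g x • φ x :=
    hφ.int.bdd_smul σ hc.aestronglyMeasurable (Eventually.of_forall h1)
  refine ⟨hi, ?_, fun h => ?_⟩
  · calc ∫ x, ‖g x • φ x‖ ≤ ∫ x, σ * ‖φ x‖ := by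
          refine integral_mono hi.norm (hφ.int.norm.const_mul _) fun x => ?_
          simp only [norm_smul, Real.norm_eq_abs]
          gcongr
          exact h1 x
      _ ≤ _ := by rw [integral_const_mul]; gcongr; exact hφ.l1
  · have hd : Integrable fun x => φ (x + h) - φ x := (hφ.int.comp_add_right h).sub hφ.int
    have hK := (abs_nonneg _).trans (h2 h 0)
    rw [sub_zero] at hK
    calc ∫ x, ‖g (x + h) • φ (x + h) - g x • φ x‖
        ≤ ∫ x, (K * ‖h‖ * ‖φ x‖ + σ * ‖φ (x + h) - φ x‖) := by
          refine integral_mono ((hi.comp_add_right h).sub hi).norm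
            ((hφ.int.norm.const_mul _).add (hd.norm.const_mul _)) fun x => ?_
          have e : g (x + h) • φ (x + h) - g x • φ x =
              (g (x + h) - g x) • φ x + g (x + h) • (φ (x + h) - φ x) := by module
          simp only [e]
          refine (norm_add_le _ _).trans (add_le_add ?_ ?_) <;> rw [norm_smul, Real.norm_eq_abs]
          · gcongr
            simpa using h2 (x + h) x
          · gcongr
            exact h1 _
      _ = K * ‖h‖ * (∫ x, ‖φ x‖) + σ * ∫ x, ‖φ (x + h) - φ x‖ := by
          rw [integral_add (hφ.int.norm.const_mul _) (hd.norm.const_mul _), integral_const_mul,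
            integral_const_mul]
      _ ≤ K * ‖h‖ * A + σ * (B * ‖h‖) := by gcongr <;> [exact hφ.l1; exact hφ.lip h]
      _ = _ := by ring

/-- Compactly supported fields with one derivative of finite mass. -/
def Test (φ : E → F) : Prop := (∃ A B, TF φ A B) ∧ HasCompactSupport φ

lemma Test.mul {φ : E → F} (hφ : Test φ) {g : E → ℝ} (hg : BLip g) : Test fun x => g x • φ x := by
  obtain ⟨⟨A, B, h⟩, hs⟩ := hφ
  obtain ⟨σ, K, h1, h2⟩ := hg
  exact ⟨⟨_, _, h.mul h1 h2⟩, hs.smul_left⟩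

lemma Test.add {φ ψ : E → F} (hφ : Test φ) (hψ : Test ψ) : Test fun x => φ x + ψ x := by
  obtain ⟨⟨A, B, h⟩, hs⟩ := hφ
  obtain ⟨⟨A', B', h'⟩, hs'⟩ := hψ
  exact ⟨⟨_, _, h.add h'⟩, hs.add hs'⟩

/-- Truncation of a real number at height `σ`. -/
def clip (σ s : ℝ) : ℝ := max (-σ) (min s σ)

lemma abs_clip_le {σ : ℝ} (hσ : 0 ≤ σ) (s : ℝ) : |clip σ s| ≤ σ :=
  abs_le.2 ⟨le_max_left _ _, max_le (by linarith) (min_le_right _ _)⟩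

lemma clip_lip (σ s t : ℝ) : |clip σ s - clip σ t| ≤ |s - t| := by
  rw [clip, clip, max_comm, max_comm (-σ)]
  refine (abs_max_sub_max_le_abs _ _ _).trans ?_
  refine (abs_min_sub_min_le_max s σ t σ).trans ?_
  simp

lemma clip_of_le {σ s : ℝ} (h : |s| ≤ σ) : clip σ s = s := by
  rw [abs_le] at h
  rw [clip, min_eq_left h.2, max_eq_right h.1]

lemma sub_clip_eq {σ : ℝ} (hσ : 0 < σ) (s : ℝ) :
    s - clip σ s = s ^ 2 * ((s - clip σ s) * ((max |s| σ)⁻¹) ^ 2) := by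
  rcases le_total |s| σ with h | h
  · rw [clip_of_le h]; simp
  · have : s ≠ 0 := by
      rintro rfl; simp at h; linarith
    rw [max_eq_left h, inv_pow, sq_abs]
    field_simp

lemma BLip.clip {g : E → ℝ} (hg : BLip g) (σ : ℝ) : BLip fun x => clip σ (g x) :=
  (BLip.const _).max (hg.min (BLip.const _))

lemma BLip.inv_max {g : E → ℝ} (hg : BLip g) {σ : ℝ} (hσ : 0 < σ) :
    BLip fun x => (Max.max |g x| σ)⁻¹ :=
  (hg.abs.max (BLip.const σ)).inv hσ fun _ => le_max_right _ _

end Multiplier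

section Vanishing

variable {τ : ℕ → (E → E) → ℝ} {c κ : ℝ} {U : Filter ℕ}

/-- A family of additive functionals, uniformly bounded by an interpolation inequality. -/
structure Fam (τ : ℕ → (E → E) → ℝ) (c κ : ℝ) : Prop where
  add : ∀ n φ ψ, Test φ → Test ψ → τ n (fun x => φ x + ψ x) = τ n φ + τ n ψ
  bound : ∀ n φ A B, TF φ A B → |τ n φ| ≤ A + c * (A ^ (1 - κ) * B ^ κ)
  pos : 0 < κ
  lt_one : κ < 1

lemma Fam.exists_small (hτ : Fam τ c κ) (B : ℝ) {δ : ℝ} (hδ : 0 < δ) :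
    ∃ η > 0, ∀ A ≤ η, ∀ n φ, TF φ A B → |τ n φ| ≤ δ := by
  have h1 : Tendsto (fun A : ℝ => A + c * (A ^ (1 - κ) * B ^ κ)) (𝓝 0)
      (𝓝 (0 + c * ((0 : ℝ) ^ (1 - κ) * B ^ κ))) := by
    refine tendsto_id.add (Tendsto.const_mul _ (Tendsto.mul_const _ ?_))
    exact (Real.continuousAt_rpow_const _ _ (Or.inr (by linarith [hτ.lt_one]))).tendsto
  rw [Real.zero_rpow (by linarith [hτ.lt_one]), zero_mul, mul_zero, add_zero] at h1
  obtain ⟨η, hη, h2⟩ := Metric.eventually_nhds_iff.1 (h1.eventually (gt_mem_nhds hδ))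
  refine ⟨η / 2, by positivity, fun A hA n φ hφ => (hτ.bound n φ A B hφ).trans (h2 ?_).le⟩
  rw [Real.dist_eq, sub_zero, abs_of_nonneg hφ.nonneg_left]
  linarith

variable (U τ) in
/-- The multiplier `g` kills the limit of the family along `U`. -/
def Kills (g : E → ℝ) : Prop :=
  ∀ φ, Test φ → Tendsto (fun n => τ n fun x => g x • φ x) U (𝓝 0)

lemma Kills.mul {g q : E → ℝ} (h : Kills τ U g) (hq : BLip q) : Kills τ U fun x => g x * q x := by
  intro φ hφ
  simpa only [mul_smul] using h _ (hφ.mul hq)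

lemma Kills.add (hτ : Fam τ c κ) {g q : E → ℝ} (hg : BLip g) (hq : BLip q) (h : Kills τ U g)
    (h' : Kills τ U q) : Kills τ U fun x => g x + q x := by
  intro φ hφ
  have := (h φ hφ).add (h' φ hφ)
  rw [add_zero] at this
  refine this.congr fun n => ?_
  rw [← hτ.add n _ _ (hφ.mul hg) (hφ.mul hq)]
  simp only [add_smul]

lemma kills_of_approx (hτ : Fam τ c κ) {g : E → ℝ}
    (h : ∀ φ : E → E, Test φ → ∀ δ > 0, ∃ ψ₁ ψ₂ : E → E, Test ψ₁ ∧ Test ψ₂ ∧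
      (∀ x, g x • φ x = ψ₁ x + ψ₂ x) ∧ (∀ n, |τ n ψ₁| ≤ δ) ∧
      Tendsto (fun n => τ n ψ₂) U (𝓝 0)) : Kills τ U g := by
  intro φ hφ
  rw [Metric.tendsto_nhds]
  intro δ hδ
  obtain ⟨ψ₁, ψ₂, h1, h2, he, hs, ht⟩ := h φ hφ (δ / 2) (half_pos hδ)
  filter_upwards [(Metric.tendsto_nhds.1 ht) (δ / 2) (half_pos hδ)] with n hn
  rw [Real.dist_eq, sub_zero] at hn ⊢
  simp only [he]
  rw [hτ.add n _ _ h1 h2]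
  linarith [abs_add_le (τ n ψ₁) (τ n ψ₂), hs n]

lemma kills_of_sq (hτ : Fam τ c κ) {g : E → ℝ} (hg : BLip g)
    (h : Kills τ U fun x => g x ^ 2) : Kills τ U g := by
  refine kills_of_approx hτ fun φ hφ δ hδ => ?_
  obtain ⟨⟨A, B, hT⟩, -⟩ := id hφ
  obtain ⟨C, K, -, hK⟩ := id hg
  have hA := hT.nonneg_left
  obtain ⟨η, hη, hs⟩ := hτ.exists_small (K * A + 1 * max B 0) hδ
  set σ := min 1 (η / (A + 1)) with hσ
  have hσ0 : 0 < σ := lt_min one_pos (by positivity)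
  have hm := hT.mul (g := fun x => clip σ (g x)) (fun x => abs_clip_le hσ0.le _)
    (fun x y => (clip_lip _ _ _).trans (hK x y))
  refine ⟨fun x => clip σ (g x) • φ x, fun x => (g x ^ 2 *
    ((g x - clip σ (g x)) * ((max |g x| σ)⁻¹) ^ 2)) • φ x, hφ.mul (hg.clip σ), ?_, fun x => ?_,
    fun n => hs (σ * A) ?_ n _ (hm.mono le_rfl ?_), ?_⟩
  · simp only [← sub_clip_eq hσ0]
    exact hφ.mul (hg.sub (hg.clip σ))
  · simp only [← sub_clip_eq hσ0]
    rw [← add_smul, add_sub_cancel]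
  · calc σ * A ≤ η / (A + 1) * (A + 1) := by gcongr <;> [exact min_le_right _ _; linarith]
      _ = η := by field_simp
  · refine add_le_add_right ?_ _
    have := le_max_left B 0
    have h0 := le_max_right B 0
    calc σ * B ≤ σ * max B 0 := by gcongr
      _ ≤ _ := by gcongr; exact min_le_left _ _
  · refine (h.mul ?_) φ hφ
    simp only [pow_two]
    exact (hg.sub (hg.clip σ)).mul ((hg.inv_max hσ0).mul (hg.inv_max hσ0))

lemma abs_integral_mul_deriv_le {m f f' : E → ℝ} {A B σ K : ℝ} {e : E} (hm : TF m A B)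
    (h1 : ∀ x, |f x| ≤ σ) (h2 : ∀ x y, |f x - f y| ≤ K * ‖x - y‖)
    (h3 : ∀ x, HasDerivAt (fun t : ℝ => f (x + t • e)) (f' x) 0) :
    |∫ x, m x * f' x| ≤ σ * (B * ‖e‖) := by
  have hσ : 0 ≤ σ := (abs_nonneg _).trans (h1 0)
  have hc := continuous_of_lip h2
  set t : ℕ → ℝ := fun n => ((n : ℝ) + 1)⁻¹ with ht
  have ht0 (n : ℕ) : 0 < t n := by positivity
  have hK (s : ℝ) (hs : 0 ≤ s) : 0 ≤ K * (s * ‖e‖) := by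
    have := (abs_nonneg _).trans (h2 (s • e) 0)
    rwa [sub_zero, norm_smul, Real.norm_of_nonneg hs] at this
  have hlim : Tendsto (fun n => ∫ x, m x * ((t n)⁻¹ * (f (x + t n • e) - f x))) atTop
      (𝓝 (∫ x, m x * f' x)) := by
    refine tendsto_integral_of_dominated_convergence (fun x => K * ‖e‖ * ‖m x‖) (fun n => ?_)
      (hm.int.norm.const_mul _) (fun n => Eventually.of_forall fun x => ?_)
      (Eventually.of_forall fun x => ?_)
    · exact hm.int.1.mul (by fun_prop : Continuous _).aestronglyMeasurable
    · rw [norm_mul, mul_comm]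
      gcongr
      rw [norm_mul, norm_inv, Real.norm_of_nonneg (ht0 n).le, inv_mul_le_iff₀ (ht0 n)]
      refine (h2 _ _).trans (le_of_eq ?_)
      rw [add_sub_cancel_left, norm_smul, Real.norm_of_nonneg (ht0 n).le]
      ring
    · refine Tendsto.const_mul _ ?_
      have h4 := (h3 x).tendsto_slope
      have h5 : Tendsto t atTop (𝓝[≠] 0) := by
        refine tendsto_nhdsWithin_of_tendsto_nhds_of_eventually_within _ ?_
          (Eventually.of_forall fun n => (ht0 n).ne')
        exact (tendsto_natCast_atTop_atTop.atTop_add tendsto_const_nhds).inv_tendsto_atTop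
      refine (h4.comp h5).congr fun n => ?_
      simp [slope_def_field, div_eq_inv_mul]
  refine le_of_tendsto hlim.abs (Eventually.of_forall fun n => ?_)
  have hi : Integrable fun x => m x * f x :=
    hm.int.mul_bdd (c := σ) hc.aestronglyMeasurable (Eventually.of_forall h1)
  have hi2 : Integrable fun x => m x * f (x + t n • e) :=
    hm.int.mul_bdd (c := σ) (by fun_prop : Continuous fun x => f (x + t n • e)).aestronglyMeasurable
      (Eventually.of_forall fun x => h1 _)
  have hi3 : Integrable fun x => m (x - t n • e) * f x := by
    have := hi2.comp_sub_right (t n • e)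
    simpa using this
  have e1 : ∫ x, m x * ((t n)⁻¹ * (f (x + t n • e) - f x)) =
      (t n)⁻¹ * ∫ x, (m (x + -(t n • e)) - m x) * f x := by
    have e2 : ∫ x, m x * f (x + t n • e) = ∫ x, m (x - t n • e) * f x := by
      rw [← integral_sub_right_eq_self (fun x => m x * f (x + t n • e)) (t n • e)]
      simp
    simp only [sub_mul, ← sub_eq_add_neg]
    rw [integral_sub hi3 hi, ← e2, ← integral_sub hi2 hi, ← integral_const_mul]
    congr 1; ext x; ring
  rw [e1, abs_mul, abs_of_pos (inv_pos.2 (ht0 n)), inv_mul_le_iff₀ (ht0 n)]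
  have hl := hm.lip (-(t n • e))
  rw [norm_neg, norm_smul, Real.norm_of_nonneg (ht0 n).le] at hl
  calc |∫ x, (m (x + -(t n • e)) - m x) * f x|
      ≤ ∫ x, ‖m (x + -(t n • e)) - m x‖ * σ := by
        rw [← Real.norm_eq_abs]
        refine norm_integral_le_of_norm_le
          (((hm.int.comp_add_right _).sub hm.int).norm.mul_const σ)
          (Eventually.of_forall fun x => ?_)
        rw [norm_mul]
        gcongr
        exact h1 x
    _ = (∫ x, ‖m (x + -(t n • e)) - m x‖) * σ := integral_mul_const _ _
    _ ≤ B * (t n * ‖e‖) * σ := by gcongr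
    _ = _ := by ring

end Vanishing

section Directional

variable {τ : ℕ → (E → E) → ℝ} {c κ : ℝ} {U : Filter ℕ}

lemma abs_arctan_sub_le (s t : ℝ) : |arctan s - arctan t| ≤ |s - t| := by
  have h := Convex.norm_image_sub_le_of_norm_hasDerivWithin_le (f := arctan) (s := Set.univ)
    (C := 1) (fun x _ => (hasDerivAt_arctan x).hasDerivWithinAt) (fun x _ => ?_) convex_univ
    (mem_univ t) (mem_univ s)
  · simpa using h
  · rw [Real.norm_of_nonneg (by positivity), div_le_one (by positivity)]
    nlinarith [sq_nonneg x]

lemma abs_arctan_le_two (s : ℝ) : |arctan s| ≤ 2 := by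
  have := Real.pi_le_four
  exact abs_le.2 ⟨by linarith [neg_pi_div_two_lt_arctan s], by linarith [arctan_lt_pi_div_two s]⟩

/-- The Lorentz profile of width `σ`. -/
def lor (σ s : ℝ) : ℝ := σ ^ 2 / (σ ^ 2 + s ^ 2)

lemma lor_nonneg (σ s : ℝ) : 0 ≤ lor σ s := by rw [lor]; positivity

lemma lor_le_one (σ s : ℝ) : lor σ s ≤ 1 := div_le_one_of_le₀ (by nlinarith) (by positivity)

lemma one_sub_lor {σ : ℝ} (hσ : 0 < σ) (s : ℝ) : 1 - lor σ s = s * (s * (σ ^ 2 + s ^ 2)⁻¹) := by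
  have : σ ^ 2 + s ^ 2 ≠ 0 := by positivity
  rw [lor]; field_simp; ring

lemma abs_lor_sub_le {σ s t : ℝ} (hσ : 0 < σ) (h : |t - s| ≤ σ) :
    |lor σ t - lor σ s| ≤ 2 * |t - s| / σ * lor σ s := by
  have hs : 0 < σ ^ 2 + s ^ 2 := by positivity
  have ht : 0 < σ ^ 2 + t ^ 2 := by positivity
  have e : lor σ t - lor σ s = (s - t) * ((s + t) / (σ ^ 2 + t ^ 2)) * lor σ s := by
    rw [lor, lor]; field_simp; ring
  have h1 : |s + t| ≤ 2 * |t| + σ := by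
    have : s + t = 2 * t - (t - s) := by ring
    rw [this]
    refine (abs_sub _ _).trans ?_
    rw [abs_mul, abs_two]; linarith
  have h2 : |(s + t) / (σ ^ 2 + t ^ 2)| ≤ 2 / σ := by
    rw [abs_div, abs_of_pos ht, div_le_div_iff₀ ht hσ]
    nlinarith [sq_nonneg (|t| - σ), sq_abs t, mul_le_mul_of_nonneg_right h1 hσ.le]
  rw [e, abs_mul, abs_mul, abs_of_nonneg (lor_nonneg σ s), abs_sub_comm]
  calc |t - s| * |(s + t) / (σ ^ 2 + t ^ 2)| * lor σ s ≤ |t - s| * (2 / σ) * lor σ s := by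
        have := lor_nonneg σ s
        gcongr
    _ = _ := by ring

lemma BLip.lor {g : E → ℝ} (hg : BLip g) {σ : ℝ} (hσ : 0 < σ) : BLip fun x => lor σ (g x) := by
  simp only [LameFrac.lor, div_eq_mul_inv, pow_two]
  exact (BLip.const _).mul (((BLip.const _).add (hg.mul hg)).inv (c := σ * σ) (by positivity)
    fun x => by nlinarith [mul_self_nonneg (g x)])

lemma TF.norm {φ : E → F} {A B : ℝ} (h : TF φ A B) : TF (fun x => ‖φ x‖) A B := by
  refine ⟨h.int.norm, by simpa using h.l1, fun y => le_trans ?_ (h.lip y)⟩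
  refine integral_mono ((h.int.comp_add_right y).norm.sub h.int.norm).norm
    ((h.int.comp_add_right y).sub h.int).norm fun x => ?_
  exact abs_norm_sub_norm_le _ _

/-- The part of a squared derivative on the small values of the function is small in `L¹`,
with a uniform bound for the derivative. -/
lemma lor_deriv_tf [Nontrivial E] {g g' : E → ℝ} {σ K C₁ K₁ : ℝ} {e : E} (hσ : 0 < σ) (he : ‖e‖ ≤ 1)
    (hK : ∀ x y, |g x - g y| ≤ K * ‖x - y‖) (hC₁ : ∀ x, |g' x| ≤ C₁)
    (hK₁ : ∀ x y, |g' x - g' y| ≤ K₁ * ‖x - y‖)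
    (hd : ∀ x, HasDerivAt (fun t : ℝ => g (x + t • e)) (g' x) 0)
    {φ : E → F} {A B A₂ B₂ : ℝ} (hφ : TF φ A B) (h₂ : TF (fun x => (g' x * g' x) • φ x) A₂ B₂) :
    TF (fun x => lor σ (g x) • (g' x * g' x) • φ x) (2 * σ * (K₁ * A + C₁ * B))
      (B₂ + 4 * K * (K₁ * A + C₁ * B)) := by
  set B₁ := K₁ * A + C₁ * B
  set m₂ : E → F := fun x => (g' x * g' x) • φ x with hm₂
  set ψ : E → F := fun x => lor σ (g x) • m₂ x with hψ
  have hm : TF (fun x => g' x * ‖φ x‖) (C₁ * A) B₁ := hφ.norm.mul hC₁ hK₁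
  have hgc := continuous_of_lip hK
  have hn (x : E) : ‖ψ x‖ = g' x * ‖φ x‖ * (lor σ (g x) * g' x) := by
    simp only [hψ, hm₂, norm_smul, Real.norm_eq_abs]
    rw [abs_of_nonneg (lor_nonneg _ _), abs_of_nonneg (mul_self_nonneg _)]
    ring
  have hlc : Continuous fun x => lor σ (g x) := by
    simp only [lor]
    refine continuous_const.div (by fun_prop) fun x => by positivity
  have hψi : Integrable ψ := h₂.int.bdd_smul 1 hlc.aestronglyMeasurable
    (Eventually.of_forall fun x => by
      rw [Real.norm_of_nonneg (lor_nonneg _ _)]; exact lor_le_one _ _)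
  have hl1 : ∫ x, ‖ψ x‖ ≤ 2 * σ * (B₁ * ‖e‖) := by
    simp only [hn]
    refine (le_abs_self _).trans (abs_integral_mul_deriv_le (f := fun x => σ * arctan (g x / σ))
      (K := K) hm (fun x => ?_) (fun x y => ?_) fun x => ?_)
    · rw [abs_mul, abs_of_pos hσ, mul_comm]
      gcongr
      exact abs_arctan_le_two _
    · rw [← mul_sub, abs_mul, abs_of_pos hσ]
      calc σ * |arctan (g x / σ) - arctan (g y / σ)| ≤ σ * |g x / σ - g y / σ| := by
            exact mul_le_mul_of_nonneg_left (abs_arctan_sub_le _ _) hσ.le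
        _ = |g x - g y| := by
            rw [← sub_div, abs_div, abs_of_pos hσ]; field_simp
        _ ≤ _ := hK x y
    · have h := (((hasDerivAt_arctan (g (x + (0 : ℝ) • e) / σ)).comp (0 : ℝ)
        ((hd x).div_const σ)).const_mul σ)
      refine h.congr_deriv ?_
      rw [zero_smul, add_zero, lor]
      field_simp
  have hB₁0 : 0 ≤ B₁ := hm.nonneg_right
  have hB₁' : B₁ * ‖e‖ ≤ B₁ := mul_le_of_le_one_right hB₁0 he
  have hl1' : ∫ x, ‖ψ x‖ ≤ 2 * σ * B₁ := hl1.trans (by gcongr)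
  refine ⟨hψi, hl1', fun h => ?_⟩
  have hK0 : 0 ≤ K * ‖h‖ := by simpa using (abs_nonneg _).trans (hK h 0)
  have hB₂0 : 0 ≤ B₂ * ‖h‖ := (integral_nonneg fun _ => norm_nonneg _).trans (h₂.lip h)
  have hψd := ((hψi.comp_add_right h).sub hψi).norm
  rcases le_or_gt (K * ‖h‖) σ with hh | hh
  · have h2i : Integrable fun x => ‖m₂ (x + h) - m₂ x‖ :=
      ((h₂.int.comp_add_right h).sub h₂.int).norm
    calc ∫ x, ‖ψ (x + h) - ψ x‖
        ≤ ∫ x, (‖m₂ (x + h) - m₂ x‖ + 2 * (K * ‖h‖) / σ * ‖ψ x‖) := by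
          refine integral_mono hψd (h2i.add (hψi.norm.const_mul _)) fun x => ?_
          have e1 : ψ (x + h) - ψ x = lor σ (g (x + h)) • (m₂ (x + h) - m₂ x) +
              (lor σ (g (x + h)) - lor σ (g x)) • m₂ x := by simp only [hψ]; module
          have hgx : |g (x + h) - g x| ≤ K * ‖h‖ := by simpa using hK (x + h) x
          simp only [e1]
          refine (norm_add_le _ _).trans (add_le_add ?_ ?_) <;> rw [norm_smul]
          · rw [Real.norm_of_nonneg (lor_nonneg _ _)]
            exact mul_le_of_le_one_left (norm_nonneg _) (lor_le_one _ _)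
          · have e2 : ‖ψ x‖ = lor σ (g x) * ‖m₂ x‖ := by
              rw [hψ, norm_smul, Real.norm_of_nonneg (lor_nonneg _ _)]
            rw [e2, ← mul_assoc]
            refine mul_le_mul_of_nonneg_right ?_ (norm_nonneg _)
            refine (abs_lor_sub_le hσ (hgx.trans hh)).trans ?_
            have := lor_nonneg σ (g x)
            gcongr
      _ = (∫ x, ‖m₂ (x + h) - m₂ x‖) + 2 * (K * ‖h‖) / σ * ∫ x, ‖ψ x‖ := by
          rw [integral_add h2i (hψi.norm.const_mul _), integral_const_mul]
      _ ≤ B₂ * ‖h‖ + 2 * (K * ‖h‖) / σ * (2 * σ * B₁) := by gcongr; exact h₂.lip h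
      _ = _ := by field_simp; ring
  · calc ∫ x, ‖ψ (x + h) - ψ x‖ ≤ ∫ x, (‖ψ (x + h)‖ + ‖ψ x‖) :=
          integral_mono hψd ((hψi.comp_add_right h).norm.add hψi.norm) fun x => norm_sub_le _ _
      _ = (∫ x, ‖ψ x‖) + ∫ x, ‖ψ x‖ := by
          rw [integral_add (hψi.comp_add_right h).norm hψi.norm,
            integral_add_right_eq_self fun x => ‖ψ x‖]
      _ ≤ 2 * σ * B₁ + 2 * σ * B₁ := by gcongr
      _ ≤ 2 * (K * ‖h‖) * B₁ + 2 * (K * ‖h‖) * B₁ := by gcongr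
      _ ≤ _ := by linarith

lemma Kills.deriv_sq [Nontrivial E] (hτ : Fam τ c κ) {g g' : E → ℝ} {e : E} (hg : BLip g)
    (hg' : BLip g') (he : ‖e‖ ≤ 1) (hd : ∀ x, HasDerivAt (fun t : ℝ => g (x + t • e)) (g' x) 0)
    (h : Kills τ U g) : Kills τ U fun x => g' x ^ 2 := by
  refine kills_of_approx hτ fun φ hφ δ hδ => ?_
  have hm := hφ.mul (hg'.mul hg')
  obtain ⟨⟨A, B, hT⟩, -⟩ := id hφ
  obtain ⟨⟨A₂, B₂, h₂⟩, -⟩ := id hm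
  obtain ⟨C, K, -, hK⟩ := id hg
  obtain ⟨C₁, K₁, hC₁, hK₁⟩ := id hg'
  set B₁ := K₁ * A + C₁ * B with hB₁
  have hB₁0 : 0 ≤ B₁ := (hT.mul hC₁ hK₁).nonneg_right
  obtain ⟨η, hη, hs⟩ := hτ.exists_small (B₂ + 4 * K * B₁) hδ
  set σ := η / (2 * (B₁ + 1)) with hσ
  have hσ0 : 0 < σ := by positivity
  refine ⟨fun x => lor σ (g x) • (g' x * g' x) • φ x,
    fun x => (g x * ((g x * (σ ^ 2 + g x ^ 2)⁻¹) * (g' x * g' x))) • φ x, hm.mul (hg.lor hσ0), ?_,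
    fun x => ?_, fun n => hs _ ?_ n _ (lor_deriv_tf hσ0 he hK hC₁ hK₁ hd hT h₂), ?_⟩
  · simp only [← mul_assoc]
    simp only [mul_assoc (g _) (g _) (_)⁻¹, ← one_sub_lor hσ0]
    exact hφ.mul ((((BLip.const 1).sub (hg.lor hσ0)).mul hg').mul hg')
  · have := one_sub_lor hσ0 (g x)
    simp only
    rw [← mul_assoc (g x), ← this]
    module
  · calc 2 * σ * B₁ ≤ 2 * σ * (B₁ + 1) := by gcongr; linarith
      _ = η := by rw [hσ]; field_simp
  · refine (h.mul ((hg.mul ?_).mul (hg'.mul hg'))) φ hφ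
    refine ((BLip.const _).add ?_).inv (c := σ ^ 2) (by positivity) fun x => by
      nlinarith [sq_nonneg (g x)]
    simpa only [pow_two] using hg.mul hg

end Directional

section Alternative

variable {τ : ℕ → (E → E) → ℝ} {c κ : ℝ} {U : Filter ℕ}

lemma eventually_close {g : ℕ → E → ℝ} {G : E → ℝ} {K : ℝ}
    (hg : ∀ n x y, |g n x - g n y| ≤ K * ‖x - y‖) (hG : ∀ x y, |G x - G y| ≤ K * ‖x - y‖)
    (hl : ∀ x, Tendsto (fun n => g n x) U (𝓝 (G x))) {S : Set E} (hS : IsCompact S) {δ : ℝ}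
    (hδ : 0 < δ) : ∀ᶠ n in U, ∀ x ∈ S, |G x - g n x| ≤ δ := by
  refine hS.induction_on (p := fun S => ∀ᶠ n in U, ∀ x ∈ S, |G x - g n x| ≤ δ) (by simp)
    (fun s t hst h => h.mono fun n hn x hx => hn x (hst hx))
    (fun s t h h' => (h.and h').mono fun n hn x hx => hx.elim (hn.1 x) (hn.2 x)) fun x _ => ?_
  have hK : 0 < |K| + 1 := by positivity
  refine ⟨Metric.ball x (δ / (3 * (|K| + 1))),
    mem_nhdsWithin_of_mem_nhds (Metric.ball_mem_nhds _ (by positivity)), ?_⟩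
  filter_upwards [Metric.tendsto_nhds.1 (hl x) (δ / 3) (by positivity)] with n hn y hy
  rw [Real.dist_eq, abs_sub_comm] at hn
  rw [Metric.mem_ball, dist_eq_norm] at hy
  have h1 : K * ‖y - x‖ ≤ δ / 3 := by
    calc K * ‖y - x‖ ≤ (|K| + 1) * (δ / (3 * (|K| + 1))) := by
          gcongr; exact le_trans (le_abs_self K) (by linarith)
      _ = δ / 3 := by field_simp
  have h2 : |g n x - g n y| ≤ δ / 3 := (hg n x y).trans (by rwa [norm_sub_rev])
  have h3 := (hG y x).trans h1
  have e : G y - g n y = (G y - G x) + (G x - g n x) + (g n x - g n y) := by ring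
  rw [e]
  linarith [abs_add_three (G y - G x) (G x - g n x) (g n x - g n y)]

lemma kills_of_lim [Nontrivial E] (hτ : Fam τ c κ) {g : ℕ → E → ℝ} {G : E → ℝ} {C K : ℝ}
    (hC : ∀ n x, |g n x| ≤ C) (hg : ∀ n x y, |g n x - g n y| ≤ K * ‖x - y‖)
    (hGC : ∀ x, |G x| ≤ C) (hG : ∀ x y, |G x - G y| ≤ K * ‖x - y‖)
    (hl : ∀ x, Tendsto (fun n => g n x) U (𝓝 (G x))) {M : ℕ → ℝ} (hM : ∀ n, 0 < M n)
    (hM0 : Tendsto M U (𝓝 0))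
    (h : ∀ n φ, Test φ → (∀ x ∈ tsupport φ, M n < |g n x|) → |τ n φ| ≤ M n * ∫ x, ‖φ x‖) :
    Kills τ U G := by
  intro φ hφ
  obtain ⟨⟨A, B, hT⟩, hsup⟩ := id hφ
  have hA := hT.nonneg_left
  have hB := hT.nonneg_right
  rw [Metric.tendsto_nhds]
  intro δ hδ
  obtain ⟨η, hη, hs⟩ := hτ.exists_small (2 * K * A + B) (show 0 < δ / 4 by positivity)
  have hKA : 0 ≤ K * A := by
    obtain ⟨e, he⟩ := exists_norm_eq E zero_le_one
    have := (abs_nonneg _).trans (hG e 0)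
    rw [sub_zero, he, mul_one] at this
    positivity
  set σ := min 1 (η / (A + 1)) with hσ
  have hσ0 : 0 < σ := lt_min one_pos (by positivity)
  have hσ1 : σ ≤ 1 := min_le_left _ _
  have hσA : σ * A ≤ η := by
    calc σ * A ≤ η / (A + 1) * (A + 1) := by gcongr <;> [exact min_le_right _ _; linarith]
      _ = η := by field_simp
  have hlimM : Tendsto (fun n => M n * ((C + 2 * M n) * A)) U (𝓝 (0 * ((C + 2 * 0) * A))) :=
    hM0.mul ((tendsto_const_nhds.add (hM0.const_mul 2)).mul_const A)
  rw [zero_mul] at hlimM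
  filter_upwards [eventually_close hg hG hl hsup hσ0, hlimM.eventually (gt_mem_nhds
    (show 0 < δ / 4 by positivity)), hM0.eventually (gt_mem_nhds (show 0 < σ / 2 by positivity))]
    with n h1 h2 h3
  have hBg : BLip (g n) := ⟨C, K, hC n, hg n⟩
  have hBG : BLip G := ⟨C, K, hGC, hG⟩
  have hM' := hM n
  have e : (fun x => G x • φ x) = fun x => clip σ (G x - g n x) • φ x +
      (clip (2 * M n) (g n x) • φ x + (g n x - clip (2 * M n) (g n x)) • φ x) := by
    ext x
    by_cases hx : x ∈ tsupport φ
    · rw [clip_of_le (h1 x hx)]; module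
    · simp [image_eq_zero_of_notMem_tsupport hx]
  have t1 := hφ.mul ((hBG.sub hBg).clip σ)
  have t2 := hφ.mul (hBg.clip (2 * M n))
  have t3 := hφ.mul (hBg.sub (hBg.clip (2 * M n)))
  rw [Real.dist_eq, sub_zero, e, hτ.add n _ _ t1 (t2.add t3), hτ.add n _ _ t2 t3]
  have b1 : |τ n fun x => clip σ (G x - g n x) • φ x| ≤ δ / 4 := by
    refine hs _ hσA n _ ((hT.mul (K := 2 * K) (fun x => abs_clip_le hσ0.le _) fun x y => ?_).mono
      le_rfl ?_)
    · refine (clip_lip _ _ _).trans ?_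
      rw [sub_sub_sub_comm]
      refine (abs_sub _ _).trans ?_
      linarith [hG x y, hg n x y]
    · gcongr; exact mul_le_of_le_one_left hB hσ1
  have b2 : |τ n fun x => clip (2 * M n) (g n x) • φ x| ≤ δ / 4 := by
    refine hs (2 * M n * A) (le_trans (by gcongr; linarith) hσA) n _
      ((hT.mul (fun x => abs_clip_le (by positivity) _) fun x y =>
        (clip_lip _ _ _).trans (hg n x y)).mono le_rfl ?_)
    have : 2 * M n * B ≤ B := mul_le_of_le_one_left hB (by linarith)
    linarith
  have b3 : |τ n fun x => (g n x - clip (2 * M n) (g n x)) • φ x| ≤ δ / 4 := by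
    refine (h n _ t3 fun x hx => ?_).trans (le_trans ?_ h2.le)
    · have hcl : IsClosed {x | 2 * M n ≤ |g n x|} :=
        isClosed_le continuous_const (by have := hBg.continuous; fun_prop)
      have : x ∈ {x | 2 * M n ≤ |g n x|} := by
        refine closure_minimal (fun y hy => ?_) hcl hx
        by_contra hlt
        refine hy ?_
        simp only [Set.mem_ofPred_eq, not_le] at hlt
        simp only
        rw [clip_of_le hlt.le, sub_self, zero_smul]
      exact lt_of_lt_of_le (by linarith) this
    · gcongr
      refine (hT.mul (σ := C + 2 * M n) (K := 2 * K) (fun x => ?_) fun x y => ?_).l1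
      · exact (abs_sub _ _).trans (add_le_add (hC n x) (abs_clip_le (by positivity) _))
      · rw [sub_sub_sub_comm]
        refine (abs_sub _ _).trans ?_
        linarith [hg n x y, (clip_lip (2 * M n) (g n x) (g n y)).trans (hg n x y)]
  refine lt_of_le_of_lt (abs_add_le _ _) ?_
  refine lt_of_le_of_lt (add_le_add b1 ((abs_add_le _ _).trans (add_le_add b2 b3))) ?_
  linarith

lemma tendsto_zero_of_kills (hτ : Fam τ c κ)
    (h : ∀ z, ∃ q : E → ℝ, BLip q ∧ Kills τ U q ∧ q z ≠ 0) {φ : E → E} (hφ : Test φ) :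
    Tendsto (fun n => τ n φ) U (𝓝 0) := by
  obtain ⟨G, hG, hk, h0, hpos⟩ : ∃ G : E → ℝ, BLip G ∧ Kills τ U G ∧ (∀ x, 0 ≤ G x) ∧
      ∀ x ∈ tsupport φ, 0 < G x := by
    refine hφ.2.isCompact.induction_on (p := fun S => ∃ G : E → ℝ, BLip G ∧ Kills τ U G ∧
      (∀ x, 0 ≤ G x) ∧ ∀ x ∈ S, 0 < G x) ?_ ?_ ?_ ?_
    · obtain ⟨q, hq, hk, -⟩ := h 0
      exact ⟨fun x => q x * q x, hq.mul hq, hk.mul hq, fun x => mul_self_nonneg _, by simp⟩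
    · rintro s t hst ⟨G, h1, h2, h3, h4⟩
      exact ⟨G, h1, h2, h3, fun x hx => h4 x (hst hx)⟩
    · rintro s t ⟨G, h1, h2, h3, h4⟩ ⟨G', h1', h2', h3', h4'⟩
      refine ⟨fun x => G x + G' x, h1.add h1', h2.add hτ h1 h1' h2',
        fun x => add_nonneg (h3 x) (h3' x), fun x hx => ?_⟩
      rcases hx with hx | hx
      · exact add_pos_of_pos_of_nonneg (h4 x hx) (h3' x)
      · exact add_pos_of_nonneg_of_pos (h3 x) (h4' x hx)
    · intro x _
      obtain ⟨q, hq, hk, hx⟩ := h x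
      refine ⟨{y | q y ≠ 0}, mem_nhdsWithin_of_mem_nhds ((isOpen_ne_fun hq.continuous
        continuous_const).mem_nhds hx), fun x => q x * q x, hq.mul hq, hk.mul hq,
        fun x => mul_self_nonneg _, fun y hy => mul_self_pos.2 hy⟩
  obtain ⟨c₀, hc₀, hle⟩ : ∃ c₀ > 0, ∀ x ∈ tsupport φ, c₀ ≤ G x := by
    rcases (tsupport φ).eq_empty_or_nonempty with he | hne
    · exact ⟨1, one_pos, by simp [he]⟩
    · obtain ⟨x, hx, hmin⟩ := hφ.2.isCompact.exists_isMinOn hne hG.continuous.continuousOn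
      exact ⟨G x, hpos x hx, fun y hy => hmin hy⟩
  have hq : BLip fun x => (max (G x) c₀)⁻¹ :=
    (hG.max (BLip.const c₀)).inv hc₀ fun _ => le_max_right _ _
  refine ((hk.mul hq) φ hφ).congr fun n => ?_
  congr 1
  ext x
  by_cases hx : x ∈ tsupport φ
  · have h1 := hle x hx
    simp only
    rw [max_eq_left h1, mul_inv_cancel₀ (hc₀.trans_le h1).ne', one_smul]
  · simp [image_eq_zero_of_notMem_tsupport hx]

end Alternative

lemma Moll.test_smul [Nontrivial E] {ϱ : E → ℝ} {A : ℝ} (h : Moll ϱ A) {w : E} (hw : ‖w‖ ≤ 1) :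
    Test fun z => ϱ z • w := by
  refine ⟨⟨A, A, ?_⟩, h.supp.smul_right⟩
  simpa using (h.smul_w2 hw 0).1

lemma tendsto_integral_of_close {g : ℕ → E → E} {w : E} {ϱ : E → ℝ} {K : ℝ} {U : Filter ℕ}
    (hg : ∀ n x y, |⟪g n x, w⟫ - ⟪g n y, w⟫| ≤ K * ‖x - y‖) (hK : 0 ≤ K)
    (hl : ∀ x, Tendsto (fun n => ⟪g n x, w⟫) U (𝓝 0)) (hc : Continuous ϱ)
    (hs : HasCompactSupport ϱ) : Tendsto (fun n => ∫ x, ⟪g n x, ϱ x • w⟫) U (𝓝 0) := by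
  have hi : Integrable fun x => ‖ϱ x‖ := (hc.integrable_of_hasCompactSupport hs).norm
  have hI : 0 ≤ ∫ x, ‖ϱ x‖ := integral_nonneg fun _ => norm_nonneg _
  rw [Metric.tendsto_nhds]
  intro δ hδ
  filter_upwards [eventually_close (K := K) (g := fun n x => ⟪g n x, w⟫) (G := fun _ => 0) hg
    (by intro x y; simp; positivity) hl hs (show 0 < δ / (2 * ((∫ x, ‖ϱ x‖) + 1)) by positivity)]
    with n hn
  rw [Real.dist_eq, sub_zero, ← Real.norm_eq_abs]
  have hb : ‖∫ x, ⟪g n x, ϱ x • w⟫‖ ≤ ∫ x, δ / (2 * ((∫ x, ‖ϱ x‖) + 1)) * ‖ϱ x‖ := by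
    refine norm_integral_le_of_norm_le (hi.const_mul _) (Eventually.of_forall fun x => ?_)
    rw [inner_smul_right, norm_mul, mul_comm]
    by_cases hx : x ∈ tsupport ϱ
    · have := hn x hx
      rw [zero_sub, abs_neg] at this
      gcongr
      exact this
    · simp [image_eq_zero_of_notMem_tsupport hx]
  refine hb.trans_lt ?_
  rw [integral_const_mul, div_mul_eq_mul_div, div_lt_iff₀ (by positivity)]
  nlinarith

/-- Smallness of the data forces one of two averages to be small. -/
lemma exists_alternative [Nontrivial E] (hp : (finrank ℝ E : ℝ) < p) (hp' : p < finrank ℝ E + 1)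
    (h1 : a + b / p ≠ 0) (h2 : a + b * (1 + (p - finrank ℝ E)) / p ≠ 0) {ε : ℝ} (hε : 0 < ε)
    {ϱ : E → ℝ} {A₀ : ℝ} (hϱ : Moll ϱ A₀) {w : E} (hw : ‖w‖ ≤ 1) {c : ℝ} (hc : 0 < c) :
    ∃ M > 0, ∀ (v : E → E) (U : ℝ) (P : Set E), Continuous v → (∀ x, ‖v x‖ ≤ U) →
      (∀ φ A B, TF φ A B → |T (ker a b p) v φ| ≤
        A + ε ^ (p - finrank ℝ E) * (A ^ (1 - (p - finrank ℝ E)) * B ^ (p - finrank ℝ E))) →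
      (∀ x ∈ P, |⟪op (gk a b p) v x, w⟫| ≤ M) →
      (∀ φ : E → E, Test φ → Disjoint (tsupport φ) P →
        |T (ker a b p) v φ| ≤ M * ∫ x, ‖φ x‖) →
      |T (ker a b p) v fun x => ϱ x • w| < c ∨ |∫ x, ⟪op (gk a b p) v x, ϱ x • w⟫| < c := by
  by_contra! H
  set κ := p - finrank ℝ E with hκ
  have hκ0 : 0 < κ := by linarith
  have hκ1 : κ < 1 := by linarith
  choose v V P hv hV hb hP hT hc1 hc2 using fun n : ℕ => H (1 / ((n : ℝ) + 1)) (by positivity)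
  set τ : ℕ → (E → E) → ℝ := fun n => T (ker a b p) (v n) with hτd
  have hτ : Fam τ (ε ^ κ) κ := by
    refine ⟨fun n φ ψ hφ hψ => ?_, hb, hκ0, hκ1⟩
    obtain ⟨⟨A, B, h⟩, -⟩ := hφ
    obtain ⟨⟨A', B', h'⟩, -⟩ := hψ
    exact T_add (ker_wk hp hp') (hv n) (hV n) h h'
  obtain ⟨C, hC, hreg⟩ := exists_regular (E := E) hp hp' h1 h2
  have hS : 0 ≤ 1 + ε ^ κ := by positivity
  have hreg' n := hreg (v n) (V n) (1 + ε ^ κ) (hv n) (hV n) hS (by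
    intro φ A B hφ
    refine (hb n φ A B hφ).trans ?_
    have hA := hφ.nonneg_left
    have hB := hφ.nonneg_right
    have h3 := Real.geom_mean_le_arith_mean2_weighted (show 0 ≤ 1 - κ by linarith) hκ0.le hA hB
      (by ring)
    have h4 : A ^ (1 - κ) * B ^ κ ≤ A + B := by nlinarith
    have h5 : 0 ≤ ε ^ κ := by positivity
    nlinarith)
  set U : Ultrafilter ℕ := hyperfilter ℕ with hU
  have hUt : (U : Filter ℕ) ≤ atTop := Nat.hyperfilter_le_atTop
  have hlimM : Tendsto (fun n : ℕ => 1 / ((n : ℝ) + 1)) U (𝓝 0) :=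
    tendsto_one_div_add_atTop_nhds_zero_nat.mono_left hUt
  set L := C * (1 + ε ^ κ) with hL
  have hL0 : 0 ≤ L := by positivity
  have key (e : E) (he : ‖e‖ ≤ 1) : ∃ G : ℕ → E → ℝ, AF e (1 / 16) L G ∧
      (∀ x, Tendsto (fun n => ⟪op (gk a b p) (v n) x, w⟫) U (𝓝 (G 0 x))) ∧
      (∀ n x y, |⟪op (gk a b p) (v n) x, w⟫ - ⟪op (gk a b p) (v n) y, w⟫| ≤ L * ‖x - y‖) ∧
      ∀ k, Kills τ U (G k) := by
    choose g hg hg0 using fun n => (hreg' n).2.2 w e hw he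
    obtain ⟨G, hG, hl⟩ := AF.ultralim U (by norm_num) hg
    have hbl k : BLip (G k) := ⟨_, _, hG.bound k, hG.lip k⟩
    refine ⟨G, hG, fun x => ?_, fun n x y => ?_, fun k => ?_⟩
    · simpa only [hg0] using hl 0 x
    · rw [← hg0, ← hg0]; simpa using (hg n).lip 0 x y
    · induction k with
      | zero =>
        refine kills_of_lim hτ (fun n => (hg n).bound 0) (fun n => (hg n).lip 0) (hG.bound 0)
          (hG.lip 0) (hl 0) (M := fun n => 1 / ((n : ℝ) + 1)) (fun n => by positivity) hlimM
          fun n φ hφ h => hT n φ hφ (Set.disjoint_left.2 fun x hx hx' => ?_)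
        have := h x hx
        rw [hg0] at this
        exact absurd (hP n x hx') (not_le.2 this)
      | succ k ih =>
        exact kills_of_sq hτ (hbl _) (Kills.deriv_sq hτ (hbl k) (hbl (k + 1)) he (hG.deriv k) ih)
  obtain ⟨G₀, hG₀, hl₀, hlip, -⟩ := key 0 (by simp)
  by_cases hz : ∀ x, G₀ 0 x = 0
  · have h3 := tendsto_integral_of_close hlip hL0 (fun x => by simpa [hz] using hl₀ x) hϱ.cont
      hϱ.supp
    have h4 := h3.abs
    rw [abs_zero] at h4
    obtain ⟨n, hn⟩ := (h4.eventually (gt_mem_nhds hc)).exists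
    exact absurd (hc2 n) (not_le.2 hn)
  · push Not at hz
    obtain ⟨x₀, hx₀⟩ := hz
    have h3 : Tendsto (fun n => τ n fun x => ϱ x • w) U (𝓝 0) := by
      refine tendsto_zero_of_kills hτ (fun z => ?_) (hϱ.test_smul hw)
      obtain ⟨G, hG, hl, -, hk⟩ := key (‖x₀ - z‖⁻¹ • (x₀ - z)) (by
        rw [norm_smul, norm_inv, norm_norm]; exact inv_mul_le_one)
      by_contra! hcon
      have h4 k : G k z = 0 := hcon _ ⟨_, _, hG.bound k, hG.lip k⟩ (hk k)
      have h5 := hG.eq_zero_on_ray (by norm_num) h4 (norm_nonneg (x₀ - z)) 0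
      refine hx₀ (tendsto_nhds_unique (hl₀ x₀) ?_)
      rw [← h5]
      convert hl x₀ using 3
      rcases eq_or_ne x₀ z with rfl | hne
      · simp
      · rw [smul_smul, mul_inv_cancel₀ (norm_ne_zero_iff.2 (sub_ne_zero.2 hne)), one_smul,
          add_sub_cancel]
    have h4 := h3.abs
    rw [abs_zero] at h4
    obtain ⟨n, hn⟩ := (h4.eventually (gt_mem_nhds hc)).exists
    exact absurd (hc1 n) (not_le.2 hn)

section Scaling

lemma op_scale (k : E → E →L[ℝ] E) {t : ℝ} (ht : 0 < t) (φ : E → E) (x : E) :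
    op (fun y => k (t • y)) (fun x => φ (t • x)) x
      = t ^ (-(finrank ℝ E : ℝ)) • op k φ (t • x) := by
  have h := integral_comp_smul_pos (fun y => k y (φ (t • x) - φ (t • x - y))) ht
  simpa only [op, smul_sub] using h

lemma T_scale (k : E → E →L[ℝ] E) {t : ℝ} (ht : 0 < t) (v φ : E → E) :
    T (fun y => k (t • y)) (fun x => v (t • x)) (fun x => φ (t • x))
      = t ^ (-2 * (finrank ℝ E : ℝ)) * T k v φ := by
  simp only [T, pair, op_scale k ht, inner_smul_right]
  rw [integral_const_mul, integral_comp_smul_pos (fun x => ⟪v x, op k φ x⟫) ht, smul_eq_mul,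
    ← mul_assoc, ← Real.rpow_add ht]
  congr 2; ring

/-- The rescaled mollifier. -/
def mollScale (ϱ : E → ℝ) (r : ℝ) (x : E) : ℝ := r ^ (-(finrank ℝ E : ℝ)) * ϱ (r⁻¹ • x)

lemma TF.mollScale {ϱ : E → ℝ} {A B r : ℝ} (h : TF ϱ A B) (hr : 0 < r) :
    TF (mollScale ϱ r) A (r⁻¹ * B) := by
  have h1 := (h.scale (inv_pos.2 hr)).const_smul (r ^ (-(finrank ℝ E : ℝ)))
  have e : r ^ (-(finrank ℝ E : ℝ)) * r⁻¹ ^ (-(finrank ℝ E : ℝ)) = 1 := by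
    rw [← Real.mul_rpow hr.le (inv_pos.2 hr).le, mul_inv_cancel₀ hr.ne', Real.one_rpow]
  rw [abs_of_pos (by positivity), ← mul_assoc, ← mul_assoc, e, one_mul, one_mul] at h1
  exact h1

lemma integral_mollScale (ϱ : E → ℝ) {r : ℝ} (hr : 0 < r) (f : E → ℝ → ℝ) (c : ℝ)
    (hf : ∀ x, f (r • x) (r ^ (-(finrank ℝ E : ℝ)) * ϱ x)
      = c * (r ^ (-(finrank ℝ E : ℝ)) * f x (ϱ x))) :
    ∫ x, f x (mollScale ϱ r x) = c * ∫ x, f x (ϱ x) := by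
  have h := integral_comp_smul_pos (fun x => f x (mollScale ϱ r x)) hr
  simp only [mollScale, smul_smul, inv_mul_cancel₀ hr.ne', one_smul, hf, smul_eq_mul] at h
  rw [integral_const_mul, integral_const_mul, mul_left_comm] at h
  exact (mul_left_cancel₀ (Real.rpow_pos_of_pos hr _).ne' h).symm

lemma Moll.scale {ϱ : E → ℝ} {A r : ℝ} (h : Moll ϱ A) (hr : 0 < r) :
    ∃ A', Moll (mollScale ϱ r) A' := by
  have hA := h.w2.1.nonneg_left
  refine ⟨A + r⁻¹ * A + r⁻¹ * (r⁻¹ * A), ?_, ?_, ?_, ?_, fun y => ?_⟩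
  · have := h.cont; unfold mollScale; fun_prop
  · have h1 : HasCompactSupport fun x => ϱ (r⁻¹ • x) :=
      h.supp.comp_homeomorph (Homeomorph.smulOfNeZero r⁻¹ (inv_ne_zero hr.ne'))
    exact h1.mul_left (f := fun _ => r ^ (-(finrank ℝ E : ℝ)))
  · rw [integral_mollScale ϱ hr (fun _ y => y) 1 (by simp), h.mass, mul_one]
  · refine (h.w2.1.mollScale hr).mono ?_ ?_ <;>
    linarith [show 0 ≤ r⁻¹ * A by positivity, show 0 ≤ r⁻¹ * (r⁻¹ * A) by positivity]
  · have h1 := (h.w2.2 (r⁻¹ • y)).mollScale hr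
    rw [norm_smul, Real.norm_of_nonneg (inv_pos.2 hr).le] at h1
    have e : mollScale (fun x => ϱ (x + r⁻¹ • y) - ϱ x) r
        = fun x => mollScale ϱ r (x + y) - mollScale ϱ r x := by
      ext x; simp only [mollScale, smul_add]; ring
    rw [e] at h1
    have h0 : 0 ≤ ‖y‖ * A := by positivity
    have h2 : 0 ≤ r⁻¹ * (‖y‖ * A) := by positivity
    have h3 : 0 ≤ r⁻¹ * (r⁻¹ * (‖y‖ * A)) := by positivity
    refine h1.mono ?_ ?_ <;> linarith

variable (a b p) in
/-- Interpolation bound for the weak form of the operator on `v`. -/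
def HB (v : E → E) (S Q : ℝ) : Prop := ∀ φ A B, TF φ A B → |T (ker a b p) v φ| ≤
  S * A + Q * (A ^ (1 - (p - finrank ℝ E)) * B ^ (p - finrank ℝ E))

variable (a b p) in
/-- Bounds for the truncated operators on `P` and for the weak form outside `P`. -/
structure Data (v : E → E) (P : Set E) (M : ℝ) : Prop where
  reg : ∀ x ∈ P, ∀ ε > 0, ‖trunc (ker a b p) v ε x‖ ≤ M
  off : ∀ φ : E → E, Test φ → Disjoint (tsupport φ) P →
    |T (ker a b p) v φ| ≤ M * ∫ x, ‖φ x‖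

lemma T_ker_comp_smul {t : ℝ} (ht : 0 < t) (v φ : E → E) :
    T (ker a b p) (fun x => v (t • x)) φ
      = t ^ (p - 2 * finrank ℝ E) * T (ker a b p) v (fun x => φ (t⁻¹ • x)) := by
  rw [← T_ker_scale ht]
  simp only [smul_smul, inv_mul_cancel₀ ht.ne', one_smul]

lemma HB.scale [Nontrivial E] {v : E → E} {S Q t : ℝ} (h : HB a b p v S Q) (ht : 0 < t) :
    HB a b p (fun x => v (t • x)) (t ^ (p - finrank ℝ E) * S) Q := by
  intro φ A B hφ
  have hA := hφ.nonneg_left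
  have hB := hφ.nonneg_right
  rw [T_ker_comp_smul ht, abs_mul, abs_of_pos (by positivity)]
  refine (mul_le_mul_of_nonneg_left (h _ _ _ (hφ.scale (inv_pos.2 ht))) (by positivity)).trans ?_
  set D : ℝ := (finrank ℝ E : ℝ)
  rw [Real.inv_rpow ht.le, Real.rpow_neg ht.le, inv_inv, Real.mul_rpow (by positivity) hA,
    Real.mul_rpow (by positivity) (by positivity), Real.mul_rpow (by positivity) hB,
    Real.inv_rpow ht.le, ← Real.rpow_mul ht.le, ← Real.rpow_mul ht.le, ← Real.rpow_neg ht.le]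
  have e1 : t ^ (p - 2 * D) * t ^ D = t ^ (p - D) := by rw [← Real.rpow_add ht]; ring_nf
  have e2 : t ^ (p - 2 * D) * (t ^ (D * (1 - (p - D))) * t ^ (D * (p - D)) * t ^ (-(p - D)))
      = 1 := by
    rw [← Real.rpow_add ht, ← Real.rpow_add ht, ← Real.rpow_add ht]
    convert Real.rpow_zero t using 2; ring
  refine le_of_eq ?_
  linear_combination (S * A) * e1 + (Q * A ^ (1 - (p - D)) * B ^ (p - D)) * e2

lemma T_const_smul_left (k : E → E →L[ℝ] E) (c : ℝ) (v φ : E → E) :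
    T k (fun x => c • v x) φ = c * T k v φ := by
  simp only [T, pair, real_inner_smul_left, integral_const_mul]

lemma HB.smul {v : E → E} {S Q : ℝ} (h : HB a b p v S Q) (c : ℝ) :
    HB a b p (fun x => c • v x) (|c| * S) (|c| * Q) := by
  intro φ A B hφ
  rw [T_const_smul_left, abs_mul]
  refine (mul_le_mul_of_nonneg_left (h φ A B hφ) (abs_nonneg c)).trans (le_of_eq (by ring))

lemma Test.comp_smul {φ : E → E} (h : Test φ) {t : ℝ} (ht : 0 < t) :
    Test fun x => φ (t • x) := by
  obtain ⟨⟨A, B, h⟩, hs⟩ := h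
  exact ⟨⟨_, _, h.scale ht⟩, hs.comp_homeomorph (Homeomorph.smulOfNeZero t ht.ne')⟩

lemma Data.scale {v : E → E} {P : Set E} {M t : ℝ} (h : Data a b p v P M) (ht : 0 < t) :
    Data a b p (fun x => v (t • x)) {x | t • x ∈ P} (t ^ (p - finrank ℝ E) * M) := by
  refine ⟨fun x hx ε hε => ?_, fun φ hφ hd => ?_⟩
  · rw [trunc_scale ht, norm_smul, Real.norm_of_nonneg (by positivity)]
    gcongr
    exact h.reg _ hx _ (by positivity)
  · rw [T_ker_comp_smul ht, abs_mul, abs_of_pos (by positivity)]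
    have h1 := h.off (fun x => φ (t⁻¹ • x)) (hφ.comp_smul (inv_pos.2 ht))
      (Set.disjoint_left.2 fun x hx hxP => by
        have : t⁻¹ • x ∈ tsupport φ := tsupport_comp_subset_preimage (f := fun x : E => t⁻¹ • x) φ
          (by fun_prop) hx
        exact Set.disjoint_left.1 hd this (by simpa [smul_smul, mul_inv_cancel₀ ht.ne'] using hxP))
    rw [integral_comp_smul_pos (fun x => ‖φ x‖) (inv_pos.2 ht), smul_eq_mul, Real.inv_rpow ht.le,
      Real.rpow_neg ht.le, inv_inv] at h1
    refine (mul_le_mul_of_nonneg_left h1 (by positivity)).trans (le_of_eq ?_)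
    have e1 : t ^ (p - 2 * finrank ℝ E) * t ^ (finrank ℝ E : ℝ) = t ^ (p - finrank ℝ E) := by
      rw [← Real.rpow_add ht]; ring_nf
    rw [← e1]; ring

lemma trunc_const_smul (k : E → E →L[ℝ] E) (c : ℝ) (v : E → E) (ε : ℝ) (x : E) :
    trunc k (fun x => c • v x) ε x = c • trunc k v ε x := by
  simp only [trunc, ← smul_sub, map_smul, integral_smul]

lemma Data.smul {v : E → E} {P : Set E} {M : ℝ} (h : Data a b p v P M) (c : ℝ) :
    Data a b p (fun x => c • v x) P (|c| * M) := by
  refine ⟨fun x hx ε hε => ?_, fun φ hφ hd => ?_⟩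
  · rw [trunc_const_smul, norm_smul, Real.norm_eq_abs]
    gcongr
    exact h.reg _ hx _ hε
  · rw [T_const_smul_left, abs_mul, mul_assoc]
    gcongr
    exact h.off φ hφ hd

lemma Test.translate {φ : E → E} (h : Test φ) (z : E) : Test fun x => φ (x + z) := by
  obtain ⟨⟨A, B, h⟩, hs⟩ := h
  exact ⟨⟨_, _, h.translate z⟩, hs.comp_homeomorph (Homeomorph.addRight z)⟩

lemma T_comp_add (k : E → E →L[ℝ] E) (v φ : E → E) (z : E) :
    T k (fun x => v (x + z)) φ = T k v (fun x => φ (x + -z)) := by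
  rw [← T_translate k v _ z]
  simp only [add_neg_cancel_right]

lemma HB.translate {v : E → E} {S Q : ℝ} (h : HB a b p v S Q) (z : E) :
    HB a b p (fun x => v (x + z)) S Q := by
  intro φ A B hφ
  rw [T_comp_add]
  exact h _ _ _ (hφ.translate _)

lemma Data.translate {v : E → E} {P : Set E} {M : ℝ} (h : Data a b p v P M) (z : E) :
    Data a b p (fun x => v (x + z)) {x | x + z ∈ P} M := by
  refine ⟨fun x hx ε hε => ?_, fun φ hφ hd => ?_⟩
  · have := h.reg _ hx ε hε
    simpa only [trunc, sub_add_eq_add_sub] using this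
  · rw [T_comp_add, ← integral_add_right_eq_self (fun x => ‖φ x‖) (-z)]
    refine h.off _ (hφ.translate _) (Set.disjoint_left.2 fun x hx hxP => ?_)
    have : x + -z ∈ tsupport φ := tsupport_comp_subset_preimage (f := fun x : E => x + -z) φ
      (by fun_prop) hx
    exact Set.disjoint_left.1 hd this (by simpa using hxP)

end Scaling

section WeakBound

lemma T_lk_mollScale_le [Nontrivial E] (hp : (finrank ℝ E : ℝ) < p) (hp' : p < finrank ℝ E + 1)
    {v : E → E} {U L r A : ℝ} (hr : 0 < r) (hv : Continuous v) (hU : ∀ x, ‖v x‖ ≤ U)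
    (hL : DB (fun x => v (r • x)) L) {ϱ : E → ℝ} (hϱ : Moll ϱ A) {w : E} (hw : ‖w‖ ≤ 1) :
    |T (lk a b p) v fun x => mollScale ϱ r x • w|
      ≤ L * A * (∫ y : E, ‖lk a b p y‖ * ‖y‖) * r⁻¹ := by
  set D : ℝ := (finrank ℝ E : ℝ) with hD
  have hm : Integrable fun y : E => ‖lk a b p (r • y)‖ * ‖y‖ := by
    have h1 := ((integrable_comp_smul_iff volume (fun y : E => ‖lk a b p y‖ * ‖y‖) hr.ne').2
      (lk_moment hp hp')).const_mul r⁻¹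
    refine h1.congr (Eventually.of_forall fun y => ?_)
    simp only [norm_smul, Real.norm_of_nonneg hr.le]
    field_simp
  have hmi : ∫ y : E, ‖lk a b p (r • y)‖ * ‖y‖
      = r ^ (-D) * r⁻¹ * ∫ y : E, ‖lk a b p y‖ * ‖y‖ := by
    have h1 := integral_comp_smul_pos (fun y : E => ‖lk a b p y‖ * ‖y‖) hr
    simp only [norm_smul r, Real.norm_of_nonneg hr.le, smul_eq_mul, ← hD] at h1
    rw [mul_right_comm, ← h1, ← integral_mul_const]
    congr 1
    ext y
    field_simp
  have hmeas : AEStronglyMeasurable (fun y : E => lk a b p (r • y)) volume :=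
    ((ker_measurable.sub gk_measurable).comp_measurable
      (measurable_const_smul r)).aestronglyMeasurable
  have hk : WK fun y : E => lk a b p (r • y) := by
    refine ⟨hmeas, hm.mono' (hmeas.norm.mul (by fun_prop)) (Eventually.of_forall fun y => ?_)⟩
    rw [Real.norm_of_nonneg (by positivity)]
    gcongr
    exact min_le_right _ _
  have h1 := hL.T_le hk hm (hv.comp (continuous_const_smul r)) (fun x => hU _) (hϱ.smul_w2 hw 0)
  simp only [sub_zero] at h1
  have h2 := T_scale (lk a b p) hr v fun x => mollScale ϱ r x • w
  simp only [mollScale, smul_smul, inv_mul_cancel₀ hr.ne', one_smul] at h2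
  simp only [← smul_smul] at h2
  rw [T_smul (fun y => lk a b p (r • y)) (fun x => v (r • x)) (r ^ (-D)) fun x => ϱ x • w] at h2
  have e1 : r ^ (-2 * D) = r ^ (-D) * r ^ (-D) := by rw [← Real.rpow_add hr]; ring_nf
  have hrD : 0 < r ^ (-D) := Real.rpow_pos_of_pos hr _
  rw [← hD, e1, mul_assoc] at h2
  have h3 := mul_left_cancel₀ hrD.ne' h2
  have h4 : r ^ (-D) * |T (lk a b p) v fun x => mollScale ϱ r x • w|
      ≤ r ^ (-D) * (L * A * (∫ y : E, ‖lk a b p y‖ * ‖y‖) * r⁻¹) := by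
    calc _ = |r ^ (-D) * T (lk a b p) v fun x => mollScale ϱ r x • w| := by
          rw [abs_mul, abs_of_pos hrD]
      _ = |T (fun y => lk a b p (r • y)) (fun x => v (r • x)) fun x => ϱ x • w| := by
          rw [h3]; simp only [mollScale, smul_smul, ← hD]
      _ ≤ _ := h1.trans (le_of_eq (by rw [hmi]; ring))
  exact le_of_mul_le_mul_left h4 hrD

lemma exists_avg_small [Nontrivial E] (hp : (finrank ℝ E : ℝ) < p) (hp' : p < finrank ℝ E + 1)
    (h1 : a + b / p ≠ 0) (h2 : a + b * (1 + (p - finrank ℝ E)) / p ≠ 0)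
    {ϱ : E → ℝ} {A : ℝ} (hϱ : Moll ϱ A) {δ η : ℝ} (hδ : 0 < δ) (hδ1 : δ ≤ 1) (hη : 0 < η) :
    ∃ ε > 0, ∀ w : E, ‖w‖ ≤ 1 → ∃ M > 0, ∀ (v : E → E) (U : ℝ) (P : Set E), Continuous v →
      (∀ x, ‖v x‖ ≤ U) → HB a b p v 1 (ε ^ (p - finrank ℝ E)) →
      (∀ x ∈ P, ‖op (gk a b p) v x‖ ≤ M) →
      (∀ φ : E → E, Test φ → Disjoint (tsupport φ) P →
        |T (ker a b p) v φ| ≤ M * ∫ x, ‖φ x‖) →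
      |T (ker a b p) v fun x => mollScale ϱ (δ * ε) x • w| ≤ η := by
  set κ := p - finrank ℝ E with hκ
  have hκ0 : 0 < κ := by linarith
  have hκ1 : κ < 1 := by linarith
  obtain ⟨C, hC, hreg⟩ := exists_regular (E := E) hp hp' h1 h2
  set I := ∫ y : E, ‖(lk a b p y : E →L[ℝ] E)‖ * ‖y‖ with hI
  obtain ⟨ε, hε, hεK⟩ : ∃ ε > 0, C * 2 * A * I / δ * ε ^ (-(1 - κ)) < η / 2 := by
    have h3 := (tendsto_rpow_neg_atTop (show 0 < 1 - κ by linarith)).const_mul (C * 2 * A * I / δ)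
    rw [mul_zero] at h3
    obtain ⟨ε, h4, h5⟩ := ((h3.eventually (gt_mem_nhds (half_pos hη))).and
      (eventually_gt_atTop 0)).exists
    exact ⟨ε, h5, h4⟩
  have hr : 0 < δ * ε := by positivity
  refine ⟨ε, hε, fun w hw => ?_⟩
  obtain ⟨A', hϱ'⟩ := hϱ.scale hr
  obtain ⟨M, hM, hal⟩ := exists_alternative hp hp' h1 h2 hε hϱ' hw (half_pos hη)
  refine ⟨M, hM, fun v U P hv hU hb hP hT => ?_⟩
  rcases hal v U P hv hU (fun φ A B hφ => by simpa using hb φ A B hφ)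
    (fun x hx => (abs_real_inner_le_norm _ _).trans
      ((mul_le_of_le_one_right (norm_nonneg _) hw).trans (hP x hx))) hT with h3 | h3
  · linarith
  rw [T_ker_split hp hp' hv hU (hϱ'.test_smul hw).1.choose_spec.choose_spec]
  have hDB := (hreg (fun x => v ((δ * ε) • x)) U (2 * ε ^ κ) (hv.comp (continuous_const_smul _))
    (fun x => hU _) (by positivity) fun φ A B hφ => by
      refine (hb.scale hr φ A B hφ).trans ?_
      have hA := hφ.nonneg_left
      have hB := hφ.nonneg_right
      have h4 := Real.geom_mean_le_arith_mean2_weighted (show 0 ≤ 1 - κ by linarith) hκ0.le hA hB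
        (by ring)
      have h5 : (δ * ε) ^ κ ≤ ε ^ κ :=
        Real.rpow_le_rpow hr.le (mul_le_of_le_one_left hε.le hδ1) hκ0.le
      have h6 : A ^ (1 - κ) * B ^ κ ≤ A + B := by nlinarith
      have h7 : 0 ≤ ε ^ κ := by positivity
      rw [← hκ]
      nlinarith).1
  have h4 := T_lk_mollScale_le (a := a) (b := b) hp hp' hr hv hU hDB hϱ hw
  have e : C * (2 * ε ^ κ) * A * I * (δ * ε)⁻¹ = C * 2 * A * I / δ * ε ^ (-(1 - κ)) := by
    rw [neg_sub, Real.rpow_sub_one hε.ne']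
    field_simp
  rw [← hI, e] at h4
  exact (abs_add_le _ _).trans (by linarith)

lemma abs_le_of_basis (l : E →ₗ[ℝ] ℝ) {η : ℝ} (h : ∀ i, |l (stdOrthonormalBasis ℝ E i)| ≤ η)
    (w : E) : |l w| ≤ finrank ℝ E * η * ‖w‖ := by
  rw [← (stdOrthonormalBasis ℝ E).sum_repr' w, map_sum]
  refine (Finset.abs_sum_le_sum_abs _ _).trans ((Finset.sum_le_card_nsmul _ _ (η * ‖w‖)
    fun i _ => ?_).trans (le_of_eq ?_))
  · rw [map_smul, smul_eq_mul, abs_mul, mul_comm]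
    refine mul_le_mul (h i) ?_ (abs_nonneg _) ((abs_nonneg _).trans (h i))
    refine (abs_real_inner_le_norm _ _).trans ?_
    simp
  · rw [(stdOrthonormalBasis ℝ E).sum_repr']; simp [mul_assoc]

lemma T_conv_sid_le [Nontrivial E] {k : E → E →L[ℝ] E} (hk : WK k) {v : E → E} {U : ℝ}
    (hv : Continuous v) (hU : ∀ x, ‖v x‖ ≤ U) {θ : E → ℝ} {A B : ℝ} (hθ : TF θ A B) {η : ℝ}
    (h : ∀ z i, |T k (fun x => v (x + z)) fun x => θ x • stdOrthonormalBasis ℝ E i| ≤ η)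
    {φ : E → E} (hφ : Integrable φ) :
    |T k v (conv (sid θ) φ)| ≤ finrank ℝ E * η * ∫ x, ‖φ x‖ := by
  rw [(T_conv hk hv hU (sid_tf hθ) hφ).2, ← integral_const_mul, ← Real.norm_eq_abs]
  refine norm_integral_le_of_norm_le (hφ.norm.const_mul _) (Eventually.of_forall fun z => ?_)
  have ht (w : E) : ∃ A B, TF (fun x => θ (x + -z) • w) A B :=
    ⟨_, _, (hθ.translate (-z)).clm (ContinuousLinearMap.toSpanSingleton ℝ w)⟩
  let l : E →ₗ[ℝ] ℝ :=
    { toFun := fun w => T k v fun x => θ (x + -z) • w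
      map_add' := fun w w' => by
        obtain ⟨_, _, h1⟩ := ht w
        obtain ⟨_, _, h2⟩ := ht w'
        simp only [smul_add]
        exact T_add hk hv hU h1 h2
      map_smul' := fun c w => by
        simp only [smul_comm _ c w, T_smul, RingHom.id_apply, smul_eq_mul] }
  have h3 := abs_le_of_basis l (η := η) (fun i => by
    have := h z i
    rw [T_comp_add] at this
    exact this) (φ z)
  rw [Real.norm_eq_abs]
  simpa [l, sid, sub_eq_add_neg] using h3

lemma TF.sub {φ ψ : E → F} {A B A' B' : ℝ} (h : TF φ A B) (h' : TF ψ A' B') :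
    TF (fun x => φ x - ψ x) (A + A') (B + B') := by
  have h1 := h.add (h'.const_smul (-1))
  simpa [sub_eq_add_neg] using h1

/-- Small data halve the weak form at the critical scale. -/
lemma exists_half [Nontrivial E] (hp : (finrank ℝ E : ℝ) < p) (hp' : p < finrank ℝ E + 1)
    (h1 : a + b / p ≠ 0) (h2 : a + b * (1 + (p - finrank ℝ E)) / p ≠ 0) :
    ∃ ε > 0, ∃ M > 0, ∀ (v : E → E) (U : ℝ) (P : Set E), Continuous v →
      (∀ x, ‖v x‖ ≤ U) → HB a b p v 1 (ε ^ (p - finrank ℝ E)) → Data a b p v P M →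
      ∀ φ, TF φ 1 (1 / ε) → |T (ker a b p) v φ| ≤ 1 / 2 := by
  set κ := p - finrank ℝ E with hκ
  have hκ0 : 0 < κ := by linarith
  have hκ1 : κ < 1 := by linarith
  obtain ⟨ϱ, A₀, hϱ⟩ := exists_moll (E := E)
  set m := ∫ y, ‖y‖ * ‖ϱ y‖ with hm
  set N := ∫ y, ‖ϱ y‖ with hN
  have hm0 : 0 ≤ m := integral_nonneg fun _ => by positivity
  have hN0 : 0 ≤ N := integral_nonneg fun _ => norm_nonneg _
  obtain ⟨δ, hδ, hδ1, hδs⟩ : ∃ δ > 0, δ ≤ 1 ∧ δ * m + (δ * m) ^ (1 - κ) * (1 + N) ^ κ ≤ 1 / 4 := by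
    have h3 : Tendsto (fun δ : ℝ => δ * m + (δ * m) ^ (1 - κ) * (1 + N) ^ κ) (𝓝 0)
        (𝓝 (0 * m + (0 * m) ^ (1 - κ) * (1 + N) ^ κ)) := by
      refine (tendsto_id.mul_const _).add (Tendsto.mul_const _ ?_)
      exact (tendsto_id.mul_const m).rpow_const (Or.inr (by linarith))
    rw [zero_mul, Real.zero_rpow (by linarith), zero_mul, add_zero] at h3
    obtain ⟨η, hη, h4⟩ := Metric.eventually_nhds_iff.1
      (h3.eventually (gt_mem_nhds (show (0 : ℝ) < 1 / 4 by norm_num)))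
    refine ⟨min (η / 2) 1, by positivity, min_le_right _ _, (h4 ?_).le⟩
    rw [Real.dist_eq, sub_zero, abs_of_pos (by positivity)]
    exact (min_le_left _ _).trans_lt (by linarith)
  obtain ⟨ε, hε, havg⟩ := exists_avg_small hp hp' h1 h2 hϱ hδ hδ1
    (show 0 < 1 / (4 * ((finrank ℝ E : ℝ) + 1)) by positivity)
  have hr : 0 < δ * ε := by positivity
  choose M hM hMb using fun i => havg (stdOrthonormalBasis ℝ E i) (by simp)
  set cE := |etaA E p| + |etaB E p| with hcE
  have hcE0 : 0 ≤ cE := by positivity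
  obtain ⟨M₀, hM₀, hM₀i⟩ : ∃ M₀ > 0, ∀ i, M₀ ≤ M i := by
    have : Nonempty (Fin (finrank ℝ E)) := ⟨⟨0, finrank_pos⟩⟩
    obtain ⟨i, hi⟩ := Finite.exists_min M
    exact ⟨M i, hM i, hi⟩
  refine ⟨ε, hε, M₀ / (cE + 1), by positivity, fun v U P hv hU hb hd φ hφ => ?_⟩
  have hle : M₀ / (cE + 1) ≤ M₀ := div_le_self hM₀.le (by linarith)
  have hle' : cE * (M₀ / (cE + 1)) ≤ M₀ := by
    rw [mul_div_assoc', div_le_iff₀ (by positivity)]; nlinarith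
  set θ := mollScale ϱ (δ * ε) with hθ
  have hk := ker_wk (a := a) (b := b) hp hp'
  have hθT := hϱ.w2.1.mollScale hr
  have hc := conv_tf (k := sid θ) (sid_tf hθT).int hφ
  have hNθ : ∫ y, ‖sid θ y‖ = N := by
    simp only [sid_norm, ← Real.norm_eq_abs]
    rw [integral_mollScale ϱ hr (fun _ y => ‖y‖) 1 fun x => ?_, one_mul]
    rw [norm_mul, Real.norm_of_nonneg (by positivity), one_mul]
  have hmθ : ∫ y, ‖y‖ * ‖θ y‖ = δ * ε * m := by
    rw [integral_mollScale ϱ hr (fun x y => ‖x‖ * ‖y‖) (δ * ε) fun x => ?_]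
    rw [norm_smul, Real.norm_of_nonneg hr.le, norm_mul, Real.norm_of_nonneg (by positivity)]
    ring
  have hmass : ∫ y, θ y = 1 := by
    rw [integral_mollScale ϱ hr (fun _ y => y) 1 (by simp), hϱ.mass, mul_one]
  have hθm : Integrable fun y => ‖y‖ * ‖θ y‖ := by
    obtain ⟨_, h⟩ := hϱ.scale hr
    exact h.moment
  rw [hNθ] at hc
  have hdiff : TF (fun x => φ x - conv (sid θ) φ x) (δ * m) ((1 + N) / ε) := by
    refine ⟨(hφ.sub hc).int, (conv_sid_sub hθT.int hθm hmass hφ).trans (le_of_eq ?_), fun h => ?_⟩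
    · rw [hmθ]; field_simp
    · refine ((hφ.sub hc).lip h).trans (le_of_eq ?_)
      ring
  have e : T (ker a b p) v φ = T (ker a b p) v (fun x => φ x - conv (sid θ) φ x)
      + T (ker a b p) v (conv (sid θ) φ) := by
    rw [T_sub hk hv hU hφ hc]; ring
  have hT1 := hb _ _ _ hdiff
  have hT2 := T_conv_sid_le hk hv hU hθT (η := 1 / (4 * ((finrank ℝ E : ℝ) + 1))) (fun z i => by
    have hd' := hd.translate z
    refine hMb i _ U {x | x + z ∈ P} (by fun_prop) (fun x => hU _) (hb.translate z)
      (fun x hx => ?_) fun ψ hψ hψd => ?_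
    · refine (op_gk_bound hp (by fun_prop) (fun x => hU _) x (hd'.reg x hx)).trans ?_
      exact hle'.trans (hM₀i i)
    · refine (hd'.off ψ hψ hψd).trans ?_
      gcongr
      exact hle.trans (hM₀i i)) hφ.int
  have h5 : (finrank ℝ E : ℝ) * (1 / (4 * ((finrank ℝ E : ℝ) + 1))) * ∫ x, ‖φ x‖ ≤ 1 / 4 := by
    have h6 : (finrank ℝ E : ℝ) * (1 / (4 * ((finrank ℝ E : ℝ) + 1))) ≤ 1 / 4 := by
      rw [mul_one_div, div_le_div_iff₀ (by positivity) (by norm_num)]; linarith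
    have h7 := hφ.l1
    calc _ ≤ (1 / 4 : ℝ) * 1 := by gcongr
      _ = 1 / 4 := by norm_num
  have h6 : ε ^ κ * ((δ * m) ^ (1 - κ) * ((1 + N) / ε) ^ κ)
      = (δ * m) ^ (1 - κ) * (1 + N) ^ κ := by
    rw [Real.div_rpow (by positivity) hε.le]
    field_simp
  rw [← hκ, h6] at hT1
  rw [e]
  refine (abs_add_le _ _).trans ?_
  linarith

end WeakBound

section Descent

lemma Data.mono {v : E → E} {P : Set E} {M M' : ℝ} (h : Data a b p v P M) (hM : M ≤ M') :
    Data a b p v P M' :=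
  ⟨fun x hx ε hε => (h.reg x hx ε hε).trans hM, fun φ hφ hd => (h.off φ hφ hd).trans (by
    gcongr)⟩

lemma HB.mono {v : E → E} {S Q S' Q' : ℝ} (h : HB a b p v S Q) [Nontrivial E] (hS : S ≤ S')
    (hQ : Q ≤ Q') : HB a b p v S' Q' := by
  intro φ A B hφ
  have hA := hφ.nonneg_left
  have hB := hφ.nonneg_right
  refine (h φ A B hφ).trans ?_
  gcongr

/-- Data bounds on a set and off it give a global weak bound of order zero. -/
lemma exists_weak_bound [Nontrivial E] (hp : (finrank ℝ E : ℝ) < p) (hp' : p < finrank ℝ E + 1)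
    (h1 : a + b / p ≠ 0) (h2 : a + b * (1 + (p - finrank ℝ E)) / p ≠ 0) :
    ∃ C, 0 ≤ C ∧ ∀ (v : E → E) (U : ℝ) (P : Set E) (M : ℝ), Continuous v → (∀ x, ‖v x‖ ≤ U) →
      0 < M → Data a b p v P M → HB a b p v (C * M) 0 := by
  obtain ⟨ε, hε, M₀, hM₀, hhalf⟩ := exists_half (E := E) hp hp' h1 h2
  have hκ0 : 0 < p - finrank ℝ E := by linarith
  have hκ1 : p - finrank ℝ E < 1 := by linarith
  refine ⟨1 / M₀, by positivity, fun v U P M hv hU hM hd => ?_⟩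
  have hU0 : 0 ≤ U := (norm_nonneg _).trans (hU 0)
  set S := 1 / M₀ * M with hS
  have hS0 : 0 < S := by positivity
  have step (Q : ℝ) (hQ : 0 < Q) (hb : HB a b p v S Q) : HB a b p v S (Q / 2) := by
    intro φ A B hφ
    have hT := T_ker_bound (a := a) (b := b) hp hp' hU hφ
    rcases hφ.nonneg_left.eq_or_lt with hA | hA
    · rw [← hA, Real.zero_rpow (by linarith)] at hT ⊢
      simpa using hT
    rcases hφ.nonneg_right.eq_or_lt with hB | hB
    · rw [← hB, Real.zero_rpow (by linarith)] at hT ⊢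
      refine hT.trans ?_
      simp only [mul_zero, add_zero]
      positivity
    set κ := p - finrank ℝ E with hκ
    set D : ℝ := (finrank ℝ E : ℝ) with hD
    set S' := max S (Q * (B / A) ^ κ) with hS'
    have hS'0 : 0 < S' := lt_max_of_lt_left hS0
    set t := (Q / S') ^ (1 / κ) / ε with ht
    have ht0 : 0 < t := by positivity
    have htκ : t ^ κ * ε ^ κ = Q / S' := by
      rw [← Real.mul_rpow ht0.le hε.le, ht, div_mul_cancel₀ _ hε.ne',
        ← Real.rpow_mul (by positivity), one_div_mul_cancel hκ0.ne', Real.rpow_one]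
    set c := (t ^ κ * S')⁻¹ with hc
    have hc0 : 0 < c := by positivity
    have hb' := ((hb.mono (le_max_left _ _) le_rfl : HB a b p v S' Q).scale ht0).smul c
    rw [abs_of_pos hc0, ← hκ, hc, inv_mul_cancel₀ (by positivity), ← hc] at hb'
    have e1 : c * Q = ε ^ κ := by
      have : Q = t ^ κ * ε ^ κ * S' := by rw [htκ, div_mul_cancel₀ _ hS'0.ne']
      rw [hc, inv_mul_eq_div, div_eq_iff (by positivity)]
      linarith
    rw [e1] at hb'
    have hd' := ((hd.scale ht0).smul c).mono (M' := M₀) (by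
      have e0 : (t ^ κ * S')⁻¹ * (t ^ κ * M) = M / S' := by field_simp
      rw [abs_of_pos hc0, ← hκ, hc, e0, div_le_iff₀ hS'0]
      have : S ≤ S' := le_max_left _ _
      rw [hS, one_div_mul_eq_div, div_le_iff₀ hM₀] at this
      linarith)
    have e2 : t ^ D / A * (t ^ (-D) * A) = 1 := by
      rw [Real.rpow_neg ht0.le]; field_simp
    have hφ' : TF (fun x => (t ^ D / A) • φ (t • x)) 1 (1 / ε) := by
      refine ((hφ.scale ht0).const_smul (t ^ D / A)).mono ?_ ?_
      · rw [abs_of_pos (by positivity), ← hD, e2]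
      · rw [abs_of_pos (by positivity), ← hD]
        have e3 : t ^ D / A * (t ^ (-D) * (t * B)) = t * (B / A) := by
          rw [Real.rpow_neg ht0.le]; field_simp
        rw [e3, ht, div_mul_eq_mul_div]
        gcongr
        refine (Real.rpow_le_rpow_iff (by positivity) zero_le_one hκ0).1 ?_
        rw [Real.one_rpow, Real.mul_rpow (by positivity) (by positivity),
          ← Real.rpow_mul (by positivity), one_div_mul_cancel hκ0.ne', Real.rpow_one,
          div_mul_eq_mul_div, div_le_one hS'0]
        exact le_max_right _ _
    have h3 := hhalf (fun x => c • v (t • x)) (c * U) _ (by fun_prop) (fun x => by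
      rw [norm_smul, Real.norm_of_nonneg hc0.le]; gcongr; exact hU _) hb' hd' _ hφ'
    rw [T_const_smul_left, T_smul (ker a b p) (fun x => v (t • x)) _ fun x => φ (t • x),
      T_ker_scale ht0, ← hD, abs_mul, abs_mul, abs_mul, abs_of_pos hc0,
      abs_of_pos (show 0 < t ^ D / A by positivity),
      abs_of_pos (show 0 < t ^ (p - 2 * D) by positivity)] at h3
    have e4 : c * (t ^ D / A * (t ^ (p - 2 * D) * |T (ker a b p) v φ|))
        = |T (ker a b p) v φ| / (S' * A) := by
      have : t ^ D * t ^ (p - 2 * D) = t ^ κ := by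
        rw [← Real.rpow_add ht0, hκ]; ring_nf
      rw [hc, ← this]
      field_simp
    rw [e4, div_le_iff₀ (by positivity)] at h3
    have h4 : S' ≤ S + Q * (B / A) ^ κ :=
      max_le (by linarith [show 0 ≤ Q * (B / A) ^ κ by positivity]) (by linarith)
    have e5 : (B / A) ^ κ * A = A ^ (1 - κ) * B ^ κ := by
      rw [Real.div_rpow hB.le hA.le, Real.rpow_sub hA 1 κ, Real.rpow_one]
      field_simp
    have h5 : S' * A ≤ S * A + Q * (A ^ (1 - κ) * B ^ κ) := by
      rw [← e5, ← mul_assoc, ← add_mul]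
      gcongr
    have h6 : 0 ≤ S * A := by positivity
    linarith
  set Q₀ := kC E a b p * U + 1 with hQ₀
  have hkC := kC_nonneg (E := E) (a := a) (b := b) (p := p)
  have hQ₀0 : 0 < Q₀ := by positivity
  have key (n : ℕ) : HB a b p v S (Q₀ * (1 / 2) ^ n) := by
    induction n with
    | zero =>
      intro φ A B hφ
      have hA := hφ.nonneg_left
      have hB := hφ.nonneg_right
      refine (T_ker_bound hp hp' hU hφ).trans ?_
      have : 0 ≤ A ^ (1 - (p - finrank ℝ E)) * B ^ (p - finrank ℝ E) := by positivity
      rw [pow_zero, mul_one, hQ₀, add_mul (kC E a b p * U)]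
      have h6 : 0 ≤ S * A := by positivity
      linarith
    | succ n ih =>
      have := step _ (by positivity) ih
      convert this using 1
      ring
  intro φ A B hφ
  have hl : Tendsto (fun n : ℕ => S * A + Q₀ * (1 / 2) ^ n *
      (A ^ (1 - (p - finrank ℝ E)) * B ^ (p - finrank ℝ E))) atTop (𝓝 (S * A + Q₀ * 0 *
      (A ^ (1 - (p - finrank ℝ E)) * B ^ (p - finrank ℝ E)))) :=
    (((tendsto_pow_atTop_nhds_zero_of_lt_one (by norm_num) (by norm_num)).const_mul _).mul_const
      _).const_add _
  rw [mul_zero] at hl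
  exact ge_of_tendsto' hl fun n => key n φ A B hφ

end Descent

section Representation

lemma op_continuous {k : E → E →L[ℝ] E} (hk : Integrable k) {v : E → E} {U : ℝ}
    (hv : Continuous v) (hU : ∀ x, ‖v x‖ ≤ U) : Continuous (op k v) := by
  refine continuous_of_dominated (bound := fun y => ‖k y‖ * (U + U)) (fun x => ?_)
    (fun x => Eventually.of_forall fun y => ?_) (hk.norm.mul_const _)
    (Eventually.of_forall fun y => by fun_prop)
  · exact aesm_clm_apply hk.aestronglyMeasurable
      (continuous_const.sub (hv.comp (continuous_const.sub continuous_id))).aestronglyMeasurable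
  · exact ((k y).le_opNorm _).trans (by
      gcongr; exact (norm_sub_le _ _).trans (add_le_add (hU _) (hU _)))

/-- The regularised operator at scale `t`. -/
def opScale (a b p t : ℝ) (v : E → E) (x : E) : E :=
  t ^ (-(p - finrank ℝ E)) • op (gk a b p) (fun z => v (t • z)) (t⁻¹ • x)

lemma opScale_continuous (hp : (finrank ℝ E : ℝ) < p) {v : E → E} {U : ℝ}
    (hv : Continuous v) (hU : ∀ x, ‖v x‖ ≤ U) (t : ℝ) : Continuous (opScale a b p t v) := by
  have := op_continuous (gk_integrable (a := a) (b := b) hp)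
    (hv.comp (continuous_const_smul t)) fun x => hU _
  exact (this.comp (continuous_const_smul t⁻¹)).const_smul _

lemma tendsto_integral_opScale [Nontrivial E] (hp : (finrank ℝ E : ℝ) < p)
    (hp' : p < finrank ℝ E + 1) {v : E → E} {U : ℝ} (hv : Continuous v) (hU : ∀ x, ‖v x‖ ≤ U)
    {ψ : E → E} {A B : ℝ} (hψ : TF ψ A B) :
    Tendsto (fun t => ∫ x, ⟪opScale a b p t v x, ψ x⟫) (𝓝[>] 0) (𝓝 (T (ker a b p) v ψ)) := by
  set D : ℝ := (finrank ℝ E : ℝ) with hD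
  set I := ∫ y : E, ‖(lk a b p y : E →L[ℝ] E)‖ * ‖y‖ with hI
  have hU0 : 0 ≤ U := (norm_nonneg _).trans (hU 0)
  have hA := hψ.nonneg_left
  have hB := hψ.nonneg_right
  have key : ∀ t : ℝ, 0 < t → dist (∫ x, ⟪opScale a b p t v x, ψ x⟫) (T (ker a b p) v ψ)
      ≤ t ^ (1 - (p - D)) * (U * B * I) := by
    intro t ht
    have hvt : Continuous fun z => v (t • z) := by fun_prop
    have hs := hψ.scale ht
    have e1 := T_ker_scale (a := a) (b := b) (p := p) ht v ψ
    rw [T_ker_split hp hp' hvt (fun x => hU _) hs] at e1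
    have e2 : ∫ x, ⟪op (gk a b p) (fun z => v (t • z)) x, ψ (t • x)⟫
        = t ^ (p - 2 * D) * ∫ x, ⟪opScale a b p t v x, ψ x⟫ := by
      have h := integral_comp_smul_pos (fun x => ⟪opScale a b p t v x, ψ x⟫) ht
      simp only [opScale, smul_smul, inv_mul_cancel₀ ht.ne', one_smul, real_inner_smul_left,
        integral_const_mul, smul_eq_mul, ← hD] at h ⊢
      have h3 : t ^ (p - 2 * D) = t ^ (p - D) * t ^ (-D) := by
        rw [← Real.rpow_add ht]; ring_nf
      rw [h3, mul_assoc, ← h, ← mul_assoc, ← Real.rpow_add ht, add_neg_cancel, Real.rpow_zero,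
        one_mul]
    have h4 : |T (lk a b p) (fun z => v (t • z)) fun x => ψ (t • x)|
        ≤ U * (t ^ (-D) * (t * B) * I) := by
      refine (T_bound (lk_wk hp hp') (fun x => hU _) hs).trans
        (mul_le_mul_of_nonneg_left ?_ hU0)
      rw [hI, ← integral_const_mul]
      refine integral_mono_of_nonneg (Eventually.of_forall fun y => ?_)
        ((lk_moment hp hp').const_mul _) (Eventually.of_forall fun y => ?_)
      · positivity
      · have := min_le_right (2 * (t ^ (-D) * A)) (t ^ (-D) * (t * B) * ‖y‖)
        calc _ ≤ ‖(lk a b p y : E →L[ℝ] E)‖ * (t ^ (-D) * (t * B) * ‖y‖) :=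
            mul_le_mul_of_nonneg_left this (norm_nonneg _)
          _ = _ := by ring
    have hc : 0 < t ^ (p - 2 * D) := by positivity
    rw [e2, ← hD] at e1
    rw [Real.dist_eq]
    refine le_of_mul_le_mul_left (a := t ^ (p - 2 * D)) ?_ hc
    rw [← abs_of_pos hc, ← abs_mul, abs_of_pos hc, mul_sub, ← e1, sub_add_cancel_left, abs_neg]
    refine h4.trans (le_of_eq ?_)
    have h5 : t ^ (p - 2 * D) * t ^ (1 - (p - D)) = t ^ (-D) * t := by
      rw [← Real.rpow_add ht, ← Real.rpow_add_one ht.ne']; ring_nf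
    linear_combination (-(U * B * I)) * h5
  refine tendsto_iff_dist_tendsto_zero.2 (squeeze_zero' (Eventually.of_forall fun _ => dist_nonneg)
    (eventually_nhdsWithin_of_forall fun t ht => key t ht) ?_)
  have h6 : Tendsto (fun t : ℝ => t ^ (1 - (p - D)) * (U * B * I)) (𝓝 0)
      (𝓝 ((0 : ℝ) ^ (1 - (p - D)) * (U * B * I))) :=
    ((Real.continuousAt_rpow_const _ _ (Or.inr (by linarith))).tendsto).mul_const _
  rw [Real.zero_rpow (by linarith), zero_mul] at h6
  exact h6.mono_left nhdsWithin_le_nhds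

lemma norm_le_of_inner_le {x : E} {c : ℝ} (h : ∀ w : E, ‖w‖ ≤ 1 → |⟪x, w⟫| ≤ c) : ‖x‖ ≤ c := by
  have h1 := h (‖x‖⁻¹ • x) (by rw [norm_smul, norm_inv, norm_norm]; exact inv_mul_le_one)
  rw [real_inner_smul_right, real_inner_self_eq_norm_sq] at h1
  rcases eq_or_ne ‖x‖ 0 with h0 | h0
  · rw [h0] at h1 ⊢; simpa using h1
  · rwa [sq, ← mul_assoc, inv_mul_cancel₀ h0, one_mul, abs_of_nonneg (norm_nonneg _)] at h1

lemma exists_opScale_bound [Nontrivial E] (hp : (finrank ℝ E : ℝ) < p)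
    (hp' : p < finrank ℝ E + 1) (h1 : a + b / p ≠ 0)
    (h2 : a + b * (1 + (p - finrank ℝ E)) / p ≠ 0) {v : E → E} {U S : ℝ} (hv : Continuous v)
    (hU : ∀ x, ‖v x‖ ≤ U) (hS : 0 ≤ S) (hb : HB a b p v S 0) :
    ∃ L, ∀ t > 0, ∀ x, ‖opScale a b p t v x‖ ≤ L := by
  obtain ⟨C, hC, hreg⟩ := exists_regular (E := E) hp hp' h1 h2
  refine ⟨C * S, fun t ht x => ?_⟩
  have h3 := (hreg (fun z => v (t • z)) U (t ^ (p - finrank ℝ E) * S) (by fun_prop)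
    (fun x => hU _) (by positivity) fun φ A B hφ => by
      refine ((hb.scale ht) φ A B hφ).trans ?_
      have hB := hφ.nonneg_right
      rw [zero_mul, add_zero]
      gcongr
      linarith).2.1
  rw [opScale, norm_smul, Real.norm_of_nonneg (by positivity), Real.rpow_neg ht.le,
    inv_mul_le_iff₀ (by positivity)]
  refine (norm_le_of_inner_le (h3 _)).trans (le_of_eq (by ring))

lemma abs_integral_inner_le {h ψ : E → E} {M : ℝ} (hM : ∀ x, ‖h x‖ ≤ M) (hψ : Integrable ψ) :
    |∫ x, ⟪h x, ψ x⟫| ≤ M * ∫ x, ‖ψ x‖ := by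
  rw [← integral_const_mul, ← Real.norm_eq_abs]
  refine norm_integral_le_of_norm_le (hψ.norm.const_mul _) (Eventually.of_forall fun x => ?_)
  exact (norm_inner_le_norm _ _).trans (by gcongr; exact hM x)

lemma T_sub_integral_le [Nontrivial E] (hp : (finrank ℝ E : ℝ) < p) (hp' : p < finrank ℝ E + 1)
    {v h : E → E} {U M M' L : ℝ} {P : Set E} (hv : Continuous v) (hU : ∀ x, ‖v x‖ ≤ U)
    (hP : IsClosed P) (hh : Continuous h) (hM' : ∀ x, ‖h x‖ ≤ M')
    (hreg : ∀ x ∈ P, ∀ ε > 0, ‖trunc (ker a b p) v ε x‖ ≤ M)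
    (hlim : ∀ x ∈ P, Tendsto (fun ε => trunc (ker a b p) v ε x) (𝓝[>] 0) (𝓝 (h x)))
    (hL : ∀ t > 0, ∀ x, ‖opScale a b p t v x‖ ≤ L) {ψ : E → E} {A B : ℝ} (hψ : TF ψ A B) :
    |T (ker a b p) v ψ - ∫ x, ⟪h x, ψ x⟫| ≤ (L + M') * ∫ x in Pᶜ, ‖ψ x‖ := by
  have hi (t : ℝ) (ht : 0 < t) : Integrable fun x => ⟪opScale a b p t v x - h x, ψ x⟫ :=
    pair_integrable ((opScale_continuous hp hv hU t).sub hh)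
      (fun x => (norm_sub_le _ _).trans (add_le_add (hL t ht x) (hM' x))) hψ.int
  have h1 : Tendsto (fun t => ∫ x, ⟪opScale a b p t v x - h x, ψ x⟫) (𝓝[>] 0)
      (𝓝 (T (ker a b p) v ψ - ∫ x, ⟪h x, ψ x⟫)) := by
    refine Tendsto.congr' ?_ ((tendsto_integral_opScale hp hp' hv hU hψ).sub_const _)
    filter_upwards [self_mem_nhdsWithin] with t ht
    rw [← integral_sub (pair_integrable (opScale_continuous hp hv hU t) (hL t ht) hψ.int)
      (pair_integrable hh hM' hψ.int)]
    simp only [inner_sub_left]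
  have h2 : Tendsto (fun t => ∫ x in P, ⟪opScale a b p t v x - h x, ψ x⟫) (𝓝[>] 0) (𝓝 0) := by
    have h0 : ∫ x in P, (0 : ℝ) = 0 := by simp
    conv => arg 3; rw [← h0]
    refine tendsto_integral_filter_of_dominated_convergence (fun x => (L + M') * ‖ψ x‖) ?_ ?_
      (hψ.int.norm.const_mul _).integrableOn ?_
    · filter_upwards [self_mem_nhdsWithin] with t ht
      exact (hi t ht).aestronglyMeasurable.restrict
    · filter_upwards [self_mem_nhdsWithin] with t ht
      refine Eventually.of_forall fun x => ?_
      refine (norm_inner_le_norm _ _).trans ?_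
      gcongr
      exact (norm_sub_le _ _).trans (add_le_add (hL t ht x) (hM' x))
    · filter_upwards [ae_restrict_mem hP.measurableSet] with x hx
      have h3 : Tendsto (fun t => opScale a b p t v x) (𝓝[>] 0) (𝓝 (h x)) :=
        op_gk_tendsto hp hv hU x (hreg x hx) (hlim x hx)
      have h4 := (h3.sub_const (h x)).inner (𝕜 := ℝ) (tendsto_const_nhds (x := ψ x))
      simpa using h4
  have h5 := (h1.sub h2).abs
  rw [sub_zero] at h5
  refine le_of_tendsto h5 ?_
  filter_upwards [self_mem_nhdsWithin] with t ht
  rw [← integral_add_compl hP.measurableSet (hi t ht), add_sub_cancel_left,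
    ← integral_const_mul, ← Real.norm_eq_abs]
  refine norm_integral_le_of_norm_le (hψ.int.norm.const_mul _).integrableOn
    (Eventually.of_forall fun x => ?_)
  refine (norm_inner_le_norm _ _).trans ?_
  gcongr
  exact (norm_sub_le _ _).trans (add_le_add (hL t ht x) (hM' x))

lemma blip_dist_cut (P : Set E) {δ : ℝ} (hδ : 0 < δ) :
    BLip fun x => max 0 (min 1 (Metric.infDist x P / δ - 1)) := by
  refine ⟨1, δ⁻¹, fun x => ?_, fun x y => ?_⟩
  · rw [abs_of_nonneg (le_max_left _ _)]
    exact max_le zero_le_one (min_le_left _ _)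
  · have h1 : |Metric.infDist x P - Metric.infDist y P| ≤ ‖x - y‖ := by
      rw [← dist_eq_norm, ← Real.dist_eq]
      simpa using (Metric.lipschitz_infDist_pt P).dist_le_mul x y
    simp only [max_comm (0 : ℝ)]
    refine (abs_max_sub_max_le_abs _ _ _).trans ((abs_min_sub_min_le_max _ _ _ _).trans
      (max_le ?_ ?_))
    · rw [sub_self, abs_zero]; positivity
    · rw [sub_sub_sub_cancel_right, ← sub_div, abs_div, abs_of_pos hδ, div_eq_inv_mul]
      gcongr

/-- The strong equation on a closed set and the weak equation off it give the weak equation. -/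
lemma T_eq_of_data [Nontrivial E] (hp : (finrank ℝ E : ℝ) < p) (hp' : p < finrank ℝ E + 1)
    (h1 : a + b / p ≠ 0) (h2 : a + b * (1 + (p - finrank ℝ E)) / p ≠ 0)
    {v h : E → E} {U M M' : ℝ} {P : Set E} (hv : Continuous v) (hU : ∀ x, ‖v x‖ ≤ U)
    (hP : IsClosed P) (hh : Continuous h) (hM' : ∀ x, ‖h x‖ ≤ M')
    (hreg : ∀ x ∈ P, ∀ ε > 0, ‖trunc (ker a b p) v ε x‖ ≤ M)
    (hlim : ∀ x ∈ P, Tendsto (fun ε => trunc (ker a b p) v ε x) (𝓝[>] 0) (𝓝 (h x)))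
    (hoff : ∀ φ : E → E, Test φ → Disjoint (tsupport φ) P →
      T (ker a b p) v φ = ∫ x, ⟪h x, φ x⟫) {φ : E → E} (hφ : Test φ) :
    T (ker a b p) v φ = ∫ x, ⟪h x, φ x⟫ := by
  rcases P.eq_empty_or_nonempty with rfl | hne
  · exact hoff φ hφ (Set.disjoint_empty _)
  obtain ⟨C, hC, hw⟩ := exists_weak_bound (E := E) hp hp' h1 h2
  have hM'0 : 0 ≤ M' := (norm_nonneg _).trans (hM' 0)
  have hd : Data a b p v P (|M| + M' + 1) := by
    refine ⟨fun x hx ε hε => (hreg x hx ε hε).trans (by linarith [le_abs_self M]),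
      fun ψ hψ hψd => ?_⟩
    rw [hoff ψ hψ hψd]
    refine (abs_integral_inner_le hM' hψ.1.choose_spec.choose_spec.int).trans ?_
    gcongr
    linarith [abs_nonneg M]
  have hM0 : 0 < |M| + M' + 1 := by positivity
  obtain ⟨L, hL⟩ := exists_opScale_bound hp hp' h1 h2 hv hU (by positivity)
    (hw v U P _ hv hU hM0 hd)
  set η : ℕ → E → ℝ := fun n x =>
    max 0 (min 1 (Metric.infDist x P / (1 / ((n : ℝ) + 1)) - 1)) with hη
  have hηB n : BLip (η n) := blip_dist_cut P (by positivity)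
  have hη0 n x : 0 ≤ η n x := le_max_left _ _
  have hη1 n x : η n x ≤ 1 := max_le zero_le_one (min_le_left _ _)
  obtain ⟨⟨A, B, hT⟩, hs⟩ := id hφ
  have hk := ker_wk (a := a) (b := b) hp hp'
  have hbd (n : ℕ) : |T (ker a b p) v φ - ∫ x, ⟪h x, φ x⟫|
      ≤ (L + M') * ∫ x in Pᶜ, ‖(1 - η n x) • φ x‖ := by
    have t1 := hφ.mul (hηB n)
    have t2 := hφ.mul ((BLip.const 1).sub (hηB n))
    obtain ⟨A₁, B₁, h₁⟩ := id t1.1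
    obtain ⟨A₂, B₂, h₂⟩ := id t2.1
    have e : φ = fun x => η n x • φ x + (1 - η n x) • φ x := by ext x; module
    have e1 : T (ker a b p) v φ = T (ker a b p) v (fun x => η n x • φ x)
        + T (ker a b p) v fun x => (1 - η n x) • φ x := by
      conv_lhs => rw [e]
      exact T_add hk hv hU h₁ h₂
    have e2 : ∫ x, ⟪h x, φ x⟫ = (∫ x, ⟪h x, η n x • φ x⟫) + ∫ x, ⟪h x, (1 - η n x) • φ x⟫ := by
      rw [← integral_add (pair_integrable hh hM' h₁.int) (pair_integrable hh hM' h₂.int)]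
      simp only [← inner_add_right, ← add_smul, add_sub_cancel, one_smul]
    rw [e1, e2, hoff _ t1 (Set.disjoint_left.2 fun x hx hxP => ?_), add_sub_add_left_eq_sub]
    · exact T_sub_integral_le hp hp' hv hU hP hh hM' hreg hlim hL h₂
    · have hcl : IsClosed {x | 1 / ((n : ℝ) + 1) ≤ Metric.infDist x P} :=
        isClosed_le continuous_const (Metric.continuous_infDist_pt P)
      have hx' : x ∈ {x | 1 / ((n : ℝ) + 1) ≤ Metric.infDist x P} := by
        refine closure_minimal (fun y hy => ?_) hcl hx
        by_contra hlt
        refine hy ?_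
        simp only [Set.mem_ofPred_eq, not_le] at hlt
        have : Metric.infDist y P / (1 / ((n : ℝ) + 1)) - 1 ≤ 0 := by
          rw [sub_nonpos, div_le_one (by positivity)]; exact hlt.le
        simp only [hη]
        rw [max_eq_left ((min_le_right _ _).trans this), zero_smul]
      have h0 : (0 : ℝ) < 1 / ((n : ℝ) + 1) := by positivity
      rw [Set.mem_ofPred_eq, Metric.infDist_zero_of_mem hxP] at hx'
      linarith
  have hl : Tendsto (fun n : ℕ => (L + M') * ∫ x in Pᶜ, ‖(1 - η n x) • φ x‖) atTop
      (𝓝 ((L + M') * ∫ x in Pᶜ, (0 : ℝ))) := by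
    refine Tendsto.const_mul _ (tendsto_integral_of_dominated_convergence (fun x => ‖φ x‖)
      (fun n => ?_) hT.int.norm.integrableOn (fun n => Eventually.of_forall fun x => ?_) ?_)
    · have := (hφ.mul ((BLip.const 1).sub (hηB n))).1.choose_spec.choose_spec.int
      exact this.aestronglyMeasurable.norm.restrict
    · rw [norm_norm, norm_smul, Real.norm_of_nonneg (by linarith [hη1 n x])]
      exact mul_le_of_le_one_left (norm_nonneg _) (by linarith [hη0 n x])
    · filter_upwards [ae_restrict_mem hP.measurableSet.compl] with x hx
      have hpos : 0 < Metric.infDist x P := (hP.notMem_iff_infDist_pos hne).1 hx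
      obtain ⟨N, hN⟩ := exists_nat_ge (2 / Metric.infDist x P)
      refine tendsto_const_nhds.congr' ?_
      filter_upwards [eventually_ge_atTop N] with n hn
      have h3 : η n x = 1 := by
        have hn' : (N : ℝ) ≤ n := by exact_mod_cast hn
        have h4 : 2 ≤ ((n : ℝ) + 1) * Metric.infDist x P := by
          rw [← div_le_iff₀ hpos]; linarith
        have h5 : 1 ≤ Metric.infDist x P / (1 / ((n : ℝ) + 1)) - 1 := by
          rw [div_div_eq_mul_div, div_one]; linarith
        simp only [hη]
        rw [min_eq_left h5, max_eq_right zero_le_one]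
      simp [h3]
  rw [integral_zero, mul_zero] at hl
  have := ge_of_tendsto' hl hbd
  exact sub_eq_zero.1 (abs_nonpos_iff.1 this)

end Representation

section Localization

/-- The commutator of the operator with kernel `k` with multiplication by `χ`. -/
def comm (k : E → E →L[ℝ] E) (χ : E → ℝ) (u : E → E) (x : E) : E :=
  ∫ y, k y ((χ x - χ (x - y)) • u (x - y))

variable {k : E → E →L[ℝ] E} {χ : E → ℝ} {u : E → E} {σ L U : ℝ}

lemma comm_term_le (hU : ∀ x, ‖u x‖ ≤ U) (hσ : ∀ x, |χ x| ≤ σ)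
    (hL : ∀ x y, |χ x - χ y| ≤ L * ‖x - y‖) (x y : E) :
    ‖k y ((χ x - χ (x - y)) • u (x - y))‖ ≤ ‖k y‖ * min (2 * σ) (L * ‖y‖) * U := by
  refine ((k y).le_opNorm _).trans ?_
  rw [norm_smul, Real.norm_eq_abs, mul_assoc]
  have h : |χ x - χ (x - y)| ≤ min (2 * σ) (L * ‖y‖) :=
    le_min ((abs_sub _ _).trans (by linarith [hσ x, hσ (x - y)])) (by simpa using hL x (x - y))
  exact mul_le_mul_of_nonneg_left (mul_le_mul h (hU _) (norm_nonneg _)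
    ((abs_nonneg _).trans h)) (norm_nonneg _)

lemma lip_nonneg [Nontrivial E] (hL : ∀ x y, |χ x - χ y| ≤ L * ‖x - y‖) : 0 ≤ L := by
  obtain ⟨e, he⟩ := exists_ne (0 : E)
  have := (abs_nonneg _).trans (hL e 0)
  rw [sub_zero] at this
  exact nonneg_of_mul_nonneg_left this (norm_pos_iff.2 he)

lemma comm_bound_integrable [Nontrivial E] (hk : WK k) (hσ : ∀ x, |χ x| ≤ σ)
    (hL : ∀ x y, |χ x - χ y| ≤ L * ‖x - y‖) :
    Integrable fun y => ‖k y‖ * min (2 * σ) (L * ‖y‖) * U :=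
  (hk.int_min (2 * σ) L (by linarith [(abs_nonneg _).trans (hσ 0)]) (lip_nonneg hL)).mul_const _

lemma comm_aesm (hk : WK k) (hu : Continuous u) (hχ : Continuous χ) (x : E) :
    AEStronglyMeasurable (fun y => k y ((χ x - χ (x - y)) • u (x - y))) volume :=
  aesm_clm_apply hk.meas
    (by fun_prop : Continuous fun y => (χ x - χ (x - y)) • u (x - y)).aestronglyMeasurable

lemma comm_integrable [Nontrivial E] (hk : WK k) (hu : Continuous u) (hU : ∀ x, ‖u x‖ ≤ U)
    (hσ : ∀ x, |χ x| ≤ σ) (hL : ∀ x y, |χ x - χ y| ≤ L * ‖x - y‖) (x : E) :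
    Integrable fun y => k y ((χ x - χ (x - y)) • u (x - y)) :=
  (comm_bound_integrable hk hσ hL).mono' (comm_aesm hk hu (continuous_of_lip hL) x)
    (Eventually.of_forall fun y => comm_term_le hU hσ hL x y)

lemma comm_continuous [Nontrivial E] (hk : WK k) (hu : Continuous u) (hU : ∀ x, ‖u x‖ ≤ U)
    (hσ : ∀ x, |χ x| ≤ σ) (hL : ∀ x y, |χ x - χ y| ≤ L * ‖x - y‖) :
    Continuous (comm k χ u) := by
  have hχ := continuous_of_lip hL
  exact continuous_of_dominated (fun x => comm_aesm hk hu hχ x)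
    (fun x => Eventually.of_forall fun y => comm_term_le hU hσ hL x y)
    (comm_bound_integrable hk hσ hL) (Eventually.of_forall fun y => by fun_prop)

lemma setIntegral_comm_le [Nontrivial E] (hk : WK k) (hU : ∀ x, ‖u x‖ ≤ U)
    (hσ : ∀ x, |χ x| ≤ σ) (hL : ∀ x y, |χ x - χ y| ≤ L * ‖x - y‖) (s : Set E) (x : E) :
    ‖∫ y in s, k y ((χ x - χ (x - y)) • u (x - y))‖
      ≤ ∫ y, ‖k y‖ * min (2 * σ) (L * ‖y‖) * U := by
  have hσ0 : 0 ≤ σ := (abs_nonneg _).trans (hσ 0)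
  have hU0 : 0 ≤ U := (norm_nonneg _).trans (hU 0)
  have hL0 := lip_nonneg hL
  refine (norm_integral_le_of_norm_le (comm_bound_integrable hk hσ hL).integrableOn
    (Eventually.of_forall fun y => comm_term_le hU hσ hL x y)).trans ?_
  exact setIntegral_le_integral (comm_bound_integrable hk hσ hL)
    (Eventually.of_forall fun y => by positivity)

lemma comm_le [Nontrivial E] (hk : WK k) (hU : ∀ x, ‖u x‖ ≤ U)
    (hσ : ∀ x, |χ x| ≤ σ) (hL : ∀ x y, |χ x - χ y| ≤ L * ‖x - y‖) (x : E) :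
    ‖comm k χ u x‖ ≤ ∫ y, ‖k y‖ * min (2 * σ) (L * ‖y‖) * U := by
  simpa [comm] using setIntegral_comm_le hk hU hσ hL Set.univ x

lemma tendsto_comm [Nontrivial E] (hk : WK k) (hu : Continuous u) (hU : ∀ x, ‖u x‖ ≤ U)
    (hσ : ∀ x, |χ x| ≤ σ) (hL : ∀ x y, |χ x - χ y| ≤ L * ‖x - y‖) (x : E) :
    Tendsto (fun ε : ℝ => ∫ y in {y : E | ε ≤ ‖y‖}, k y ((χ x - χ (x - y)) • u (x - y)))
      (𝓝[>] 0) (𝓝 (comm k χ u x)) := by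
  have hm (ε : ℝ) : MeasurableSet {y : E | ε ≤ ‖y‖} := measurableSet_le (by fun_prop) (by fun_prop)
  have hi := comm_integrable hk hu hU hσ hL x
  simp only [← integral_indicator (hm _), comm]
  refine tendsto_integral_filter_of_dominated_convergence _
    (Eventually.of_forall fun ε => hi.aestronglyMeasurable.indicator (hm ε))
    (Eventually.of_forall fun ε => Eventually.of_forall fun y => norm_indicator_le_norm_self _ _)
    hi.norm ?_
  have h0 : ∀ᵐ y : E, y ≠ 0 := by simp [ae_iff]
  filter_upwards [h0] with y hy
  refine tendsto_const_nhds.congr' ?_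
  filter_upwards [Ioo_mem_nhdsGT (norm_pos_iff.2 hy)] with ε hε
  rw [Set.indicator_of_mem]
  exact hε.2.le

lemma trunc_mul [Nontrivial E] (hp : (finrank ℝ E : ℝ) < p) (hp' : p < finrank ℝ E + 1)
    (hu : Continuous u) (hU : ∀ x, ‖u x‖ ≤ U)
    (hσ : ∀ x, |χ x| ≤ σ) (hL : ∀ x y, |χ x - χ y| ≤ L * ‖x - y‖) {ε : ℝ} (hε : 0 < ε) (x : E) :
    trunc (ker a b p) (fun x => χ x • u x) ε x = χ x • trunc (ker a b p) u ε x
      + ∫ y in {y : E | ε ≤ ‖y‖}, ker a b p y ((χ x - χ (x - y)) • u (x - y)) := by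
  have hi : IntegrableOn (fun y => χ x • ker a b p y (u x - u (x - y))) {y : E | ε ≤ ‖y‖} :=
    (trunc_integrable hp hu hU hε x).smul (χ x)
  rw [trunc, trunc, ← integral_smul,
    ← integral_add hi (comm_integrable (ker_wk hp hp') hu hU hσ hL x).integrableOn]
  refine integral_congr_ae (Eventually.of_forall fun y => ?_)
  simp only [← map_smul, ← map_add]
  congr 1
  module

lemma T_mul_left [Nontrivial E] (hk : WK k) (he : ∀ y, k (-y) = k y)
    (hs : ∀ y w z, ⟪k y w, z⟫ = ⟪w, k y z⟫) (hu : Continuous u) (hU : ∀ x, ‖u x‖ ≤ U)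
    (hσ : ∀ x, |χ x| ≤ σ) (hL : ∀ x y, |χ x - χ y| ≤ L * ‖x - y‖) {φ : E → E} {A B : ℝ}
    (hφ : TF φ A B) :
    T k (fun x => χ x • u x) φ = T k u (fun x => χ x • φ x) + ∫ x, ⟪comm k χ u x, φ x⟫ := by
  have hχ := continuous_of_lip hL
  have hχu : Continuous fun x => χ x • u x := hχ.smul hu
  have hχU x : ‖χ x • u x‖ ≤ σ * U := by
    rw [norm_smul]
    exact mul_le_mul (hσ x) (hU x) (norm_nonneg _) ((abs_nonneg _).trans (hσ 0))
  have hχφ := hφ.mul hσ hL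
  have i1 := pair_integral_integrable hχu hχU (op_prod_integrable hk hφ)
  have i2 := pair_integral_integrable hu hU (op_prod_integrable hk hχφ)
  have hF : Integrable (fun q : E × E => ⟪k q.1 ((χ q.2 - χ (q.2 - q.1)) • u (q.2 - q.1)), φ q.2⟫)
      (volume.prod volume) := by
    refine ((comm_bound_integrable (U := U) hk hσ hL).mul_prod hφ.int.norm).mono' ?_
      (Eventually.of_forall fun q => ?_)
    · refine (aesm_clm_apply hk.meas.comp_fst ?_).inner hφ.int.aestronglyMeasurable.comp_snd
      exact (by fun_prop : Continuous fun q : E × E =>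
        (χ q.2 - χ (q.2 - q.1)) • u (q.2 - q.1)).aestronglyMeasurable
    · refine (norm_inner_le_norm _ _).trans ?_
      exact mul_le_mul_of_nonneg_right (comm_term_le hU hσ hL q.2 q.1) (norm_nonneg _)
  have e1 : ∫ x, ⟪comm k χ u x, φ x⟫
      = ∫ y, ∫ x, ⟪k y ((χ x - χ (x - y)) • u (x - y)), φ x⟫ := by
    rw [integral_integral_swap hF]
    refine integral_congr_ae (Eventually.of_forall fun x => ?_)
    simp only [comm]
    rw [real_inner_comm, ← integral_inner (comm_integrable hk hu hU hσ hL x)]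
    simp only [real_inner_comm]
  rw [← sub_eq_iff_eq_add', T_eq_integral hk hχu hχU hφ, T_eq_integral hk hu hU hχφ,
    ← integral_sub i1 i2, e1, ← integral_neg_eq_self]
  refine integral_congr_ae (Eventually.of_forall fun y => ?_)
  have hi : Integrable fun x => k y (φ x - φ (x - y)) := (k y).integrable_comp (hφ.int_sub y)
  have hi' : Integrable fun x => k y (χ x • φ x - χ (x - y) • φ (x - y)) :=
    (k y).integrable_comp (hχφ.int_sub y)
  have hi_neg : Integrable fun x => k (-y) (φ x - φ (x - -y)) :=
    (k (-y)).integrable_comp (hφ.int_sub (-y))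
  have hi'_neg : Integrable fun x => k (-y) (χ x • φ x - χ (x - -y) • φ (x - -y)) :=
    (k (-y)).integrable_comp (hχφ.int_sub (-y))
  simp only [pair]
  rw [← integral_sub (pair_integrable hχu hχU hi_neg) (pair_integrable hu hU hi'_neg),
    ← integral_sub_right_eq_self _ y]
  refine integral_congr_ae (Eventually.of_forall fun x => ?_)
  simp only [sub_neg_eq_add, sub_add_cancel, he, hs, real_inner_smul_left, real_inner_smul_right,
    map_sub, map_smul, inner_sub_right]
  ring

/-- Localising the strong equation. -/
lemma T_mul_eq_of_local [Nontrivial E] (hp : (finrank ℝ E : ℝ) < p) (hp' : p < finrank ℝ E + 1)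
    (h1 : a + b / p ≠ 0) (h2 : a + b * (1 + (p - finrank ℝ E)) / p ≠ 0)
    {f : E → E} {M N : ℝ} {P : Set E} (hu : Continuous u) (hU : ∀ x, ‖u x‖ ≤ U)
    (hP : IsClosed P) (hf : Continuous f) (hN : ∀ x, ‖f x‖ ≤ N) (hχ : BLip χ)
    (hreg : ∀ x ∈ P ∩ tsupport χ, ∀ ε > 0, ‖trunc (ker a b p) u ε x‖ ≤ M)
    (hlim : ∀ x, Tendsto (fun ε => trunc (ker a b p) u ε x) (𝓝[>] 0) (𝓝 (f x)))
    (hoff : ∀ φ : E → E, Test φ → Disjoint (tsupport φ) P →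
      T (ker a b p) u φ = ∫ x, ⟪f x, φ x⟫) {φ : E → E} (hφ : Test φ) :
    T (ker a b p) u (fun x => χ x • φ x) = ∫ x, ⟪f x, χ x • φ x⟫ := by
  obtain ⟨σ, L, hσ, hL⟩ := id hχ
  have hk := ker_wk (a := a) (b := b) hp hp'
  have hσ0 : 0 ≤ σ := (abs_nonneg _).trans (hσ 0)
  have hχc := hχ.continuous
  have hbd {z : E → E} {Z : ℝ} (hz : ∀ x, ‖z x‖ ≤ Z) x : ‖χ x • z x‖ ≤ σ * Z := by
    rw [norm_smul]
    exact mul_le_mul (hσ x) (hz x) (norm_nonneg _) hσ0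
  have hcc := comm_continuous hk hu hU hσ hL
  have hcb := comm_le hk hU hσ hL
  have hsplit {φ : E → E} (hφ : Test φ) :
      T (ker a b p) (fun x => χ x • u x) φ = T (ker a b p) u (fun x => χ x • φ x)
        + ∫ x, ⟪comm (ker a b p) χ u x, φ x⟫ :=
    T_mul_left hk ker_neg ker_symm hu hU hσ hL hφ.1.choose_spec.choose_spec
  have hsum {φ : E → E} (hφ : Test φ) :
      ∫ x, ⟪χ x • f x + comm (ker a b p) χ u x, φ x⟫
        = (∫ x, ⟪f x, χ x • φ x⟫) + ∫ x, ⟪comm (ker a b p) χ u x, φ x⟫ := by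
    have hi := hφ.1.choose_spec.choose_spec.int
    rw [← integral_add (pair_integrable hf hN (hφ.mul hχ).1.choose_spec.choose_spec.int)
      (pair_integrable hcc hcb hi)]
    simp only [inner_add_left, real_inner_smul_left, real_inner_smul_right]
  have key := T_eq_of_data (a := a) (b := b) (p := p) (v := fun x => χ x • u x)
    (h := fun x => χ x • f x + comm (ker a b p) χ u x) (P := P ∩ tsupport χ) hp hp' h1 h2
    (hχc.smul hu) (hbd hU) (hP.inter (isClosed_tsupport _)) ((hχc.smul hf).add hcc)
    (fun x => (norm_add_le _ _).trans (add_le_add (hbd hN x) (hcb x)))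
    (M := σ * M + ∫ y, ‖(ker a b p y : E →L[ℝ] E)‖ * min (2 * σ) (L * ‖y‖) * U)
    (fun x hx ε hε => ?_) (fun x hx => ?_) (fun φ hφ hd => ?_) hφ
  · rw [hsplit hφ, hsum hφ] at key
    exact add_right_cancel key
  · rw [trunc_mul hp hp' hu hU hσ hL hε]
    refine (norm_add_le _ _).trans (add_le_add ?_ (setIntegral_comm_le hk hU hσ hL _ x))
    rw [norm_smul]
    exact mul_le_mul (hσ x) (hreg x hx ε hε) (norm_nonneg _) hσ0
  · refine (((hlim x).const_smul (χ x)).add (tendsto_comm hk hu hU hσ hL x)).congr' ?_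
    filter_upwards [self_mem_nhdsWithin] with ε hε
    exact (trunc_mul hp hp' hu hU hσ hL hε x).symm
  · rw [hsplit hφ, hsum hφ, hoff _ (hφ.mul hχ) (Set.disjoint_left.2 fun x hx hxP => ?_)]
    exact Set.disjoint_left.1 hd (tsupport_smul_subset_right χ φ hx)
      ⟨hxP, tsupport_smul_subset_left χ φ hx⟩

lemma exists_cut (x : E) {ρ : ℝ} (hρ : 0 < ρ) : ∃ χ : E → ℝ, BLip χ ∧
    (∀ y ∈ Metric.ball x ρ, χ y = 1) ∧ tsupport χ ⊆ Metric.closedBall x (2 * ρ) := by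
  refine ⟨_, (BLip.const 1).sub (blip_dist_cut {x} hρ), fun y hy => ?_,
    closure_minimal (fun y hy => ?_) Metric.isClosed_closedBall⟩
  · have : dist y x / ρ - 1 ≤ 0 := by
      rw [sub_nonpos, div_le_one hρ]; exact (Metric.mem_ball.1 hy).le
    rw [Metric.infDist_singleton, max_eq_left ((min_le_right _ _).trans this), sub_zero]
  · by_contra hlt
    refine hy ?_
    rw [Metric.mem_closedBall, not_le, ← lt_div_iff₀ hρ] at hlt
    simp only [Metric.infDist_singleton]
    rw [min_eq_left (by linarith), max_eq_right zero_le_one, sub_self]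

lemma eq_of_locally_eq [Nontrivial E] (hk : WK k) {f : E → E} {N : ℝ} (hu : Continuous u)
    (hU : ∀ x, ‖u x‖ ≤ U) (hf : Continuous f) (hN : ∀ x, ‖f x‖ ≤ N) {φ : E → E} (hφ : Test φ)
    (hloc : ∀ x ∈ tsupport φ, ∃ r > 0, ∀ ψ : E → E, Test ψ → tsupport ψ ⊆ Metric.ball x r →
      T k u ψ = ∫ x, ⟪f x, ψ x⟫) : T k u φ = ∫ x, ⟪f x, φ x⟫ := by
  classical
  choose! r hr0 hr using hloc
  obtain ⟨t, ht, hcov⟩ := hφ.2.elim_nhds_subcover (fun x => Metric.ball x (r x / 3))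
    fun x hx => Metric.ball_mem_nhds x (by have := hr0 x hx; positivity)
  have key : ∀ t : Finset E, (∀ x ∈ t, x ∈ tsupport φ) → ∀ ψ : E → E, Test ψ →
      (tsupport ψ ⊆ ⋃ x ∈ t, Metric.ball x (r x / 3)) → T k u ψ = ∫ x, ⟪f x, ψ x⟫ := by
    intro t
    induction t using Finset.induction_on with
    | empty =>
      intro _ ψ hψ hs
      have h0 : ψ = fun _ => 0 := by
        have : tsupport ψ = ∅ := by simpa using hs
        exact tsupport_eq_empty_iff.1 this
      rw [h0]
      simpa using T_smul k u 0 0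
    | insert z t hz ih =>
      intro ht ψ hψ hs
      have hzφ := ht z (Finset.mem_insert_self _ _)
      have hρ : 0 < r z / 3 := by have := hr0 z hzφ; positivity
      obtain ⟨χ, hχ, hχ1, hχs⟩ := exists_cut z hρ
      have t1 := hψ.mul hχ
      have t2 := hψ.mul ((BLip.const 1).sub hχ)
      obtain ⟨A₁, B₁, h₁⟩ := id t1.1
      obtain ⟨A₂, B₂, h₂⟩ := id t2.1
      have e : ψ = fun x => χ x • ψ x + (1 - χ x) • ψ x := by ext x; module
      have e1 : T k u ψ = T k u (fun x => χ x • ψ x) + T k u fun x => (1 - χ x) • ψ x := by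
        conv_lhs => rw [e]
        exact T_add hk hu hU h₁ h₂
      have e2 : ∫ x, ⟪f x, ψ x⟫
          = (∫ x, ⟪f x, χ x • ψ x⟫) + ∫ x, ⟪f x, (1 - χ x) • ψ x⟫ := by
        rw [← integral_add (pair_integrable hf hN h₁.int) (pair_integrable hf hN h₂.int)]
        simp only [← inner_add_right, ← add_smul, add_sub_cancel, one_smul]
      rw [e1, e2, hr z hzφ _ t1 fun x hx => ?_,
        ih (fun x hx => ht x (Finset.mem_insert_of_mem hx)) _ t2 fun x hx => ?_]
      · have := hs (tsupport_smul_subset_right _ ψ hx)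
        rw [Finset.set_biUnion_insert] at this
        refine this.resolve_left fun hb => ?_
        have hsub : tsupport (fun x => (1 - χ x) • ψ x) ⊆ (Metric.ball z (r z / 3))ᶜ :=
          closure_minimal (fun y hy hyb => hy (by simp [hχ1 y hyb])) Metric.isOpen_ball.isClosed_compl
        exact hsub hx hb
      · have := hχs (tsupport_smul_subset_left χ ψ hx)
        rw [Metric.mem_closedBall] at this
        rw [Metric.mem_ball]
        linarith
  exact key t ht φ hφ hcov

lemma trunc_bounded_of_tendsto (hp : (finrank ℝ E : ℝ) < p) (hU : ∀ x, ‖u x‖ ≤ U) {x z : E}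
    (h : Tendsto (fun ε => trunc (ker a b p) u ε x) (𝓝[>] 0) (𝓝 z)) :
    ∃ n : ℕ, ∀ ε > 0, ‖trunc (ker a b p) u ε x‖ ≤ n := by
  have hU0 : 0 ≤ U := (norm_nonneg _).trans (hU 0)
  have h1 : ∀ᶠ ε in 𝓝[>] (0 : ℝ), ‖trunc (ker a b p) u ε x‖ < ‖z‖ + 1 :=
    h.norm.eventually_lt_const (by linarith)
  obtain ⟨δ, hδ, hsub⟩ := (mem_nhdsGT_iff_exists_Ioo_subset).1 h1
  have hδ : 0 < δ := hδ
  set c := ((|a| + |b|) * (2 * U)) * ∫ y in {y : E | δ ≤ ‖y‖}, ‖y‖ ^ (-p) with hc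
  obtain ⟨n, hn⟩ := exists_nat_ge (max (‖z‖ + 1) c)
  refine ⟨n, fun ε hε => ?_⟩
  rcases lt_or_ge ε δ with hlt | hge
  · exact (le_of_lt (hsub ⟨hε, hlt⟩)).trans ((le_max_left _ _).trans hn)
  · refine (trunc_bound hp hU hε x).trans (le_trans ?_ ((le_max_right _ _).trans hn))
    rw [hc]
    refine mul_le_mul_of_nonneg_left (setIntegral_mono_set (integrable_tail hp hδ)
      (Eventually.of_forall fun y => by positivity)
      (Eventually.of_forall fun y (hy : ε ≤ ‖y‖) => hge.trans hy)) (by positivity)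

/-- A pointwise solution of the principal value equation is a weak solution. -/
theorem weak_of_pointwise [Nontrivial E] (hp : (finrank ℝ E : ℝ) < p)
    (hp' : p < finrank ℝ E + 1) (h1 : a + b / p ≠ 0)
    (h2 : a + b * (1 + (p - finrank ℝ E)) / p ≠ 0) {f : E → E} {N : ℝ} (hu : Continuous u)
    (hU : ∀ x, ‖u x‖ ≤ U) (hf : Continuous f) (hN : ∀ x, ‖f x‖ ≤ N)
    (hlim : ∀ x, Tendsto (fun ε => trunc (ker a b p) u ε x) (𝓝[>] 0) (𝓝 (f x)))
    {φ : E → E} (hφ : Test φ) : T (ker a b p) u φ = ∫ x, ⟪f x, φ x⟫ := by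
  set P : Set E := {x | ¬ ∃ r > 0, ∀ ψ : E → E, Test ψ → tsupport ψ ⊆ Metric.ball x r →
    T (ker a b p) u ψ = ∫ x, ⟪f x, ψ x⟫} with hPdef
  have hk := ker_wk (a := a) (b := b) hp hp'
  have hoff : ∀ ψ : E → E, Test ψ → Disjoint (tsupport ψ) P →
      T (ker a b p) u ψ = ∫ x, ⟪f x, ψ x⟫ := fun ψ hψ hd =>
    eq_of_locally_eq hk hu hU hf hN hψ fun x hx => not_not.1 (Set.disjoint_left.1 hd hx)
  rcases P.eq_empty_or_nonempty with hP0 | hne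
  · exact hoff φ hφ (hP0 ▸ Set.disjoint_empty _)
  have hPc : IsClosed P := by
    rw [← isOpen_compl_iff, Metric.isOpen_iff]
    intro x hx
    obtain ⟨r, hr, h⟩ := not_not.1 hx
    refine ⟨r / 2, half_pos hr, fun y hy hyP => hyP ⟨r / 2, half_pos hr, fun ψ hψ hs =>
      h ψ hψ (hs.trans (Metric.ball_subset_ball' ?_))⟩⟩
    have := Metric.mem_ball.1 hy
    linarith
  exfalso
  have : Nonempty P := hne.to_subtype
  have : CompleteSpace P := hPc.completeSpace_coe
  obtain ⟨n, x₀, hx₀⟩ := nonempty_interior_of_iUnion_of_closed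
    (f := fun n : ℕ => {x : P | ∀ ε > 0, ‖trunc (ker a b p) u ε (x : E)‖ ≤ n})
    (fun n => by
      simp only [Set.ofPred_forall]
      refine isClosed_iInter fun ε => isClosed_iInter fun hε => ?_
      exact isClosed_le ((trunc_continuous hp hu hU hε).comp continuous_subtype_val).norm
        continuous_const)
    (Set.eq_univ_of_forall fun x => by
      obtain ⟨n, hn⟩ := trunc_bounded_of_tendsto hp hU (hlim x)
      exact Set.mem_iUnion.2 ⟨n, hn⟩)
  obtain ⟨r, hr, hball⟩ := Metric.mem_nhds_iff.1 (mem_interior_iff_mem_nhds.1 hx₀)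
  have hρ : 0 < r / 3 := by positivity
  obtain ⟨χ, hχ, hχ1, hχs⟩ := exists_cut (x₀ : E) hρ
  refine x₀.2 ⟨r / 3, hρ, fun ψ hψ hs => ?_⟩
  have e : (fun x => χ x • ψ x) = ψ := by
    ext x
    by_cases hx : x ∈ tsupport ψ
    · rw [hχ1 x (hs hx), one_smul]
    · rw [image_eq_zero_of_notMem_tsupport hx, smul_zero]
  have key := T_mul_eq_of_local (M := (n : ℝ)) hp hp' h1 h2 hu hU hPc hf hN hχ
    (fun x hx ε hε => ?_) hlim hoff hψ
  · simp only [congrFun e] at key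
    exact key
  · refine hball (?_ : (⟨x, hx.1⟩ : P) ∈ Metric.ball x₀ r) ε hε
    have := Metric.mem_closedBall.1 (hχs hx.2)
    rw [Metric.mem_ball, Subtype.dist_eq]
    change dist x (x₀ : E) < r
    linarith

end Localization

section Schauder

lemma T_eq_pair_of_test [Nontrivial E] (hp : (finrank ℝ E : ℝ) < p)
    (hp' : p < finrank ℝ E + 1) {u f : E → E} {U N : ℝ} (hu : Continuous u)
    (hU : ∀ x, ‖u x‖ ≤ U) (hf : Continuous f) (hN : ∀ x, ‖f x‖ ≤ N)
    (h : ∀ φ, Test φ → T (ker a b p) u φ = pair f φ) {φ : E → E} {A B : ℝ} (hφ : TF φ A B) :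
    T (ker a b p) u φ = pair f φ := by
  have hk := ker_wk (a := a) (b := b) hp hp'
  have hU0 : 0 ≤ U := (norm_nonneg _).trans (hU 0)
  have hB := hφ.nonneg_right
  obtain ⟨χ, ⟨σ, L, hσ, hL⟩, hχ1, hχs⟩ := exists_cut (E := E) 0 one_pos
  have hσ0 : 0 ≤ σ := (abs_nonneg _).trans (hσ 0)
  set η : ℕ → E → ℝ := fun n x => χ (((n : ℝ) + 1)⁻¹ • x) with hη
  have hc (n : ℕ) : (0 : ℝ) < ((n : ℝ) + 1)⁻¹ := by positivity
  have hc1 (n : ℕ) : ((n : ℝ) + 1)⁻¹ ≤ 1 := inv_le_one_of_one_le₀ (by simp)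
  have hησ (n x) : |η n x| ≤ σ := hσ _
  have hηL (n x y) : |η n x - η n y| ≤ |L| * ‖x - y‖ := by
    refine (hL _ _).trans ?_
    rw [← smul_sub, norm_smul, Real.norm_of_nonneg (hc n).le]
    exact mul_le_mul (le_abs_self L) (mul_le_of_le_one_left (norm_nonneg _) (hc1 n))
      (by have := hc n; positivity) (abs_nonneg L)
  have hησ' (n x) : |1 - η n x| ≤ 1 + σ :=
    (abs_sub _ _).trans (by rw [abs_one]; linarith [hησ n x])
  have hηL' (n x y) : |(1 - η n x) - (1 - η n y)| ≤ |L| * ‖x - y‖ := by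
    rw [sub_sub_sub_cancel_left, abs_sub_comm]; exact hηL n x y
  have t1 (n : ℕ) : TF (fun x => η n x • φ x) (σ * A) (|L| * A + σ * B) := hφ.mul (hησ n) (hηL n)
  have t2 (n : ℕ) : TF (fun x => (1 - η n x) • φ x) ((1 + σ) * A) (|L| * A + (1 + σ) * B) :=
    hφ.mul (hησ' n) (hηL' n)
  have hcs (n : ℕ) : HasCompactSupport (η n) := by
    have h0 : HasCompactSupport χ :=
      (isCompact_closedBall (0 : E) (2 * 1)).of_isClosed_subset (isClosed_tsupport _) hχs
    exact h0.comp_smul (hc n).ne'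
  have e (n : ℕ) : φ = fun x => η n x • φ x + (1 - η n x) • φ x := by ext x; module
  have hD (n : ℕ) : T (ker a b p) u φ - pair f φ = T (ker a b p) u (fun x => (1 - η n x) • φ x)
      - pair f fun x => (1 - η n x) • φ x := by
    conv_lhs => rw [e n, T_add hk hu hU (t1 n) (t2 n), pair_add hf hN (t1 n).int (t2 n).int,
      h _ ⟨⟨_, _, t1 n⟩, (hcs n).smul_right⟩]
    ring
  set S : ℕ → ℝ := fun n => ∫ x, ‖(1 - η n x) • φ x‖ with hS
  have hS0 : Tendsto S atTop (𝓝 0) := by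
    rw [← integral_zero E ℝ (μ := volume)]
    refine tendsto_integral_of_dominated_convergence (fun x => (1 + σ) * ‖φ x‖)
      (fun n => (t2 n).int.norm.aestronglyMeasurable) (hφ.int.norm.const_mul _)
      (fun n => Eventually.of_forall fun x => ?_) (Eventually.of_forall fun x => ?_)
    · rw [norm_norm, norm_smul]
      gcongr
      exact hησ' n x
    · have h0 : Tendsto (fun n : ℕ => ((n : ℝ) + 1)⁻¹ • x) atTop (𝓝 0) := by
        simpa using (tendsto_one_div_add_atTop_nhds_zero_nat (𝕜 := ℝ)).smul_const x
      refine tendsto_const_nhds.congr' ?_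
      filter_upwards [h0 (Metric.ball_mem_nhds 0 one_pos)] with n hn
      simp only [hη]
      rw [hχ1 _ hn, sub_self, zero_smul, norm_zero]
  have hb (n : ℕ) : |T (ker a b p) u φ - pair f φ| ≤ kC E a b p * U *
      (S n ^ (1 - (p - finrank ℝ E)) * (|L| * A + (1 + σ) * B) ^ (p - finrank ℝ E)) + N * S n := by
    rw [hD n]
    exact (abs_sub _ _).trans (add_le_add
      (T_ker_bound hp hp' hU ⟨(t2 n).int, le_rfl, (t2 n).lip⟩) (pair_le hN (t2 n).int))
  have hlim : Tendsto (fun n => kC E a b p * U *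
      (S n ^ (1 - (p - finrank ℝ E)) * (|L| * A + (1 + σ) * B) ^ (p - finrank ℝ E)) + N * S n)
      atTop (𝓝 0) := by
    have h1 := (hS0.rpow_const (p := 1 - (p - finrank ℝ E)) (Or.inr (by linarith)))
    rw [Real.zero_rpow (by linarith)] at h1
    simpa using ((h1.mul_const _).const_mul _).add (hS0.const_mul N)
  exact sub_eq_zero.1 (abs_nonpos_iff.1 (ge_of_tendsto hlim (Eventually.of_forall hb)))

lemma abs_pair_conv_le {f : E → E} {α K N : ℝ} (hf : Continuous f) (hN : ∀ x, ‖f x‖ ≤ N)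
    (hK : ∀ x y, ‖f x - f y‖ ≤ K * ‖x - y‖ ^ α) {m : E → E →L[ℝ] E} (hm : Integrable m)
    (hm0 : ∫ y, m y = 0) (hmα : Integrable fun y => ‖m y‖ * ‖y‖ ^ α) {φ : E → E}
    (hφ : Integrable φ) :
    |pair f (conv m φ)| ≤ K * (∫ y, ‖m y‖ * ‖y‖ ^ α) * ∫ x, ‖φ x‖ := by
  have hi : Integrable (fun q : E × E => m (q.1 - q.2) (φ q.2)) (volume.prod volume) :=
    hφ.convolution_integrand (ContinuousLinearMap.id ℝ (E →L[ℝ] E)).flip hm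
  have e1 : pair f (conv m φ) = ∫ z, pair f fun x => m (x - z) (φ z) := by
    rw [← pair_integral hf hN hi]
    simp_rw [← conv_eq]
  have e2 (z w : E) : |pair f fun x => m (x - z) w|
      ≤ K * (∫ y, ‖m y‖ * ‖y‖ ^ α) * ‖w‖ := by
    have hw : Integrable fun x => m x w := hm.apply_continuousLinearMap w
    have e3 : pair f (fun x => m (x - z) w) = ∫ x, ⟪f (x + z) - f z, m x w⟫ := by
      have h0 : ∫ x, ⟪f z, m x w⟫ = 0 := by
        rw [integral_inner hw, ← ContinuousLinearMap.integral_apply hm, hm0]; simp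
      have h1 : Integrable fun x => ⟪f (x + z), m x w⟫ :=
        pair_integrable (by fun_prop) (fun x => hN _) hw
      have h2 : Integrable fun x => ⟪f z, m x w⟫ :=
        pair_integrable continuous_const (fun _ => hN z) hw
      simp only [inner_sub_left]
      rw [integral_sub h1 h2, h0, sub_zero, pair,
        ← integral_add_right_eq_self (fun x => ⟪f x, m (x - z) w⟫) z]
      simp only [add_sub_cancel_right]
    rw [e3, mul_assoc, ← integral_mul_const, ← integral_const_mul, ← Real.norm_eq_abs]
    refine norm_integral_le_of_norm_le ((hmα.mul_const _).const_mul _)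
      (Eventually.of_forall fun x => ?_)
    have h3 : ‖f (x + z) - f z‖ ≤ K * ‖x‖ ^ α := by simpa using hK (x + z) z
    calc ‖⟪f (x + z) - f z, m x w⟫‖ ≤ ‖f (x + z) - f z‖ * ‖m x w‖ := norm_inner_le_norm _ _
      _ ≤ (K * ‖x‖ ^ α) * (‖m x‖ * ‖w‖) :=
        mul_le_mul h3 ((m x).le_opNorm w) (norm_nonneg _) ((norm_nonneg _).trans h3)
      _ = _ := by ring
  rw [e1, ← integral_const_mul, ← Real.norm_eq_abs]
  exact norm_integral_le_of_norm_le (hφ.norm.const_mul _)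
    (Eventually.of_forall fun z => e2 z (φ z))

variable {ψ : E → ℝ} {H : E → E →L[ℝ] E} {C α : ℝ}

lemma rpow_le_one_add {t : ℝ} (ht : 0 ≤ t) (hα : α ∈ Set.Ioc (0 : ℝ) 1) : t ^ α ≤ 1 + t := by
  rcases le_total t 1 with h | h
  · exact (Real.rpow_le_one ht h hα.1.le).trans (by linarith)
  · exact (Real.rpow_le_rpow_of_exponent_le h hα.2).trans (by rw [Real.rpow_one]; linarith)

lemma holder_moment {m : E → F} (hα : α ∈ Set.Ioc (0 : ℝ) 1) (hm : Integrable m)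
    (h1 : Integrable fun y => ‖y‖ * ‖m y‖) : (Integrable fun y => ‖m y‖ * ‖y‖ ^ α) ∧
      ∫ y, ‖m y‖ * ‖y‖ ^ α ≤ (∫ y, ‖m y‖) + ∫ y, ‖y‖ * ‖m y‖ := by
  have hb (y : E) : ‖m y‖ * ‖y‖ ^ α ≤ ‖m y‖ + ‖y‖ * ‖m y‖ := by
    have := mul_le_mul_of_nonneg_left (rpow_le_one_add (norm_nonneg y) hα) (norm_nonneg (m y))
    linarith
  have hi : Integrable fun y => ‖m y‖ * ‖y‖ ^ α := by
    refine (hm.norm.add h1).mono' (hm.aestronglyMeasurable.norm.mul (by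
      exact (by fun_prop : Measurable fun y : E => ‖y‖ ^ α).aestronglyMeasurable))
      (Eventually.of_forall fun y => ?_)
    rw [Real.norm_of_nonneg (by positivity)]
    exact hb y
  refine ⟨hi, ?_⟩
  rw [← integral_add hm.norm h1]
  exact integral_mono hi (hm.norm.add h1) hb

/-- A bound for the Hölder moments of a parametrix and of its differences. -/
def Para.cH (hP : Para a b p ψ H C) : ℝ :=
  hP.c + (∫ y, ‖y‖ * ‖H y‖) + C * massI E ((finrank ℝ E : ℝ) + 1)

lemma Para.cH_nonneg (hP : Para a b p ψ H C) : 0 ≤ hP.cH :=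
  add_nonneg (add_nonneg hP.c_nonneg (integral_nonneg fun _ => by positivity))
    (mul_nonneg hP.psi.nonneg massI_nonneg)

lemma Para.ker_moment (hP : Para a b p ψ H C) (hα : α ∈ Set.Ioc (0 : ℝ) 1) :
    (Integrable fun y => ‖H y‖ * ‖y‖ ^ α) ∧ ∫ y, ‖H y‖ * ‖y‖ ^ α ≤ hP.cH := by
  obtain ⟨h1, h2⟩ := holder_moment hα hP.ker_tf.int (hP.ker.moment (by linarith))
  refine ⟨h1, h2.trans ?_⟩
  have : 0 ≤ C * massI E ((finrank ℝ E : ℝ) + 1) := mul_nonneg hP.psi.nonneg massI_nonneg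
  rw [cH]
  linarith [hP.ker_tf.l1]

lemma Para.ker_diff_moment (hP : Para a b p ψ H C) (hα : α ∈ Set.Ioc (0 : ℝ) 1) {k : E}
    (hk : ‖k‖ ≤ 1) : (Integrable fun y => ‖H (y + k) - H y‖ * ‖y‖ ^ α) ∧
      ∫ y, ‖H (y + k) - H y‖ * ‖y‖ ^ α ≤ hP.cH * ‖k‖ := by
  obtain ⟨h3, h4⟩ := hP.ker.moment_lip (by linarith) hk
  have hi := hP.ker_tf.int
  obtain ⟨h1, h2⟩ := holder_moment hα ((hi.comp_add_right k).sub hi) h3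
  refine ⟨h1, h2.trans ?_⟩
  have : 0 ≤ (∫ y, ‖y‖ * ‖H y‖) * ‖k‖ :=
    mul_nonneg (integral_nonneg fun _ => by positivity) (norm_nonneg _)
  have h5 := hP.ker_tf.lip k
  rw [cH, add_mul, add_mul]
  refine (add_le_add h5 h4).trans ?_
  linarith

lemma holder_moment_scale {m : E → F} {l : ℝ} (hl : 0 < l)
    (hm : Integrable fun y => ‖m y‖ * ‖y‖ ^ α) :
    (Integrable fun y => ‖l ^ (2 * (finrank ℝ E : ℝ) - p) • m (l • y)‖ * ‖y‖ ^ α) ∧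
      ∫ y, ‖l ^ (2 * (finrank ℝ E : ℝ) - p) • m (l • y)‖ * ‖y‖ ^ α
        = l ^ (-(p - finrank ℝ E + α)) * ∫ y, ‖m y‖ * ‖y‖ ^ α := by
  have e (y : E) : ‖l ^ (2 * (finrank ℝ E : ℝ) - p) • m (l • y)‖ * ‖y‖ ^ α
      = l ^ (2 * (finrank ℝ E : ℝ) - p - α) * (‖m (l • y)‖ * ‖l • y‖ ^ α) := by
    have h : l ^ (2 * (finrank ℝ E : ℝ) - p) = l ^ (2 * (finrank ℝ E : ℝ) - p - α) * l ^ α := by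
      rw [← Real.rpow_add hl]; ring_nf
    rw [norm_smul, Real.norm_of_nonneg (by positivity), norm_smul, Real.norm_of_nonneg hl.le,
      Real.mul_rpow hl.le (norm_nonneg _), h]
    ring
  simp_rw [e]
  refine ⟨(hm.comp_smul hl.ne').const_mul _, ?_⟩
  rw [integral_const_mul, integral_comp_smul_pos (fun y : E => ‖m y‖ * ‖y‖ ^ α) hl, smul_eq_mul,
    ← mul_assoc, ← Real.rpow_add hl]
  ring_nf

/-- The constant in the Hölder estimate. -/
def Para.cS (hP : Para a b p ψ H C) (α : ℝ) : ℝ :=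
  2 * hP.cH * (1 / (1 - 2 ^ (-(p - finrank ℝ E + α)))
    + 1 / (1 - 2 ^ (-(1 - (p - finrank ℝ E + α)))))

lemma Para.pair_diff_holder [Nontrivial E] (hP : Para a b p ψ H C) (hp : (finrank ℝ E : ℝ) < p)
    (hp' : p < finrank ℝ E + 1) (hα : α ∈ Set.Ioc (0 : ℝ) 1) (hα' : p - finrank ℝ E + α < 1)
    {u f : E → E} {U N K : ℝ} (hu : Continuous u)
    (hU : ∀ x, ‖u x‖ ≤ U) (hf : Continuous f) (hN : ∀ x, ‖f x‖ ≤ N) (hK0 : 0 ≤ K)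
    (hK : ∀ x y, ‖f x - f y‖ ≤ K * ‖x - y‖ ^ α)
    (heq : ∀ φ A B, TF φ A B → T (LameFrac.ker a b p) u φ = pair f φ)
    {φ : E → E} {A B : ℝ} (hφ : TF φ A B) {h : E} (hh : h ≠ 0) :
    |pair u fun x => φ (x + h) - φ x| ≤ hP.cS α * K * A * ‖h‖ ^ (p - finrank ℝ E + α) := by
  set g : E → E := fun x => φ (x + h) - φ x with hgdef
  set β := p - finrank ℝ E + α with hβ
  have hβ0 : 0 < β := add_pos (sub_pos.2 hp) hα.1
  have hβ1 : 0 < 1 - β := by linarith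
  have hh0 : 0 < ‖h‖ := norm_pos_iff.2 hh
  have hA := hφ.nonneg_left
  have hcH := hP.cH_nonneg
  have hgi : Integrable g := (hφ.int.comp_add_right h).sub hφ.int
  have hg1 : ∫ x, ‖g x‖ ≤ 2 * A := by
    have := (hφ.diff_le (-h)).trans (min_le_left _ _)
    simp only [sub_neg_eq_add] at this
    simpa only [hgdef, norm_sub_rev] using this
  have hg : TF g (2 * A) (2 * B) := by
    have := (hφ.translate h).add (hφ.const_smul (-1))
    simp only [neg_smul, one_smul, ← sub_eq_add_neg, abs_neg, abs_one, one_mul] at this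
    exact this.mono (by linarith) (by linarith)
  set P := lowPair ψ u g with hPdef
  have hint0 {l : ℝ} (hl : 0 < l) : ∫ y, hs p H l y = 0 := by
    simp only [hs]
    rw [integral_smul, integral_comp_smul_pos H hl, hP.ker_int, smul_zero, smul_zero]
  have hT {l : ℝ} (hl : 0 < l) : P (2 * l) - P l = pair f (conv (hs p H l) g) := by
    rw [hPdef, ← hP.T_conv_hs hp hp' hu hU hl hg.int]
    exact heq _ _ _ (conv_tf (hP.hs_tf hl).int hg)
  have hstep {l : ℝ} (hl : 0 < l) : |P (2 * l) - P l| ≤ 2 * hP.cH * K * A * l ^ (-β) := by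
    obtain ⟨m1, m2⟩ := hP.ker_moment hα
    obtain ⟨m3, m4⟩ := holder_moment_scale (p := p) hl m1
    rw [hT hl]
    refine (abs_pair_conv_le hf hN hK (hP.hs_tf hl).int (hint0 hl) m3 hgi).trans ?_
    simp only [hs]
    rw [m4]
    calc K * (l ^ (-β) * ∫ y, ‖H y‖ * ‖y‖ ^ α) * ∫ x, ‖g x‖
        ≤ K * (l ^ (-β) * hP.cH) * (2 * A) := by gcongr
      _ = _ := by ring
  have hstep' {l : ℝ} (hl : 0 < l) (hlh : l * ‖h‖ ≤ 1) :
      |P (2 * l) - P l| ≤ 2 * hP.cH * K * A * ‖h‖ * l ^ (1 - β) := by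
    have hlh' : ‖l • h‖ ≤ 1 := by rwa [norm_smul, Real.norm_of_nonneg hl.le]
    obtain ⟨m1, m2⟩ := hP.ker_diff_moment hα hlh'
    obtain ⟨m3, m4⟩ := holder_moment_scale (p := p) hl m1
    have hki := (hP.hs_tf hl).int
    have ed : (fun y => hs p H l (y + h) - hs p H l y) = fun y =>
        l ^ (2 * (finrank ℝ E : ℝ) - p) • (H (l • y + l • h) - H (l • y)) := by
      ext1 y; simp only [hs, smul_add, smul_sub]
    have hd0 : ∫ y, (hs p H l (y + h) - hs p H l y) = 0 := by
      rw [integral_sub (hki.comp_add_right h) hki, integral_add_right_eq_self, sub_self]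
    have e : pair f (conv (hs p H l) g) = pair f (conv (fun y => hs p H l (y + h) - hs p H l y) φ) := by
      refine integral_congr_ae ?_
      filter_upwards [conv_diff_ae hki hφ.int h] with x hx
      rw [hx]
    have hdi : Integrable fun y => hs p H l (y + h) - hs p H l y := (hki.comp_add_right h).sub hki
    rw [hT hl, e]
    refine (abs_pair_conv_le hf hN hK hdi hd0 ?_ hφ.int).trans ?_
    · exact m3.congr (Eventually.of_forall fun y => by simp only [congrFun ed y])
    · have e5 : ∫ y, ‖hs p H l (y + h) - hs p H l y‖ * ‖y‖ ^ α
          = l ^ (-β) * ∫ y, ‖H (y + l • h) - H y‖ * ‖y‖ ^ α := by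
        rw [← m4]
        exact integral_congr_ae (Eventually.of_forall fun y => by simp only [congrFun ed y])
      rw [e5]
      have e6 : l ^ (1 - β) = l ^ (-β) * l := by
        rw [← Real.rpow_add_one hl.ne']; ring_nf
      calc K * (l ^ (-β) * ∫ y, ‖H (y + l • h) - H y‖ * ‖y‖ ^ α) * ∫ x, ‖φ x‖
          ≤ K * (l ^ (-β) * (hP.cH * ‖l • h‖)) * (2 * A) := by
            gcongr
            exact hφ.l1.trans (by linarith)
        _ = _ := by
            rw [norm_smul, Real.norm_of_nonneg hl.le, e6]; ring
  set l₀ := ‖h‖⁻¹ with hl₀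
  have hl₀0 : 0 < l₀ := inv_pos.2 hh0
  have hpow (t : ℝ) (n : ℕ) : (l₀ * (2 : ℝ) ^ n) ^ (-t) = ‖h‖ ^ t * ((2 : ℝ) ^ (-t)) ^ n := by
    rw [Real.mul_rpow hl₀0.le (by positivity), hl₀, Real.inv_rpow hh0.le, Real.rpow_neg hh0.le,
      inv_inv, ← Real.rpow_natCast, ← Real.rpow_mul (by norm_num), mul_comm (n : ℝ),
      Real.rpow_mul (by norm_num), Real.rpow_natCast]
  have hinv (n : ℕ) : ‖h‖ * (l₀ * ((2 : ℝ) ^ n)⁻¹) ^ (1 - β)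
      = ‖h‖ ^ β * ((2 : ℝ) ^ (-(1 - β))) ^ n := by
    rw [Real.mul_rpow hl₀0.le (by positivity), hl₀, Real.inv_rpow hh0.le, ← Real.rpow_neg hh0.le,
      ← mul_assoc, ← Real.rpow_one_add' hh0.le (by linarith)]
    rw [show 1 + -(1 - β) = β by ring, Real.inv_rpow (by positivity),
      ← Real.rpow_neg (by positivity), ← Real.rpow_natCast, ← Real.rpow_mul (by norm_num),
      mul_comm (n : ℝ), Real.rpow_mul (by norm_num), Real.rpow_natCast]
  have lim1 : Tendsto (fun n : ℕ => P (l₀ * 2 ^ n)) atTop (𝓝 (pair u g)) := by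
    rw [tendsto_iff_norm_sub_tendsto_zero]
    refine squeeze_zero (fun _ => norm_nonneg _) (fun n => ?_)
      (g := fun n : ℕ => U * (2 * B) * (∫ y, ‖y‖ * ‖ψ y‖) * (l₀⁻¹ * ((2 : ℝ) ^ n)⁻¹)) ?_
    · rw [← norm_neg, neg_sub, ← mul_inv]
      exact hP.lowPair_sub hu hU (by positivity) hg
    · have := ((tendsto_inv_atTop_zero.comp (tendsto_pow_atTop_atTop_of_one_lt
        (one_lt_two (α := ℝ)))).const_mul l₀⁻¹).const_mul (U * (2 * B) * (∫ y, ‖y‖ * ‖ψ y‖))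
      simpa using this
  have lim2 : Tendsto (fun n : ℕ => P (l₀ * (2 ^ n)⁻¹)) atTop (𝓝 0) := by
    refine squeeze_zero_norm (fun n => hP.lowPair_diff hU (by positivity) hφ h) ?_
    have := ((tendsto_inv_atTop_zero.comp (tendsto_pow_atTop_atTop_of_one_lt
        (one_lt_two (α := ℝ)))).const_mul l₀).const_mul (U * hP.c * ‖h‖ * A)
    simpa using this
  have b1 : dist (P (l₀ * 2 ^ 0)) (pair u g) ≤
      2 * hP.cH * K * A * ‖h‖ ^ β / (1 - (2 : ℝ) ^ (-β)) := by
    refine dist_le_of_le_geometric_of_tendsto₀ _ _ (two_rpow_lt_one hβ0) (fun n => ?_) lim1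
    rw [dist_comm, Real.dist_eq, pow_succ', mul_left_comm, mul_assoc _ (‖h‖ ^ β), ← hpow]
    exact hstep (by positivity)
  have b2 : dist (P (l₀ * (2 ^ 0)⁻¹)) 0 ≤
      2 * hP.cH * K * A * ‖h‖ ^ β / (1 - (2 : ℝ) ^ (-(1 - β))) := by
    refine dist_le_of_le_geometric_of_tendsto₀ _ _ (two_rpow_lt_one hβ1) (fun n => ?_) lim2
    have e : l₀ * ((2 : ℝ) ^ n)⁻¹ = 2 * (l₀ * ((2 : ℝ) ^ (n + 1))⁻¹) := by
      rw [pow_succ]; field_simp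
    have hle : l₀ * ((2 : ℝ) ^ (n + 1))⁻¹ * ‖h‖ ≤ 1 := by
      rw [mul_right_comm, hl₀, inv_mul_cancel₀ hh0.ne', one_mul]
      exact inv_le_one_of_one_le₀ (one_le_pow₀ one_le_two)
    rw [Real.dist_eq, e]
    refine (hstep' (by positivity) hle).trans ?_
    rw [mul_assoc _ ‖h‖, hinv, mul_assoc _ (‖h‖ ^ β)]
    gcongr ?_ * (?_ * ?_)
    exact pow_le_pow_of_le_one (by positivity) (two_rpow_lt_one hβ1).le (Nat.le_succ n)
  rw [Real.dist_eq] at b1 b2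
  rw [pow_zero, mul_one] at b1
  rw [pow_zero, inv_one, mul_one, sub_zero] at b2
  calc |pair u g| = |P l₀ - (P l₀ - pair u g)| := by rw [sub_sub_cancel]
    _ ≤ |P l₀| + |P l₀ - pair u g| := abs_sub _ _
    _ ≤ _ := add_le_add b2 b1
    _ = _ := by rw [cS, ← hβ]; ring

lemma Para.tendsto_pair_ps (hP : Para a b p ψ H C) {u : E → E} {U : ℝ} (hu : Continuous u)
    (hU : ∀ x, ‖u x‖ ≤ U) (x w : E) :
    Tendsto (fun n : ℕ => pair u fun z => ps ψ ((n : ℝ) + 1) (z - x) • w) atTop (𝓝 ⟪u x, w⟫) := by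
  have hψ := hP.psi_tf.int
  have e (n : ℕ) : pair u (fun z => ps ψ ((n : ℝ) + 1) (z - x) • w)
      = ∫ y, ψ y * ⟪u (((n : ℝ) + 1)⁻¹ • y + x), w⟫ := by
    have hl : (0 : ℝ) < (n : ℝ) + 1 := by positivity
    have h := integral_comp_smul_pos (fun y => ψ y * ⟪u (((n : ℝ) + 1)⁻¹ • y + x), w⟫) hl
    simp only [smul_smul, inv_mul_cancel₀ hl.ne', one_smul, smul_eq_mul] at h
    rw [pair, ← integral_add_right_eq_self _ x]
    simp only [add_sub_cancel_right, ps, real_inner_smul_right, mul_assoc]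
    rw [integral_const_mul, h, ← mul_assoc, ← Real.rpow_add hl, add_neg_cancel, Real.rpow_zero,
      one_mul]
  have e0 : ⟪u x, w⟫ = ∫ y, ψ y * ⟪u x, w⟫ := by
    rw [integral_mul_const, hP.psi_int, one_mul]
  simp_rw [e]
  rw [e0]
  refine tendsto_integral_of_dominated_convergence (fun y => ‖ψ y‖ * (U * ‖w‖)) (fun n => ?_)
    (hψ.norm.mul_const _) (fun n => Eventually.of_forall fun y => ?_)
    (Eventually.of_forall fun y => ?_)
  · exact hψ.aestronglyMeasurable.mul (by fun_prop :
      Continuous fun y => ⟪u (((n : ℝ) + 1)⁻¹ • y + x), w⟫).aestronglyMeasurable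
  · rw [norm_mul]
    gcongr
    exact (norm_inner_le_norm _ _).trans (by gcongr; exact hU _)
  · refine Tendsto.const_mul _ ?_
    have h1 : Tendsto (fun n : ℕ => ((n : ℝ) + 1)⁻¹ • y + x) atTop (𝓝 x) := by
      have := ((tendsto_one_div_add_atTop_nhds_zero_nat (𝕜 := ℝ)).smul_const y).add_const x
      simpa using this
    exact ((hu.tendsto x).comp h1).inner (𝕜 := ℝ) tendsto_const_nhds

/-- The Schauder estimate for pointwise solutions. -/
theorem exists_schauder [Nontrivial E] (hp : (finrank ℝ E : ℝ) < p)
    (hp' : p < finrank ℝ E + 1) (h1 : a + b / p ≠ 0)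
    (h2 : a + b * (1 + (p - finrank ℝ E)) / p ≠ 0) (hα : α ∈ Set.Ioc (0 : ℝ) 1)
    (hα' : p - finrank ℝ E + α < 1) :
    ∃ C, 0 ≤ C ∧ ∀ (u f : E → E) (U N K : ℝ), Continuous u → (∀ x, ‖u x‖ ≤ U) →
      (∀ x, ‖f x‖ ≤ N) → 0 ≤ K → (∀ x y, ‖f x - f y‖ ≤ K * ‖x - y‖ ^ α) →
      (∀ x, Tendsto (fun ε => trunc (ker a b p) u ε x) (𝓝[>] 0) (𝓝 (f x))) →
      ∀ x y, ‖u x - u y‖ ≤ C * K * ‖x - y‖ ^ (p - finrank ℝ E + α) := by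
  obtain ⟨ψ, H, C, hP⟩ := exists_para (E := E) (a := a) (b := b) hp hp' h1 h2
  have hβ0 : 0 < p - finrank ℝ E + α := add_pos (sub_pos.2 hp) hα.1
  have hcS : 0 ≤ hP.cS α := by
    have := hP.cH_nonneg
    have h3 := two_rpow_lt_one hβ0
    have h4 := two_rpow_lt_one (sub_pos.2 hα')
    rw [Para.cS]
    have : 0 ≤ 1 / (1 - (2 : ℝ) ^ (-(p - finrank ℝ E + α))) := by
      apply one_div_nonneg.2; linarith
    have : 0 ≤ 1 / (1 - (2 : ℝ) ^ (-(1 - (p - finrank ℝ E + α)))) := by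
      apply one_div_nonneg.2; linarith
    positivity
  have hc := hP.c_nonneg
  refine ⟨hP.cS α * hP.c, by positivity, fun u f U N K hu hU hN hK0 hK hlim x y => ?_⟩
  have hf : Continuous f := by
    refine continuous_iff_continuousAt.2 fun y => tendsto_iff_norm_sub_tendsto_zero.2 ?_
    refine squeeze_zero (fun _ => norm_nonneg _) (fun x => hK x y) ?_
    have h3 : Continuous fun x => K * ‖x - y‖ ^ α :=
      continuous_const.mul (by
        exact Continuous.rpow_const (by fun_prop) fun _ => Or.inr hα.1.le)
    simpa [Real.zero_rpow hα.1.ne'] using h3.tendsto y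
  have heq : ∀ φ A B, TF φ A B → T (ker a b p) u φ = pair f φ := fun φ A B hφ =>
    T_eq_pair_of_test hp hp' hu hU hf hN
      (fun φ hφ => weak_of_pointwise hp hp' h1 h2 hu hU hf hN hlim hφ) hφ
  rcases eq_or_ne x y with rfl | hxy
  · rw [sub_self, norm_zero]
    positivity
  refine norm_le_of_inner_le fun w hw => ?_
  have l1 := (hP.tendsto_pair_ps hu hU x w).sub (hP.tendsto_pair_ps hu hU y w)
  rw [← inner_sub_left] at l1
  refine le_of_tendsto l1.abs (Eventually.of_forall fun n => ?_)
  have hl : (0 : ℝ) < (n : ℝ) + 1 := by positivity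
  have ht : TF (fun z => ps ψ ((n : ℝ) + 1) (z - y) • w) (hP.c * ‖w‖)
      (((n : ℝ) + 1) * hP.c * ‖w‖) := by
    have := ((hP.ps_tf hl).translate (-y)).clm (ContinuousLinearMap.toSpanSingleton ℝ w)
    rw [ContinuousLinearMap.norm_toSpanSingleton] at this
    simp only [ContinuousLinearMap.toSpanSingleton_apply, ← sub_eq_add_neg] at this
    exact this.mono (by rw [mul_comm]) (by rw [mul_comm])
  have h5 := hP.pair_diff_holder hp hp' hα hα' hu hU hf hN hK0 hK heq ht
    (h := y - x) (sub_ne_zero.2 hxy.symm)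
  have e : (fun z => ps ψ ((n : ℝ) + 1) (z + (y - x) - y) • w - ps ψ ((n : ℝ) + 1) (z - y) • w)
      = fun z => ps ψ ((n : ℝ) + 1) (z - x) • w - ps ψ ((n : ℝ) + 1) (z - y) • w := by
    ext1 z
    rw [show z + (y - x) - y = z - x by abel]
  have hi (x : E) : Integrable fun z => ps ψ ((n : ℝ) + 1) (z - x) • w :=
    ((hP.ps_tf hl).int.comp_sub_right x).smul_const w
  rw [e, pair_sub hu hU (hi x) (hi y), norm_sub_rev] at h5
  refine h5.trans ?_
  calc _ ≤ hP.cS α * K * (hP.c * 1) * ‖x - y‖ ^ (p - finrank ℝ E + α) := by gcongr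
    _ = _ := by ring

end Schauder

lemma setIntegral_norm_sub_left (G : E → F) (ε : ℝ) (x : E) :
    ∫ y in {y : E | ε ≤ ‖x - y‖}, G (x - y) = ∫ z in {z : E | ε ≤ ‖z‖}, G z := by
  rw [← integral_indicator (measurableSet_le (by fun_prop) (by fun_prop)),
    ← integral_indicator (measurableSet_le (by fun_prop) (by fun_prop)),
    ← integral_sub_left_eq_self ({z : E | ε ≤ ‖z‖}.indicator G) volume x]
  rfl

lemma trunc_ker_eq {a b p : ℝ} (hp : (finrank ℝ E : ℝ) < p) {v : E → E} {U : ℝ}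
    (hv : Continuous v) (hU : ∀ x, ‖v x‖ ≤ U) {ε : ℝ} (hε : 0 < ε) (x : E) :
    trunc (ker a b p) v ε x =
      a • (∫ y in {y : E | ε ≤ ‖x - y‖}, (‖x - y‖ ^ p)⁻¹ • (v x - v y)) +
      b • ∫ y in {y : E | ε ≤ ‖x - y‖},
        (⟪x - y, v x - v y⟫ / (‖x - y‖ ^ 2 * ‖x - y‖ ^ p)) • (x - y) := by
  have h1 := setIntegral_norm_sub_left (fun z => ker 1 0 p z (v x - v (x - z))) ε x
  have h2 := setIntegral_norm_sub_left (fun z => ker 0 1 p z (v x - v (x - z))) ε x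
  have hm : MeasurableSet {y : E | ε ≤ ‖x - y‖} := measurableSet_le (by fun_prop) (by fun_prop)
  have hm' : MeasurableSet {y : E | ε ≤ ‖y‖} := measurableSet_le (by fun_prop) (by fun_prop)
  have i1 := trunc_integrable (a := 1) (b := 0) hp hv hU hε x
  have i2 := trunc_integrable (a := 0) (b := 1) hp hv hU hε x
  have e1 : ∫ y in {y : E | ε ≤ ‖x - y‖}, (‖x - y‖ ^ p)⁻¹ • (v x - v y)
      = ∫ z in {z : E | ε ≤ ‖z‖}, ker 1 0 p z (v x - v (x - z)) := by
    rw [← h1]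
    refine setIntegral_congr_fun hm fun y _ => ?_
    simp only [ker_apply, sub_sub_cancel, zero_mul, zero_smul, add_zero, mul_one]
    rw [Real.rpow_neg (norm_nonneg _)]
  have e2 : ∫ y in {y : E | ε ≤ ‖x - y‖},
        (⟪x - y, v x - v y⟫ / (‖x - y‖ ^ 2 * ‖x - y‖ ^ p)) • (x - y)
      = ∫ z in {z : E | ε ≤ ‖z‖}, ker 0 1 p z (v x - v (x - z)) := by
    rw [← h2]
    refine setIntegral_congr_fun hm fun y hy => ?_
    have h0 : 0 < ‖x - y‖ := hε.trans_le hy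
    simp only [ker_apply, sub_sub_cancel, mul_zero, zero_smul, zero_add, one_mul]
    rw [neg_add, add_comm, Real.rpow_add h0, Real.rpow_neg h0.le, Real.rpow_neg h0.le,
      Real.rpow_two, ← mul_inv, div_eq_inv_mul]
  rw [e1, e2, ← integral_smul, ← integral_smul, trunc]
  refine Eq.trans ?_ (integral_add (i1.smul a) (i2.smul b))
  refine setIntegral_congr_fun hm' fun y _ => ?_
  simp only [ker_apply, smul_add, smul_smul]
  ring_nf
  simp

end LameFrac

lemma cConst_pos {d : ℕ} {s : ℝ} (hs : s ∈ Set.Ioo (0 : ℝ) 1) : 0 < cConst d s := by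
  have h1 : 0 < Real.Gamma ((d : ℝ) / 2 + s) :=
    Real.Gamma_pos_of_pos (add_pos_of_nonneg_of_pos (by positivity) hs.1)
  have h2 : 0 < Real.Gamma (1 - s) := Real.Gamma_pos_of_pos (sub_pos.2 hs.2)
  have := hs.1
  rw [cConst]
  positivity

/-- Schauder estimate: if `u` is bounded continuous, `f` is bounded `α`-Hölder with
`α + 2s < 1`, and `𝕃^s_ε u(x) → f(x)` pointwise as `ε → 0⁺`, then `u` is
`(α+2s)`-Hölder with seminorm controlled by `sup|u| + sup|f| + [f]_{C^{0,α}}`. -/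
theorem lameFrac_schauder (d : ℕ) (hd : 3 ≤ d) (s : ℝ) (hs : s ∈ Set.Ioo (0 : ℝ) 1)
    (μ lam : ℝ) (hμ : 0 < μ) (hlam : 0 < 2 * μ + lam)
    (α : ℝ) (hα : α ∈ Set.Ioc (0 : ℝ) 1) (hα2s : α + 2 * s < 1) :
    ∃ C : ℝ, 0 < C ∧
      ∀ (u f : EuclideanSpace ℝ (Fin d) → EuclideanSpace ℝ (Fin d)) (Mu Mf Kf : ℝ),
        Continuous u →
        (∀ x, ‖u x‖ ≤ Mu) →
        (∀ x, ‖f x‖ ≤ Mf) →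
        (∀ x y, ‖f x - f y‖ ≤ Kf * ‖x - y‖ ^ α) →
        (∀ x : EuclideanSpace ℝ (Fin d),
          Tendsto (fun ε : ℝ => lameFracTrunc d s μ lam u ε x)
            (nhdsWithin 0 (Set.Ioi 0)) (nhds (f x))) →
        ∀ x y : EuclideanSpace ℝ (Fin d),
          ‖u x - u y‖ ≤ C * (Mu + Mf + Kf) * ‖x - y‖ ^ (α + 2 * s) := by
  have hs0 := hs.1
  have hc := cConst_pos (d := d) hs
  have hμs : 0 < μ ^ s := Real.rpow_pos_of_pos hμ s
  have hls : 0 < (2 * μ + lam) ^ s := Real.rpow_pos_of_pos hlam s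
  have hfr : (Module.finrank ℝ (EuclideanSpace ℝ (Fin d)) : ℝ) = d := by
    rw [finrank_euclideanSpace_fin]
  have : NeZero d := ⟨by lia⟩
  set p : ℝ := d + 2 * s with hp_def
  have hp0 : 0 < p := by positivity
  have hp : (Module.finrank ℝ (EuclideanSpace ℝ (Fin d)) : ℝ) < p := by rw [hfr]; linarith
  set a := ((2 * s + 1) * μ ^ s - (2 * μ + lam) ^ s) / (2 * s) * cConst d s with ha
  set b := ((2 * μ + lam) ^ s - μ ^ s) / (2 * s) * kappaConst d s with hb
  have hbp : b / p = ((2 * μ + lam) ^ s - μ ^ s) / (2 * s) * cConst d s := by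
    rw [hb, kappaConst, ← hp_def]; field_simp
  have h1 : a + b / p ≠ 0 := by
    have : a + b / p = μ ^ s * cConst d s := by rw [hbp, ha]; field_simp; ring
    rw [this]; positivity
  have h2 : a + b * (1 + (p - Module.finrank ℝ (EuclideanSpace ℝ (Fin d)))) / p ≠ 0 := by
    have : a + b * (1 + (p - Module.finrank ℝ (EuclideanSpace ℝ (Fin d)))) / p
        = (2 * μ + lam) ^ s * cConst d s := by
      rw [mul_div_right_comm, hbp, ha, hfr, hp_def]; field_simp; ring
    rw [this]; positivity
  obtain ⟨C, hC0, hC⟩ := LameFrac.exists_schauder hp (by rw [hfr]; linarith [hα.1]) h1 h2 hα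
    (by rw [hfr]; linarith)
  refine ⟨C + 1, by positivity, fun u f Mu Mf Kf hu hMu hMf hKf hlim x y => ?_⟩
  have hMu0 : 0 ≤ Mu := (norm_nonneg _).trans (hMu 0)
  have hMf0 : 0 ≤ Mf := (norm_nonneg _).trans (hMf 0)
  have hKf0 : 0 ≤ Kf := by
    obtain ⟨z, hz⟩ := exists_ne (0 : EuclideanSpace ℝ (Fin d))
    have hz0 : 0 < ‖z - 0‖ ^ α := Real.rpow_pos_of_pos (norm_pos_iff.2 (by rwa [sub_zero])) α
    exact nonneg_of_mul_nonneg_left ((norm_nonneg _).trans (hKf z 0)) hz0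
  have key := hC u f Mu Mf Kf hu hMu hMf hKf0 hKf (fun x => (hlim x).congr' ?_) x y
  · rw [hfr, show p - d + α = α + 2 * s by rw [hp_def]; ring] at key
    refine key.trans ?_
    gcongr <;> linarith
  · filter_upwards [self_mem_nhdsWithin] with ε hε
    rw [LameFrac.trunc_ker_eq hp hu hMu hε]
    rfl
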